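/- There exist absolute constants c > 0 and C > 0 such that for all real x ≥ 3 and all integers ℓ with 1 ≤ ℓ ≤ x^{10}, both of the following hold: | Σ_{n > x, gcd(n,ℓ)=1} μ(n)²/n² − (1/(ζ(2)·x)) · Π_{p | ℓ} (1 + 1/p)^{−1} | ≤ C / ( x^{3/2} · exp( c (log x)^{3/5} (log log x)^{−1/5} ) ), and | Σ_{n > x, gcd(n,ℓ)=1} μ(n)²·(log n)/n² − ((log x + 1)/(ζ(2)·x)) · Π_{p | ℓ} (1 + 1/p)^{−1} | ≤ C / ( x^{3/2} · exp( c (log x)^{3/5} (log log x)^{−1/5} ) ), where n runs over positive integers coprime to ℓ, the product is over primes p dividing ℓ, μ is the Möbius function, and ζ is the Riemann zeta function. -/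

import Mathlib

namespace VinogradovKorobov

open Finset

/-- The `n`-th elementary symmetric function of a finite family. -/
def elemSymm {σ R : Type*} [Fintype σ] [CommRing R] (a : σ → R) (n : ℕ) : R :=
  ∑ t ∈ powersetCard n (univ : Finset σ), ∏ i ∈ t, a i

lemma elemSymm_zero {σ R : Type*} [Fintype σ] [CommRing R] (a : σ → R) : elemSymm a 0 = 1 := by
  simp [elemSymm]

lemma elemSymm_eq_multiset {σ R : Type*} [Fintype σ] [CommRing R] (a : σ → R) (n : ℕ) :
    elemSymm a n = ((univ : Finset σ).val.map a).esymm n := by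
  rw [elemSymm, Finset.esymm_map_val]

lemma mul_elemSymm {σ R : Type*} [Fintype σ] [CommRing R] (a : σ → R) (n : ℕ) :
    n * elemSymm a n = (-1) ^ (n + 1) * ∑ x ∈ antidiagonal n with x.1 < n,
      (-1) ^ x.1 * elemSymm a x.1 * ∑ i, a i ^ x.2 := by
  have h := congrArg (MvPolynomial.aeval a) (MvPolynomial.mul_esymm_eq_sum σ ℤ n)
  simpa [MvPolynomial.esymm, MvPolynomial.psum, map_sum, map_prod, elemSymm] using h

lemma elemSymm_congr {σ τ R : Type*} [Fintype σ] [Fintype τ] [CommRing R] (a : σ → R) (b : τ → R)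
    {k : ℕ} (hu : ∀ j, 1 ≤ j → j ≤ k → IsUnit (j : R))
    (h : ∀ j, 1 ≤ j → j ≤ k → ∑ i, a i ^ j = ∑ i, b i ^ j) {n : ℕ} (hn : n ≤ k) :
    elemSymm a n = elemSymm b n := by
  induction n using Nat.strong_induction_on with
  | _ n ih =>
    rcases Nat.eq_zero_or_pos n with rfl | hpos
    · simp [elemSymm_zero]
    · refine (hu n hpos hn).mul_left_cancel ?_
      rw [mul_elemSymm, mul_elemSymm]
      congr 1
      refine sum_congr rfl fun x hx => ?_
      rw [mem_filter, HasAntidiagonal.mem_antidiagonal] at hx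
      rw [ih x.1 hx.2 (by omega), h x.2 (by omega) (by omega)]

lemma prod_sub_eq_of_power_sums_eq {R : Type*} [CommRing R] {k : ℕ} (a b : Fin k → R)
    (hu : ∀ j, 1 ≤ j → j ≤ k → IsUnit (j : R))
    (h : ∀ j, 1 ≤ j → j ≤ k → ∑ i, a i ^ j = ∑ i, b i ^ j) (z : R) :
    ∏ i, (z - a i) = ∏ i, (z - b i) := by
  have key : ∀ a : Fin k → R, ∏ i, (z - a i) =
      ∑ j ∈ range (k + 1), (-1) ^ j * (elemSymm a j * z ^ (k - j)) := by
    intro a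
    have := congrArg (Polynomial.eval z)
      (Multiset.prod_X_sub_X_eq_sum_esymm ((univ : Finset (Fin k)).val.map a))
    rw [Polynomial.eval_multiset_prod, Polynomial.eval_finsetSum] at this
    simpa [elemSymm_eq_multiset, Multiset.map_map, Function.comp_def, List.prod_ofFn] using this
  rw [key, key]
  refine sum_congr rfl fun j hj => ?_
  rw [elemSymm_congr a b hu h (by simpa [Nat.lt_succ_iff] using hj)]

/-- Linnik's lemma, uniqueness part: modulo `p ^ k`, the power sums of a family which is
distinct modulo `p` determine it up to permutation. -/
lemma exists_perm_of_power_sums_modEq {p k P : ℕ} (hp : p.Prime) (hkp : k < p) (hP : P ≤ p ^ k)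
    (c : ℤ) (x y : Fin k → ℕ) (hx : ∀ i, x i < P) (hy : ∀ i, y i < P)
    (hxi : Function.Injective fun i => (x i : ZMod p))
    (hyi : Function.Injective fun i => (y i : ZMod p))
    (h : ∀ j, 1 ≤ j → j ≤ k →
      ((p ^ k : ℕ) : ℤ) ∣ ∑ i, ((x i : ℤ) - c) ^ j - ∑ i, ((y i : ℤ) - c) ^ j) :
    ∃ σ : Equiv.Perm (Fin k), y = x ∘ σ := by
  rcases Nat.eq_zero_or_pos k with rfl | hk
  · exact ⟨1, Subsingleton.elim _ _⟩
  have : NeZero (p ^ k) := ⟨pow_ne_zero _ hp.ne_zero⟩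
  have hunit : ∀ m : ℤ, ¬ (p : ℤ) ∣ m → IsUnit ((m : ℤ) : ZMod (p ^ k)) := by
    intro m hm
    rw [ZMod.coe_int_isUnit_iff_isCoprime]
    push_cast
    refine IsCoprime.pow_left ?_
    exact (Nat.prime_iff_prime_int.mp hp).coprime_iff_not_dvd.mpr hm
  have hall : ∀ i, ∃ l, y i = x l := by
    intro i
    have hprod := prod_sub_eq_of_power_sums_eq (R := ZMod (p ^ k)) (k := k)
      (fun i => (((x i : ℤ) - c : ℤ) : ZMod (p ^ k)))
      (fun i => (((y i : ℤ) - c : ℤ) : ZMod (p ^ k)))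
      (by
        intro j hj1 hj2
        have := hunit j (by
          intro hd
          have := Nat.le_of_dvd (by omega) (Int.natCast_dvd_natCast.mp hd)
          omega)
        simpa using this)
      (by
        intro j hj1 hj2
        have := (ZMod.intCast_zmod_eq_zero_iff_dvd _ (p ^ k)).mpr (by exact_mod_cast h j hj1 hj2)
        push_cast at this ⊢
        exact sub_eq_zero.mp this)
      (((y i : ℤ) - c : ℤ) : ZMod (p ^ k))
    have hzero : ∏ l,
        ((((y i : ℤ) - c : ℤ) : ZMod (p ^ k)) - (((y l : ℤ) - c : ℤ) : ZMod (p ^ k))) = 0 :=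
      prod_eq_zero (mem_univ i) (sub_self _)
    rw [hzero] at hprod
    by_cases hex : ∃ l, (p : ℤ) ∣ (y i : ℤ) - x l
    · obtain ⟨l, hl⟩ := hex
      refine ⟨l, ?_⟩
      rw [← mul_prod_erase _ _ (mem_univ l)] at hprod
      have hu : IsUnit (∏ m ∈ univ.erase l,
          ((((y i : ℤ) - c : ℤ) : ZMod (p ^ k)) - (((x m : ℤ) - c : ℤ) : ZMod (p ^ k)))) := by
        rw [IsUnit.prod_iff]
        intro m hm
        have : ¬ (p : ℤ) ∣ (y i : ℤ) - x m := by
          intro hd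
          have h1 : (p : ℤ) ∣ (x m : ℤ) - x l := by
            have := dvd_sub hl hd
            ring_nf at this ⊢
            exact this
          have h2 : (x l : ZMod p) = x m := by
            have := (ZMod.intCast_eq_intCast_iff_dvd_sub (x l) (x m) p).mpr h1
            simpa using this
          exact (ne_of_mem_erase hm) (hxi h2).symm
        have := hunit _ this
        push_cast at this ⊢
        simpa using this
      have h0 := (hu.mul_left_eq_zero).mp hprod
      have h3 : ((x l : ℤ) : ZMod (p ^ k)) = ((y i : ℤ) : ZMod (p ^ k)) := by
        push_cast at h0 ⊢
        linear_combination -h0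
      have h4 : ((x l : ℕ) : ZMod (p ^ k)) = ((y i : ℕ) : ZMod (p ^ k)) := by simpa using h3
      rw [ZMod.natCast_eq_natCast_iff] at h4
      exact (Nat.ModEq.eq_of_lt_of_lt h4 ((hx l).trans_le hP) ((hy i).trans_le hP)).symm
    · push Not at hex
      exfalso
      have hu : IsUnit (∏ m,
          ((((y i : ℤ) - c : ℤ) : ZMod (p ^ k)) - (((x m : ℤ) - c : ℤ) : ZMod (p ^ k)))) := by
        rw [IsUnit.prod_iff]
        intro m _
        have := hunit _ (hex m)
        push_cast at this ⊢
        simpa using this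
      rw [hprod] at hu
      have : Nontrivial (ZMod (p ^ k)) := by
        have : Fact (1 < p ^ k) := ⟨Nat.one_lt_pow hk.ne' hp.one_lt⟩
        infer_instance
      exact not_isUnit_zero hu
  choose σ hσ using hall
  have hinj : Function.Injective σ := by
    intro i j hij
    apply hyi
    simp only [hσ, hij]
  refine ⟨Equiv.ofBijective σ (Finite.injective_iff_bijective.mp hinj), ?_⟩
  ext i
  simp [hσ i]

/-- Linnik's lemma, counting form. -/
lemma card_le_of_power_sums_modEq {p k P : ℕ} (hp : p.Prime) (hkp : k < p) (hP : P ≤ p ^ k)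
    (c : ℤ) (y : Fin k → ℕ) :
    #{x ∈ Fintype.piFinset (fun _ : Fin k => range P) |
        Function.Injective (fun i => (x i : ZMod p)) ∧
        ∀ j, 1 ≤ j → j ≤ k →
          ((p ^ j : ℕ) : ℤ) ∣ ∑ i, ((x i : ℤ) - c) ^ j - ∑ i, ((y i : ℤ) - c) ^ j}
      ≤ k.factorial * p ^ (k * (k - 1) / 2) := by
  classical
  set A := {x ∈ Fintype.piFinset (fun _ : Fin k => range P) |
        Function.Injective (fun i => (x i : ZMod p)) ∧
        ∀ j, 1 ≤ j → j ≤ k →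
          ((p ^ j : ℕ) : ℤ) ∣ ∑ i, ((x i : ℤ) - c) ^ j - ∑ i, ((y i : ℤ) - c) ^ j}
    with hA
  let q : (Fin k → ℕ) → (Fin k → ℤ) := fun x j =>
    ((∑ i, ((x i : ℤ) - c) ^ (j.1 + 1) - ∑ i, ((y i : ℤ) - c) ^ (j.1 + 1)) / (p ^ (j.1 + 1) : ℕ))
      % (p ^ (k - (j.1 + 1)) : ℕ)
  let B : Finset (Fin k → ℤ) := Fintype.piFinset fun j : Fin k =>
    Finset.Ico (0 : ℤ) (p ^ (k - (j.1 + 1)) : ℕ)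
  have hmaps : ∀ x ∈ A, q x ∈ B := by
    intro x _
    rw [Fintype.mem_piFinset]
    intro j
    have : (0 : ℤ) < (p ^ (k - (j.1 + 1)) : ℕ) := by exact_mod_cast pow_pos hp.pos _
    rw [mem_Ico]
    exact ⟨Int.emod_nonneg _ this.ne', Int.emod_lt_of_pos _ this⟩
  have hfib : ∀ b ∈ B, #{x ∈ A | q x = b} ≤ k.factorial := by
    intro b _
    rcases Finset.eq_empty_or_nonempty {x ∈ A | q x = b} with he | ⟨x0, hx0⟩
    · rw [he]; simp
    · calc #{x ∈ A | q x = b}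
          ≤ #((univ : Finset (Equiv.Perm (Fin k))).image fun σ : Equiv.Perm (Fin k) =>
            x0 ∘ (σ : Fin k → Fin k)) := by
            refine card_le_card fun x hx => ?_
            rw [mem_filter, hA, mem_filter, Fintype.mem_piFinset] at hx hx0
            obtain ⟨σ, hσ⟩ := exists_perm_of_power_sums_modEq hp hkp hP c x0 x
              (fun i => by simpa using hx0.1.1 i) (fun i => by simpa using hx.1.1 i)
              hx0.1.2.1 hx.1.2.1 (by
                intro j hj1 hj2
                have e := congrFun (hx0.2.trans hx.2.symm) ⟨j - 1, by omega⟩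
                simp only [q] at e
                have hj : j - 1 + 1 = j := by omega
                rw [hj] at e
                obtain ⟨u, hu⟩ := hx0.1.2.2 j hj1 hj2
                obtain ⟨v, hv⟩ := hx.1.2.2 j hj1 hj2
                have hpj : ((p ^ j : ℕ) : ℤ) ≠ 0 := by exact_mod_cast pow_ne_zero _ hp.ne_zero
                rw [hu, hv, Int.mul_ediv_cancel_left _ hpj, Int.mul_ediv_cancel_left _ hpj] at e
                obtain ⟨w, hw⟩ := Int.ModEq.dvd (Eq.symm e : v ≡ u [ZMOD _])
                refine ⟨w, ?_⟩
                have hsplit : ((p ^ k : ℕ) : ℤ) = (p ^ j : ℕ) * (p ^ (k - j) : ℕ) := by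
                  rw [← Nat.cast_mul, ← pow_add]; congr 3; omega
                rw [hsplit]
                linear_combination hu - hv + ((p ^ j : ℕ) : ℤ) * hw)
            exact mem_image.mpr ⟨σ, mem_univ _, hσ.symm⟩
        _ ≤ Fintype.card (Equiv.Perm (Fin k)) := card_image_le
        _ = k.factorial := by rw [Fintype.card_perm, Fintype.card_fin]
  have h1 := card_le_mul_card_image_of_maps_to hmaps k.factorial hfib
  refine h1.trans (le_of_eq ?_)
  congr 1
  simp only [B, Fintype.card_piFinset, Int.card_Ico, sub_zero, Int.toNat_natCast]
  rw [Fin.prod_univ_eq_prod_range (fun j => p ^ (k - (j + 1))) k, prod_pow_eq_pow_sum,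
    ← Finset.sum_range_reflect, ← Finset.sum_range_id]
  congr 1
  refine sum_congr rfl fun j hj => ?_
  rw [mem_range] at hj
  omega

/-- The number of pairs in `T × T` on which `φ` takes equal values. -/
def energy {ι G : Type*} [DecidableEq G] (T : Finset ι) (φ : ι → G) : ℕ :=
  #{z ∈ T ×ˢ T | φ z.1 = φ z.2}

lemma energy_eq_sum {ι G : Type*} [DecidableEq G] (T : Finset ι) (φ : ι → G) :
    energy T φ = ∑ w ∈ T.image φ, #{v ∈ T | φ v = w} ^ 2 := by
  rw [energy, card_filter, sum_product, ← sum_fiberwise_of_maps_to (g := φ) (t := T.image φ)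
    (fun x hx => mem_image_of_mem φ hx)]
  refine sum_congr rfl fun w _ => ?_
  rw [sq, ← smul_eq_mul, ← sum_const]
  refine sum_congr rfl fun x hx => ?_
  rw [mem_filter] at hx
  simp only [← card_filter, hx.2, eq_comm]

lemma card_translate_le_energy {ι G : Type*} [DecidableEq G] [AddCommGroup G] (T : Finset ι)
    (φ : ι → G) (h : G) : #{z ∈ T ×ˢ T | φ z.2 = φ z.1 + h} ≤ energy T φ := by
  set n : G → ℕ := fun w => #{v ∈ T | φ v = w} with hn
  have h1 : #{z ∈ T ×ˢ T | φ z.2 = φ z.1 + h} = ∑ w ∈ T.image φ, n w * n (w + h) := by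
    rw [card_filter, sum_product, ← sum_fiberwise_of_maps_to (g := φ) (t := T.image φ)
      (fun x hx => mem_image_of_mem φ hx)]
    refine sum_congr rfl fun w _ => ?_
    rw [hn, ← smul_eq_mul, ← sum_const]
    refine sum_congr rfl fun x hx => ?_
    rw [mem_filter] at hx
    simp only [← card_filter, hx.2]
  have h2 : ∑ w ∈ T.image φ, n (w + h) ^ 2 ≤ ∑ w ∈ T.image φ, n w ^ 2 := by
    rw [← sum_image (s := T.image φ) (g := fun w => w + h) (f := fun w => n w ^ 2)
      (fun _ _ _ _ e => add_right_cancel e)]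
    refine sum_le_sum_of_ne_zero fun w _ hw => ?_
    have : n w ≠ 0 := by intro e; simp [e] at hw
    obtain ⟨v, hv⟩ := card_ne_zero.mp this
    rw [mem_filter] at hv
    exact mem_image.mpr ⟨v, hv.1, hv.2⟩
  rw [h1, energy_eq_sum]
  have h3 : 2 * ∑ w ∈ T.image φ, n w * n (w + h) ≤
      ∑ w ∈ T.image φ, n w ^ 2 + ∑ w ∈ T.image φ, n (w + h) ^ 2 := by
    rw [mul_sum, ← sum_add_distrib]
    refine sum_le_sum fun w _ => ?_
    nlinarith [two_mul_le_add_sq (n w) (n (w + h))]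
  change _ ≤ ∑ w ∈ T.image φ, n w ^ 2
  omega

lemma sum_addChar_norm_sq {ι V : Type*} [AddCommGroup V] [Fintype V] [DecidableEq V]
    (T : Finset ι) (φ : ι → V) :
    ∑ ψ : AddChar V ℂ, ‖∑ x ∈ T, ψ (φ x)‖ ^ 2 = Fintype.card V * energy T φ := by
  have h : ((∑ ψ : AddChar V ℂ, ‖∑ x ∈ T, ψ (φ x)‖ ^ 2 : ℝ) : ℂ) =
      ((Fintype.card V * energy T φ : ℝ) : ℂ) := by
    push_cast
    have h1 : ∀ ψ : AddChar V ℂ, ((‖∑ x ∈ T, ψ (φ x)‖ : ℂ)) ^ 2 =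
        ∑ z ∈ T ×ˢ T, ψ (φ z.1 - φ z.2) := by
      intro ψ
      rw [← Complex.mul_conj', map_sum, sum_mul_sum, sum_product]
      refine sum_congr rfl fun x _ => sum_congr rfl fun y _ => ?_
      rw [AddChar.map_sub_eq_div, div_eq_mul_inv, ← AddChar.map_neg_eq_inv,
        AddChar.map_neg_eq_conj]
    simp_rw [h1]
    rw [sum_comm]
    simp_rw [AddChar.sum_apply_eq_ite, sub_eq_zero]
    rw [energy, card_filter]
    push_cast
    rw [mul_sum]
    refine sum_congr rfl fun z _ => ?_
    split_ifs <;> simp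
  exact_mod_cast h

lemma elemSymm_near_pow {σ : Type*} [Fintype σ] (a : σ → ℂ) {k : ℕ} (hk : 1 ≤ k) {G : ℝ}
    (hG : 0 ≤ G) (hG2 : ∑ c, ‖a c‖ ^ 2 ≤ G ^ 2) (hf : 4 * k * G ≤ ‖∑ c, a c‖) :
    ∀ m, m ≤ k → ‖(m.factorial : ℂ) * elemSymm a m - (∑ c, a c) ^ m‖ ≤
      m / (2 * k) * ‖∑ c, a c‖ ^ m := by
  set f := ∑ c, a c with hfdef
  have hk0 : (0 : ℝ) < k := by exact_mod_cast hk
  have hps : ∀ i, 2 ≤ i → ‖∑ c, a c ^ i‖ ≤ G ^ i := by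
    intro i hi
    have hac : ∀ c, ‖a c‖ ≤ G := fun c => by
      refine le_of_sq_le_sq ?_ hG |> fun h => h
      exact (single_le_sum (f := fun c => ‖a c‖ ^ 2) (fun _ _ => by positivity)
        (mem_univ c)).trans hG2
    calc ‖∑ c, a c ^ i‖ ≤ ∑ c, ‖a c ^ i‖ := norm_sum_le _ _
      _ ≤ ∑ c, ‖a c‖ ^ 2 * G ^ (i - 2) := by
          refine sum_le_sum fun c _ => ?_
          rw [norm_pow]
          conv_lhs => rw [show i = 2 + (i - 2) by omega, pow_add]
          gcongr
          exact hac c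
      _ ≤ G ^ 2 * G ^ (i - 2) := by rw [← sum_mul]; gcongr
      _ = G ^ i := by rw [← pow_add]; congr 1; omega
  intro m
  induction m using Nat.strong_induction_on with
  | _ m ih =>
    intro hm
    rcases Nat.eq_zero_or_pos m with rfl | hpos
    · simp [elemSymm_zero]
    obtain ⟨m, rfl⟩ : ∃ n, m = n + 1 := ⟨m - 1, by omega⟩
    have hsize : ∀ n, n < m + 1 → ‖(n.factorial : ℂ) * elemSymm a n‖ ≤ 2 * ‖f‖ ^ n := by
      intro n hn
      have h1 := ih n hn (by omega)
      have h2 : (n : ℝ) / (2 * k) ≤ 1 := by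
        rw [div_le_one (by positivity)]
        have : (n : ℝ) ≤ k := by exact_mod_cast (by omega : n ≤ k)
        linarith
      calc _ = ‖((n.factorial : ℂ) * elemSymm a n - f ^ n) + f ^ n‖ := by ring_nf
        _ ≤ _ := norm_add_le _ _
        _ ≤ 1 * ‖f‖ ^ n + ‖f‖ ^ n := by
          rw [norm_pow]
          gcongr
          exact h1.trans (by gcongr)
        _ = _ := by ring
    -- isolate the leading term of Newton's recursion
    have hnewt := mul_elemSymm a (m + 1)
    rw [sum_filter, Nat.sum_antidiagonal_eq_sum_range_succ
      (fun i j => if i < m + 1 then (-1 : ℂ) ^ i * elemSymm a i * ∑ c, a c ^ j else 0),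
      sum_range_succ, if_neg (lt_irrefl _), add_zero, sum_congr rfl (fun i hi =>
        if_pos (mem_range.mp hi)), sum_range_succ, sum_congr rfl (fun i hi => by
          rw [show m + 1 - i = m - i + 1 by have := mem_range.mp hi; omega])] at hnewt
    rw [show m + 1 - m = 1 by omega] at hnewt
    simp only [pow_one, ← hfdef] at hnewt
    have hrec : ((m + 1).factorial : ℂ) * elemSymm a (m + 1) -
        f * ((m.factorial : ℂ) * elemSymm a m) =
          (-1) ^ (m + 1 + 1) * ∑ i ∈ range m, (m.factorial : ℂ) * ((-1) ^ i * elemSymm a i *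
          ∑ c, a c ^ (m - i + 1)) := by
      rw [← mul_sum, Nat.factorial_succ]
      push_cast at hnewt ⊢
      have hs : ((-1 : ℂ)) ^ (m + 1 + 1) * (-1) ^ m = 1 := by
        rw [← pow_add]; exact Even.neg_one_pow ⟨m + 1, by ring⟩
      linear_combination (m.factorial : ℂ) * hnewt + (m.factorial : ℂ) * elemSymm a m * f * hs
    have hbound : ‖((m + 1).factorial : ℂ) * elemSymm a (m + 1) -
        f * ((m.factorial : ℂ) * elemSymm a m)‖ ≤ 1 / (2 * k) * ‖f‖ ^ (m + 1) := by
      rw [hrec, norm_mul, norm_pow, norm_neg, norm_one, one_pow, one_mul]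
      have hterm : ∀ i ∈ range m, ‖(m.factorial : ℂ) * ((-1) ^ i * elemSymm a i *
          ∑ c, a c ^ (m - i + 1))‖ ≤ 1 / (2 * k) * ‖f‖ ^ (m + 1) * ((1 / 2) ^ (m - 1 - i) / 2) := by
        intro i hi
        rw [mem_range] at hi
        have hfac : (m.factorial : ℝ) ≤ i.factorial * (k : ℝ) ^ (m - i) := by
          have h1 : m.factorial ≤ i.factorial * m ^ (m - i) := by
            have h4 := Nat.factorial_mul_descFactorial (n := m) (k := m - i) (by omega)
            rw [show m - (m - i) = i by omega] at h4
            rw [← h4]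
            exact Nat.mul_le_mul_left _ (Nat.descFactorial_le_pow _ _)
          calc (m.factorial : ℝ) ≤ ((i.factorial * m ^ (m - i) : ℕ) : ℝ) := by exact_mod_cast h1
            _ ≤ _ := by
              push_cast
              have : (m : ℝ) ≤ k := by exact_mod_cast (by omega : m ≤ k)
              gcongr
        have h1 := hsize i (by omega)
        have h2 := hps (m - i + 1) (by omega)
        have hG' : G ≤ ‖f‖ / (4 * k) := by rw [le_div_iff₀ (by positivity)]; linarith
        rw [norm_mul] at h1
        simp only [Complex.norm_natCast] at h1
        calc ‖(m.factorial : ℂ) * ((-1) ^ i * elemSymm a i * ∑ c, a c ^ (m - i + 1))‖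
            = (m.factorial : ℝ) * ‖elemSymm a i‖ * ‖∑ c, a c ^ (m - i + 1)‖ := by
              simp; ring
          _ ≤ (i.factorial * (k : ℝ) ^ (m - i)) * ‖elemSymm a i‖ *
              (‖f‖ / (4 * k)) ^ (m - i + 1) := by
              gcongr
              exact h2.trans (by gcongr)
          _ = (i.factorial * ‖elemSymm a i‖) * (k : ℝ) ^ (m - i) *
              (‖f‖ / (4 * k)) ^ (m - i + 1) := by
              ring
          _ ≤ (2 * ‖f‖ ^ i) * (k : ℝ) ^ (m - i) * (‖f‖ / (4 * k)) ^ (m - i + 1) := by gcongr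
          _ = 2 / (4 * k) * ‖f‖ ^ (m + 1) * (1 / 4) ^ (m - i) := by
              obtain ⟨d, hd⟩ : ∃ d, m = i + d := ⟨m - i, by omega⟩
              subst hd
              rw [Nat.add_sub_cancel_left]
              have : (‖f‖ / (4 * k)) ^ (d + 1) =
                  ‖f‖ ^ (d + 1) * (1 / 4) ^ d * (1 / (k : ℝ) ^ d) / (4 * k) := by
                rw [div_pow, pow_succ (4 * (k : ℝ)), mul_pow, div_pow, one_pow]; field_simp
              rw [this]
              field_simp
              ring
          _ ≤ 2 / (4 * k) * ‖f‖ ^ (m + 1) * ((1 / 2) ^ (m - i)) := by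
              gcongr
              norm_num
          _ = _ := by
              rw [show m - i = (m - 1 - i) + 1 by omega, pow_succ]; field_simp; ring
      refine (norm_sum_le _ _).trans ((sum_le_sum hterm).trans ?_)
      rw [← mul_sum, sum_range_reflect (fun j => ((1 : ℝ) / 2) ^ j / 2) m, ← sum_div]
      have hgeo : ∑ j ∈ range m, ((1 : ℝ) / 2) ^ j ≤ 2 := by
        have := geom_sum_eq (show (1 / 2 : ℝ) ≠ 1 by norm_num) m
        rw [this]
        have : (0 : ℝ) ≤ (1 / 2) ^ m := by positivity
        rw [div_le_iff_of_neg (by norm_num)]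
        linarith
      have : (∑ j ∈ range m, ((1 : ℝ) / 2) ^ j) / 2 ≤ 1 := by linarith
      calc _ ≤ 1 / (2 * (k : ℝ)) * ‖f‖ ^ (m + 1) * 1 := by gcongr
        _ = _ := mul_one _
    have hih := ih m (by omega) (by omega)
    calc _ = ‖(((m + 1).factorial : ℂ) * elemSymm a (m + 1) -
            f * ((m.factorial : ℂ) * elemSymm a m))
          + f * ((m.factorial : ℂ) * elemSymm a m - f ^ m)‖ := by ring_nf
      _ ≤ _ := norm_add_le _ _
      _ ≤ 1 / (2 * k) * ‖f‖ ^ (m + 1) + ‖f‖ * (m / (2 * k) * ‖f‖ ^ m) := by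
          rw [norm_mul f]; gcongr
      _ = _ := by push_cast; ring

lemma norm_sum_pow_le {σ : Type*} [Fintype σ] [Nonempty σ] (a : σ → ℂ) {k : ℕ} (hk : 1 ≤ k)
    (s : ℕ) :
    ‖∑ c, a c‖ ^ (2 * (s + k)) ≤
      4 * ‖(k.factorial : ℂ) * elemSymm a k‖ ^ 2 * ‖∑ c, a c‖ ^ (2 * s) +
      (4 * k) ^ (2 * (s + k)) * (Fintype.card σ : ℝ) ^ (s + k) * ∑ c, ‖a c‖ ^ (2 * (s + k)) := by
  set f := ∑ c, a c with hfdef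
  set G := Real.sqrt (∑ c, ‖a c‖ ^ 2) with hGdef
  have hG2 : G ^ 2 = ∑ c, ‖a c‖ ^ 2 := Real.sq_sqrt (sum_nonneg fun _ _ => by positivity)
  have hG : 0 ≤ G := Real.sqrt_nonneg _
  have hk0 : (0 : ℝ) < k := by exact_mod_cast hk
  rcases le_total (4 * k * G) ‖f‖ with h | h
  · have h1 := elemSymm_near_pow a hk hG hG2.ge h k le_rfl
    rw [← hfdef] at h1
    have h2 : (k : ℝ) / (2 * k) = 1 / 2 := by field_simp
    rw [h2] at h1
    have h3 : ‖f‖ ^ k ≤ 2 * ‖(k.factorial : ℂ) * elemSymm a k‖ := by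
      have := norm_sub_norm_le (f ^ k) ((k.factorial : ℂ) * elemSymm a k)
      rw [norm_sub_rev, norm_pow] at this
      linarith
    have h4 : ‖f‖ ^ (2 * (s + k)) ≤
        4 * ‖(k.factorial : ℂ) * elemSymm a k‖ ^ 2 * ‖f‖ ^ (2 * s) := by
      calc ‖f‖ ^ (2 * (s + k)) = (‖f‖ ^ k) ^ 2 * ‖f‖ ^ (2 * s) := by ring
        _ ≤ (2 * ‖(k.factorial : ℂ) * elemSymm a k‖) ^ 2 * ‖f‖ ^ (2 * s) := by gcongr
        _ = _ := by ring
    have : 0 ≤ (4 * (k : ℝ)) ^ (2 * (s + k)) * (Fintype.card σ : ℝ) ^ (s + k) *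
      ∑ c, ‖a c‖ ^ (2 * (s + k)) := by positivity
    linarith
  · have hS : s + k ≠ 0 := by omega
    have h5 : (∑ c, ‖a c‖ ^ 2) ^ (s + k) ≤
        (Fintype.card σ : ℝ) ^ (s + k) * ∑ c, ‖a c‖ ^ (2 * (s + k)) := by
      obtain ⟨n, hn⟩ : ∃ n, s + k = n + 1 := ⟨s + k - 1, by omega⟩
      have h6 := pow_sum_div_card_le_sum_pow (s := (univ : Finset σ)) (f := fun c => ‖a c‖ ^ 2)
        (fun _ _ => by positivity) n
      have hc : (1 : ℝ) ≤ Fintype.card σ := by exact_mod_cast Fintype.card_pos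
      rw [div_le_iff₀ (by rw [card_univ]; positivity), card_univ] at h6
      simp only [hn, pow_mul]
      refine h6.trans ?_
      rw [mul_comm]
      gcongr
      omega
    have h7 : ‖f‖ ^ (2 * (s + k)) ≤ (4 * k) ^ (2 * (s + k)) * (∑ c, ‖a c‖ ^ 2) ^ (s + k) := by
      rw [← hG2, ← pow_mul, ← mul_pow]
      gcongr
    have : 0 ≤ 4 * ‖(k.factorial : ℂ) * elemSymm a k‖ ^ 2 * ‖f‖ ^ (2 * s) := by positivity
    calc _ ≤ _ := h7
      _ ≤ (4 * k) ^ (2 * (s + k)) * ((Fintype.card σ : ℝ) ^ (s + k) *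
          ∑ c, ‖a c‖ ^ (2 * (s + k))) := by gcongr
      _ ≤ _ := by rw [← mul_assoc]; linarith

/-- The vector of power sums of exponents `1, …, k` of a tuple. -/
def tupleSum (k : ℕ) {s : ℕ} (x : Fin s → ℕ) : Fin k → ℤ :=
  fun j => ∑ i, (x i : ℤ) ^ (j + 1 : ℕ)

/-- The Vinogradov mean value: the number of solutions of the Vinogradov system of degree `k` in
`2 * s` variables from `{0, …, P - 1}`. -/
def vinogradovMean (s k P : ℕ) : ℕ :=
  energy (Fintype.piFinset fun _ : Fin s => range P) (tupleSum k)

lemma sum_sub_pow_eq {ι : Type*} [Fintype ι] (x y : ι → ℤ) {k : ℕ}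
    (h : ∀ j, 1 ≤ j → j ≤ k → ∑ i, x i ^ j = ∑ i, y i ^ j) (c : ℤ) {j : ℕ} (hj : j ≤ k) :
    ∑ i, (x i - c) ^ j = ∑ i, (y i - c) ^ j := by
  simp only [sub_eq_add_neg, add_pow]
  rw [sum_comm, sum_comm (s := univ) (t := range (j + 1))]
  refine sum_congr rfl fun m hm => ?_
  rw [← sum_mul, ← sum_mul, ← sum_mul, ← sum_mul]
  congr 2
  rcases Nat.eq_zero_or_pos m with rfl | hpos
  · simp
  · exact h m hpos (by rw [mem_range] at hm; omega)

/-- Pairs of elements of `T` whose shifted power sums of exponent `j ≤ k` agree modulo `p ^ j`. -/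
def compatiblePairs (p k : ℕ) {m : ℕ} (T : Finset (Fin m → ℕ)) (c : ℤ) :
    Finset ((Fin m → ℕ) × (Fin m → ℕ)) :=
  open Classical in
  {z ∈ T ×ˢ T | ∀ j, 1 ≤ j → j ≤ k →
    ((p ^ j : ℕ) : ℤ) ∣ ∑ i, ((z.1 i : ℤ) - c) ^ j - ∑ i, ((z.2 i : ℤ) - c) ^ j}

lemma energy_class_le {p k P Q s m : ℕ} [NeZero p] (hPQ : P ≤ p * Q) (T : Finset (Fin m → ℕ))
    (c : ZMod p) :
    energy (T ×ˢ Fintype.piFinset (fun _ : Fin s => {x ∈ range P | ((x : ℕ) : ZMod p) = c}))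
      (fun z => tupleSum k z.1 + tupleSum k z.2) ≤
      vinogradovMean s k Q * #(compatiblePairs p k T (c.val : ℤ)) := by
  classical
  have hp : 0 < p := Nat.pos_of_ne_zero (NeZero.ne p)
  set X : Finset (Fin s → ℕ) :=
    Fintype.piFinset (fun _ : Fin s => {x ∈ range P | ((x : ℕ) : ZMod p) = c}) with hX
  have hXp : ∀ u ∈ X, ∀ i, u i < P ∧ u i = c.val + p * (u i / p) := by
    intro u hu i
    rw [hX, Fintype.mem_piFinset] at hu
    have := hu i
    rw [mem_filter, mem_range] at this
    refine ⟨this.1, ?_⟩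
    have h2 : c.val = u i % p := by rw [← this.2, ZMod.val_natCast]
    rw [h2, Nat.mod_add_div]
  have key : ∀ x y : Fin m → ℕ, ∀ u ∈ X, ∀ v ∈ X,
      tupleSum k x + tupleSum k u = tupleSum k y + tupleSum k v → ∀ j, 1 ≤ j → j ≤ k →
      ∑ i, ((x i : ℤ) - c.val) ^ j - ∑ i, ((y i : ℤ) - c.val) ^ j =
        ((p ^ j : ℕ) : ℤ) * (∑ i, ((v i / p : ℕ) : ℤ) ^ j - ∑ i, ((u i / p : ℕ) : ℤ) ^ j) := by
    intro x y u hu v hv h j hj hjk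
    have h1 := sum_sub_pow_eq (Sum.elim (fun i => (x i : ℤ)) fun i => (u i : ℤ))
      (Sum.elim (fun i => (y i : ℤ)) fun i => (v i : ℤ)) (k := k) (by
        intro j hj hjk
        have := congrFun h ⟨j - 1, by omega⟩
        simp only [Pi.add_apply, tupleSum, Nat.sub_add_cancel hj] at this
        simpa using this) c.val hjk
    simp only [Fintype.sum_sum_type, Sum.elim_inl, Sum.elim_inr] at h1
    have h2 : ∀ w ∈ X, ∑ i, ((w i : ℤ) - c.val) ^ j =
        ((p ^ j : ℕ) : ℤ) * ∑ i, ((w i / p : ℕ) : ℤ) ^ j := by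
      intro w hw
      rw [mul_sum]
      refine sum_congr rfl fun i _ => ?_
      have := (hXp w hw i).2
      have h3 : (w i : ℤ) - c.val = p * ((w i / p : ℕ) : ℤ) := by
        conv_lhs => rw [this]
        push_cast; ring
      rw [h3, mul_pow]; push_cast; ring
    rw [h2 u hu, h2 v hv] at h1
    linarith
  rw [energy]
  refine card_le_mul_card_image_of_maps_to (f := fun w => (w.1.1, w.2.1)) ?_ _ ?_
  · rintro ⟨⟨x, u⟩, ⟨y, v⟩⟩ hw
    simp only [mem_filter, mem_product] at hw
    simp only [compatiblePairs, mem_filter, mem_product]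
    refine ⟨⟨hw.1.1.1, hw.1.2.1⟩, fun j hj hjk => ?_⟩
    rw [key x y u hw.1.1.2 v hw.1.2.2 hw.2 j hj hjk]
    exact dvd_mul_right _ _
  · rintro ⟨x, y⟩ -
    set h : Fin k → ℤ := fun j => (∑ i, ((x i : ℤ) - c.val) ^ (j + 1 : ℕ) -
      ∑ i, ((y i : ℤ) - c.val) ^ (j + 1 : ℕ)) / ((p ^ (j + 1 : ℕ) : ℕ) : ℤ) with hh
    refine le_trans ?_ (card_translate_le_energy
      (Fintype.piFinset fun _ : Fin s => range Q) (tupleSum k) h)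
    refine card_le_card_of_injOn (fun w => (fun i => w.1.2 i / p, fun i => w.2.2 i / p)) ?_ ?_
    · rintro ⟨⟨x', u⟩, ⟨y', v⟩⟩ hw
      simp only [coe_filter, mem_filter, mem_product, Set.mem_ofPred_eq, Prod.mk.injEq] at hw
      obtain ⟨⟨⟨⟨-, hu⟩, -, hv⟩, he⟩, rfl, rfl⟩ := hw
      have hlt : ∀ w ∈ X, ∀ i, w i / p < Q := fun w hw i =>
        Nat.div_lt_of_lt_mul ((hXp w hw i).1.trans_le hPQ)
      simp only [coe_filter, mem_product, Set.mem_ofPred_eq, Fintype.mem_piFinset, mem_range]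
      refine ⟨⟨hlt u hu, hlt v hv⟩, ?_⟩
      funext j
      have := key _ _ u hu v hv he (j + 1) (by omega) (by omega)
      simp only [tupleSum, Pi.add_apply, hh]
      rw [this, Int.mul_ediv_cancel_left _ (by positivity)]
      ring
    · rintro ⟨⟨x', u⟩, ⟨y', v⟩⟩ hw ⟨⟨x'', u'⟩, ⟨y'', v'⟩⟩ hw' e
      simp only [coe_filter, mem_filter, mem_product, Set.mem_ofPred_eq, Prod.mk.injEq] at hw hw' e
      obtain ⟨⟨⟨⟨-, hu⟩, -, hv⟩, he⟩, rfl, rfl⟩ := hw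
      obtain ⟨⟨⟨⟨-, hu'⟩, -, hv'⟩, he'⟩, rfl, rfl⟩ := hw'
      have : ∀ a ∈ X, ∀ b ∈ X, (fun i => a i / p) = (fun i => b i / p) → a = b := by
        intro a ha b hb hab
        funext i
        rw [(hXp a ha i).2, (hXp b hb i).2, congrFun hab i]
      rw [this u hu u' hu' e.1, this v hv v' hv' e.2]

lemma card_compatiblePairs_le {p k P : ℕ} (hp : p.Prime) (hkp : k < p) (hP : P ≤ p ^ k) (c : ℤ) :
    #(compatiblePairs p k {x ∈ Fintype.piFinset (fun _ : Fin k => range P) |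
      Function.Injective (fun i => (x i : ZMod p))} c) ≤
      P ^ k * (k.factorial * p ^ (k * (k - 1) / 2)) := by
  classical
  set T : Finset (Fin k → ℕ) := {x ∈ Fintype.piFinset (fun _ : Fin k => range P) |
      Function.Injective (fun i => (x i : ZMod p))} with hT
  have hTc : #T ≤ P ^ k := (card_filter_le _ _).trans (by simp)
  refine (card_le_mul_card_image_of_maps_to (f := Prod.snd) (t := T) ?_
    (k.factorial * p ^ (k * (k - 1) / 2)) ?_).trans (by rw [mul_comm]; gcongr)
  · intro z hz
    simp only [compatiblePairs, mem_filter, mem_product] at hz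
    exact hz.1.2
  · intro y _
    refine le_trans ?_ (card_le_of_power_sums_modEq hp hkp hP c y)
    refine card_le_card_of_injOn Prod.fst ?_ ?_
    · rintro ⟨a, b⟩ hz
      simp only [compatiblePairs, coe_filter, mem_filter, mem_product, Set.mem_ofPred_eq,
        hT] at hz ⊢
      obtain ⟨⟨⟨h1, -⟩, h2⟩, rfl⟩ := hz
      exact ⟨h1.1, h1.2, h2⟩
    · rintro ⟨a, b⟩ hz ⟨a', b'⟩ hz' e
      simp only [coe_filter, Set.mem_ofPred_eq] at hz hz' e
      rw [e, hz.2, hz'.2]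

lemma card_compatiblePairs_fin_zero (p k : ℕ) (c : ℤ) :
    #(compatiblePairs p k (univ : Finset (Fin 0 → ℕ)) c) ≤ 1 :=
  card_le_one_of_subsingleton _

/-- `k!` times the elementary symmetric polynomial is the sum over injective tuples. -/
lemma factorial_mul_elemSymm {σ : Type*} [Fintype σ] [DecidableEq σ] (a : σ → ℂ) (k : ℕ) :
    (k.factorial : ℂ) * elemSymm a k =
      ∑ c : Fin k → σ with Function.Injective c, ∏ i, a (c i) := by
  classical
  rw [elemSymm, ← sum_fiberwise_of_maps_to (s := univ.filter fun c : Fin k → σ =>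
    Function.Injective c) (g := fun c => univ.image c) (t := powersetCard k univ)]
  · rw [mul_sum]
    refine sum_congr rfl fun t ht => ?_
    rw [mem_powersetCard] at ht
    have h1 : ∀ c ∈ ((univ.filter fun c : Fin k → σ => Function.Injective c).filter
        fun c => univ.image c = t), ∏ i, a (c i) = ∏ i ∈ t, a i := by
      intro c hc
      simp only [mem_filter, mem_univ, true_and] at hc
      rw [← hc.2, prod_image (fun x _ y _ h => hc.1 h)]
    rw [sum_congr rfl h1, sum_const, nsmul_eq_mul]
    congr 2
    have h2 : Fintype.card (Fin k ≃ t) = k.factorial := by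
      have e : Fin k ≃ t := (Fintype.equivFinOfCardEq (by simp [ht.2])).symm
      rw [Fintype.card_equiv e, Fintype.card_fin]
    rw [← h2, ← card_univ]
    refine (card_bij (fun (e : Fin k ≃ t) _ => fun i => (e i : σ)) ?_ ?_ ?_)
    · intro e _
      simp only [mem_filter, mem_univ, true_and]
      refine ⟨Subtype.val_injective.comp e.injective, ?_⟩
      ext x
      simp only [mem_image, mem_univ, true_and]
      exact ⟨fun ⟨i, hi⟩ => hi ▸ (e i).2, fun hx => ⟨e.symm ⟨x, hx⟩, by simp⟩⟩
    · intro e _ e' _ h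
      ext i
      exact congrFun h i
    · intro c hc
      simp only [mem_filter, mem_univ, true_and] at hc
      have hm : ∀ i, c i ∈ t := fun i => hc.2 ▸ mem_image_of_mem c (mem_univ i)
      refine ⟨Equiv.ofBijective (fun i => (⟨c i, hm i⟩ : t)) ⟨fun i j h => hc.1 (by simpa using h),
        fun ⟨x, hx⟩ => ?_⟩, mem_univ _, rfl⟩
      rw [← hc.2, mem_image] at hx
      obtain ⟨i, -, hi⟩ := hx
      exact ⟨i, Subtype.ext hi⟩
  · intro c hc
    simp only [mem_filter, mem_univ, true_and] at hc
    rw [mem_powersetCard, card_image_of_injective _ hc]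
    simp

/-- Elementary symmetric functions of the fibre sums of `g` along `r`. -/
lemma factorial_mul_elemSymm_fiber {σ : Type*} [Fintype σ] [DecidableEq σ] (X : Finset ℕ)
    (r : ℕ → σ) (g : ℕ → ℂ) (k : ℕ) :
    (k.factorial : ℂ) * elemSymm (fun c => ∑ x ∈ X with r x = c, g x) k =
      ∑ x ∈ Fintype.piFinset (fun _ : Fin k => X) with Function.Injective (fun i => r (x i)),
        ∏ i, g (x i) := by
  classical
  rw [factorial_mul_elemSymm]
  rw [← sum_fiberwise_of_maps_to (g := fun (x : Fin k → ℕ) => fun i => r (x i))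
    (t := univ.filter fun c : Fin k → σ => Function.Injective c)]
  · refine sum_congr rfl fun c hc => ?_
    rw [mem_filter] at hc
    rw [prod_univ_sum]
    refine sum_congr ?_ fun _ _ => rfl
    ext x
    simp only [Fintype.mem_piFinset, mem_filter]
    constructor
    · intro h
      have e : (fun i => r (x i)) = c := funext fun i => (h i).2
      exact ⟨⟨fun i => (h i).1, by rw [e]; exact hc.2⟩, e⟩
    · rintro ⟨⟨h1, -⟩, h2⟩ i
      exact ⟨h1 i, congrFun h2 i⟩
  · intro x hx
    rw [mem_filter] at hx
    simpa using hx.2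

lemma energy_intCast_eq {ι : Type*} {k M : ℕ} (T : Finset ι) (φ : ι → Fin k → ℤ)
    (h0 : ∀ x ∈ T, ∀ j, 0 ≤ φ x j) (hM : ∀ x ∈ T, ∀ j, φ x j < M) :
    energy T (fun x j => (φ x j : ZMod M)) = energy T φ := by
  rw [energy, energy]
  congr 1
  refine filter_congr fun z hz => ?_
  rw [mem_product] at hz
  refine ⟨fun h => funext fun j => ?_, fun h => by rw [h]⟩
  have := congrFun h j
  rw [ZMod.intCast_eq_intCast_iff', Int.emod_eq_of_lt (h0 _ hz.1 j) (hM _ hz.1 j),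
    Int.emod_eq_of_lt (h0 _ hz.2 j) (hM _ hz.2 j)] at this
  exact this

lemma energy_le_intCast {ι : Type*} {k M : ℕ} (T : Finset ι) (φ : ι → Fin k → ℤ) :
    energy T φ ≤ energy T (fun x j => (φ x j : ZMod M)) := by
  rw [energy, energy]
  refine card_le_card fun z hz => ?_
  rw [mem_filter] at hz ⊢
  exact ⟨hz.1, by rw [hz.2]⟩

/-- The point `(x, x ^ 2, …, x ^ k)` modulo `M`. -/
def momentPoint (k M : ℕ) (x : ℕ) : Fin k → ZMod M := fun j => (x : ZMod M) ^ (j + 1 : ℕ)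

lemma sum_momentPoint {k M s : ℕ} (x : Fin s → ℕ) :
    ∑ i, momentPoint k M (x i) = fun j => ((tupleSum k x j : ℤ) : ZMod M) := by
  funext j
  simp [momentPoint, tupleSum]

lemma addChar_map_sum {V ι : Type*} [AddCommGroup V] (ψ : AddChar V ℂ) (s : Finset ι) (f : ι → V) :
    ψ (∑ i ∈ s, f i) = ∏ i ∈ s, ψ (f i) := by
  classical
  induction s using Finset.induction_on with
  | empty => simp
  | insert a s ha ih => rw [sum_insert ha, prod_insert ha, AddChar.map_add_eq_mul, ih]

lemma sum_addChar_pow {V : Type*} [AddCommGroup V] (ψ : AddChar V ℂ) (X : Finset ℕ) (θ : ℕ → V)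
    (s : ℕ) : (∑ x ∈ X, ψ (θ x)) ^ s =
      ∑ x ∈ Fintype.piFinset (fun _ : Fin s => X), ψ (∑ i, θ (x i)) := by
  have h : (∑ x ∈ X, ψ (θ x)) ^ s = ∏ _i : Fin s, ∑ x ∈ X, ψ (θ x) := by simp
  rw [h, prod_univ_sum]
  simp only [addChar_map_sum]

lemma norm_sum_addChar_pow {V : Type*} [AddCommGroup V] (ψ : AddChar V ℂ) (X : Finset ℕ)
    (θ : ℕ → V) (s : ℕ) : ‖∑ x ∈ X, ψ (θ x)‖ ^ (2 * s) =
      ‖∑ x ∈ Fintype.piFinset (fun _ : Fin s => X), ψ (∑ i, θ (x i))‖ ^ 2 := by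
  rw [← sum_addChar_pow, norm_pow, ← pow_mul, mul_comm]

lemma tupleSum_nonneg {k s : ℕ} (x : Fin s → ℕ) (j : Fin k) : 0 ≤ tupleSum k x j :=
  sum_nonneg fun _ _ => by positivity

lemma tupleSum_le {k s P : ℕ} (x : Fin s → ℕ) (hx : ∀ i, x i < P) (j : Fin k) :
    tupleSum k x j ≤ s * (P ^ k : ℕ) := by
  calc tupleSum k x j ≤ ∑ _i : Fin s, ((P ^ k : ℕ) : ℤ) := by
        refine sum_le_sum fun i _ => ?_
        have h1 : (x i) ^ (j + 1 : ℕ) ≤ P ^ k :=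
          (Nat.pow_le_pow_left (hx i).le _).trans
            (Nat.pow_le_pow_right (by have := hx i; omega) j.2)
        exact_mod_cast h1
    _ = _ := by simp

lemma sum_addChar_mixed {k M m s P : ℕ} [NeZero M] (hM : (m + s) * P ^ k < M)
    (T : Finset (Fin m → ℕ)) (hT : ∀ x ∈ T, ∀ i, x i < P) (X : Finset ℕ) (hX : ∀ x ∈ X, x < P) :
    ∑ ψ : AddChar (Fin k → ZMod M) ℂ, ‖∑ x ∈ T, ψ (∑ i, momentPoint k M (x i))‖ ^ 2 *
      ‖∑ x ∈ X, ψ (momentPoint k M x)‖ ^ (2 * s) =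
    Fintype.card (Fin k → ZMod M) * energy (T ×ˢ Fintype.piFinset (fun _ : Fin s => X))
      (fun z => tupleSum k z.1 + tupleSum k z.2) := by
  rw [← energy_intCast_eq (M := M), ← sum_addChar_norm_sq]
  · refine sum_congr rfl fun ψ _ => ?_
    rw [norm_sum_addChar_pow, ← mul_pow, ← norm_mul, sum_mul_sum,
      sum_product]
    congr 2
    refine sum_congr rfl fun x _ => sum_congr rfl fun u _ => ?_
    rw [← AddChar.map_add_eq_mul, sum_momentPoint, sum_momentPoint]
    congr 1
    funext j
    simp
  · intro z _ j
    exact add_nonneg (tupleSum_nonneg _ _) (tupleSum_nonneg _ _)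
  · intro z hz j
    rw [mem_product, Fintype.mem_piFinset] at hz
    have h1 := tupleSum_le z.1 (hT _ hz.1) j
    have h2 := tupleSum_le z.2 (fun i => hX _ (hz.2 i)) j
    have h3 : ((m : ℤ) + s) * (P ^ k : ℕ) < M := by exact_mod_cast hM
    simp only [Pi.add_apply]
    linarith

lemma vinogradovMean_rec {p k P Q s : ℕ} (hp : p.Prime) (hk : 1 ≤ k) (hkp : k < p)
    (hP : P ≤ p ^ k) (hPQ : P ≤ p * Q) (hs : 1 ≤ s) :
    (vinogradovMean (s + k) k P : ℝ) ≤
      (4 * (p : ℝ) ^ (2 * s) * (P ^ k * (k.factorial * p ^ (k * (k - 1) / 2))) +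
      (4 * k) ^ (2 * (s + k)) * (p : ℝ) ^ (s + k + 1) * (Q : ℝ) ^ (2 * k)) *
        vinogradovMean s k Q := by
  classical
  have : NeZero p := ⟨hp.ne_zero⟩
  have : Fact p.Prime := ⟨hp⟩
  set M := (k + s) * P ^ k + 1 with hMdef
  have : NeZero M := ⟨by omega⟩
  have hV0 : (0 : ℝ) < Fintype.card (Fin k → ZMod M) := by exact_mod_cast Fintype.card_pos
  set V : ℝ := (Fintype.card (Fin k → ZMod M) : ℝ) with hV
  set J : ℝ := (vinogradovMean s k Q : ℝ) with hJ
  have hJ0 : 0 ≤ J := by positivity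
  let X : ZMod p → Finset ℕ := fun c => {x ∈ range P | ((x : ℕ) : ZMod p) = c}
  have hXP : ∀ c, ∀ x ∈ X c, x < P := fun c x hx => by
    simp only [X, mem_filter, mem_range] at hx; exact hx.1
  let a : AddChar (Fin k → ZMod M) ℂ → ZMod p → ℂ :=
    fun ψ c => ∑ x ∈ X c, ψ (momentPoint k M x)
  have hsum : ∀ ψ, ∑ c, a ψ c = ∑ x ∈ range P, ψ (momentPoint k M x) := fun ψ =>
    sum_fiberwise_of_maps_to (fun x _ => mem_univ _) _
  let T : Finset (Fin k → ℕ) := {x ∈ Fintype.piFinset (fun _ : Fin k => range P) |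
      Function.Injective (fun i => (x i : ZMod p))}
  have hTP : ∀ x ∈ T, ∀ i, x i < P := fun x hx i => by
    simp only [T, mem_filter, Fintype.mem_piFinset, mem_range] at hx; exact hx.1 i
  have hD : ∀ ψ, (k.factorial : ℂ) * elemSymm (a ψ) k =
      ∑ x ∈ T, ψ (∑ i, momentPoint k M (x i)) := by
    intro ψ
    simp only [addChar_map_sum]
    exact factorial_mul_elemSymm_fiber (range P) (fun x => (x : ZMod p))
      (fun x => ψ (momentPoint k M x)) k
  -- the full mean value
  have hleft : V * vinogradovMean (s + k) k P ≤
      ∑ ψ : AddChar (Fin k → ZMod M) ℂ, ‖∑ c, a ψ c‖ ^ (2 * (s + k)) := by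
    calc V * vinogradovMean (s + k) k P
        ≤ V * energy (Fintype.piFinset fun _ : Fin (s + k) => range P)
          (fun x j => (tupleSum k x j : ZMod M)) := by
          gcongr
          exact energy_le_intCast _ _
      _ = _ := by
          rw [hV, ← sum_addChar_norm_sq]
          refine sum_congr rfl fun ψ _ => ?_
          rw [hsum, norm_sum_addChar_pow]
          simp only [sum_momentPoint]
  have hmain : ∀ c, ∑ ψ, ‖(k.factorial : ℂ) * elemSymm (a ψ) k‖ ^ 2 * ‖a ψ c‖ ^ (2 * s) ≤
      V * (P ^ k * (k.factorial * p ^ (k * (k - 1) / 2)) * J) := by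
    intro c
    simp only [hD]
    rw [sum_addChar_mixed (by omega) T hTP (X c) (hXP c)]
    gcongr
    have h1 := (energy_class_le (k := k) (s := s) hPQ T c).trans
      (Nat.mul_le_mul_left _ (card_compatiblePairs_le hp hkp hP _))
    rw [mul_comm, hJ]
    exact_mod_cast h1
  have haQ : ∀ ψ c, ‖a ψ c‖ ≤ Q := by
    intro ψ c
    have h1 : #(X c) ≤ Q := by
      rw [← card_range Q]
      refine card_le_card_of_injOn (fun x => x / p) ?_ ?_
      · intro x hx
        simp only [coe_range, Set.mem_Iio]
        exact Nat.div_lt_of_lt_mul ((hXP c x hx).trans_le hPQ)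
      · intro x hx y hy e
        simp only [X, coe_filter, Set.mem_ofPred_eq] at hx hy e
        have h2 : x % p = y % p := by
          rw [← ZMod.val_natCast, ← ZMod.val_natCast, hx.2, hy.2]
        rw [← Nat.div_add_mod x p, ← Nat.div_add_mod y p, e, h2]
    calc ‖a ψ c‖ ≤ ∑ x ∈ X c, ‖ψ (momentPoint k M x)‖ := norm_sum_le _ _
      _ = #(X c) := by simp
      _ ≤ Q := by exact_mod_cast h1
  have hclass : ∀ c, ∑ ψ, ‖a ψ c‖ ^ (2 * (s + k)) ≤ V * ((Q : ℝ) ^ (2 * k) * J) := by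
    intro c
    have h2 : ∑ ψ, ‖a ψ c‖ ^ (2 * s) ≤ V * J := by
      have h3 := sum_addChar_mixed (k := k) (m := 0) (s := s) (P := P) (M := M)
        (by rw [hMdef]; nlinarith [Nat.zero_le (k * P ^ k)])
        (univ : Finset (Fin 0 → ℕ)) (fun x _ i => i.elim0) (X c) (hXP c)
      simp only [Fintype.sum_unique, univ_eq_empty, sum_empty, AddChar.map_zero_eq_one,
        norm_one, one_pow, one_mul] at h3
      rw [h3]
      gcongr
      have h4 := (energy_class_le (k := k) (s := s) hPQ (univ : Finset (Fin 0 → ℕ)) c).trans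
        (Nat.mul_le_mul_left _ (card_compatiblePairs_fin_zero p k _))
      rw [mul_one] at h4
      rw [hJ]
      exact_mod_cast h4
    calc ∑ ψ, ‖a ψ c‖ ^ (2 * (s + k)) ≤ ∑ ψ, (Q : ℝ) ^ (2 * k) * ‖a ψ c‖ ^ (2 * s) := by
          refine sum_le_sum fun ψ _ => ?_
          rw [mul_add, pow_add, mul_comm]
          gcongr
          exact haQ ψ c
      _ ≤ _ := by
          rw [← mul_sum, mul_left_comm]
          gcongr
  have hpoint : ∀ ψ, ‖∑ c, a ψ c‖ ^ (2 * (s + k)) ≤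
      4 * (p : ℝ) ^ (2 * s - 1) * ∑ c, ‖(k.factorial : ℂ) * elemSymm (a ψ) k‖ ^ 2 *
        ‖a ψ c‖ ^ (2 * s) +
      (4 * k) ^ (2 * (s + k)) * (p : ℝ) ^ (s + k) * ∑ c, ‖a ψ c‖ ^ (2 * (s + k)) := by
    intro ψ
    have h1 := norm_sum_pow_le (a ψ) hk s
    rw [ZMod.card] at h1
    refine h1.trans ?_
    gcongr ?_ + _
    have h2 : ‖∑ c, a ψ c‖ ^ (2 * s) ≤ (p : ℝ) ^ (2 * s - 1) * ∑ c, ‖a ψ c‖ ^ (2 * s) := by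
      obtain ⟨n, hn⟩ : ∃ n, 2 * s = n + 1 := ⟨2 * s - 1, by omega⟩
      have h3 := pow_sum_div_card_le_sum_pow (s := (univ : Finset (ZMod p)))
        (f := fun c => ‖a ψ c‖) (fun _ _ => by positivity) n
      rw [card_univ, ZMod.card, div_le_iff₀ (by have := hp.pos; positivity)] at h3
      rw [hn, Nat.add_sub_cancel, mul_comm]
      exact (pow_le_pow_left₀ (norm_nonneg _) (norm_sum_le _ _) _).trans h3
    calc _ ≤ 4 * ‖(k.factorial : ℂ) * elemSymm (a ψ) k‖ ^ 2 *
          ((p : ℝ) ^ (2 * s - 1) * ∑ c, ‖a ψ c‖ ^ (2 * s)) := by gcongr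
      _ = _ := by rw [← mul_sum]; ring
  have htotal : V * vinogradovMean (s + k) k P ≤ V *
      ((4 * (p : ℝ) ^ (2 * s) * (P ^ k * (k.factorial * p ^ (k * (k - 1) / 2))) +
      (4 * k) ^ (2 * (s + k)) * (p : ℝ) ^ (s + k + 1) * (Q : ℝ) ^ (2 * k)) * J) := by
    refine hleft.trans ((sum_le_sum fun ψ _ => hpoint ψ).trans ?_)
    rw [sum_add_distrib, ← mul_sum, ← mul_sum, sum_comm, sum_comm (s := univ) (t := univ)
      (f := fun ψ c => ‖a ψ c‖ ^ (2 * (s + k)))]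
    calc _ ≤ 4 * (p : ℝ) ^ (2 * s - 1) *
          ∑ _c : ZMod p, V * (P ^ k * (k.factorial * p ^ (k * (k - 1) / 2)) * J) +
        (4 * k) ^ (2 * (s + k)) * (p : ℝ) ^ (s + k) *
          ∑ _c : ZMod p, V * ((Q : ℝ) ^ (2 * k) * J) := by
          gcongr with c _ c _
          · exact hmain c
          · exact hclass c
      _ = _ := by
          simp only [sum_const, card_univ, ZMod.card, nsmul_eq_mul]
          have h1 : (p : ℝ) ^ (2 * s) = (p : ℝ) ^ (2 * s - 1) * p := by
            rw [← pow_succ]; congr 1; omega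
          rw [h1]; ring
  exact le_of_mul_le_mul_left htotal hV0

lemma vinogradovMean_le_trivial (s k P : ℕ) : vinogradovMean s k P ≤ P ^ (2 * s) := by
  refine (card_filter_le _ _).trans ?_
  rw [card_product, Fintype.card_piFinset]
  simp [two_mul, pow_add]

/-- A prime of size about `P ^ (1 / k)`. -/
lemma exists_prime_near_root {k P : ℕ} (hk : 1 ≤ k) (hP : k ^ k ≤ P) :
    ∃ p : ℕ, p.Prime ∧ k < p ∧ P ≤ p ^ k ∧ (P : ℝ) ^ (1 / (k : ℝ)) ≤ p ∧
      (p : ℝ) ≤ 4 * (P : ℝ) ^ (1 / (k : ℝ)) := by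
  set R : ℝ := (P : ℝ) ^ (1 / (k : ℝ)) with hR
  have hk0 : (0 : ℝ) < k := by exact_mod_cast hk
  have hRk : R ^ k = P := by
    rw [hR, one_div, Real.rpow_inv_natCast_pow (by positivity) (by omega)]
  have hRge : (k : ℝ) ≤ R := by
    refine le_of_pow_le_pow_left₀ (n := k) (by omega) (by positivity) ?_
    rw [hRk]; exact_mod_cast hP
  have hR1 : 1 ≤ R := le_trans (by exact_mod_cast hk) hRge
  set n := ⌈R⌉₊ with hn
  have hnR : R ≤ n := Nat.le_ceil R
  have hn2 : (n : ℝ) < R + 1 := Nat.ceil_lt_add_one (by positivity)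
  have hkn : k ≤ n := by exact_mod_cast hRge.trans hnR
  obtain ⟨p, hp, h1, h2⟩ := Nat.exists_prime_lt_and_le_two_mul n (by omega)
  have h1' : (n : ℝ) ≤ p := by exact_mod_cast h1.le
  have h2' : (p : ℝ) ≤ 2 * n := by exact_mod_cast h2
  refine ⟨p, hp, by omega, ?_, hnR.trans h1', by linarith⟩
  have : (P : ℝ) ≤ (p : ℝ) ^ k := by
    rw [← hRk]; exact pow_le_pow_left₀ (by positivity) (hnR.trans h1') _
  exact_mod_cast this

/-- The saving missing from the optimal exponent after `τ` steps of the recursion. -/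
noncomputable def excess (k τ : ℕ) : ℝ := (k * (k + 1) / 2 : ℝ) * (1 - 1 / (k : ℝ)) ^ τ

lemma excess_nonneg {k : ℕ} (hk : 1 ≤ k) (τ : ℕ) : 0 ≤ excess k τ := by
  have : 1 / (k : ℝ) ≤ 1 := by
    rw [div_le_one (by exact_mod_cast hk)]; exact_mod_cast hk
  have h : 0 ≤ 1 - 1 / (k : ℝ) := by linarith
  unfold excess
  positivity

lemma excess_le {k : ℕ} (hk : 1 ≤ k) (τ : ℕ) : excess k τ ≤ k * (k + 1) / 2 := by
  have : 1 / (k : ℝ) ≤ 1 := by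
    rw [div_le_one (by exact_mod_cast hk)]; exact_mod_cast hk
  have h0 : (0 : ℝ) ≤ 1 / k := by positivity
  have h : (1 - 1 / (k : ℝ)) ^ τ ≤ 1 := pow_le_one₀ (by linarith) (by linarith)
  unfold excess
  exact mul_le_of_le_one_right (by positivity) h

lemma vinogradovMean_step {k P s : ℕ} {K η : ℝ} (hk : 4 ≤ k) (hs : k ^ 2 ≤ s)
    (hs9 : s + k ≤ 9 * k ^ 2) (hK : 0 ≤ K) (hη0 : 0 ≤ η) (hη : η ≤ k * (k + 1) / 2)
    (hJ : ∀ Q : ℕ, 1 ≤ Q → (vinogradovMean s k Q : ℝ) ≤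
      K * (Q : ℝ) ^ (2 * (s : ℝ) - k * (k + 1) / 2 + η)) (hP : k ^ k ≤ P) :
    (vinogradovMean (s + k) k P : ℝ) ≤ (4 * (k : ℝ)) ^ (47 * k ^ 2) * K *
      (P : ℝ) ^ (2 * ((s + k : ℕ) : ℝ) - k * (k + 1) / 2 + η * (1 - 1 / (k : ℝ))) := by
  obtain ⟨p, hp, hkp, hPp, hRp, hpR⟩ := exists_prime_near_root (by omega) hP
  set R : ℝ := (P : ℝ) ^ (1 / (k : ℝ)) with hR
  set Q := P / p + 1 with hQ
  have hk4 : (4 : ℝ) ≤ k := by exact_mod_cast hk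
  have hk0 : (0 : ℝ) < k := by linarith
  have hP1 : 4 ≤ P := hk.trans ((Nat.le_self_pow (by omega) k).trans hP)
  have hP1' : (1 : ℝ) ≤ P := by exact_mod_cast (by omega : 1 ≤ P)
  have hPQ : P ≤ p * Q := by
    rw [hQ, mul_add, mul_one]
    have := Nat.div_add_mod P p
    have := Nat.mod_lt P hp.pos
    omega
  have hQP : Q ≤ P := by
    have h1 : P / p ≤ P / 2 := Nat.div_le_div_left hp.two_le (by norm_num)
    omega
  have hrec := vinogradovMean_rec (s := s) hp (by omega) hkp hPp hPQ (by nlinarith)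
  have hp0 : (0 : ℝ) < p := by exact_mod_cast hp.pos
  have hp1 : (1 : ℝ) ≤ p := by exact_mod_cast hp.one_le
  have hsk : (k : ℝ) ^ 2 ≤ s := by exact_mod_cast hs
  set h := k * (k - 1) / 2 with hh
  have hh2 : 2 * h = k * (k - 1) := by
    rw [hh]; exact Nat.mul_div_cancel' (even_iff_two_dvd.mp (Nat.even_mul_pred_self k))
  have hhr : (h : ℝ) = k * (k - 1) / 2 := by
    have : (2 * h : ℝ) = k * ((k - 1 : ℕ) : ℝ) := by exact_mod_cast hh2
    rw [Nat.cast_sub (by omega)] at this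
    push_cast at this
    linarith
  -- merge the two terms of the recursion
  have hmerge : 4 * (p : ℝ) ^ (2 * s) * (P ^ k * (k.factorial * p ^ h)) +
      (4 * k) ^ (2 * (s + k)) * (p : ℝ) ^ (s + k + 1) * (Q : ℝ) ^ (2 * k) ≤
      2 * (4 * k) ^ (2 * (s + k)) * (p : ℝ) ^ (2 * s + h) * (P : ℝ) ^ k := by
    have h1 : 4 * (k.factorial : ℝ) ≤ (4 * k) ^ (2 * (s + k)) := by
      have e1 : (k.factorial : ℝ) ≤ (k : ℝ) ^ k := by exact_mod_cast Nat.factorial_le_pow k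
      calc 4 * (k.factorial : ℝ) ≤ 4 ^ k * (k : ℝ) ^ k := by
            gcongr
            exact le_self_pow₀ (by norm_num) (by omega)
        _ = (4 * k) ^ k := by rw [mul_pow]
        _ ≤ _ := pow_le_pow_right₀ (by linarith) (by omega)
    have h2 : (p : ℝ) ^ (s + k + 1) * (Q : ℝ) ^ (2 * k) ≤ (p : ℝ) ^ (2 * s + h) * (P : ℝ) ^ k := by
      have e1 : (Q : ℝ) ^ (2 * k) ≤ P ^ k * p ^ (k * k) := by
        calc (Q : ℝ) ^ (2 * k) ≤ (P : ℝ) ^ (2 * k) := by gcongr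
          _ = P ^ k * P ^ k := by ring
          _ ≤ P ^ k * (p ^ k) ^ k := by gcongr; exact_mod_cast hPp
          _ = _ := by rw [pow_mul]
      calc _ ≤ (p : ℝ) ^ (s + k + 1) * (P ^ k * p ^ (k * k)) := by gcongr
        _ = (p : ℝ) ^ (s + k + 1 + k * k) * P ^ k := by ring
        _ ≤ _ := by
          have e3 : k + 1 ≤ h := by
            obtain ⟨m, rfl⟩ : ∃ m, k = m + 4 := ⟨k - 4, by omega⟩
            rw [show m + 4 - 1 = m + 3 by omega] at hh2
            nlinarith
          have e4 : s + k + 1 + k * k ≤ 2 * s + h := by nlinarith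
          have e5 : (p : ℝ) ^ (s + k + 1 + k * k) ≤ p ^ (2 * s + h) := pow_le_pow_right₀ hp1 e4
          gcongr
    calc _ = (4 * (k.factorial : ℝ)) * (p : ℝ) ^ (2 * s + h) * P ^ k +
          (4 * k) ^ (2 * (s + k)) * ((p : ℝ) ^ (s + k + 1) * (Q : ℝ) ^ (2 * k)) := by ring
      _ ≤ (4 * k) ^ (2 * (s + k)) * (p : ℝ) ^ (2 * s + h) * P ^ k +
          (4 * k) ^ (2 * (s + k)) * ((p : ℝ) ^ (2 * s + h) * (P : ℝ) ^ k) := by gcongr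
      _ = _ := by ring
  set e : ℝ := 2 * (s : ℝ) - k * (k + 1) / 2 + η with he
  have he0 : 0 ≤ e := by nlinarith
  have he2 : e ≤ 2 * s := by linarith
  -- real powers
  have hQe : (Q : ℝ) ^ e ≤ 2 ^ (2 * s) * (P : ℝ) ^ ((1 - 1 / (k : ℝ)) * e) := by
    have e1 : (Q : ℝ) ≤ 2 * (P : ℝ) ^ (1 - 1 / (k : ℝ)) := by
      have a1 : ((P / p : ℕ) : ℝ) ≤ (P : ℝ) ^ (1 - 1 / (k : ℝ)) := by
        refine Nat.cast_div_le.trans ?_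
        rw [Real.rpow_sub (by linarith), Real.rpow_one]
        gcongr
      have a2 : 1 ≤ (P : ℝ) ^ (1 - 1 / (k : ℝ)) := by
        refine Real.one_le_rpow hP1' ?_
        rw [sub_nonneg, div_le_one hk0]; linarith
      rw [hQ]; push_cast; linarith
    calc (Q : ℝ) ^ e ≤ (2 * (P : ℝ) ^ (1 - 1 / (k : ℝ))) ^ e :=
          Real.rpow_le_rpow (by positivity) e1 he0
      _ = 2 ^ e * (P : ℝ) ^ ((1 - 1 / (k : ℝ)) * e) := by
          rw [Real.mul_rpow (by norm_num) (by positivity), ← Real.rpow_mul (by positivity)]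
      _ ≤ _ := by
          gcongr
          rw [← Real.rpow_natCast]
          refine Real.rpow_le_rpow_of_exponent_le (by norm_num) ?_
          push_cast; exact he2
  have hpe : (p : ℝ) ^ (2 * s + h) ≤ 4 ^ (19 * k ^ 2) * (P : ℝ) ^ (1 / (k : ℝ) * (2 * s + h)) := by
    calc (p : ℝ) ^ (2 * s + h) ≤ (4 * R) ^ (2 * s + h) := by gcongr
      _ = 4 ^ (2 * s + h) * R ^ (2 * s + h) := by rw [mul_pow]
      _ ≤ 4 ^ (19 * k ^ 2) * R ^ (2 * s + h) := by
          have a1 : h ≤ k ^ 2 := by rw [sq]; nlinarith [Nat.mul_le_mul_left k (Nat.sub_le k 1)]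
          have a2 : 2 * s + h ≤ 19 * k ^ 2 := by omega
          have a3 : (4 : ℝ) ^ (2 * s + h) ≤ 4 ^ (19 * k ^ 2) := pow_le_pow_right₀ (by norm_num) a2
          gcongr
      _ = _ := by
          rw [hR, ← Real.rpow_natCast (_ ^ _), ← Real.rpow_mul (by positivity)]
          push_cast; rfl
  have hconst : 2 * (4 * (k : ℝ)) ^ (2 * (s + k)) * 4 ^ (19 * k ^ 2) * 2 ^ (2 * s) ≤
      (4 * (k : ℝ)) ^ (47 * k ^ 2) := by
    have hb : (1 : ℝ) ≤ 4 * k := by linarith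
    calc 2 * (4 * (k : ℝ)) ^ (2 * (s + k)) * 4 ^ (19 * k ^ 2) * 2 ^ (2 * s)
        = 2 * (4 * (k : ℝ)) ^ (2 * (s + k)) * 4 ^ (19 * k ^ 2) * 4 ^ s := by
          rw [pow_mul 2 2 s]; norm_num
      _ ≤ (4 * (k : ℝ)) ^ k * (4 * (k : ℝ)) ^ (2 * (s + k)) * (4 * k) ^ (19 * k ^ 2) *
          (4 * k) ^ s := by
          gcongr
          · exact le_trans (by linarith) (le_self_pow₀ hb (by omega))
          · linarith
          · linarith
      _ = (4 * (k : ℝ)) ^ (k + 2 * (s + k) + 19 * k ^ 2 + s) := by simp only [pow_add]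
      _ ≤ _ := pow_le_pow_right₀ hb (by omega)
  have hPexp : (P : ℝ) ^ (1 / (k : ℝ) * (2 * s + h)) * (P : ℝ) ^ k *
      (P : ℝ) ^ ((1 - 1 / (k : ℝ)) * e) =
      (P : ℝ) ^ (2 * ((s + k : ℕ) : ℝ) - k * (k + 1) / 2 + η * (1 - 1 / (k : ℝ))) := by
    rw [← Real.rpow_natCast (P : ℝ) k, ← Real.rpow_add (by linarith),
      ← Real.rpow_add (by linarith)]
    congr 1
    rw [he, hhr]; push_cast; field_simp; ring
  have hQ1 : 1 ≤ Q := Nat.le_add_left 1 _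
  calc (vinogradovMean (s + k) k P : ℝ)
      ≤ (2 * (4 * k) ^ (2 * (s + k)) * (p : ℝ) ^ (2 * s + h) * (P : ℝ) ^ k) *
        (K * (2 ^ (2 * s) * (P : ℝ) ^ ((1 - 1 / (k : ℝ)) * e))) := by
        refine hrec.trans ?_
        gcongr
        exact (hJ Q hQ1).trans (by gcongr)
    _ ≤ (2 * (4 * k) ^ (2 * (s + k)) * (4 ^ (19 * k ^ 2) *
        (P : ℝ) ^ (1 / (k : ℝ) * (2 * s + h))) * (P : ℝ) ^ k) *
        (K * (2 ^ (2 * s) * (P : ℝ) ^ ((1 - 1 / (k : ℝ)) * e))) := by gcongr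
    _ = (2 * (4 * (k : ℝ)) ^ (2 * (s + k)) * 4 ^ (19 * k ^ 2) * 2 ^ (2 * s)) * K *
        ((P : ℝ) ^ (1 / (k : ℝ) * (2 * s + h)) * (P : ℝ) ^ k *
          (P : ℝ) ^ ((1 - 1 / (k : ℝ)) * e)) := by ring
    _ ≤ _ := by rw [hPexp]; gcongr

lemma vinogradovMean_iterate {k : ℕ} (hk : 4 ≤ k) (τ : ℕ) (hτ : τ ≤ 8 * k) {P : ℕ} (hP : 1 ≤ P) :
    (vinogradovMean (k ^ 2 + k * τ) k P : ℝ) ≤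
      (k : ℝ) ^ k ^ 3 * ((4 * (k : ℝ)) ^ (47 * k ^ 2)) ^ τ *
        (P : ℝ) ^ (2 * ((k ^ 2 + k * τ : ℕ) : ℝ) - k * (k + 1) / 2 + excess k τ) := by
  have hk4 : (4 : ℝ) ≤ k := by exact_mod_cast hk
  have hb : (1 : ℝ) ≤ 4 * k := by linarith
  induction τ generalizing P with
  | zero =>
    have h1 : (1 : ℝ) ≤ (k : ℝ) ^ k ^ 3 := one_le_pow₀ (by linarith)
    have h2 : (vinogradovMean (k ^ 2 + k * 0) k P : ℝ) ≤ (P : ℝ) ^ (2 * (k ^ 2 + k * 0)) := by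
      exact_mod_cast vinogradovMean_le_trivial _ _ _
    refine h2.trans ?_
    rw [pow_zero, mul_one, excess, pow_zero, mul_one, sub_add_cancel, ← Real.rpow_natCast]
    push_cast
    exact le_mul_of_one_le_left (by positivity) h1
  | succ τ ih =>
    have hexc : excess k (τ + 1) = excess k τ * (1 - 1 / (k : ℝ)) := by
      rw [excess, excess, pow_succ]; ring
    have hidx : k ^ 2 + k * (τ + 1) = k ^ 2 + k * τ + k := by ring
    rcases le_total (k ^ k) P with hPk | hPk
    · have h1 := vinogradovMean_step (P := P) (s := k ^ 2 + k * τ) hk (by omega)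
        (by nlinarith) (by positivity) (excess_nonneg (by omega) τ) (excess_le (by omega) τ)
        (fun Q hQ => ih (by omega) hQ) hPk
      rw [hexc, hidx, pow_succ]
      refine h1.trans (le_of_eq ?_)
      ring_nf
    · have hP0 : (0 : ℝ) < P := by exact_mod_cast hP
      have h2 : (vinogradovMean (k ^ 2 + k * (τ + 1)) k P : ℝ) ≤
          (P : ℝ) ^ (2 * (k ^ 2 + k * (τ + 1))) := by
        exact_mod_cast vinogradovMean_le_trivial _ _ _
      set E : ℝ := 2 * ((k ^ 2 + k * (τ + 1) : ℕ) : ℝ) - k * (k + 1) / 2 + excess k (τ + 1) with hE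
      have h3 : (P : ℝ) ^ (2 * (k ^ 2 + k * (τ + 1))) ≤ (P : ℝ) ^ (k ^ 2) * (P : ℝ) ^ E := by
        rw [← Real.rpow_natCast, ← Real.rpow_natCast, ← Real.rpow_add hP0]
        refine Real.rpow_le_rpow_of_exponent_le (by exact_mod_cast hP) ?_
        have := excess_nonneg (k := k) (by omega) (τ + 1)
        rw [hE]; push_cast; nlinarith
      have h4 : (P : ℝ) ^ (k ^ 2) ≤ (k : ℝ) ^ k ^ 3 := by
        calc (P : ℝ) ^ (k ^ 2) ≤ ((k : ℝ) ^ k) ^ (k ^ 2) := by gcongr; exact_mod_cast hPk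
          _ = _ := by rw [← pow_mul]; congr 1; ring
      have h5 : (1 : ℝ) ≤ ((4 * (k : ℝ)) ^ (47 * k ^ 2)) ^ (τ + 1) :=
        one_le_pow₀ (one_le_pow₀ hb)
      calc _ ≤ _ := h2.trans h3
        _ ≤ (k : ℝ) ^ k ^ 3 * (P : ℝ) ^ E := by gcongr
        _ ≤ _ := by
          gcongr
          exact le_mul_of_one_le_right (by positivity) h5

/-- Vinogradov's mean value theorem with `9 * k ^ 2` variables on each side. -/
theorem vinogradovMean_le {k P : ℕ} (hk : 4 ≤ k) (hP : 1 ≤ P) :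
    (vinogradovMean (9 * k ^ 2) k P : ℝ) ≤ (4 * (k : ℝ)) ^ (377 * k ^ 3) *
      (P : ℝ) ^ (18 * (k : ℝ) ^ 2 - (1 - 1 / 2000) * (k * (k + 1) / 2)) := by
  have hk4 : (4 : ℝ) ≤ k := by exact_mod_cast hk
  have h1 := vinogradovMean_iterate hk (8 * k) le_rfl hP
  rw [show k ^ 2 + k * (8 * k) = 9 * k ^ 2 by ring] at h1
  refine h1.trans ?_
  have h2 : (1 - 1 / (k : ℝ)) ^ (8 * k) ≤ 1 / 2000 := by
    have e0 : 0 ≤ 1 - 1 / (k : ℝ) := by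
      rw [sub_nonneg, div_le_one (by linarith)]; linarith
    have e1 : 1 - 1 / (k : ℝ) ≤ Real.exp (-(1 / k)) := by
      have := Real.add_one_le_exp (-(1 / (k : ℝ))); linarith
    calc (1 - 1 / (k : ℝ)) ^ (8 * k) ≤ Real.exp (-(1 / k)) ^ (8 * k) := by gcongr
      _ = Real.exp (-8) := by
        rw [← Real.exp_nat_mul]; congr 1; push_cast; field_simp
      _ ≤ 1 / 2000 := by
        rw [Real.exp_neg, one_div]
        gcongr
        have := Real.exp_one_gt_d9
        calc (2000 : ℝ) ≤ 2.7 ^ 8 := by norm_num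
          _ ≤ Real.exp 1 ^ 8 := by gcongr; linarith
          _ = _ := by rw [← Real.exp_nat_mul]; norm_num
  have h3 : (k : ℝ) ^ k ^ 3 * ((4 * (k : ℝ)) ^ (47 * k ^ 2)) ^ (8 * k) ≤
      (4 * (k : ℝ)) ^ (377 * k ^ 3) := by
    calc _ ≤ (4 * (k : ℝ)) ^ k ^ 3 * ((4 * (k : ℝ)) ^ (47 * k ^ 2)) ^ (8 * k) := by
          gcongr; linarith
      _ = _ := by rw [← pow_mul, ← pow_add]; congr 1; ring
  gcongr
  · exact_mod_cast hP
  · rw [excess]; push_cast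
    nlinarith [mul_le_mul_of_nonneg_left h2 (show (0 : ℝ) ≤ k * (k + 1) / 2 by positivity)]

/-- The oscillating factor `exp (i x)`. -/
noncomputable def osc (x : ℝ) : ℂ := Complex.exp (x * Complex.I)

lemma osc_zero : osc 0 = 1 := by simp [osc]

lemma osc_add (x y : ℝ) : osc (x + y) = osc x * osc y := by
  rw [osc, osc, osc, ← Complex.exp_add]; push_cast; ring_nf

lemma norm_osc (x : ℝ) : ‖osc x‖ = 1 := Complex.norm_exp_ofReal_mul_I x

lemma conj_osc (x : ℝ) : (starRingEnd ℂ) (osc x) = osc (-x) := by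
  rw [osc, osc, ← Complex.exp_conj]; simp

lemma osc_sum {ι : Type*} (s : Finset ι) (f : ι → ℝ) : osc (∑ i ∈ s, f i) = ∏ i ∈ s, osc (f i) := by
  classical
  induction s using Finset.induction_on with
  | empty => simp [osc_zero]
  | insert a s ha ih => rw [sum_insert ha, prod_insert ha, osc_add, ih]

lemma norm_osc_sub_le (x y : ℝ) : ‖osc x - osc y‖ ≤ |x - y| := by
  have h : osc x - osc y = osc y * (osc (x - y) - 1) := by
    rw [mul_sub, ← osc_add]; ring_nf
  rw [h, norm_mul, norm_osc, one_mul, osc, mul_comm]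
  simpa using Real.norm_exp_I_mul_ofReal_sub_one_le (x := x - y)

/-- The bicharacter on `ℤ ^ k` attached to `β`. -/
noncomputable def bichar {k : ℕ} (β : Fin k → ℝ) (l : Fin k → ℤ) : AddChar (Fin k → ℤ) ℂ where
  toFun m := osc (∑ j, β j * l j * m j)
  map_zero_eq_one' := by simp [osc_zero]
  map_add_eq_mul' m m' := by
    rw [← osc_add, ← sum_add_distrib]; congr 1
    exact sum_congr rfl fun j _ => by simp only [Pi.add_apply]; push_cast; ring

lemma bichar_apply {k : ℕ} (β : Fin k → ℝ) (l m : Fin k → ℤ) :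
    bichar β l m = osc (∑ j, β j * l j * m j) := rfl

lemma bichar_comm {k : ℕ} (β : Fin k → ℝ) (l m : Fin k → ℤ) : bichar β l m = bichar β m l := by
  rw [bichar_apply, bichar_apply]; congr 1; exact sum_congr rfl fun j _ => by ring

lemma conj_bichar {k : ℕ} (β : Fin k → ℝ) (l m : Fin k → ℤ) :
    (starRingEnd ℂ) (bichar β l m) = bichar β l (-m) := by
  rw [bichar_apply, bichar_apply, conj_osc, ← sum_neg_distrib]; congr 1
  exact sum_congr rfl fun j _ => by simp

/-- The point `(a, a ^ 2, …, a ^ k)`. -/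
def powerPoint (k a : ℕ) : Fin k → ℤ := fun j => (a : ℤ) ^ (j + 1 : ℕ)

lemma sum_powerPoint {k s : ℕ} (x : Fin s → ℕ) : ∑ i, powerPoint k (x i) = tupleSum k x := by
  funext j; simp [powerPoint, tupleSum]

/-- Tuples of length `s` with entries below `A`. -/
def tuples (s A : ℕ) : Finset (Fin s → ℕ) := Fintype.piFinset fun _ => range A

lemma card_tuples (s A : ℕ) : #(tuples s A) = A ^ s := by simp [tuples]

lemma norm_sum_bichar_pow {k : ℕ} (β : Fin k → ℝ) (l : Fin k → ℤ) (A s : ℕ) :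
    ((‖∑ b ∈ range A, bichar β l (powerPoint k b)‖ ^ (2 * s) : ℝ) : ℂ) =
      ∑ z ∈ tuples s A ×ˢ tuples s A, bichar β l (tupleSum k z.1 - tupleSum k z.2) := by
  rw [norm_sum_addChar_pow]
  push_cast
  rw [← Complex.mul_conj', map_sum, sum_mul_sum, sum_product]
  refine sum_congr rfl fun x _ => sum_congr rfl fun y _ => ?_
  rw [conj_bichar, ← AddChar.map_add_eq_mul, sum_powerPoint, sum_powerPoint, sub_eq_add_neg]

/-- The box containing all differences of power sums of `s`-tuples below `A`. -/
noncomputable def powerBox (s k A : ℕ) : Finset (Fin k → ℤ) :=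
  Fintype.piFinset fun j => Icc (-((s * A ^ (j + 1 : ℕ) : ℕ) : ℤ)) ((s * A ^ (j + 1 : ℕ) : ℕ) : ℤ)

lemma sub_mem_powerBox {s k A : ℕ} {x y : Fin s → ℕ} (hx : x ∈ tuples s A) (hy : y ∈ tuples s A) :
    tupleSum k x - tupleSum k y ∈ powerBox s k A := by
  have key : ∀ x ∈ tuples s A, ∀ j, tupleSum k x j ≤ ((s * A ^ (j + 1 : ℕ) : ℕ) : ℤ) := by
    intro x hx j
    calc tupleSum k x j ≤ ∑ _i : Fin s, ((A ^ (j + 1 : ℕ) : ℕ) : ℤ) := by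
          refine sum_le_sum fun i _ => ?_
          have h : x i ≤ A := by
            rw [tuples, Fintype.mem_piFinset] at hx
            exact (mem_range.mp (hx i)).le
          exact_mod_cast Nat.pow_le_pow_left h _
      _ = _ := by simp
  rw [powerBox, Fintype.mem_piFinset]
  intro j
  rw [mem_Icc, Pi.sub_apply]
  have h1 := key x hx j
  have h2 := key y hy j
  have h3 := tupleSum_nonneg (k := k) x j
  have h4 := tupleSum_nonneg (k := k) y j
  omega

lemma sum_differences_le {s k A : ℕ} (F : (Fin k → ℤ) → ℝ) (hF : ∀ l, 0 ≤ F l) :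
    ∑ z ∈ tuples s A ×ˢ tuples s A, F (tupleSum k z.1 - tupleSum k z.2) ≤
      vinogradovMean s k A * ∑ l ∈ powerBox s k A, F l := by
  rw [← sum_fiberwise_of_maps_to (g := fun z : (Fin s → ℕ) × (Fin s → ℕ) =>
    tupleSum k z.1 - tupleSum k z.2) (t := powerBox s k A) (fun z hz => by
      rw [mem_product] at hz; exact sub_mem_powerBox hz.1 hz.2), mul_sum]
  refine sum_le_sum fun l _ => ?_
  rw [sum_congr rfl (fun z hz => by rw [(mem_filter.mp hz).2]), sum_const, nsmul_eq_mul]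
  refine mul_le_mul_of_nonneg_right ?_ (hF l)
  have h := card_translate_le_energy (tuples s A) (tupleSum k) (-l)
  have h2 : #{z ∈ tuples s A ×ˢ tuples s A | tupleSum k z.1 - tupleSum k z.2 = l} ≤
      energy (tuples s A) (tupleSum k) := by
    refine le_trans (card_le_card fun z hz => ?_) h
    rw [mem_filter] at hz ⊢
    refine ⟨hz.1, ?_⟩
    rw [← hz.2]; abel
  exact_mod_cast h2

/-- The bilinear sum controlling one coordinate. -/
noncomputable def bilinearSum (β : ℝ) (L : ℕ) : ℝ :=
  ∑ m ∈ Icc (-(L : ℤ)) L, ‖∑ l ∈ Icc (-(L : ℤ)) L, osc (β * l * m)‖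

lemma sum_powerBox_norm {s k A : ℕ} (β : Fin k → ℝ) :
    ∑ m ∈ powerBox s k A, ‖∑ l ∈ powerBox s k A, bichar β l m‖ =
      ∏ j : Fin k, bilinearSum (β j) (s * A ^ (j + 1 : ℕ)) := by
  simp only [bilinearSum]
  rw [prod_univ_sum]
  refine sum_congr rfl fun m _ => ?_
  rw [← norm_prod, prod_univ_sum]
  congr 1
  refine sum_congr rfl fun l _ => ?_
  rw [bichar_apply, osc_sum]

lemma sum_pow_le_card_pow {ι : Type*} (T : Finset ι) (f : ι → ℝ) (hf : ∀ i ∈ T, 0 ≤ f i) {n : ℕ}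
    (hn : 1 ≤ n) : (∑ i ∈ T, f i) ^ n ≤ (#T : ℝ) ^ (n - 1) * ∑ i ∈ T, f i ^ n := by
  obtain ⟨n, rfl⟩ : ∃ m, n = m + 1 := ⟨n - 1, by omega⟩
  rcases T.eq_empty_or_nonempty with rfl | hT
  · simp
  have h := pow_sum_div_card_le_sum_pow hf n
  have hc : (0 : ℝ) < #T := by exact_mod_cast hT.card_pos
  rw [div_le_iff₀ (by positivity)] at h
  rw [Nat.add_sub_cancel, mul_comm]
  exact h

/-- Vinogradov's bilinear estimate in terms of the mean value. -/
theorem norm_bilinear_pow_le {k s A : ℕ} (hs : 1 ≤ s) (β : Fin k → ℝ) :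
    ‖∑ a ∈ range A, ∑ b ∈ range A, osc (∑ j, β j * ((a * b : ℕ) : ℝ) ^ (j + 1 : ℕ))‖ ^ (4 * s ^ 2) ≤
      (A : ℝ) ^ (4 * s * (2 * s - 1)) * (vinogradovMean s k A : ℝ) ^ 2 *
        ∏ j : Fin k, bilinearSum (β j) (s * A ^ (j + 1 : ℕ)) := by
  set J : ℝ := (vinogradovMean s k A : ℝ) with hJ
  have hJ0 : 0 ≤ J := by positivity
  let g : (Fin k → ℤ) → ℂ := fun l => ∑ b ∈ range A, bichar β l (powerPoint k b)
  have hW : ∑ a ∈ range A, ∑ b ∈ range A, osc (∑ j, β j * ((a * b : ℕ) : ℝ) ^ (j + 1 : ℕ)) =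
      ∑ a ∈ range A, g (powerPoint k a) := by
    refine sum_congr rfl fun a _ => sum_congr rfl fun b _ => ?_
    rw [bichar_apply]
    congr 1
    refine sum_congr rfl fun j _ => ?_
    simp only [powerPoint]; push_cast; ring
  rw [hW]
  have hfirst : ‖∑ a ∈ range A, g (powerPoint k a)‖ ^ (2 * s) ≤
      (A : ℝ) ^ (2 * s - 1) * ∑ z ∈ tuples s A ×ˢ tuples s A,
        ‖g (tupleSum k z.1 - tupleSum k z.2)‖ := by
    calc ‖∑ a ∈ range A, g (powerPoint k a)‖ ^ (2 * s)
        ≤ (∑ a ∈ range A, ‖g (powerPoint k a)‖) ^ (2 * s) := by gcongr; exact norm_sum_le _ _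
      _ ≤ (A : ℝ) ^ (2 * s - 1) * ∑ a ∈ range A, ‖g (powerPoint k a)‖ ^ (2 * s) := by
          have := sum_pow_le_card_pow (range A) (fun a => ‖g (powerPoint k a)‖)
            (fun _ _ => norm_nonneg _) (n := 2 * s) (by omega)
          rwa [card_range] at this
      _ ≤ _ := by
          gcongr
          have h1 : ((∑ a ∈ range A, ‖g (powerPoint k a)‖ ^ (2 * s) : ℝ) : ℂ) =
              ∑ z ∈ tuples s A ×ˢ tuples s A, g (tupleSum k z.1 - tupleSum k z.2) := by
            push_cast
            simp only [g]
            rw [sum_comm]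
            refine sum_congr rfl fun a _ => ?_
            have := norm_sum_bichar_pow β (powerPoint k a) A s
            push_cast at this
            rw [this]
            exact sum_congr rfl fun z _ => bichar_comm _ _ _
          have h2 : (0 : ℝ) ≤ ∑ a ∈ range A, ‖g (powerPoint k a)‖ ^ (2 * s) := by positivity
          have h3 := congrArg norm h1
          rw [Complex.norm_real, Real.norm_of_nonneg h2] at h3
          rw [h3]
          exact norm_sum_le _ _
  have hsecond : (∑ z ∈ tuples s A ×ˢ tuples s A, ‖g (tupleSum k z.1 - tupleSum k z.2)‖) ^ (2 * s) ≤
      ((A : ℝ) ^ (2 * s)) ^ (2 * s - 1) * (J * ∑ l ∈ powerBox s k A, ‖g l‖ ^ (2 * s)) := by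
    have h1 := sum_pow_le_card_pow (tuples s A ×ˢ tuples s A)
      (fun z => ‖g (tupleSum k z.1 - tupleSum k z.2)‖) (fun _ _ => norm_nonneg _) (n := 2 * s)
      (by omega)
    have h2 : (#(tuples s A ×ˢ tuples s A) : ℝ) = (A : ℝ) ^ (2 * s) := by
      rw [card_product, card_tuples]; push_cast; ring
    rw [h2] at h1
    refine h1.trans ?_
    gcongr
    exact sum_differences_le (fun l => ‖g l‖ ^ (2 * s)) (fun _ => by positivity)
  have hthird : ∑ l ∈ powerBox s k A, ‖g l‖ ^ (2 * s) ≤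
      J * ∏ j : Fin k, bilinearSum (β j) (s * A ^ (j + 1 : ℕ)) := by
    have h1 : ((∑ l ∈ powerBox s k A, ‖g l‖ ^ (2 * s) : ℝ) : ℂ) =
        ∑ z ∈ tuples s A ×ˢ tuples s A, ∑ l ∈ powerBox s k A,
          bichar β l (tupleSum k z.1 - tupleSum k z.2) := by
      rw [sum_comm]
      push_cast
      refine sum_congr rfl fun l _ => ?_
      have := norm_sum_bichar_pow β l A s
      push_cast at this
      exact this
    have h2 : (0 : ℝ) ≤ ∑ l ∈ powerBox s k A, ‖g l‖ ^ (2 * s) := by positivity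
    have h3 := congrArg norm h1
    rw [Complex.norm_real, Real.norm_of_nonneg h2] at h3
    rw [h3, ← sum_powerBox_norm]
    exact (norm_sum_le _ _).trans
      (sum_differences_le (fun m => ‖∑ l ∈ powerBox s k A, bichar β l m‖) fun _ => norm_nonneg _)
  calc _ = (‖∑ a ∈ range A, g (powerPoint k a)‖ ^ (2 * s)) ^ (2 * s) := by
        rw [← pow_mul]; congr 1; ring
    _ ≤ ((A : ℝ) ^ (2 * s - 1) * ∑ z ∈ tuples s A ×ˢ tuples s A,
        ‖g (tupleSum k z.1 - tupleSum k z.2)‖) ^ (2 * s) := by gcongr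
    _ = ((A : ℝ) ^ (2 * s - 1)) ^ (2 * s) * (∑ z ∈ tuples s A ×ˢ tuples s A,
        ‖g (tupleSum k z.1 - tupleSum k z.2)‖) ^ (2 * s) := mul_pow _ _ _
    _ ≤ ((A : ℝ) ^ (2 * s - 1)) ^ (2 * s) * (((A : ℝ) ^ (2 * s)) ^ (2 * s - 1) * (J *
        (J * ∏ j : Fin k, bilinearSum (β j) (s * A ^ (j + 1 : ℕ))))) := by
        gcongr
        exact hsecond.trans (by gcongr)
    _ = ((A : ℝ) ^ (2 * s - 1)) ^ (2 * s) * ((A : ℝ) ^ (2 * s)) ^ (2 * s - 1) * J ^ 2 *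
        ∏ j : Fin k, bilinearSum (β j) (s * A ^ (j + 1 : ℕ)) := by ring
    _ = _ := by
        rw [← pow_mul, ← pow_mul, ← pow_add]
        congr 3
        ring

lemma bilinearSum_nonneg (β : ℝ) (L : ℕ) : 0 ≤ bilinearSum β L :=
  sum_nonneg fun _ _ => norm_nonneg _

lemma bilinearSum_le_trivial (β : ℝ) {L : ℕ} (hL : 1 ≤ L) : bilinearSum β L ≤ 9 * (L : ℝ) ^ 2 := by
  have hc : (#(Icc (-(L : ℤ)) L) : ℝ) ≤ 3 * L := by
    rw [Int.card_Icc]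
    have h : ((L : ℤ) + 1 - -(L : ℤ)).toNat ≤ 3 * L := by omega
    exact_mod_cast h
  calc bilinearSum β L ≤ ∑ _m ∈ Icc (-(L : ℤ)) L, (3 * L : ℝ) := by
        refine sum_le_sum fun m _ => (norm_sum_le _ _).trans ?_
        simpa [norm_osc] using hc
    _ = #(Icc (-(L : ℤ)) L) * (3 * L : ℝ) := by simp
    _ ≤ (3 * L) * (3 * L) := by gcongr
    _ = _ := by ring

lemma sum_Icc_neg_self {M : Type*} [AddCommMonoid M] (f : ℤ → M) (L : ℕ) :
    ∑ m ∈ Icc (-(L : ℤ)) L, f m = f 0 + ∑ i ∈ range L, (f (i + 1) + f (-(i + 1))) := by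
  induction L with
  | zero => simp
  | succ L ih =>
    have h : Icc (-((L + 1 : ℕ) : ℤ)) ((L + 1 : ℕ) : ℤ) =
        insert ((L : ℤ) + 1) (insert (-((L : ℤ) + 1)) (Icc (-(L : ℤ)) L)) := by
      ext x; simp only [mem_Icc, mem_insert]; omega
    rw [h, sum_insert (by simp only [mem_insert, mem_Icc]; omega),
      sum_insert (by simp only [mem_Icc]; omega), ih, sum_range_succ]
    abel

lemma le_norm_osc_sub_one {x : ℝ} (hx : |x| ≤ Real.pi) : 2 / Real.pi * |x| ≤ ‖osc x - 1‖ := by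
  rw [osc, mul_comm (x : ℂ), Complex.norm_exp_I_mul_ofReal_sub_one, norm_mul, Real.norm_ofNat,
    Real.norm_eq_abs]
  have h : |Real.sin (x / 2)| = Real.sin (|x| / 2) := by
    rcases abs_cases x with ⟨h, h'⟩ | ⟨h, h'⟩
    · rw [h, abs_of_nonneg (Real.sin_nonneg_of_nonneg_of_le_pi (by linarith) (by linarith))]
    · rw [h, neg_div, Real.sin_neg, abs_of_nonpos]
      exact Real.sin_nonpos_of_nonpos_of_neg_pi_le (by linarith) (by linarith)
  rw [h]
  have := Real.mul_le_sin (x := |x| / 2) (by positivity) (by linarith)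
  linarith

lemma norm_sum_osc_le {α : ℝ} {L : ℕ} (h0 : α ≠ 0) (hα : |α| ≤ Real.pi) :
    ‖∑ l ∈ Icc (-(L : ℤ)) L, osc (α * l)‖ ≤ Real.pi / |α| := by
  have hpos : 0 < |α| := abs_pos.mpr h0
  have hlow := le_norm_osc_sub_one hα
  have hne : (0 : ℝ) < ‖osc α - 1‖ := lt_of_lt_of_le (by positivity) hlow
  have hgeo : ∀ L : ℕ, (∑ l ∈ Icc (-(L : ℤ)) L, osc (α * l)) * (osc α - 1) =
      osc (α * (L + 1)) - osc (α * (-L)) := by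
    intro L
    rw [sum_Icc_neg_self]
    induction L with
    | zero => simp [osc_zero]
    | succ L ih =>
      rw [sum_range_succ, ← add_assoc, add_mul, ih]
      have e1 : osc (α * (((L + 1 : ℕ) : ℝ) + 1)) = osc (α * (L + 1)) * osc α := by
        rw [← osc_add]; congr 1; push_cast; ring
      have e2 : osc (α * (-L)) = osc (α * (-((L + 1 : ℕ) : ℝ))) * osc α := by
        rw [← osc_add]; congr 1; push_cast; ring
      rw [e1, e2]; push_cast; ring
  have h2 : ‖∑ l ∈ Icc (-(L : ℤ)) L, osc (α * l)‖ * ‖osc α - 1‖ ≤ 2 := by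
    rw [← norm_mul, hgeo]
    refine (norm_sub_le _ _).trans ?_
    rw [norm_osc, norm_osc]; norm_num
  have h3 : ‖∑ l ∈ Icc (-(L : ℤ)) L, osc (α * l)‖ * (2 / Real.pi * |α|) ≤ 2 :=
    (mul_le_mul_of_nonneg_left hlow (norm_nonneg _)).trans h2
  rw [le_div_iff₀ hpos]
  have hpi := Real.pi_pos
  calc _ = ‖∑ l ∈ Icc (-(L : ℤ)) L, osc (α * l)‖ * (2 / Real.pi * |α|) * (Real.pi / 2) := by
        field_simp
    _ ≤ 2 * (Real.pi / 2) := by gcongr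
    _ = _ := by ring

lemma sum_inv_sqrt_le (L : ℕ) : ∑ i ∈ range L, 1 / √((i : ℝ) + 1) ≤ 2 * √(L : ℝ) := by
  induction L with
  | zero => simp
  | succ L ih =>
    rw [sum_range_succ]
    have h : 1 / √((L : ℝ) + 1) ≤ 2 * √((L : ℝ) + 1) - 2 * √(L : ℝ) := by
      have hpos : 0 < √((L : ℝ) + 1) := Real.sqrt_pos.mpr (by positivity)
      rw [div_le_iff₀ hpos]
      have h1 := Real.sq_sqrt (show (0 : ℝ) ≤ (L : ℝ) + 1 by positivity)
      have h2 := Real.sq_sqrt (show (0 : ℝ) ≤ (L : ℝ) by positivity)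
      nlinarith [sq_nonneg (√((L : ℝ) + 1) - √(L : ℝ))]
    push_cast
    linarith

lemma bilinearSum_le {β : ℝ} {L : ℕ} (hL : 1 ≤ L) (h0 : β ≠ 0) (hβ : |β| * L ≤ Real.pi) :
    bilinearSum β L ≤ 3 * L + 13 * L / √|β| := by
  have hb : 0 < |β| := abs_pos.mpr h0
  have hL1 : (1 : ℝ) ≤ L := by exact_mod_cast hL
  have hc : ∀ m : ℤ, ‖∑ l ∈ Icc (-(L : ℤ)) L, osc (β * l * m)‖ ≤ 3 * L := by
    intro m
    refine (norm_sum_le _ _).trans ?_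
    have h : ((L : ℤ) + 1 - -(L : ℤ)).toNat ≤ 3 * L := by omega
    simp only [norm_osc, sum_const, Int.card_Icc, nsmul_eq_mul, mul_one]
    exact_mod_cast h
  have hm : ∀ i ∈ range L, ∀ m : ℤ, |(m : ℝ)| = i + 1 →
      ‖∑ l ∈ Icc (-(L : ℤ)) L, osc (β * l * m)‖ ≤ √(9.6 * L / |β|) * (1 / √((i : ℝ) + 1)) := by
    intro i hi m hmi
    rw [mem_range] at hi
    have hi' : (i : ℝ) + 1 ≤ L := by exact_mod_cast hi
    have e : ∀ l : ℤ, β * l * m = (β * m) * l := fun l => by ring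
    have habs : |β * m| = |β| * (i + 1) := by rw [abs_mul, hmi]
    have h1 : ‖∑ l ∈ Icc (-(L : ℤ)) L, osc (β * l * m)‖ ≤ Real.pi / (|β| * (i + 1)) := by
      simp only [e]
      rw [← habs]
      refine norm_sum_osc_le (abs_pos.mp (by rw [habs]; positivity)) ?_
      rw [habs]
      exact (mul_le_mul_of_nonneg_left hi' hb.le).trans hβ
    rw [mul_one_div, ← Real.sqrt_div' _ (by positivity)]
    refine Real.le_sqrt_of_sq_le ?_
    rw [sq]
    calc _ ≤ (3 * L) * (Real.pi / (|β| * (i + 1))) := by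
          exact mul_le_mul (hc m) h1 (norm_nonneg _) (by positivity)
      _ ≤ (3 * L) * (3.2 / (|β| * (i + 1))) := by
          gcongr; have := Real.pi_lt_d2; linarith
      _ = _ := by field_simp; norm_num
  rw [bilinearSum, sum_Icc_neg_self]
  have hsum : ∑ i ∈ range L, (‖∑ l ∈ Icc (-(L : ℤ)) L, osc (β * l * (((i : ℤ) + 1 : ℤ) : ℝ))‖ +
      ‖∑ l ∈ Icc (-(L : ℤ)) L, osc (β * l * ((-((i : ℤ) + 1) : ℤ) : ℝ))‖) ≤
      ∑ i ∈ range L, 2 * √(9.6 * L / |β|) * (1 / √((i : ℝ) + 1)) := by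
    refine sum_le_sum fun i hi => ?_
    have hpos : (0 : ℝ) ≤ (i : ℝ) + 1 := by positivity
    have h1 := hm i hi ((i : ℤ) + 1) (by push_cast; exact abs_of_nonneg hpos)
    have h2 := hm i hi (-((i : ℤ) + 1)) (by push_cast; rw [abs_neg]; exact abs_of_nonneg hpos)
    linarith
  refine (add_le_add (hc 0) hsum).trans ?_
  gcongr
  rw [← mul_sum]
  calc 2 * √(9.6 * L / |β|) * ∑ i ∈ range L, 1 / √((i : ℝ) + 1)
      ≤ 2 * √(9.6 * L / |β|) * (2 * √(L : ℝ)) := by gcongr; exact sum_inv_sqrt_le L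
    _ = 4 * √9.6 * (√(L : ℝ) * √(L : ℝ)) / √|β| := by
        rw [Real.sqrt_div (by positivity), Real.sqrt_mul (by norm_num)]; ring
    _ = 4 * √9.6 * L / √|β| := by rw [Real.mul_self_sqrt (by positivity)]
    _ ≤ _ := by
        gcongr
        have : √9.6 ≤ 3.1 := by rw [Real.sqrt_le_left (by norm_num)]; norm_num
        linarith

lemma two_le_exp : (2 : ℝ) ≤ Real.exp 0.7 := by
  rw [← Real.log_le_iff_le_exp (by norm_num)]
  have := Real.log_two_lt_d9
  linarith

set_option maxHeartbeats 800000 in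
lemma bilinearSum_good_le {B θ β : ℝ} {A n s J : ℕ} (hB : 443 ≤ B) (hθ : 1 / 2 ≤ θ)
    (hA1 : (A : ℝ) ≤ Real.exp (0.4 * B)) (hA2 : Real.exp (0.4 * B) ≤ 2 * A)
    (hn1 : Real.exp B ≤ n) (hn2 : (n : ℝ) ≤ 2 * Real.exp B)
    (hJ1 : 1.75 * θ ≤ J) (hJ2 : (J : ℝ) ≤ 4 * θ) (hJs : J ≤ s) (hs : (s : ℝ) ≤ 729 * θ ^ 2)
    (hβ : |β| = Real.exp (θ * B) / (J * (n : ℝ) ^ J)) :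
    bilinearSum β (s * A ^ J) ≤
      9 * ((s : ℝ) * (A : ℝ) ^ J) ^ 2 * Real.exp (-(0.05 * θ * B)) := by
  have hJ0 : 1 ≤ J := by
    by_contra h
    have : J = 0 := by omega
    subst this
    norm_num at hJ1; linarith
  have hJ0' : (1 : ℝ) ≤ J := by exact_mod_cast hJ0
  have hs1 : (1 : ℝ) ≤ s := by exact_mod_cast hJ0.trans hJs
  have hJs' : (J : ℝ) ≤ s := by exact_mod_cast hJs
  have hn0 : (0 : ℝ) < n := (Real.exp_pos _).trans_le hn1
  have hA0 : (0 : ℝ) < A := by have := Real.exp_pos (0.4 * B); linarith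
  have hA1' : 1 ≤ A := by exact_mod_cast hA0
  have hL : 1 ≤ s * A ^ J := Nat.mul_pos (by omega) (pow_pos (by omega) _)
  have hθB : 221 ≤ θ * B := by nlinarith
  have hAlow : Real.exp ((0.4 * B - 0.7) * J) ≤ (A : ℝ) ^ J := by
    rw [mul_comm, Real.exp_nat_mul]
    refine pow_le_pow_left₀ (Real.exp_pos _).le ?_ J
    rw [Real.exp_sub, div_le_iff₀ (Real.exp_pos _)]
    nlinarith [two_le_exp]
  have hAup : (A : ℝ) ^ J ≤ Real.exp (0.4 * B * J) := by
    rw [mul_comm (0.4 * B), Real.exp_nat_mul]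
    exact pow_le_pow_left₀ hA0.le hA1 J
  have hnlow : Real.exp (B * J) ≤ (n : ℝ) ^ J := by
    rw [mul_comm B, Real.exp_nat_mul]
    exact pow_le_pow_left₀ (Real.exp_pos _).le hn1 J
  have hnup : (n : ℝ) ^ J ≤ Real.exp ((B + 0.7) * J) := by
    rw [mul_comm (B + 0.7), Real.exp_nat_mul]
    refine pow_le_pow_left₀ hn0.le (hn2.trans ?_) J
    rw [Real.exp_add, mul_comm]
    exact mul_le_mul_of_nonneg_left two_le_exp (Real.exp_pos _).le
  have hLr : ((s * A ^ J : ℕ) : ℝ) = (s : ℝ) * (A : ℝ) ^ J := by push_cast; ring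
  have hβpos : 0 < |β| := by rw [hβ]; positivity
  have hbase : |β| * ((s * A ^ J : ℕ) : ℝ) ≤ Real.pi := by
    rw [hβ, hLr]
    calc Real.exp (θ * B) / (J * (n : ℝ) ^ J) * (s * (A : ℝ) ^ J)
        ≤ Real.exp (θ * B) / (1 * Real.exp (B * J)) * (s * Real.exp (0.4 * B * J)) := by gcongr
      _ = s * Real.exp (θ * B - B * J + 0.4 * B * J) := by
          rw [Real.exp_add, Real.exp_sub, one_mul]; ring
      _ ≤ s * Real.exp (-(0.05 * θ * B)) := by
          gcongr
          nlinarith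
      _ ≤ 1 := by
          rw [Real.exp_neg, ← div_eq_mul_inv, div_le_one (Real.exp_pos _)]
          have h1 := Real.pow_div_factorial_le_exp (x := 0.05 * θ * B) (by positivity) 3
          refine (hs.trans ?_).trans h1
          have h2 : 22 * θ ≤ 0.05 * θ * B := by nlinarith
          have h3 : (22 * θ) ^ 3 ≤ (0.05 * θ * B) ^ 3 := pow_le_pow_left₀ (by linarith) h2 3
          have h4 : (Nat.factorial 3 : ℝ) = 6 := by norm_num [Nat.factorial]
          rw [h4]
          nlinarith [mul_nonneg (sq_nonneg θ) (sub_nonneg.mpr hθ)]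
      _ ≤ Real.pi := by linarith [Real.pi_gt_three]
  refine (bilinearSum_le hL (abs_pos.mp hβpos) hbase).trans ?_
  rw [hLr]
  set L : ℝ := (s : ℝ) * (A : ℝ) ^ J with hLdef
  set q := Real.exp (-(0.05 * θ * B)) with hq
  have hq0 : 0 < q := Real.exp_pos _
  have hLpos : 0 < L := by positivity
  have hAL : Real.exp ((0.4 * B - 0.7) * J) ≤ L :=
    hAlow.trans (le_mul_of_one_le_left (by positivity) hs1)
  have h1 : 1 ≤ L * q := by
    calc (1 : ℝ) ≤ Real.exp ((0.4 * B - 0.7) * J + -(0.05 * θ * B)) := by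
          rw [Real.one_le_exp_iff]; nlinarith
      _ = Real.exp ((0.4 * B - 0.7) * J) * q := by rw [Real.exp_add]
      _ ≤ L * q := by gcongr
  have h2 : 9 ≤ L ^ 2 * |β| * q ^ 2 := by
    calc (9 : ℝ) ≤ 17 + 1 := by norm_num
      _ ≤ Real.exp 17 := Real.add_one_le_exp 17
      _ ≤ Real.exp (2 * ((0.4 * B - 0.7) * J) + (θ * B - (B + 0.7) * J) +
            2 * -(0.05 * θ * B)) := by
          rw [Real.exp_le_exp]; nlinarith
      _ = Real.exp ((0.4 * B - 0.7) * J) ^ 2 *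
            (Real.exp (θ * B) / Real.exp ((B + 0.7) * J)) * q ^ 2 := by
          rw [Real.exp_add, Real.exp_add, Real.exp_sub, hq, ← Real.exp_nat_mul,
            ← Real.exp_nat_mul]
          norm_num
      _ ≤ ((A : ℝ) ^ J) ^ 2 * (Real.exp (θ * B) / (n : ℝ) ^ J) * q ^ 2 :=
          mul_le_mul_of_nonneg_right (mul_le_mul (pow_le_pow_left₀ (Real.exp_pos _).le hAlow 2)
            (div_le_div_of_nonneg_left (Real.exp_pos _).le (pow_pos hn0 J) hnup) (by positivity)
            (by positivity)) (by positivity)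
      _ ≤ (s ^ 2 / J) * (((A : ℝ) ^ J) ^ 2 * (Real.exp (θ * B) / (n : ℝ) ^ J) * q ^ 2) := by
          refine le_mul_of_one_le_left (by positivity) ?_
          rw [one_le_div (by linarith)]
          nlinarith
      _ = L ^ 2 * |β| * q ^ 2 := by
          rw [hβ, hLdef]; field_simp
  have hsq : 0 < √|β| := Real.sqrt_pos.mpr hβpos
  have h3 : 3 ≤ L * √|β| * q := by
    refine le_of_sq_le_sq ?_ (by positivity)
    rw [mul_pow, mul_pow, Real.sq_sqrt hβpos.le]
    linarith
  have h4 : 13 * L / √|β| ≤ 5 * L ^ 2 * q := by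
    rw [div_le_iff₀ hsq]
    nlinarith [mul_pos hLpos hLpos]
  nlinarith [mul_pos hLpos hq0]

lemma log_four_mul_le {k : ℕ} (hk : 4 ≤ k) : Real.log (4 * k) ≤ k := by
  have hk' : (4 : ℝ) ≤ k := by exact_mod_cast hk
  have h16 : Real.log 16 = 4 * Real.log 2 := by
    rw [show (16 : ℝ) = 2 ^ 4 by norm_num, Real.log_pow]; norm_num
  have h1 : Real.log (4 * k) = Real.log 16 + Real.log (k / 4) := by
    rw [← Real.log_mul (by norm_num) (by positivity)]; congr 1; ring
  have h2 := Real.log_le_sub_one_of_pos (show (0 : ℝ) < k / 4 by positivity)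
  have := Real.log_two_lt_d9
  linarith

lemma card_good_ge {θ : ℝ} {k : ℕ} (hθ : 1 / 2 ≤ θ) (hk : 4 * θ ≤ k) :
    θ / 2 ≤ #{j ∈ range k | 1.75 * θ ≤ ((j + 1 : ℕ) : ℝ) ∧ ((j + 1 : ℕ) : ℝ) ≤ 4 * θ} := by
  have hsub : (Icc ⌈1.75 * θ⌉₊ ⌊4 * θ⌋₊).image (fun i => i - 1) ⊆
      {j ∈ range k | 1.75 * θ ≤ ((j + 1 : ℕ) : ℝ) ∧ ((j + 1 : ℕ) : ℝ) ≤ 4 * θ} := by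
    intro j hj
    obtain ⟨i, hi, rfl⟩ := mem_image.mp hj
    rw [mem_Icc, Nat.ceil_le, Nat.le_floor_iff (by linarith)] at hi
    have hi0 : 0 < i := by
      have : (0 : ℝ) < i := by linarith
      exact_mod_cast this
    have hik : i ≤ k := by
      have : (i : ℝ) ≤ k := hi.2.trans hk
      exact_mod_cast this
    rw [mem_filter, mem_range, show i - 1 + 1 = i by omega]
    exact ⟨by omega, hi⟩
  have hcard : ((Icc ⌈1.75 * θ⌉₊ ⌊4 * θ⌋₊).image (fun i => i - 1)).card =
      ⌊4 * θ⌋₊ + 1 - ⌈1.75 * θ⌉₊ := by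
    rw [card_image_of_injOn, Nat.card_Icc]
    intro a ha b hb hab
    have h1 : 0 < ⌈1.75 * θ⌉₊ := Nat.ceil_pos.mpr (by linarith)
    simp only [coe_Icc, Set.mem_Icc] at ha hb
    simp only at hab
    omega
  have h := card_le_card hsub
  rw [hcard] at h
  refine le_trans ?_ (Nat.cast_le.mpr h)
  have h1 : ((⌊4 * θ⌋₊ : ℕ) : ℝ) + 1 - ⌈1.75 * θ⌉₊ ≤ ((⌊4 * θ⌋₊ + 1 - ⌈1.75 * θ⌉₊ : ℕ) : ℝ) := by
    rw [sub_le_iff_le_add]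
    exact_mod_cast (by omega : ⌊4 * θ⌋₊ + 1 ≤ ⌊4 * θ⌋₊ + 1 - ⌈1.75 * θ⌉₊ + ⌈1.75 * θ⌉₊)
  refine le_trans ?_ h1
  have hfl := Nat.lt_floor_add_one (4 * θ)
  have hce := Nat.ceil_lt_add_one (show 0 ≤ 1.75 * θ by linarith)
  by_cases hc : θ ≤ 4 / 7
  · have h2 : ⌈1.75 * θ⌉₊ ≤ 1 := Nat.ceil_le.mpr (by push_cast; linarith)
    have h3 : 2 ≤ ⌊4 * θ⌋₊ := Nat.le_floor (by push_cast; linarith)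
    have h2' : (⌈1.75 * θ⌉₊ : ℝ) ≤ 1 := by exact_mod_cast h2
    have h3' : (2 : ℝ) ≤ ⌊4 * θ⌋₊ := by exact_mod_cast h3
    linarith
  · push Not at hc
    linarith

lemma prod_bilinearSum_le {B θ : ℝ} {A n k : ℕ} (β : Fin k → ℝ) (hB : 443 ≤ B) (hθ : 1 / 2 ≤ θ)
    (hk4 : 4 ≤ k) (hk1 : 4 * θ ≤ k) (hk2 : (k : ℝ) ≤ 9 * θ)
    (hA1 : (A : ℝ) ≤ Real.exp (0.4 * B)) (hA2 : Real.exp (0.4 * B) ≤ 2 * A)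
    (hn1 : Real.exp B ≤ n) (hn2 : (n : ℝ) ≤ 2 * Real.exp B)
    (hβ : ∀ j, |β j| = Real.exp (θ * B) / (((j + 1 : ℕ) : ℝ) * (n : ℝ) ^ (j + 1 : ℕ))) :
    ∏ j : Fin k, bilinearSum (β j) (9 * k ^ 2 * A ^ (j + 1 : ℕ)) ≤
      (729 * (k : ℝ) ^ 4) ^ k * (A : ℝ) ^ (k * (k + 1)) * Real.exp (-(0.025 * θ ^ 2 * B)) := by
  have hA0 : (0 : ℝ) < A := by have := Real.exp_pos (0.4 * B); linarith
  have hA1' : 1 ≤ A := by exact_mod_cast hA0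
  set p : ℕ → Prop := fun j => 1.75 * θ ≤ ((j + 1 : ℕ) : ℝ) ∧ ((j + 1 : ℕ) : ℝ) ≤ 4 * θ with hp
  set q := Real.exp (-(0.05 * θ * B)) with hq
  classical
  have hstep : ∀ j : Fin k, bilinearSum (β j) (9 * k ^ 2 * A ^ (j + 1 : ℕ)) ≤
      9 * (9 * (k : ℝ) ^ 2) ^ 2 * (A : ℝ) ^ (2 * (j + 1 : ℕ)) * (if p j then q else 1) := by
    intro j
    have e : 9 * (9 * (k : ℝ) ^ 2) ^ 2 * (A : ℝ) ^ (2 * (j + 1 : ℕ)) =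
        9 * (((9 * k ^ 2 : ℕ) : ℝ) * (A : ℝ) ^ (j + 1 : ℕ)) ^ 2 := by
      push_cast; rw [mul_pow (9 * (k : ℝ) ^ 2), ← pow_mul, mul_comm 2, mul_assoc]
    rw [e]
    split_ifs with h
    · refine bilinearSum_good_le hB hθ hA1 hA2 hn1 hn2 h.1 h.2 ?_ ?_ (hβ j)
      · have := j.2; nlinarith
      · push_cast; nlinarith
    · rw [mul_one]
      refine (bilinearSum_le_trivial _ (Nat.mul_pos (by positivity) (pow_pos (by omega) _))).trans
        (le_of_eq ?_)
      push_cast; ring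
  refine (prod_le_prod (fun j _ => bilinearSum_nonneg _ _) fun j _ => hstep j).trans ?_
  rw [Fin.prod_univ_eq_prod_range (fun j => 9 * (9 * (k : ℝ) ^ 2) ^ 2 *
    (A : ℝ) ^ (2 * (j + 1 : ℕ)) * (if p j then q else 1)), prod_mul_distrib, prod_mul_distrib,
    prod_const, card_range, prod_pow_eq_pow_sum]
  have hsum : ∑ j ∈ range k, 2 * (j + 1) = k * (k + 1) := by
    clear * -
    induction k with
    | zero => simp
    | succ k ih => rw [sum_range_succ, ih]; ring
  rw [hsum, show 9 * (9 * (k : ℝ) ^ 2) ^ 2 = 729 * (k : ℝ) ^ 4 by ring]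
  gcongr
  rw [prod_ite, prod_const, prod_const_one, mul_one, hq, ← Real.exp_nat_mul, Real.exp_le_exp]
  have hc := card_good_ge hθ hk1
  have h2 : 0 ≤ 0.05 * θ * B := by positivity
  have h3 := mul_le_mul_of_nonneg_right hc h2
  simp only [hp]
  linarith

lemma norm_bilinear_le {B θ : ℝ} {A n k : ℕ} (β : Fin k → ℝ) (hB : 443 ≤ B) (hθ : 1 / 2 ≤ θ)
    (hk4 : 4 ≤ k) (hk1 : 4 * θ ≤ k) (hk2 : (k : ℝ) ≤ 9 * θ)
    (hA1 : (A : ℝ) ≤ Real.exp (0.4 * B)) (hA2 : Real.exp (0.4 * B) ≤ 2 * A)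
    (hn1 : Real.exp B ≤ n) (hn2 : (n : ℝ) ≤ 2 * Real.exp B)
    (hβ : ∀ j, |β j| = Real.exp (θ * B) / (((j + 1 : ℕ) : ℝ) * (n : ℝ) ^ (j + 1 : ℕ))) :
    ‖∑ a ∈ range A, ∑ b ∈ range A, osc (∑ j, β j * ((a * b : ℕ) : ℝ) ^ (j + 1 : ℕ))‖ ≤
      (A : ℝ) ^ 2 * Real.exp (3 - 1 / 10 ^ 9 * B / θ ^ 2) := by
  have hA0 : (0 : ℝ) < A := by have := Real.exp_pos (0.4 * B); linarith
  have hA1' : 1 ≤ A := by exact_mod_cast hA0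
  have hk4' : (4 : ℝ) ≤ k := by exact_mod_cast hk4
  set X := ‖∑ a ∈ range A, ∑ b ∈ range A, osc (∑ j, β j * ((a * b : ℕ) : ℝ) ^ (j + 1 : ℕ))‖ with hX
  have h1 := norm_bilinear_pow_le (s := 9 * k ^ 2) (A := A) (by nlinarith) β
  rw [← hX] at h1
  have h2 := vinogradovMean_le hk4 hA1'
  have h3 := prod_bilinearSum_le β hB hθ hk4 hk1 hk2 hA1 hA2 hn1 hn2 hβ
  have hJ0 : (0 : ℝ) ≤ (vinogradovMean (9 * k ^ 2) k A : ℝ) := Nat.cast_nonneg _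
  have hlogA : Real.log A ≤ 0.4 * B := (Real.log_le_iff_le_exp hA0).mpr hA1
  have hlogk := log_four_mul_le hk4
  have hAexp : ∀ m : ℕ, (A : ℝ) ^ m = Real.exp (m * Real.log A) := fun m => by
    rw [Real.exp_nat_mul, Real.exp_log hA0]
  have hkexp : ∀ m : ℕ, (4 * (k : ℝ)) ^ m = Real.exp (m * Real.log (4 * k)) := fun m => by
    rw [Real.exp_nat_mul, Real.exp_log (by positivity)]
  have hconst : (729 * (k : ℝ) ^ 4) ^ k ≤ (4 * (k : ℝ)) ^ (5 * k) := by
    rw [pow_mul]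
    refine pow_le_pow_left₀ (by positivity) ?_ k
    have : (0 : ℝ) ≤ (k : ℝ) ^ 4 := by positivity
    nlinarith
  have hm : 4 * (9 * k ^ 2) ^ 2 ≠ 0 := by positivity
  rw [← pow_le_pow_iff_left₀ (norm_nonneg _) (by positivity) hm]
  refine h1.trans ?_
  set l := Real.log A with hl
  set κ := Real.log (4 * (k : ℝ)) with hκ
  calc (A : ℝ) ^ (4 * (9 * k ^ 2) * (2 * (9 * k ^ 2) - 1)) *
        (vinogradovMean (9 * k ^ 2) k A : ℝ) ^ 2 *
        ∏ j : Fin k, bilinearSum (β j) (9 * k ^ 2 * A ^ (j + 1 : ℕ))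
      ≤ (A : ℝ) ^ (4 * (9 * k ^ 2) * (2 * (9 * k ^ 2) - 1)) *
        ((4 * (k : ℝ)) ^ (377 * k ^ 3) *
          (A : ℝ) ^ (18 * (k : ℝ) ^ 2 - (1 - 1 / 2000) * (k * (k + 1) / 2))) ^ 2 *
        ((4 * (k : ℝ)) ^ (5 * k) * (A : ℝ) ^ (k * (k + 1)) *
          Real.exp (-(0.025 * θ ^ 2 * B))) := by
        refine mul_le_mul (mul_le_mul_of_nonneg_left (pow_le_pow_left₀ hJ0 h2 2) (by positivity))
          (h3.trans ?_) (prod_nonneg fun j _ => bilinearSum_nonneg _ _) (by positivity)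
        exact mul_le_mul_of_nonneg_right (mul_le_mul_of_nonneg_right hconst (by positivity))
          (Real.exp_pos _).le
    _ = Real.exp (8 * (9 * (k : ℝ) ^ 2) ^ 2 * l + (754 * (k : ℝ) ^ 3 + 5 * k) * κ +
          k * (k + 1) / 2000 * l - 0.025 * θ ^ 2 * B) := by
        have e1 : ((4 * (9 * k ^ 2) * (2 * (9 * k ^ 2) - 1) : ℕ) : ℝ) =
            4 * (9 * (k : ℝ) ^ 2) * (2 * (9 * (k : ℝ) ^ 2) - 1) := by
          rw [Nat.cast_mul, Nat.cast_sub (by nlinarith)]; push_cast; ring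
        rw [hAexp, hAexp, hkexp, hkexp, Real.rpow_def_of_pos hA0, e1, ← Real.exp_add,
          ← Real.exp_nat_mul, ← Real.exp_add, ← Real.exp_add, ← Real.exp_add, ← Real.exp_add]
        congr 1
        push_cast
        ring
    _ ≤ Real.exp (8 * (9 * (k : ℝ) ^ 2) ^ 2 * l + 972 * (k : ℝ) ^ 4 -
          0.005 * θ ^ 2 * B) := by
        rw [Real.exp_le_exp]
        have hθ0 : 0 < θ := by linarith
        have i1 : (754 * (k : ℝ) ^ 3 + 5 * k) * κ ≤ 972 * (k : ℝ) ^ 4 := by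
          have : 754 * (k : ℝ) ^ 3 + 5 * k ≤ 972 * (k : ℝ) ^ 3 := by
            nlinarith [pow_pos (show (0 : ℝ) < k by linarith) 3,
              mul_le_mul hk4' hk4' (by norm_num) (by linarith)]
          calc _ ≤ (754 * (k : ℝ) ^ 3 + 5 * k) * k := by gcongr
            _ ≤ 972 * (k : ℝ) ^ 3 * k := by gcongr
            _ = _ := by ring
        have i2 : (k : ℝ) * (k + 1) / 2000 * l ≤ 0.02 * θ ^ 2 * B := by
          have : (k : ℝ) * (k + 1) ≤ 100 * θ ^ 2 := by nlinarith
          calc (k : ℝ) * (k + 1) / 2000 * l ≤ (k : ℝ) * (k + 1) / 2000 * (0.4 * B) := by gcongr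
            _ ≤ 100 * θ ^ 2 / 2000 * (0.4 * B) := by gcongr
            _ = _ := by ring
        linarith
    _ ≤ Real.exp (8 * (9 * (k : ℝ) ^ 2) ^ 2 * l + 4 * (9 * (k : ℝ) ^ 2) ^ 2 *
          (3 - 1 / 10 ^ 9 * B / θ ^ 2)) := by
        rw [Real.exp_le_exp]
        have hθ0 : 0 < θ := by linarith
        have i3 : 4 * (9 * (k : ℝ) ^ 2) ^ 2 * (1 / 10 ^ 9 * B / θ ^ 2) ≤ 0.005 * θ ^ 2 * B := by
          have : (k : ℝ) ^ 4 ≤ (9 * θ) ^ 4 := pow_le_pow_left₀ (by linarith) hk2 4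
          calc 4 * (9 * (k : ℝ) ^ 2) ^ 2 * (1 / 10 ^ 9 * B / θ ^ 2)
              = 324 * (k : ℝ) ^ 4 * (1 / 10 ^ 9 * B / θ ^ 2) := by ring
            _ ≤ 324 * (9 * θ) ^ 4 * (1 / 10 ^ 9 * B / θ ^ 2) := by gcongr
            _ = 324 * 6561 / 10 ^ 9 * θ ^ 2 * B := by field_simp; norm_num
            _ ≤ _ := by gcongr; norm_num
        have e : 4 * (9 * (k : ℝ) ^ 2) ^ 2 * 3 = 972 * (k : ℝ) ^ 4 := by ring
        rw [mul_sub]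
        linarith
    _ = _ := by
        rw [hAexp, ← Real.exp_add, ← Real.exp_nat_mul]
        congr 1
        push_cast
        ring

lemma norm_sum_log_shift_le {B θ : ℝ} {A n k : ℕ} (hB : 443 ≤ B) (hθ : 1 / 2 ≤ θ)
    (hk4 : 4 ≤ k) (hk2 : (k : ℝ) ≤ 9 * θ) (hk3 : 5 * θ + 1 ≤ k)
    (hA1 : (A : ℝ) ≤ Real.exp (0.4 * B)) (hA2 : Real.exp (0.4 * B) ≤ 2 * A)
    (hn1 : Real.exp B ≤ n) (hn2 : (n : ℝ) ≤ 2 * Real.exp B) :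
    ‖∑ a ∈ range A, ∑ b ∈ range A,
      osc (-(Real.exp (θ * B)) * Real.log ((n + a * b : ℕ) : ℝ))‖ ≤
      (A : ℝ) ^ 2 * (Real.exp (3 - 1 / 10 ^ 9 * B / θ ^ 2) + 2 * Real.exp (-(0.4 * B))) := by
  set t := Real.exp (θ * B) with ht
  have ht0 : 0 < t := Real.exp_pos _
  have hn0 : (0 : ℝ) < n := (Real.exp_pos _).trans_le hn1
  set β : Fin k → ℝ := fun j =>
    t * (-1) ^ (j + 1 : ℕ) / (((j + 1 : ℕ) : ℝ) * (n : ℝ) ^ (j + 1 : ℕ)) with hβ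
  have hmain := norm_bilinear_le (n := n) β hB hθ hk4 (by linarith) hk2 hA1 hA2 hn1 hn2
    (fun j => by
      simp only [hβ, abs_div, abs_mul, abs_pow, abs_neg, abs_one, one_pow, mul_one]
      rw [abs_of_pos ht0, abs_of_pos hn0, abs_of_pos (by positivity)])
  set W' := ∑ a ∈ range A, ∑ b ∈ range A, osc (∑ j, β j * ((a * b : ℕ) : ℝ) ^ (j + 1 : ℕ)) with hW'
  have hpt : ∀ a ∈ range A, ∀ b ∈ range A,
      ‖osc (-t * Real.log ((n + a * b : ℕ) : ℝ)) - osc (-t * Real.log n) *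
        osc (∑ j, β j * ((a * b : ℕ) : ℝ) ^ (j + 1 : ℕ))‖ ≤ 2 * Real.exp (-(0.4 * B)) := by
    intro a ha b hb
    rw [mem_range] at ha hb
    set y : ℝ := ((a * b : ℕ) : ℝ) / n with hy
    have hy0 : 0 ≤ y := by positivity
    have hyle : y ≤ Real.exp (-(0.2 * B)) := by
      rw [hy, div_le_iff₀ hn0]
      calc ((a * b : ℕ) : ℝ) = (a : ℝ) * b := by push_cast; ring
        _ ≤ A * A := by
          have h1 : (a : ℝ) ≤ A := by exact_mod_cast ha.le
          have h2 : (b : ℝ) ≤ A := by exact_mod_cast hb.le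
          gcongr
        _ ≤ Real.exp (0.4 * B) * Real.exp (0.4 * B) := by gcongr
        _ = Real.exp (-(0.2 * B)) * Real.exp B := by
          rw [← Real.exp_add, ← Real.exp_add]; congr 1; ring
        _ ≤ _ := by gcongr
    have hhalf : y ≤ 1 / 2 := by
      refine hyle.trans ?_
      rw [Real.exp_neg, inv_le_comm₀ (Real.exp_pos _) (by norm_num)]
      have := Real.add_one_le_exp (0.2 * B)
      norm_num; linarith
    have hlog : Real.log ((n + a * b : ℕ) : ℝ) = Real.log n + Real.log (1 + y) := by
      rw [← Real.log_mul (by positivity) (by positivity)]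
      congr 1
      rw [hy]; push_cast; field_simp
    have hT := Real.abs_log_sub_add_sum_range_le (x := -y)
      (by rw [abs_neg, abs_of_nonneg hy0]; linarith) k
    rw [sub_neg_eq_add, abs_neg, abs_of_nonneg hy0] at hT
    have hsum : ∑ j, β j * ((a * b : ℕ) : ℝ) ^ (j + 1 : ℕ) =
        t * ∑ i ∈ range k, (-y) ^ (i + 1) / ((i : ℝ) + 1) := by
      rw [Fin.sum_univ_eq_sum_range (fun j => t * (-1) ^ (j + 1 : ℕ) /
        (((j + 1 : ℕ) : ℝ) * (n : ℝ) ^ (j + 1 : ℕ)) * ((a * b : ℕ) : ℝ) ^ (j + 1 : ℕ)), mul_sum]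
      refine sum_congr rfl fun i _ => ?_
      rw [neg_pow y, hy, div_pow]
      push_cast
      field_simp
    rw [hlog, mul_add, osc_add, ← mul_sub, norm_mul, norm_osc, one_mul, hsum]
    refine (norm_osc_sub_le _ _).trans ?_
    have e : -t * Real.log (1 + y) - t * ∑ i ∈ range k, (-y) ^ (i + 1) / ((i : ℝ) + 1) =
        -t * (∑ i ∈ range k, (-y) ^ (i + 1) / ((i : ℝ) + 1) + Real.log (1 + y)) := by ring
    rw [e, abs_mul, abs_neg, abs_of_pos ht0]
    calc t * |∑ i ∈ range k, (-y) ^ (i + 1) / ((i : ℝ) + 1) + Real.log (1 + y)|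
        ≤ t * (y ^ (k + 1) / (1 - y)) := by gcongr
      _ ≤ t * (Real.exp (-(0.2 * B)) ^ (k + 1) / (1 / 2)) := by
          gcongr
          linarith
      _ = 2 * Real.exp (θ * B - 0.2 * B * (k + 1)) := by
          rw [← Real.exp_nat_mul, ht, sub_eq_add_neg, Real.exp_add]
          push_cast
          rw [show ((k : ℝ) + 1) * -(0.2 * B) = -(0.2 * B * (k + 1)) by ring]
          ring
      _ ≤ _ := by
          gcongr
          nlinarith
  have hW : ∑ a ∈ range A, ∑ b ∈ range A, osc (-t * Real.log ((n + a * b : ℕ) : ℝ)) =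
      osc (-t * Real.log n) * W' + ∑ a ∈ range A, ∑ b ∈ range A,
        (osc (-t * Real.log ((n + a * b : ℕ) : ℝ)) - osc (-t * Real.log n) *
        osc (∑ j, β j * ((a * b : ℕ) : ℝ) ^ (j + 1 : ℕ))) := by
    rw [hW', mul_sum]
    simp only [sum_sub_distrib, mul_sum]
    ring
  rw [hW]
  refine (norm_add_le _ _).trans ?_
  rw [norm_mul, norm_osc, one_mul, mul_add]
  refine add_le_add hmain ?_
  refine (norm_sum_le_of_le _ fun a ha => norm_sum_le_of_le _ fun b hb => hpt a ha b hb).trans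
    (le_of_eq ?_)
  simp; ring

lemma sum_shift_sub (g : ℕ → ℂ) {N M : ℕ} (hNM : N ≤ M) :
    ∑ n ∈ Ioc N M, g n - ∑ n ∈ Ioc N M, g (n + 1) = g (N + 1) - g (M + 1) := by
  induction M, hNM using Nat.le_induction with
  | base => simp
  | succ m hm ihm =>
    rw [sum_Ioc_succ_top (by omega), sum_Ioc_succ_top (by omega), add_sub_add_comm, ihm]
    ring

lemma norm_sum_shift_sub_le (f : ℕ → ℂ) (hf : ∀ n, ‖f n‖ ≤ 1) {N M : ℕ} (hNM : N ≤ M) (h : ℕ) :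
    ‖∑ n ∈ Ioc N M, f n - ∑ n ∈ Ioc N M, f (n + h)‖ ≤ 2 * h := by
  induction h with
  | zero => simp
  | succ h ih =>
    have e := sum_shift_sub (fun n => f (n + h)) hNM
    simp only [add_assoc, add_comm 1 h] at e
    have e2 : ∑ n ∈ Ioc N M, f n - ∑ n ∈ Ioc N M, f (n + (h + 1)) =
        (∑ n ∈ Ioc N M, f n - ∑ n ∈ Ioc N M, f (n + h)) +
          (f (N + (h + 1)) - f (M + (h + 1))) := by rw [← e]; ring
    rw [e2]
    refine (norm_add_le _ _).trans ?_
    have := (norm_sub_le (f (N + (h + 1))) (f (M + (h + 1)))).trans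
      (add_le_add (hf _) (hf _))
    push_cast
    linarith

lemma norm_sum_le_of_shifts (f : ℕ → ℂ) (hf : ∀ n, ‖f n‖ ≤ 1) {N M A : ℕ} (hNM : N ≤ M) :
    (A : ℝ) ^ 2 * ‖∑ n ∈ Ioc N M, f n‖ ≤
      ∑ n ∈ Ioc N M, ‖∑ a ∈ range A, ∑ b ∈ range A, f (n + a * b)‖ + 2 * (A : ℝ) ^ 4 := by
  have h1 : (A : ℂ) ^ 2 * ∑ n ∈ Ioc N M, f n =
      ∑ n ∈ Ioc N M, ∑ a ∈ range A, ∑ b ∈ range A, f (n + a * b) +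
      ∑ a ∈ range A, ∑ b ∈ range A,
        (∑ n ∈ Ioc N M, f n - ∑ n ∈ Ioc N M, f (n + a * b)) := by
    simp only [sum_sub_distrib, sum_const, card_range, nsmul_eq_mul]
    have : ∑ n ∈ Ioc N M, ∑ a ∈ range A, ∑ b ∈ range A, f (n + a * b) =
        ∑ a ∈ range A, ∑ b ∈ range A, ∑ n ∈ Ioc N M, f (n + a * b) := by
      rw [sum_comm]
      exact sum_congr rfl fun a _ => sum_comm
    rw [this]; ring
  have h2 : (A : ℝ) ^ 2 * ‖∑ n ∈ Ioc N M, f n‖ = ‖(A : ℂ) ^ 2 * ∑ n ∈ Ioc N M, f n‖ := by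
    rw [norm_mul, norm_pow, Complex.norm_natCast]
  rw [h2, h1]
  refine (norm_add_le _ _).trans (add_le_add (norm_sum_le _ _) ?_)
  refine (norm_sum_le_of_le (n := fun _ => (A : ℝ) * (2 * A ^ 2)) _ fun a ha =>
    (norm_sum_le_of_le (n := fun _ => 2 * (A : ℝ) ^ 2) _ fun b hb => ?_).trans
      (by simp)).trans (by simp; apply le_of_eq; ring)
  refine (norm_sum_shift_sub_le f hf hNM (a * b)).trans ?_
  rw [mem_range] at ha hb
  have h3 : (a : ℝ) ≤ A := by exact_mod_cast ha.le
  have h4 : (b : ℝ) ≤ A := by exact_mod_cast hb.le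
  push_cast
  nlinarith [mul_le_mul h3 h4 (by positivity) (by positivity)]

lemma norm_sum_osc_log_le_large {B θ : ℝ} {N M : ℕ} (hB : 443 ≤ B) (hθ : 1 / 2 ≤ θ)
    (hN : (N : ℝ) = Real.exp B) (hNM : N ≤ M) (hM : M ≤ 2 * N) :
    ‖∑ n ∈ Ioc N M, osc (-(Real.exp (θ * B)) * Real.log n)‖ ≤
      (Real.exp 3 + 4) * N * Real.exp (-(1 / 10 ^ 9 * B / θ ^ 2)) := by
  set A := ⌊Real.exp (0.4 * B)⌋₊ with hA
  have hA1 : (A : ℝ) ≤ Real.exp (0.4 * B) := Nat.floor_le (Real.exp_pos _).le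
  have hA2 : Real.exp (0.4 * B) ≤ 2 * A := by
    have h1 := Nat.lt_floor_add_one (Real.exp (0.4 * B))
    have h2 := Real.add_one_le_exp (0.4 * B)
    rw [← hA] at h1
    linarith
  have hA0 : (0 : ℝ) < A := by have := Real.exp_pos (0.4 * B); linarith
  set k := ⌈5 * θ⌉₊ + 1 with hk
  have hk3 : 5 * θ + 1 ≤ k := by
    rw [hk]; push_cast; linarith [Nat.le_ceil (5 * θ)]
  have hk2 : (k : ℝ) ≤ 9 * θ := by
    have := Nat.ceil_lt_add_one (show 0 ≤ 5 * θ by linarith)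
    rw [hk]; push_cast; linarith
  have hk4 : 4 ≤ k := by
    have : (3 : ℝ) < k := by linarith
    exact_mod_cast this
  set δ := Real.exp (3 - 1 / 10 ^ 9 * B / θ ^ 2) + 2 * Real.exp (-(0.4 * B)) with hδ
  have h1 := norm_sum_le_of_shifts (A := A) (fun n => osc (-(Real.exp (θ * B)) * Real.log n))
    (fun n => (norm_osc _).le) hNM
  have h2 : ∑ n ∈ Ioc N M, ‖∑ a ∈ range A, ∑ b ∈ range A,
      osc (-(Real.exp (θ * B)) * Real.log ((n + a * b : ℕ) : ℝ))‖ ≤ N * ((A : ℝ) ^ 2 * δ) := by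
    refine (sum_le_card_nsmul _ _ ((A : ℝ) ^ 2 * δ) fun n hn => ?_).trans ?_
    · rw [mem_Ioc] at hn
      refine norm_sum_log_shift_le hB hθ hk4 hk2 hk3 hA1 hA2 ?_ ?_
      · rw [← hN]; exact_mod_cast hn.1.le
      · rw [← hN]; exact_mod_cast hn.2.trans hM
    · rw [nsmul_eq_mul, Nat.card_Ioc]
      gcongr
      omega
  have h3 : ‖∑ n ∈ Ioc N M, osc (-(Real.exp (θ * B)) * Real.log n)‖ ≤ N * δ + 2 * (A : ℝ) ^ 2 := by
    have h4 : (0 : ℝ) < (A : ℝ) ^ 2 := by positivity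
    refine le_of_mul_le_mul_left ?_ h4
    calc _ ≤ _ := h1
      _ ≤ N * ((A : ℝ) ^ 2 * δ) + 2 * (A : ℝ) ^ 4 := by gcongr
      _ = _ := by ring
  refine h3.trans ?_
  have hsmall : 1 / 10 ^ 9 * B / θ ^ 2 ≤ 0.2 * B := by
    rw [div_le_iff₀ (by positivity)]
    have : 1 / 4 ≤ θ ^ 2 := by nlinarith
    nlinarith
  have hA3 : (A : ℝ) ^ 2 ≤ N * Real.exp (-(1 / 10 ^ 9 * B / θ ^ 2)) := by
    calc (A : ℝ) ^ 2 ≤ Real.exp (0.4 * B) ^ 2 := by gcongr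
      _ = Real.exp (B - 0.2 * B) := by rw [← Real.exp_nat_mul]; congr 1; push_cast; ring
      _ ≤ Real.exp (B + -(1 / 10 ^ 9 * B / θ ^ 2)) := by
        rw [Real.exp_le_exp]; linarith
      _ = _ := by rw [Real.exp_add, hN]
  have hδ2 : δ ≤ (Real.exp 3 + 2) * Real.exp (-(1 / 10 ^ 9 * B / θ ^ 2)) := by
    rw [hδ, sub_eq_add_neg, Real.exp_add, add_mul]
    gcongr
    linarith
  nlinarith [mul_le_mul_of_nonneg_left hδ2 (Nat.cast_nonneg (α := ℝ) N)]

theorem norm_sum_osc_log_le : ∃ c C : ℝ, 0 < c ∧ 0 < C ∧ ∀ (t : ℝ) (N M : ℕ), 2 ≤ t → 1 ≤ N →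
    N ≤ M → M ≤ 2 * N → (N : ℝ) ≤ t ^ 2 →
    ‖∑ n ∈ Ioc N M, osc (-t * Real.log n)‖ ≤
      C * N * Real.exp (-(c * Real.log N ^ 3 / Real.log t ^ 2)) := by
  refine ⟨1 / 10 ^ 9, Real.exp 3 + 4, by norm_num, by positivity, ?_⟩
  intro t N M ht hN hNM hM hNt
  have hN1 : (1 : ℝ) ≤ N := by exact_mod_cast hN
  have hlt : 0 < Real.log t := Real.log_pos (by linarith)
  have hlN : 0 ≤ Real.log N := Real.log_nonneg hN1
  have hle : Real.log N ≤ 2 * Real.log t := by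
    have := Real.log_le_log (by linarith) hNt
    rwa [Real.log_pow] at this
  by_cases hB : 443 ≤ Real.log N
  · set B := Real.log N with hBdef
    have h := norm_sum_osc_log_le_large (θ := Real.log t / B) hB
      (by rw [div_le_div_iff₀ (by norm_num) (by linarith)]; linarith)
      (Real.exp_log (by linarith)).symm hNM hM
    rw [div_mul_cancel₀ _ (by linarith), Real.exp_log (by linarith)] at h
    convert h using 3
    field_simp
  · push Not at hB
    have h1 : ‖∑ n ∈ Ioc N M, osc (-t * Real.log n)‖ ≤ N := by
      refine (norm_sum_le _ _).trans ?_
      simp only [norm_osc, sum_const, Nat.card_Ioc, nsmul_eq_mul, mul_one]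
      exact_mod_cast (by omega)
    refine h1.trans ?_
    have h2 : 1 / 10 ^ 9 * Real.log N ^ 3 / Real.log t ^ 2 ≤ 1 := by
      rw [div_le_one (by positivity)]
      have : Real.log N ^ 2 ≤ (2 * Real.log t) ^ 2 := pow_le_pow_left₀ hlN hle 2
      calc 1 / 10 ^ 9 * Real.log N ^ 3 = 1 / 10 ^ 9 * Real.log N * Real.log N ^ 2 := by ring
        _ ≤ 1 / 10 ^ 9 * 443 * (2 * Real.log t) ^ 2 := by gcongr
        _ ≤ _ := by nlinarith [sq_nonneg (Real.log t)]
    have h3 : Real.exp (-1) ≤ Real.exp (-(1 / 10 ^ 9 * Real.log N ^ 3 / Real.log t ^ 2)) := by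
      rw [Real.exp_le_exp]; linarith
    calc (N : ℝ) = Real.exp 1 * N * Real.exp (-1) := by
          rw [mul_right_comm, ← Real.exp_add]; norm_num
      _ ≤ (Real.exp 3 + 4) * N * Real.exp (-(1 / 10 ^ 9 * Real.log N ^ 3 / Real.log t ^ 2)) := by
          gcongr
          have : Real.exp 1 ≤ Real.exp 3 := Real.exp_le_exp.mpr (by norm_num)
          linarith

/-- The `n`-th error term in the Euler-Maclaurin expansion of `(s - 1) ζ(s)`. -/
noncomputable def zetaTerm (s : ℂ) (n : ℕ) : ℂ :=
  (s - 1) * (n : ℂ) ^ (-s) + ((n + 1 : ℕ) : ℂ) ^ (1 - s) - (n : ℂ) ^ (1 - s)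

lemma norm_natCast_cpow_sub_le {s : ℂ} (hs : 1 / 2 ≤ s.re) {n : ℕ} (hn : 1 ≤ n) {u : ℝ}
    (hu : u ∈ Set.Icc (n : ℝ) (n + 1)) :
    ‖(u : ℂ) ^ (-s) - (n : ℂ) ^ (-s)‖ ≤ ‖s‖ * (n : ℝ) ^ (-(3 / 2 : ℝ)) := by
  have hn0 : (1 : ℝ) ≤ n := by exact_mod_cast hn
  have hs0 : -s ≠ 0 := by
    intro h
    have := congrArg Complex.re h
    simp at this; linarith
  have h := (convex_Icc (n : ℝ) (n + 1)).norm_image_sub_le_of_norm_hasDerivWithin_le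
    (f := fun u : ℝ => (u : ℂ) ^ (-s)) (f' := fun u : ℝ => -s * (u : ℂ) ^ (-s - 1))
    (C := ‖s‖ * (n : ℝ) ^ (-(3 / 2 : ℝ)))
    (fun v hv => (hasDerivAt_ofReal_cpow_const (by linarith [hv.1]) hs0).hasDerivWithinAt)
    (fun v hv => by
      have hv0 : 0 < v := by linarith [hv.1]
      rw [norm_mul, norm_neg, Complex.norm_cpow_eq_rpow_re_of_pos hv0]
      gcongr
      have hre : (-s - 1).re ≤ -(3 / 2) := by simp; linarith
      calc v ^ (-s - 1).re ≤ v ^ (-(3 / 2 : ℝ)) :=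
            Real.rpow_le_rpow_of_exponent_le (by linarith [hv.1]) hre
        _ ≤ _ := Real.rpow_le_rpow_of_nonpos (by linarith) hv.1 (by norm_num))
    (Set.left_mem_Icc.mpr (by linarith)) hu
  simp only [Complex.ofReal_natCast] at h
  refine h.trans (mul_le_of_le_one_right (by positivity) ?_)
  rw [Real.norm_eq_abs, abs_le]
  constructor <;> linarith [hu.1, hu.2]

lemma norm_zetaTerm_le {s : ℂ} (hs : 1 / 2 ≤ s.re) {n : ℕ} (hn : 1 ≤ n) :
    ‖zetaTerm s n‖ ≤ ‖s‖ * ‖s - 1‖ * (n : ℝ) ^ (-(3 / 2 : ℝ)) := by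
  have hn0 : (1 : ℝ) ≤ n := by exact_mod_cast hn
  by_cases h1 : s = 1
  · simp [zetaTerm, h1]
  have h1' : (1 : ℂ) - s ≠ 0 := sub_ne_zero.mpr (Ne.symm h1)
  have h := (convex_Icc (n : ℝ) (n + 1)).norm_image_sub_le_of_norm_hasDerivWithin_le
    (f := fun u : ℝ => (s - 1) * (n : ℂ) ^ (-s) * u + (u : ℂ) ^ (1 - s))
    (f' := fun u : ℝ => (s - 1) * (n : ℂ) ^ (-s) * 1 + (1 - s) * (u : ℂ) ^ (1 - s - 1))
    (C := ‖s‖ * ‖s - 1‖ * (n : ℝ) ^ (-(3 / 2 : ℝ)))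
    (fun v hv => (((Complex.ofRealCLM.hasDerivAt (x := v)).const_mul _).add
      (hasDerivAt_ofReal_cpow_const (by linarith [hv.1]) h1')).hasDerivWithinAt)
    (fun v hv => by
      have e : (s - 1) * (n : ℂ) ^ (-s) * 1 + (1 - s) * (v : ℂ) ^ (1 - s - 1) =
          -(s - 1) * ((v : ℂ) ^ (-s) - (n : ℂ) ^ (-s)) := by
        rw [show 1 - s - 1 = -s by ring]; ring
      rw [e, norm_mul, norm_neg, mul_comm ‖s‖, mul_assoc]
      gcongr
      exact norm_natCast_cpow_sub_le hs hn hv)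
    (Set.left_mem_Icc.mpr (by linarith)) (Set.right_mem_Icc.mpr (by linarith))
  have e : zetaTerm s n = (s - 1) * (n : ℂ) ^ (-s) * ((n + 1 : ℝ) : ℂ) +
      ((n + 1 : ℝ) : ℂ) ^ (1 - s) - ((s - 1) * (n : ℂ) ^ (-s) * ((n : ℝ) : ℂ) +
      ((n : ℝ) : ℂ) ^ (1 - s)) := by
    rw [zetaTerm]; push_cast; ring
  rw [e]
  refine h.trans (le_of_eq ?_)
  simp

lemma inv_rpow_three_halves_le {x : ℝ} (hx : 1 < x) :
    x ^ (-(3 / 2 : ℝ)) ≤ 2 * (1 / √(x - 1) - 1 / √x) := by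
  have h0 : 0 < √x := Real.sqrt_pos.mpr (by linarith)
  have h1 : 0 < √(x - 1) := Real.sqrt_pos.mpr (by linarith)
  have h2 : √(x - 1) ≤ √x := Real.sqrt_le_sqrt (by linarith)
  have hs0 := Real.sq_sqrt (show 0 ≤ x by linarith)
  have hs1 := Real.sq_sqrt (show 0 ≤ x - 1 by linarith)
  have e : x ^ (-(3 / 2 : ℝ)) = 1 / (√x) ^ 3 := by
    rw [Real.rpow_neg (by linarith), Real.sqrt_eq_rpow, ← Real.rpow_natCast,
      ← Real.rpow_mul (by linarith)]
    norm_num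
  rw [e, div_sub_div _ _ h1.ne' h0.ne', ← mul_div_assoc, div_le_div_iff₀ (by positivity)
    (by positivity)]
  set a := √x
  set b := √(x - 1)
  have hab : (a - b) * (a + b) = 1 := by nlinarith
  have h3 : 1 ≤ (a - b) * (2 * a) := by
    rw [← hab]; exact mul_le_mul_of_nonneg_left (by linarith) (by linarith)
  nlinarith [mul_le_mul_of_nonneg_left h3 (show 0 ≤ a ^ 2 by positivity),
    mul_le_mul_of_nonneg_left h2 h0.le]

lemma sum_tail_rpow_le {M : ℕ} (hM : 2 ≤ M) (k : ℕ) :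
    ∑ i ∈ range k, ((M + i : ℕ) : ℝ) ^ (-(3 / 2 : ℝ)) ≤ 2 / √((M : ℝ) - 1) := by
  have hM' : (2 : ℝ) ≤ M := by exact_mod_cast hM
  have h : ∑ i ∈ range k, ((M + i : ℕ) : ℝ) ^ (-(3 / 2 : ℝ)) ≤
      2 * (1 / √((M : ℝ) - 1) - 1 / √((M : ℝ) + k - 1)) := by
    induction k with
    | zero => simp
    | succ k ih =>
      rw [sum_range_succ]
      have := inv_rpow_three_halves_le (x := ((M + k : ℕ) : ℝ))
        (by push_cast; linarith [Nat.cast_nonneg (α := ℝ) k])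
      push_cast at this ih ⊢
      rw [show (M : ℝ) + (k + 1) - 1 = M + k by ring]
      linarith
  refine h.trans ?_
  have : 0 ≤ 1 / √((M : ℝ) + k - 1) := by positivity
  rw [mul_sub, mul_one_div]
  linarith

lemma summable_tail_rpow {M : ℕ} (hM : 2 ≤ M) :
    Summable fun i : ℕ => ((M + i : ℕ) : ℝ) ^ (-(3 / 2 : ℝ)) :=
  summable_of_sum_range_le (fun _ => by positivity) (sum_tail_rpow_le hM)

lemma summable_zetaTerm {s : ℂ} (hs : 1 / 2 ≤ s.re) {M : ℕ} (hM : 2 ≤ M) :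
    Summable fun i => zetaTerm s (M + i) :=
  Summable.of_norm_bounded ((summable_tail_rpow hM).mul_left (‖s‖ * ‖s - 1‖))
    fun i => norm_zetaTerm_le hs (by omega)

lemma norm_tsum_zetaTerm_le {s : ℂ} (hs : 1 / 2 ≤ s.re) {M : ℕ} (hM : 2 ≤ M) :
    ‖∑' i, zetaTerm s (M + i)‖ ≤ ‖s‖ * ‖s - 1‖ * (2 / √((M : ℝ) - 1)) := by
  have h := (summable_tail_rpow hM).mul_left (‖s‖ * ‖s - 1‖)
  refine (tsum_of_norm_bounded h.hasSum fun i => norm_zetaTerm_le hs (by omega)).trans ?_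
  rw [tsum_mul_left]
  gcongr
  exact Real.tsum_le_of_sum_range_le (fun _ => by positivity) (sum_tail_rpow_le hM)

lemma differentiable_natCast_cpow {n : ℕ} (hn : 1 ≤ n) {f : ℂ → ℂ} (hf : Differentiable ℂ f) :
    Differentiable ℂ fun s => (n : ℂ) ^ f s := fun s =>
  (hf s).const_cpow (Or.inl (by exact_mod_cast (by omega : n ≠ 0)))

lemma riemannZeta₁_eq_of_one_lt_re {s : ℂ} (hs : 1 < s.re) {M : ℕ} (hM : 2 ≤ M) :
    riemannZeta₁ s = (s - 1) * ∑ n ∈ Ico 1 M, (n : ℂ) ^ (-s) + (M : ℂ) ^ (1 - s) +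
      ∑' i, zetaTerm s (M + i) := by
  have hs1 : s - 1 ≠ 0 := by
    intro h
    have := congrArg Complex.re h
    simp at this; linarith
  have hs0 : s ≠ 0 := by
    rintro rfl; simp at hs; linarith
  have hz : riemannZeta₁ s = (s - 1) * riemannZeta s := by
    rw [riemannZeta_eq_inv_sub_mul (sub_ne_zero.mp hs1), ← mul_assoc, mul_inv_cancel₀ hs1, one_mul]
  have hsum : Summable fun n : ℕ => (n : ℂ) ^ (-s) := by
    have := Complex.summable_one_div_nat_cpow.mpr hs
    refine this.congr fun n => ?_
    rw [Complex.cpow_neg, one_div]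
  have hzeta : riemannZeta s = ∑' n : ℕ, (n : ℂ) ^ (-s) := by
    rw [zeta_eq_tsum_one_div_nat_cpow hs]
    exact tsum_congr fun n => by rw [Complex.cpow_neg, one_div]
  have hsplit : ∑' n : ℕ, (n : ℂ) ^ (-s) =
      ∑ n ∈ Ico 1 M, (n : ℂ) ^ (-s) + ∑' i : ℕ, ((M + i : ℕ) : ℂ) ^ (-s) := by
    rw [← hsum.sum_add_tsum_nat_add M, range_eq_Ico, sum_eq_sum_Ico_succ_bot (by omega)]
    congr 1
    · simp [hs0]
    · exact tsum_congr fun i => by rw [add_comm]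
  have hsumM : Summable fun i : ℕ => ((M + i : ℕ) : ℂ) ^ (-s) := by
    refine ((summable_nat_add_iff M).mpr hsum).congr fun i => by rw [add_comm]
  have htel : HasSum (fun i : ℕ => ((M + i + 1 : ℕ) : ℂ) ^ (1 - s) - ((M + i : ℕ) : ℂ) ^ (1 - s))
      (-(M : ℂ) ^ (1 - s)) := by
    have hsm := (summable_zetaTerm (by linarith : 1 / 2 ≤ s.re) hM).sub (hsumM.mul_left (s - 1))
    have hsm' : Summable (fun i : ℕ => ((M + i + 1 : ℕ) : ℂ) ^ (1 - s) -
        ((M + i : ℕ) : ℂ) ^ (1 - s)) := hsm.congr fun i => by rw [zetaTerm]; ring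
    have ht := hsm'.hasSum.tendsto_sum_nat
    have e : ∀ k, ∑ i ∈ range k, (((M + i + 1 : ℕ) : ℂ) ^ (1 - s) - ((M + i : ℕ) : ℂ) ^ (1 - s)) =
        ((M + k : ℕ) : ℂ) ^ (1 - s) - (M : ℂ) ^ (1 - s) := fun k =>
      sum_range_sub (fun i => ((M + i : ℕ) : ℂ) ^ (1 - s)) k
    have hlim : Filter.Tendsto (fun k : ℕ => ((M + k : ℕ) : ℂ) ^ (1 - s) - (M : ℂ) ^ (1 - s))
        Filter.atTop (nhds (0 - (M : ℂ) ^ (1 - s))) := by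
      refine Filter.Tendsto.sub_const ?_ _
      rw [tendsto_zero_iff_norm_tendsto_zero]
      have h1 : Filter.Tendsto (fun x : ℝ => x ^ (-(s.re - 1))) Filter.atTop (nhds 0) :=
        tendsto_rpow_neg_atTop (by linarith)
      have h2 : Filter.Tendsto (fun k : ℕ => ((M + k : ℕ) : ℝ)) Filter.atTop Filter.atTop :=
        tendsto_natCast_atTop_atTop.comp (Filter.tendsto_add_atTop_nat M |>.congr fun k => by
          rw [add_comm])
      refine (h1.comp h2).congr fun k => ?_
      rw [Function.comp, Complex.norm_natCast_cpow_of_pos (by omega)]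
      simp
    rw [← zero_sub]
    have := tendsto_nhds_unique (ht.congr e) hlim
    rw [← this]
    exact hsm'.hasSum
  have hgt : ∑' i, zetaTerm s (M + i) =
      (s - 1) * ∑' i : ℕ, ((M + i : ℕ) : ℂ) ^ (-s) + -(M : ℂ) ^ (1 - s) := by
    rw [← tsum_mul_left, ← htel.tsum_eq, ← (hsumM.mul_left (s - 1)).tsum_add htel.summable]
    exact tsum_congr fun i => by rw [zetaTerm]; ring
  rw [hz, hzeta, hsplit, hgt]
  ring

lemma riemannZeta₁_eq {s : ℂ} (hs : 1 / 2 < s.re) {M : ℕ} (hM : 2 ≤ M) :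
    riemannZeta₁ s = (s - 1) * ∑ n ∈ Ico 1 M, (n : ℂ) ^ (-s) + (M : ℂ) ^ (1 - s) +
      ∑' i, zetaTerm s (M + i) := by
  set R := ‖s‖ + 3 with hR
  set U : Set ℂ := {z | 1 / 2 < z.re} ∩ Metric.ball 0 R with hU
  have hUo : IsOpen U := (isOpen_lt continuous_const Complex.continuous_re).inter Metric.isOpen_ball
  have hUc : IsPreconnected U :=
    ((convex_halfSpace_re_gt _).inter (convex_ball _ _)).isPreconnected
  have h2U : (2 : ℂ) ∈ U := by
    refine ⟨by simp; norm_num, ?_⟩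
    rw [mem_ball_zero_iff, hR, Complex.norm_ofNat]
    linarith [norm_nonneg s]
  have hsU : s ∈ U := ⟨hs, by rw [mem_ball_zero_iff, hR]; linarith⟩
  have hd : DifferentiableOn ℂ (fun s : ℂ => (s - 1) * ∑ n ∈ Ico 1 M, (n : ℂ) ^ (-s) +
      (M : ℂ) ^ (1 - s) + ∑' i, zetaTerm s (M + i)) U := by
    have h1 : DifferentiableOn ℂ (fun s : ℂ => ∑' i, zetaTerm s (M + i)) U := by
      refine Complex.differentiableOn_tsum_of_summable_norm
        ((summable_tail_rpow hM).mul_left (R * (R + 1))) (fun i => ?_) hUo fun i w hw => ?_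
      · simp only [zetaTerm]
        refine Differentiable.differentiableOn ?_
        refine (((differentiable_id.sub_const 1).mul (differentiable_natCast_cpow (by omega)
          differentiable_id.neg)).add (differentiable_natCast_cpow (by omega)
          (differentiable_id.const_sub 1))).sub (differentiable_natCast_cpow (by omega)
          (differentiable_id.const_sub 1))
      · have hw2 : ‖w‖ ≤ R := (mem_ball_zero_iff.mp hw.2).le
        refine (norm_zetaTerm_le (le_of_lt hw.1) (by omega)).trans ?_
        have hw3 : ‖w - 1‖ ≤ R + 1 := (norm_sub_le _ _).trans (by rw [norm_one]; linarith)
        gcongr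
    refine DifferentiableOn.add (Differentiable.differentiableOn ?_) h1
    refine ((differentiable_id.sub_const 1).mul (Differentiable.fun_sum fun n hn =>
      differentiable_natCast_cpow (mem_Ico.mp hn).1 differentiable_id.neg)).add
      (differentiable_natCast_cpow (by omega) (differentiable_id.const_sub 1))
  have hev : riemannZeta₁ =ᶠ[nhds 2] (fun s : ℂ => (s - 1) * ∑ n ∈ Ico 1 M, (n : ℂ) ^ (-s) +
      (M : ℂ) ^ (1 - s) + ∑' i, zetaTerm s (M + i)) :=
    Filter.eventuallyEq_of_mem
      ((isOpen_lt continuous_const Complex.continuous_re).mem_nhds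
        (show (1 : ℝ) < (2 : ℂ).re by norm_num)) fun z hz => riemannZeta₁_eq_of_one_lt_re hz hM
  exact (differentiable_riemannZeta₁.differentiableOn.analyticOnNhd hUo
    ).eqOn_of_preconnected_of_eventuallyEq (hd.analyticOnNhd hUo) hUc h2U hev hsU

lemma norm_sum_antitone_mul_le (f : ℕ → ℝ) (g : ℕ → ℂ) {N : ℕ} {B : ℝ}
    (hf : ∀ n, N < n → f (n + 1) ≤ f n) (hf0 : ∀ n, 0 ≤ f n) {M : ℕ} (hM : N < M)
    (hg : ∀ m, N < m → m ≤ M → ‖∑ n ∈ Ioc N m, g n‖ ≤ B) :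
    ‖∑ n ∈ Ioc N M, (f n : ℂ) * g n‖ ≤ f (N + 1) * B := by
  have key : ‖∑ n ∈ Ioc N M, (f n : ℂ) * g n - f M * ∑ n ∈ Ioc N M, g n‖ ≤
      (f (N + 1) - f M) * B := by
    induction M, hM using Nat.le_induction with
    | base => simp
    | succ m hm ih =>
      have ih := ih fun j h1 h2 => hg j h1 (by omega)
      have e : ∑ n ∈ Ioc N (m + 1), (f n : ℂ) * g n - f (m + 1) * ∑ n ∈ Ioc N (m + 1), g n =
          (∑ n ∈ Ioc N m, (f n : ℂ) * g n - f m * ∑ n ∈ Ioc N m, g n) +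
            ((f m - f (m + 1) : ℝ) : ℂ) * ∑ n ∈ Ioc N m, g n := by
        rw [sum_Ioc_succ_top (by omega), sum_Ioc_succ_top (by omega)]
        push_cast; ring
      rw [e]
      refine (norm_add_le _ _).trans ?_
      rw [norm_mul, Complex.norm_real, Real.norm_of_nonneg (sub_nonneg.mpr (hf m hm))]
      have h1 := mul_le_mul_of_nonneg_left (hg m hm (by omega)) (sub_nonneg.mpr (hf m hm))
      linarith
  have h2 : ‖(f M : ℂ) * ∑ n ∈ Ioc N M, g n‖ ≤ f M * B := by
    rw [norm_mul, Complex.norm_real, Real.norm_of_nonneg (hf0 M)]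
    exact mul_le_mul_of_nonneg_left (hg M hM le_rfl) (hf0 M)
  calc _ = ‖(∑ n ∈ Ioc N M, (f n : ℂ) * g n - f M * ∑ n ∈ Ioc N M, g n) +
        (f M : ℂ) * ∑ n ∈ Ioc N M, g n‖ := by rw [sub_add_cancel]
    _ ≤ (f (N + 1) - f M) * B + f M * B := (norm_add_le _ _).trans (add_le_add key h2)
    _ = _ := by ring

lemma natCast_cpow_neg_eq {n : ℕ} (hn : 1 ≤ n) (s : ℂ) :
    (n : ℂ) ^ (-s) = (((n : ℝ) ^ (-s.re) : ℝ) : ℂ) * osc (-s.im * Real.log n) := by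
  have hn0 : (0 : ℝ) < n := by exact_mod_cast hn
  rw [osc, Complex.cpow_def_of_ne_zero (by exact_mod_cast hn0.ne'), Real.rpow_def_of_pos hn0,
    Complex.ofReal_exp, ← Complex.exp_add, ← Complex.natCast_log]
  congr 1
  conv_lhs => rw [← Complex.re_add_im s]
  push_cast
  ring

lemma mul_sub_cube_le {c w u L : ℝ} (hc : 0 < c) (hw : 0 ≤ w) (hu : 0 ≤ u) (hL : 0 < L) :
    w ^ 2 * u - c * u ^ 3 / L ^ 2 ≤ w ^ 3 * L / √c := by
  have hd : 0 < √c := Real.sqrt_pos.mpr hc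
  have hdc := Real.sq_sqrt hc.le
  by_cases h : u ≤ w * L / √c
  · have h1 : 0 ≤ c * u ^ 3 / L ^ 2 := by positivity
    have h2 : w ^ 2 * u ≤ w ^ 2 * (w * L / √c) := by gcongr
    have h3 : w ^ 2 * (w * L / √c) = w ^ 3 * L / √c := by ring
    linarith
  · push Not at h
    have h1 : 0 ≤ w ^ 3 * L / √c := by positivity
    have h2 : w ^ 2 * u ≤ c * u ^ 3 / L ^ 2 := by
      rw [le_div_iff₀ (by positivity)]
      rw [div_lt_iff₀ hd] at h
      have h3 : (w * L) ^ 2 ≤ (u * √c) ^ 2 := pow_le_pow_left₀ (by positivity) h.le 2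
      rw [mul_pow, mul_pow, hdc] at h3
      nlinarith
    linarith

lemma sum_Ico_pow_two (a : ℕ → ℂ) (m : ℕ) :
    ∑ n ∈ Ico 1 (2 ^ m + 1), a n = a 1 + ∑ j ∈ range m, ∑ n ∈ Ioc (2 ^ j) (2 ^ (j + 1)), a n := by
  induction m with
  | zero => simp
  | succ m ih =>
    rw [sum_range_succ, ← add_assoc, ← ih, ← Ico_add_one_add_one_eq_Ioc,
      sum_Ico_consecutive _ (by simp) (by gcongr <;> norm_num)]

lemma exists_norm_sum_block_le : ∃ K C : ℝ, 0 < K ∧ 0 < C ∧ ∀ (s : ℂ) (j : ℕ), 3 ≤ s.im →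
    1 / 2 < s.re →
    1 - (Real.log (Real.log s.im) / Real.log s.im) ^ (2 / 3 : ℝ) ≤ s.re → (2 : ℝ) ^ j ≤ s.im ^ 2 →
    ‖∑ n ∈ Ioc (2 ^ j : ℕ) (2 ^ (j + 1)), (n : ℂ) ^ (-s)‖ ≤ C * Real.log s.im ^ K := by
  obtain ⟨c, C, hc, hC, hcC⟩ := norm_sum_osc_log_le
  refine ⟨1 / √c, C, by positivity, hC, ?_⟩
  intro s j ht hσ hη hj
  set t := s.im with htdef
  set L := Real.log t with hL
  have hL1 : 1 < L := by
    rw [hL, Real.lt_log_iff_exp_lt (by linarith)]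
    exact Real.exp_one_lt_d9.trans (by linarith)
  set N : ℕ := 2 ^ j with hN
  have hN1 : 1 ≤ N := Nat.one_le_two_pow
  have hN1' : (1 : ℝ) ≤ N := by exact_mod_cast hN1
  have hN2 : 2 ^ (j + 1) = 2 * N := by rw [hN]; ring
  set u := Real.log N with hu
  have hu0 : 0 ≤ u := Real.log_nonneg hN1'
  have hNu : (N : ℝ) = Real.exp u := (Real.exp_log (by linarith)).symm
  have hstep := norm_sum_antitone_mul_le (fun n => (n : ℝ) ^ (-s.re))
    (fun n => osc (-t * Real.log n)) (N := N) (M := 2 * N)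
    (B := C * N * Real.exp (-(c * u ^ 3 / L ^ 2)))
    (fun n hn => Real.rpow_le_rpow_of_nonpos (by exact_mod_cast (by omega : 0 < n)) (by simp)
      (by linarith)) (fun n => by positivity) (by omega)
    (fun m h1 h2 => hcC t N m (by linarith) hN1 h1.le h2 (by rw [hN]; exact_mod_cast hj))
  rw [hN2, sum_congr rfl fun n hn => natCast_cpow_neg_eq (by have := mem_Ioc.mp hn; omega) s]
  refine hstep.trans ?_
  have h1 : ((N + 1 : ℕ) : ℝ) ^ (-s.re) ≤ (N : ℝ) ^ (-s.re) :=
    Real.rpow_le_rpow_of_nonpos (by linarith) (by simp) (by linarith)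
  set w := (Real.log L / L) ^ (1 / 3 : ℝ) with hw
  have hlL : 0 < Real.log L := Real.log_pos hL1
  have hw0 : 0 ≤ w := by positivity
  have hw2 : w ^ 2 = (Real.log L / L) ^ (2 / 3 : ℝ) := by
    rw [hw, ← Real.rpow_natCast, ← Real.rpow_mul (by positivity)]; norm_num
  have hw3 : w ^ 3 * L = Real.log L := by
    rw [hw, ← Real.rpow_natCast, ← Real.rpow_mul (by positivity)]
    norm_num
    field_simp
  calc ((N + 1 : ℕ) : ℝ) ^ (-s.re) * (C * N * Real.exp (-(c * u ^ 3 / L ^ 2)))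
      ≤ (N : ℝ) ^ (-s.re) * (C * N * Real.exp (-(c * u ^ 3 / L ^ 2))) := by gcongr
    _ = C * Real.exp ((1 - s.re) * u - c * u ^ 3 / L ^ 2) := by
        rw [Real.rpow_def_of_pos (by linarith), ← hu]
        rw [sub_eq_add_neg, Real.exp_add, show (1 - s.re) * u = u * -s.re + u by ring,
          Real.exp_add, ← hNu]
        ring
    _ ≤ C * Real.exp (Real.log L * (1 / √c)) := by
        gcongr
        have h2 := mul_sub_cube_le hc hw0 hu0 (show 0 < L by linarith)
        rw [hw2, hw3] at h2
        have h3 : (1 - s.re) * u ≤ (Real.log L / L) ^ (2 / 3 : ℝ) * u := by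
          gcongr; linarith
        rw [mul_one_div]
        linarith
    _ = _ := by rw [← Real.rpow_def_of_pos (by linarith)]

lemma exists_norm_riemannZeta_le_of_im_pos : ∃ K : ℝ, 0 < K ∧ ∀ s : ℂ, 3 ≤ s.im →
    1 / 2 < s.re → s.re ≤ 2 →
    1 - (Real.log (Real.log s.im) / Real.log s.im) ^ (2 / 3 : ℝ) ≤ s.re →
    ‖riemannZeta s‖ ≤ K * Real.log s.im ^ K := by
  obtain ⟨K, C, hK, hC, hKC⟩ := exists_norm_sum_block_le
  refine ⟨7 + 4 * C + (K + 1), by positivity, ?_⟩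
  intro s ht hσ hσ2 hη
  set t := s.im with htdef
  set L := Real.log t with hL
  have hL1 : 1 < L := by
    rw [hL, Real.lt_log_iff_exp_lt (by linarith)]
    exact Real.exp_one_lt_d9.trans (by linarith)
  set m := ⌈2 * L / Real.log 2⌉₊ with hm
  have hl2 := Real.log_two_gt_d9
  have hl2' := Real.log_two_lt_d9
  have hpow : ∀ j : ℕ, (2 : ℝ) ^ j = Real.exp (j * Real.log 2) := fun j => by
    rw [Real.exp_nat_mul, Real.exp_log (by norm_num)]
  have htt : t ^ 2 = Real.exp (2 * L) := by
    rw [show (2 : ℝ) * L = (2 : ℕ) * L by norm_num, Real.exp_nat_mul, Real.exp_log (by linarith)]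
  have hmle : 2 * L / Real.log 2 ≤ m := Nat.le_ceil _
  have hmlt : (m : ℝ) < 2 * L / Real.log 2 + 1 := Nat.ceil_lt_add_one (by positivity)
  have hm4 : (m : ℝ) ≤ 4 * L := by
    have : 2 * L / Real.log 2 ≤ 3 * L := by rw [div_le_iff₀ (by linarith)]; nlinarith
    linarith
  have hMge : t ^ 2 ≤ (2 : ℝ) ^ m := by
    rw [htt, hpow, Real.exp_le_exp, ← div_le_iff₀ (by linarith)]; exact hmle
  have hMle : (2 : ℝ) ^ m ≤ 2 * t ^ 2 := by
    have h1 : ((m : ℝ) - 1) * Real.log 2 ≤ 2 * L := by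
      rw [← le_div_iff₀ (by linarith)]; linarith
    rw [htt, hpow]
    calc Real.exp (m * Real.log 2) ≤ Real.exp (Real.log 2 + 2 * L) := by
          rw [Real.exp_le_exp]; linarith
      _ = _ := by rw [Real.exp_add, Real.exp_log (by norm_num)]
  have hblock : ∀ j ∈ range m,
      ‖∑ n ∈ Ioc (2 ^ j : ℕ) (2 ^ (j + 1)), (n : ℂ) ^ (-s)‖ ≤ C * L ^ K := by
    intro j hj
    refine hKC s j ht hσ hη ?_
    rw [mem_range, hm, Nat.lt_ceil, lt_div_iff₀ (by linarith)] at hj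
    rw [htt, hpow, Real.exp_le_exp]
    exact hj.le
  have hsum : ‖∑ n ∈ Ico (1 : ℕ) (2 ^ m + 1), (n : ℂ) ^ (-s)‖ ≤ 1 + m * (C * L ^ K) := by
    rw [sum_Ico_pow_two]
    refine (norm_add_le _ _).trans (add_le_add (by simp) ?_)
    refine (norm_sum_le_of_le _ hblock).trans (by simp)
  have hs1 : t ≤ ‖s - 1‖ := by
    have := Complex.abs_im_le_norm (s - 1)
    simp only [Complex.sub_im, Complex.one_im, sub_zero] at this
    exact (le_abs_self _).trans this
  have hs1pos : 0 < ‖s - 1‖ := by linarith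
  have hsne : s ≠ 1 := by
    rintro rfl
    simp at hs1pos
  have hs0 : ‖s‖ ≤ 2 + t := by
    refine (Complex.norm_le_abs_re_add_abs_im s).trans ?_
    rw [abs_of_nonneg (by linarith), abs_of_nonneg (by linarith)]
    linarith
  have hM2 : 2 ≤ 2 ^ m + 1 := by have := Nat.one_le_two_pow (n := m); omega
  have hform := riemannZeta₁_eq hσ hM2
  have hmid : ‖((2 ^ m + 1 : ℕ) : ℂ) ^ (1 - s)‖ ≤ 2 * t := by
    rw [Complex.norm_natCast_cpow_of_pos (by omega)]
    calc ((2 ^ m + 1 : ℕ) : ℝ) ^ (1 - s).re ≤ ((2 ^ m + 1 : ℕ) : ℝ) ^ (1 / 2 : ℝ) := by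
          apply Real.rpow_le_rpow_of_exponent_le
          · push_cast; linarith [pow_pos (show (0 : ℝ) < 2 by norm_num) m]
          · simp; linarith
      _ ≤ ((2 * t) ^ 2) ^ (1 / 2 : ℝ) := by
          apply Real.rpow_le_rpow (by positivity) _ (by norm_num)
          push_cast; nlinarith
      _ = _ := by rw [← Real.sqrt_eq_rpow, Real.sqrt_sq (by linarith)]
  have htail : ‖∑' i, zetaTerm s (2 ^ m + 1 + i)‖ ≤ ‖s - 1‖ * 4 := by
    refine (norm_tsum_zetaTerm_le hσ.le hM2).trans ?_
    have h1 : t ≤ √(((2 ^ m + 1 : ℕ) : ℝ) - 1) := by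
      apply Real.le_sqrt_of_sq_le
      push_cast; linarith
    rw [mul_comm ‖s‖, mul_assoc]
    gcongr
    calc ‖s‖ * (2 / √(((2 ^ m + 1 : ℕ) : ℝ) - 1)) ≤ (2 + t) * (2 / t) := by gcongr
      _ ≤ 4 := by rw [mul_div_assoc', div_le_iff₀ (by linarith)]; linarith
  have hz : ‖riemannZeta s‖ ≤ 7 + m * (C * L ^ K) := by
    rw [riemannZeta_eq_inv_sub_mul hsne, hform, norm_mul, norm_inv, inv_mul_le_iff₀ hs1pos]
    refine (norm_add₃_le).trans ?_
    rw [norm_mul]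
    have h2 := mul_le_mul_of_nonneg_left hsum (norm_nonneg (s - 1))
    linarith
  have hLK : 1 ≤ L ^ K := Real.one_le_rpow hL1.le hK.le
  have hLL : 1 ≤ L ^ (7 + 4 * C + (K + 1)) := Real.one_le_rpow hL1.le (by positivity)
  calc ‖riemannZeta s‖ ≤ 7 + m * (C * L ^ K) := hz
    _ ≤ 7 + 4 * L * (C * L ^ K) := by gcongr
    _ = 7 + 4 * C * L ^ (K + 1) := by rw [Real.rpow_add_one (by linarith)]; ring
    _ ≤ 7 * L ^ (7 + 4 * C + (K + 1)) + 4 * C * L ^ (7 + 4 * C + (K + 1)) := by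
        have h1 := Real.rpow_le_rpow_of_exponent_le hL1.le
          (show K + 1 ≤ 7 + 4 * C + (K + 1) by linarith)
        have h2 := mul_le_mul_of_nonneg_left h1 (show 0 ≤ 4 * C by positivity)
        linarith
    _ ≤ _ := by
        rw [← add_mul]
        exact mul_le_mul_of_nonneg_right (by linarith) (by linarith)

/-- The Vinogradov-Korobov bound for `ζ` near the line `re s = 1`. -/
theorem exists_norm_riemannZeta_le : ∃ K : ℝ, 0 < K ∧ ∀ s : ℂ, 3 ≤ |s.im| →
    1 / 2 < s.re → s.re ≤ 2 →
    1 - (Real.log (Real.log |s.im|) / Real.log |s.im|) ^ (2 / 3 : ℝ) ≤ s.re →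
    ‖riemannZeta s‖ ≤ K * Real.log |s.im| ^ K := by
  obtain ⟨K, hK, h⟩ := exists_norm_riemannZeta_le_of_im_pos
  refine ⟨K, hK, fun s ht h1 h2 h3 => ?_⟩
  rcases abs_cases s.im with ⟨h4, h5⟩ | ⟨h4, h5⟩
  · rw [h4] at ht h3 ⊢
    exact h s ht h1 h2 h3
  · have := h ((starRingEnd ℂ) s) (by simpa [h4] using ht) (by simpa using h1) (by simpa using h2)
      (by simpa [h4] using h3)
    rw [riemannZeta_conj, RCLike.norm_conj] at this
    simpa [h4] using this

lemma exists_eq_mul_exp {g : ℂ → ℂ} {R : ℝ} (hR : 0 < R)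
    (hg : DifferentiableOn ℂ g (Metric.ball 0 R)) (hg0 : ∀ z ∈ Metric.ball (0 : ℂ) R, g z ≠ 0) :
    ∃ h : ℂ → ℂ, DifferentiableOn ℂ h (Metric.ball 0 R) ∧ h 0 = 0 ∧
      ∀ z ∈ Metric.ball (0 : ℂ) R, g z = g 0 * Complex.exp (h z) := by
  have h0 : (0 : ℂ) ∈ Metric.ball (0 : ℂ) R := Metric.mem_ball_self hR
  have hd : DifferentiableOn ℂ (fun z => deriv g z / g z) (Metric.ball 0 R) :=
    (hg.deriv Metric.isOpen_ball).div hg hg0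
  obtain ⟨k, hk⟩ := hd.isExactOn_ball
  have hgd : ∀ z ∈ Metric.ball (0 : ℂ) R, HasDerivAt g (deriv g z) z := fun z hz =>
    (hg.differentiableAt (Metric.isOpen_ball.mem_nhds hz)).hasDerivAt
  refine ⟨fun z => k z - k 0,
    fun z hz => ((hk z hz).sub_const _).differentiableAt.differentiableWithinAt,
    sub_self _, fun z hz => ?_⟩
  have key : ∀ w ∈ Metric.ball (0 : ℂ) R,
      HasDerivAt (fun z => g z * Complex.exp (-(k z - k 0))) 0 w := by
    intro w hw
    refine ((hgd w hw).fun_mul ((hk w hw).sub_const (k 0)).fun_neg.cexp).congr_deriv ?_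
    have e : g w * (deriv g w / g w) = deriv g w := mul_div_cancel₀ _ (hg0 w hw)
    linear_combination -Complex.exp (-(k w - k 0)) * e
  have hconst := (convex_ball (0 : ℂ) R).is_const_of_fderivWithin_eq_zero (𝕜 := ℂ)
    (f := fun z => g z * Complex.exp (-(k z - k 0)))
    (fun w hw => (key w hw).differentiableAt.differentiableWithinAt)
    (fun w hw => by
      rw [fderivWithin_of_isOpen Metric.isOpen_ball hw]
      ext
      simpa using (key w hw).deriv) hz h0
  simp only [sub_self, neg_zero, Complex.exp_zero, mul_one] at hconst
  rw [← hconst, mul_assoc, ← Complex.exp_add, neg_add_cancel, Complex.exp_zero, mul_one]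

/-- A nonvanishing function with controlled growth on a disc has controlled variation. -/
lemma exists_eq_mul_exp_le {g : ℂ → ℂ} {R M : ℝ} (hR : 0 < R) (hM : 0 < M)
    (hg : DifferentiableOn ℂ g (Metric.ball 0 R)) (hg0 : ∀ z ∈ Metric.ball (0 : ℂ) R, g z ≠ 0)
    (hgM : ∀ z ∈ Metric.ball (0 : ℂ) R, ‖g z‖ ≤ Real.exp M * ‖g 0‖) :
    ∃ h : ℂ → ℂ, DifferentiableOn ℂ h (Metric.ball 0 R) ∧ h 0 = 0 ∧
      (∀ z ∈ Metric.ball (0 : ℂ) R, g z = g 0 * Complex.exp (h z)) ∧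
      ∀ z ∈ Metric.ball (0 : ℂ) R, ‖h z‖ ≤ 2 * M * ‖z‖ / (R - ‖z‖) := by
  obtain ⟨h, hd, h0, hh⟩ := exists_eq_mul_exp hR hg hg0
  refine ⟨h, hd, h0, hh, fun z hz => Complex.borelCaratheodory_zero hM hd ?_ hR hz h0⟩
  intro w hw
  rw [Set.mem_ofPred_eq]
  have h1 := hgM w hw
  have h2 : 0 < ‖g 0‖ := norm_pos_iff.mpr (hg0 0 (Metric.mem_ball_self hR))
  rw [hh w hw, norm_mul, mul_comm, Complex.norm_exp] at h1
  exact Real.exp_le_exp.mp (le_of_mul_le_mul_right h1 h2)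

lemma norm_logDeriv_le {g : ℂ → ℂ} {R M : ℝ} (hR : 0 < R) (hM : 0 < M)
    (hg : DifferentiableOn ℂ g (Metric.ball 0 R)) (hg0 : ∀ z ∈ Metric.ball (0 : ℂ) R, g z ≠ 0)
    (hgM : ∀ z ∈ Metric.ball (0 : ℂ) R, ‖g z‖ ≤ Real.exp M * ‖g 0‖) :
    ‖logDeriv g 0‖ ≤ 4 * M / R := by
  obtain ⟨h, hd, h0, hh, hb⟩ := exists_eq_mul_exp_le hR hM hg hg0 hgM
  have hn : Metric.ball (0 : ℂ) R ∈ nhds (0 : ℂ) := Metric.ball_mem_nhds _ hR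
  have hder : HasDerivAt h (deriv h 0) 0 := (hd.differentiableAt hn).hasDerivAt
  have e : logDeriv g 0 = deriv h 0 := by
    have h1 : logDeriv g 0 = logDeriv (fun z => g 0 * Complex.exp (h z)) 0 := by
      refine (logDeriv_congr_nhds ?_).eq_of_nhds
      filter_upwards [hn] with z hz using hh z hz
    rw [h1, logDeriv_const_mul _ _ (hg0 0 (Metric.mem_ball_self hR)), logDeriv_apply,
      hder.cexp.deriv]
    simp [h0]
  rw [e]
  refine hder.le_of_lip' (by positivity) ?_
  filter_upwards [Metric.ball_mem_nhds (0 : ℂ) (half_pos hR)] with z hz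
  rw [mem_ball_zero_iff] at hz
  rw [h0, sub_zero, sub_zero]
  refine (hb z (by rw [mem_ball_zero_iff]; linarith)).trans ?_
  rw [div_mul_eq_mul_div, div_le_div_iff₀ (by linarith) hR]
  have : 0 ≤ M * ‖z‖ := by positivity
  nlinarith

lemma logDeriv_canonicalFactor_zero {R : ℝ} {w : ℂ} (hR : 0 < R) (hw : w ≠ 0) :
    logDeriv (Complex.canonicalFactor R w) 0 = 1 / w - (starRingEnd ℂ) w / R ^ 2 := by
  have hR' : (R : ℂ) ≠ 0 := by exact_mod_cast hR.ne'
  have h1 : HasDerivAt (fun z : ℂ => (R : ℂ) ^ 2 - (starRingEnd ℂ) w * z)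
      (-(starRingEnd ℂ) w) 0 := by
    simpa using ((hasDerivAt_id (0 : ℂ)).const_mul ((starRingEnd ℂ) w)).const_sub ((R : ℂ) ^ 2)
  have h2 : HasDerivAt (fun z : ℂ => (R : ℂ) * (z - w)) R 0 := by
    simpa using ((hasDerivAt_id (0 : ℂ)).sub_const w).const_mul (R : ℂ)
  have h3 := h1.fun_div h2 (by simpa using ⟨hR.ne', hw⟩)
  rw [Complex.canonicalFactor_def, logDeriv_apply, h3.deriv]
  simp only [mul_zero, sub_zero, zero_sub]
  field_simp
  ring

lemma re_one_div_sub_conj_div {R : ℝ} {w : ℂ} :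
    (1 / w - (starRingEnd ℂ) w / (R : ℂ) ^ 2).re = w.re * (1 / ‖w‖ ^ 2 - 1 / R ^ 2) := by
  rw [Complex.sub_re, one_div, Complex.inv_re, ← Complex.normSq_eq_norm_sq,
    ← Complex.ofReal_pow, Complex.div_ofReal_re, Complex.conj_re]
  ring

/-- Removing the zeros of an analytic function in a disc by canonical factors. -/
lemma exists_canonical_factorization {f : ℂ → ℂ} {R : ℝ} (hR : 0 < R)
    (hf : AnalyticOnNhd ℂ f (Metric.closedBall 0 R)) (hf0 : f 0 ≠ 0) :
    ∃ (S : Finset ℂ) (D : ℂ → ℤ) (g : ℂ → ℂ), (∀ u ∈ S, u ∈ Metric.ball (0 : ℂ) R ∧ f u = 0) ∧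
      (∀ u ∈ Metric.ball (0 : ℂ) R, f u = 0 → u ∈ S) ∧ (∀ u ∈ S, 1 ≤ D u) ∧
      AnalyticOnNhd ℂ g (Metric.closedBall 0 R) ∧ (∀ z ∈ Metric.ball (0 : ℂ) R, g z ≠ 0) ∧
      ∀ z ∈ Metric.closedBall (0 : ℂ) R, z ∉ S →
        g z = f z * ∏ u ∈ S, Complex.canonicalFactor R u z ^ D u := by
  have hball : Metric.ball (0 : ℂ) R ⊆ Metric.closedBall 0 R := Metric.ball_subset_closedBall
  have h0 : (0 : ℂ) ∈ Metric.closedBall (0 : ℂ) R := Metric.mem_closedBall_self hR.le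
  have hmer : MeromorphicOn f (Metric.closedBall 0 R) := hf.meromorphicOn
  have hord : ∀ u : Metric.closedBall (0 : ℂ) R, meromorphicOrderAt f u ≠ ⊤ := by
    apply (hmer.exists_meromorphicOrderAt_ne_top_iff_forall
      (Metric.isConnected_closedBall hR.le)).mp
    refine ⟨⟨0, h0⟩, ?_⟩
    rw [((hf 0 h0).meromorphicNFAt.meromorphicOrderAt_eq_zero_iff).mpr hf0]
    exact WithTop.zero_ne_top
  obtain ⟨g, hg⟩ := hmer.exists_canonicalDecomp hord
  set D := MeromorphicOn.divisor f (Metric.ball 0 R) with hD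
  have hDfin : D.support.Finite := hmer.divisor_ball_support_finite
  have hmem : ∀ u, D u ≠ 0 → u ∈ Metric.ball (0 : ℂ) R ∧ f u = 0 := by
    intro u hu
    have hub : u ∈ Metric.ball (0 : ℂ) R := by
      by_contra h
      exact hu (Function.locallyFinsuppWithin.apply_eq_zero_of_notMem _ h)
    refine ⟨hub, ?_⟩
    by_contra h
    apply hu
    rw [hD, MeromorphicOn.divisor_apply (hmer.mono_set hball) hub,
      ((hf u (hball hub)).meromorphicNFAt.meromorphicOrderAt_eq_zero_iff).mpr h]
    simp
  have hpos : ∀ u ∈ Metric.ball (0 : ℂ) R, f u = 0 → 1 ≤ D u := by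
    intro u hub hu
    have h1 : 0 ≤ D u := (MeromorphicOn.AnalyticOnNhd.divisor_nonneg (hf.mono hball)) u
    have h2 : D u ≠ 0 := by
      rw [hD, MeromorphicOn.divisor_apply (hmer.mono_set hball) hub]
      intro h
      rcases WithTop.untop₀_eq_zero.mp h with h | h
      · exact ((hf u (hball hub)).meromorphicNFAt.meromorphicOrderAt_eq_zero_iff).mp h hu
      · exact hord ⟨u, hball hub⟩ h
    omega
  have hgan : AnalyticOnNhd ℂ g (Metric.closedBall 0 R) := by
    intro z hz
    rw [← (hg.meromorphicNFOn hz).meromorphicOrderAt_nonneg_iff_analyticAt]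
    have h1 := hg.divisor_eq_divisor hR (x := z)
    rw [MeromorphicOn.divisor_apply hg.meromorphicNFOn.meromorphicOn hz] at h1
    have h2 : 0 ≤ MeromorphicOn.divisor f (Metric.sphere 0 R) z :=
      (MeromorphicOn.AnalyticOnNhd.divisor_nonneg (hf.mono Metric.sphere_subset_closedBall)) z
    rw [← h1] at h2
    exact WithTop.untop₀_nonneg.mp h2
  set S := hDfin.toFinset with hS
  have hSmem : ∀ u, u ∈ S ↔ D u ≠ 0 := fun u => by simp [hS]
  refine ⟨S, D, g, fun u hu => hmem u ((hSmem u).mp hu),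
    fun u hu hfu => (hSmem u).mpr (by have := hpos u hu hfu; omega),
    fun u hu => hpos u (hmem u ((hSmem u).mp hu)).1 (hmem u ((hSmem u).mp hu)).2, hgan,
    hg.ne_zero, ?_⟩
  intro z hz hzS
  have hprod : (∏ᶠ u, (Complex.canonicalFactor R u) ^ (-D u)) =
      ∏ u ∈ S, (Complex.canonicalFactor R u) ^ (-D u) := by
    apply finprod_eq_prod_of_mulSupport_subset
    intro u hu
    rw [mem_coe, hSmem]
    intro h
    simp [h] at hu
  have heq := hg.eventuallyEq
  rw [← hD, hprod] at heq
  have hF : nhdsWithin z (Metric.closedBall 0 R \ {z}) ≤ nhdsWithin z {z}ᶜ :=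
    nhdsWithin_mono _ fun x hx => hx.2
  have hF' : nhdsWithin z (Metric.closedBall 0 R \ {z}) ≤ nhds z := nhdsWithin_le_nhds
  have hev : ∀ᶠ x in nhdsWithin z (Metric.closedBall 0 R \ {z}),
      g x = f x * ∏ u ∈ S, Complex.canonicalFactor R u x ^ D u := by
    have h1 := (mem_codiscreteWithin_iff_forall_mem_nhdsNE.mp heq) z hz
    have h2 : ∀ᶠ x in nhds z, x ∉ S :=
      (S.finite_toSet.isClosed.isOpen_compl).mem_nhds (by simpa using hzS)
    filter_upwards [hF h1, hF' h2, self_mem_nhdsWithin] with x hx1 hx2 hx3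
    have hx4 : f x = (∏ u ∈ S, Complex.canonicalFactor R u x ^ (-D u)) * g x := by
      rcases hx1 with h | h
      · simpa [Finset.prod_apply] using h
      · exact absurd hx3.1 h
    have hne : ∀ u ∈ S, Complex.canonicalFactor R u x ≠ 0 := fun u hu =>
      Complex.canonicalFactor_ne_zero (hmem u ((hSmem u).mp hu)).1 hx3.1
        (fun h => hx2 (h ▸ hu))
    rw [hx4, mul_right_comm, ← prod_mul_distrib, prod_eq_one, one_mul]
    intro u hu
    rw [zpow_neg, inv_mul_cancel₀ (zpow_ne_zero _ (hne u hu))]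
  have hcont : ContinuousAt (fun x => f x * ∏ u ∈ S, Complex.canonicalFactor R u x ^ D u) z := by
    refine (hf z hz).continuousAt.mul (tendsto_finsetProd _ fun u hu => ?_)
    have hzu : z ≠ u := fun h => hzS (h ▸ hu)
    refine ContinuousAt.zpow₀ (Complex.analyticOnNhd_canonicalFactor R u z hzu).continuousAt _
      (Or.inl (Complex.canonicalFactor_ne_zero (hmem u ((hSmem u).mp hu)).1 hz hzu))
  have hne : (nhdsWithin z (Metric.closedBall 0 R \ {z})).NeBot := by
    rw [← mem_closure_iff_nhdsWithin_neBot]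
    have h1 : z ∈ closure (Metric.ball (0 : ℂ) R \ {z}) := by
      have h2 : Metric.ball (0 : ℂ) R ⊆ closure (Metric.ball (0 : ℂ) R \ {z}) := by
        exact fun x hx => by
          rw [Set.sdiff_eq]
          exact (dense_compl_singleton z).open_subset_closure_inter Metric.isOpen_ball hx
      have h3 := closure_minimal h2 isClosed_closure
      rw [closure_ball _ hR.ne'] at h3
      exact h3 hz
    exact closure_mono (Set.sdiff_subset_sdiff_left hball) h1
  refine tendsto_nhds_unique_of_eventuallyEq ((hgan z hz).continuousAt.mono_left hF')
    (hcont.tendsto.mono_left hF') hev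

/-- **Landau's lemma**: a lower bound for the real part of a logarithmic derivative at the centre of
a disc, all zeros lying in the left half. -/
lemma neg_re_logDeriv_le {f : ℂ → ℂ} {R M : ℝ} (hR : 0 < R) (hM : 0 < M)
    (hf : AnalyticOnNhd ℂ f (Metric.closedBall 0 R)) (hf0 : f 0 ≠ 0)
    (hfM : ∀ z ∈ Metric.closedBall (0 : ℂ) R, ‖f z‖ ≤ Real.exp M * ‖f 0‖)
    (hre : ∀ z ∈ Metric.ball (0 : ℂ) R, f z = 0 → z.re ≤ 0) :
    -(logDeriv f 0).re ≤ 4 * M / R ∧ ∀ ρ ∈ Metric.ball (0 : ℂ) R, f ρ = 0 →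
      -(logDeriv f 0).re ≤ 4 * M / R + ρ.re * (1 / ‖ρ‖ ^ 2 - 1 / R ^ 2) := by
  obtain ⟨S, D, g, hS, hS', hD, hg, hg0, hfg⟩ := exists_canonical_factorization hR hf hf0
  have hball : Metric.ball (0 : ℂ) R ⊆ Metric.closedBall 0 R := Metric.ball_subset_closedBall
  have h0 : (0 : ℂ) ∈ Metric.ball (0 : ℂ) R := Metric.mem_ball_self hR
  have h0S : (0 : ℂ) ∉ S := fun h => hf0 (hS 0 h).2
  have hSne : ∀ u ∈ S, u ≠ 0 := fun u hu h => h0S (h ▸ hu)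
  have hfg0 : ‖f 0‖ ≤ ‖g 0‖ := by
    rw [hfg 0 (hball h0) h0S, norm_mul, norm_prod]
    refine le_mul_of_one_le_right (norm_nonneg _) ?_
    refine Finset.one_le_prod fun u hu => ?_
    rw [norm_zpow]
    refine one_le_zpow₀ ?_ (by have := hD u hu; omega)
    have h1 : 0 < ‖u‖ := norm_pos_iff.mpr (hSne u hu)
    have h2 := mem_ball_zero_iff.mp (hS u hu).1
    rw [Complex.canonicalFactor_apply, mul_zero, sub_zero, zero_sub, norm_div, norm_pow, norm_mul,
      norm_neg, Complex.norm_real, Real.norm_of_nonneg hR.le, one_le_div (by positivity)]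
    nlinarith
  have hgM : ∀ z ∈ Metric.ball (0 : ℂ) R, ‖g z‖ ≤ Real.exp M * ‖g 0‖ := by
    intro z hz
    refine Complex.norm_le_of_forall_mem_frontier_norm_le Metric.isBounded_ball
      (f := g) (U := Metric.ball 0 R) ?_ ?_ (subset_closure hz)
    · refine ⟨(hg.mono hball).differentiableOn, ?_⟩
      rw [closure_ball _ hR.ne']
      exact hg.continuousOn
    · intro w hw
      rw [frontier_ball _ hR.ne'] at hw
      have hw' : w ∈ Metric.closedBall (0 : ℂ) R := Metric.sphere_subset_closedBall hw
      have hwS : w ∉ S := fun h => by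
        have h1 := mem_ball_zero_iff.mp (hS w h).1
        have h2 := mem_sphere_zero_iff_norm.mp hw
        linarith
      rw [hfg w hw' hwS, norm_mul, norm_prod, prod_eq_one, mul_one]
      · exact (hfM w hw').trans (by gcongr)
      · intro u hu
        rw [norm_zpow, Complex.norm_canonicalFactor_eval_circle_eq_one (hS u hu).1 hw, one_zpow]
  have hlg := norm_logDeriv_le hR hM (hg.mono hball).differentiableOn hg0 hgM
  have hcd : ∀ u ∈ S, DifferentiableAt ℂ (Complex.canonicalFactor R u) 0 := fun u hu =>
    (Complex.analyticOnNhd_canonicalFactor R u 0 (hSne u hu).symm).differentiableAt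
  have hcne : ∀ u ∈ S, Complex.canonicalFactor R u 0 ≠ 0 := fun u hu =>
    Complex.canonicalFactor_ne_zero (hS u hu).1 (hball h0) (hSne u hu).symm
  have hlog : logDeriv g 0 = logDeriv f 0 +
      ∑ u ∈ S, (D u : ℂ) * (1 / u - (starRingEnd ℂ) u / R ^ 2) := by
    have h1 : logDeriv g 0 =
        logDeriv (fun z => f z * ∏ u ∈ S, Complex.canonicalFactor R u z ^ D u) 0 := by
      refine (logDeriv_congr_nhds ?_).eq_of_nhds
      have h2 : ∀ᶠ x in nhds (0 : ℂ), x ∉ S :=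
        (S.finite_toSet.isClosed.isOpen_compl).mem_nhds (by simpa using h0S)
      filter_upwards [h2, Metric.ball_mem_nhds _ hR] with z hz hz2 using hfg z (hball hz2) hz
    rw [h1, logDeriv_mul _ hf0 (prod_ne_zero_iff.mpr fun u hu => zpow_ne_zero _ (hcne u hu))
      (hf 0 (hball h0)).differentiableAt
      (DifferentiableAt.fun_finsetProd fun u hu => (hcd u hu).zpow (Or.inl (hcne u hu))),
      logDeriv_prod (f := fun u z => Complex.canonicalFactor R u z ^ D u)
        (fun u hu => zpow_ne_zero _ (hcne u hu))
        (fun u hu => (hcd u hu).zpow (Or.inl (hcne u hu)))]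
    congr 1
    refine sum_congr rfl fun u hu => ?_
    rw [logDeriv_fun_zpow (hcd u hu), logDeriv_canonicalFactor_zero hR (hSne u hu)]
  have hre' : -(logDeriv f 0).re = -(logDeriv g 0).re +
      ∑ u ∈ S, (D u : ℝ) * (u.re * (1 / ‖u‖ ^ 2 - 1 / R ^ 2)) := by
    rw [hlog, Complex.add_re, Complex.re_sum]
    have : ∀ u ∈ S, ((D u : ℂ) * (1 / u - (starRingEnd ℂ) u / (R : ℂ) ^ 2)).re =
        (D u : ℝ) * (u.re * (1 / ‖u‖ ^ 2 - 1 / R ^ 2)) := fun u hu => by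
      rw [← Complex.ofReal_intCast, Complex.re_ofReal_mul, re_one_div_sub_conj_div]
    rw [sum_congr rfl this]
    ring
  have hterm : ∀ u ∈ S, u.re * (1 / ‖u‖ ^ 2 - 1 / R ^ 2) ≤ 0 := by
    intro u hu
    have h1 : 0 < ‖u‖ := norm_pos_iff.mpr (hSne u hu)
    have h2 := mem_ball_zero_iff.mp (hS u hu).1
    refine mul_nonpos_of_nonpos_of_nonneg (hre u (hS u hu).1 (hS u hu).2) ?_
    rw [sub_nonneg]
    gcongr
  have hDterm : ∀ u ∈ S, (D u : ℝ) * (u.re * (1 / ‖u‖ ^ 2 - 1 / R ^ 2)) ≤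
      u.re * (1 / ‖u‖ ^ 2 - 1 / R ^ 2) := fun u hu => by
    have h1 : (1 : ℝ) ≤ D u := by exact_mod_cast hD u hu
    nlinarith [hterm u hu]
  have hglog : -(logDeriv g 0).re ≤ 4 * M / R :=
    (neg_le_abs _).trans ((Complex.abs_re_le_norm _).trans hlg)
  rw [hre']
  refine ⟨?_, fun ρ hρ hfρ => ?_⟩
  · have := sum_nonpos fun u hu => (hDterm u hu).trans (hterm u hu)
    linarith
  · have hρS := hS' ρ hρ hfρ
    rw [← add_sum_erase _ _ hρS]
    have h1 := sum_nonpos fun u hu => (hDterm u (mem_of_mem_erase (a := ρ) hu)).trans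
      (hterm u (mem_of_mem_erase hu))
    linarith [hDterm ρ hρS]

lemma norm_LSeries_le_zeta {f : ℕ → ℂ} (hf : ∀ n, ‖f n‖ ≤ 1) {s : ℂ} (hs : 1 < s.re) :
    ‖LSeries f s‖ ≤ ‖riemannZeta s.re‖ := by
  have hsum := Real.summable_one_div_nat_rpow.mpr hs
  have h1 : riemannZeta s.re = ((∑' n : ℕ, 1 / (n : ℝ) ^ s.re : ℝ) : ℂ) := by
    rw [zeta_eq_tsum_one_div_nat_cpow (by simpa using hs), Complex.ofReal_tsum]
    congr 1 with n
    push_cast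
    rw [Complex.ofReal_cpow n.cast_nonneg]
    simp
  rw [h1, Complex.norm_real]
  refine le_trans ?_ (le_abs_self _)
  refine tsum_of_norm_bounded hsum.hasSum fun n => ?_
  rw [LSeries.norm_term_eq]
  split_ifs with h
  · positivity
  · gcongr
    exact hf n

lemma norm_inv_riemannZeta_le {s : ℂ} (hs : 1 < s.re) :
    ‖(riemannZeta s)⁻¹‖ ≤ ‖riemannZeta s.re‖ := by
  have h := ArithmeticFunction.LSeries_zeta_mul_Lseries_moebius hs
  rw [ArithmeticFunction.LSeries_zeta_eq_riemannZeta hs] at h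
  rw [inv_eq_of_mul_eq_one_right h]
  refine norm_LSeries_le_zeta (fun n => ?_) hs
  rw [Complex.norm_intCast]
  exact_mod_cast ArithmeticFunction.abs_moebius_le_one

lemma riemannZeta₁_ne_zero {s : ℂ} (hs : 1 ≤ s.re) : riemannZeta₁ s ≠ 0 := by
  by_cases h : s = 1
  · rw [h, riemannZeta₁_one]; exact one_ne_zero
  · have h1 := riemannZeta_ne_zero_of_one_le_re hs
    rw [riemannZeta_eq_inv_sub_mul h] at h1
    exact right_ne_zero_of_mul h1

lemma logDeriv_riemannZeta {s : ℂ} (hs : s ≠ 1) (h0 : riemannZeta₁ s ≠ 0) :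
    logDeriv riemannZeta s = -(s - 1)⁻¹ + logDeriv riemannZeta₁ s := by
  have h1 : logDeriv riemannZeta s = logDeriv (fun z => (z - 1)⁻¹ * riemannZeta₁ z) s := by
    refine (logDeriv_congr_nhds ?_).eq_of_nhds
    filter_upwards [isOpen_ne.mem_nhds hs] with z hz using riemannZeta_eq_inv_sub_mul hz
  have hs' : s - 1 ≠ 0 := sub_ne_zero.mpr hs
  have h2 : HasDerivAt (fun z : ℂ => (z - 1)⁻¹) (-1 / (s - 1) ^ 2) s :=
    ((hasDerivAt_id s).sub_const 1).fun_inv hs'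
  rw [h1, logDeriv_mul (f := fun z : ℂ => (z - 1)⁻¹) s (inv_ne_zero hs') h0 h2.differentiableAt
    (differentiable_riemannZeta₁ s), logDeriv_apply (fun z : ℂ => (z - 1)⁻¹), h2.deriv]
  congr 1
  field_simp

/-- Behaviour of `ζ` and its logarithmic derivative to the right of the pole. -/
lemma exists_riemannZeta_near_one : ∃ C : ℝ, 1 ≤ C ∧ ∀ δ : ℝ, 0 < δ → δ ≤ 1 →
    ‖riemannZeta (1 + δ : ℝ)‖ ≤ C / δ ∧ -(logDeriv riemannZeta (1 + δ : ℝ)).re ≤ 1 / δ + C := by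
  have hcomp : IsCompact (Set.Icc (0 : ℝ) 1) := isCompact_Icc
  have hc1 : Continuous fun δ : ℝ => riemannZeta₁ (1 + δ : ℝ) :=
    differentiable_riemannZeta₁.continuous.comp (by fun_prop)
  have hc2 : ContinuousOn (fun δ : ℝ => logDeriv riemannZeta₁ (1 + δ : ℝ)) (Set.Icc 0 1) := by
    have hd : Continuous (deriv riemannZeta₁) :=
      differentiable_riemannZeta₁.contDiff.continuous_deriv (n := ⊤) (by simp)
    refine ContinuousOn.div (hd.comp (by fun_prop)).continuousOn hc1.continuousOn fun x hx => ?_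
    exact riemannZeta₁_ne_zero (by simpa using hx.1)
  obtain ⟨C1, h1⟩ := hcomp.exists_bound_of_continuousOn hc1.continuousOn
  obtain ⟨C2, h2⟩ := hcomp.exists_bound_of_continuousOn hc2
  refine ⟨max 1 (max C1 C2), le_max_left _ _, fun δ h0 h3 => ?_⟩
  have hmem : δ ∈ Set.Icc (0 : ℝ) 1 := ⟨h0.le, h3⟩
  have hne : ((1 + δ : ℝ) : ℂ) ≠ 1 := by
    intro h
    have : (1 + δ : ℝ) = 1 := by exact_mod_cast h
    linarith
  have hsub : ((1 + δ : ℝ) : ℂ) - 1 = (δ : ℂ) := by push_cast; ring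
  constructor
  · rw [riemannZeta_eq_inv_sub_mul hne, norm_mul, hsub, norm_inv, Complex.norm_real,
      Real.norm_of_nonneg h0.le, inv_mul_eq_div]
    gcongr
    exact (h1 δ hmem).trans ((le_max_left _ _).trans (le_max_right _ _))
  · rw [logDeriv_riemannZeta hne (riemannZeta₁_ne_zero (by simpa using h0.le)), hsub,
      Complex.add_re, Complex.neg_re, ← Complex.ofReal_inv, Complex.ofReal_re]
    have h4 := (neg_le_abs _).trans ((Complex.abs_re_le_norm _).trans (h2 δ hmem))
    have h5 : C2 ≤ max 1 (max C1 C2) := (le_max_right _ _).trans (le_max_right _ _)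
    rw [one_div]
    linarith

lemma re_term_vonMangoldt (σ γ : ℝ) (n : ℕ) :
    (LSeries.term (fun n => (ArithmeticFunction.vonMangoldt n : ℂ)) (σ + γ * Complex.I) n).re =
      ArithmeticFunction.vonMangoldt n * (n : ℝ) ^ (-σ) * Real.cos (γ * Real.log n) := by
  rcases Nat.eq_zero_or_pos n with rfl | hn
  · simp
  rw [LSeries.term_of_ne_zero hn.ne', div_eq_mul_inv, ← Complex.cpow_neg,
    natCast_cpow_neg_eq hn, ← mul_assoc, ← Complex.ofReal_mul, Complex.re_ofReal_mul]
  congr 1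
  · simp
  · rw [osc, Complex.exp_ofReal_mul_I_re]
    simp

/-- The classical `3-4-1` inequality. -/
lemma three_four_one (δ γ : ℝ) (hδ : 0 < δ) :
    0 ≤ 3 * -(logDeriv riemannZeta (1 + δ : ℝ)).re +
      4 * -(logDeriv riemannZeta ((1 + δ : ℝ) + γ * Complex.I)).re +
      -(logDeriv riemannZeta ((1 + δ : ℝ) + (2 * γ : ℝ) * Complex.I)).re := by
  have hval : ∀ y : ℝ, HasSum (fun n : ℕ => ArithmeticFunction.vonMangoldt n *
      (n : ℝ) ^ (-(1 + δ)) * Real.cos (y * Real.log n))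
      (-(logDeriv riemannZeta ((1 + δ : ℝ) + y * Complex.I)).re) := by
    intro y
    have hs : 1 < ((1 + δ : ℝ) + y * Complex.I : ℂ).re := by simpa using hδ
    have h1 := (ArithmeticFunction.LSeriesSummable_vonMangoldt hs).hasSum
    have h2 := ArithmeticFunction.LSeries_vonMangoldt_eq_deriv_riemannZeta_div hs
    rw [LSeries] at h2
    rw [h2] at h1
    have h3 := Complex.hasSum_re h1
    simp only [re_term_vonMangoldt] at h3
    rwa [neg_div, Complex.neg_re] at h3
  have h0 := hval 0
  have h1 := hval γ
  have h2 := hval (2 * γ)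
  simp only [Complex.ofReal_zero, zero_mul, add_zero] at h0
  refine ((h0.mul_left 3).add (h1.mul_left 4)).add h2 |>.nonneg fun n => ?_
  set a := ArithmeticFunction.vonMangoldt n * (n : ℝ) ^ (-(1 + δ)) with ha
  have ha0 : 0 ≤ a := mul_nonneg ArithmeticFunction.vonMangoldt_nonneg (by positivity)
  rw [Real.cos_zero, show 2 * γ * Real.log n = 2 * (γ * Real.log n) by ring, Real.cos_two_mul]
  have : 0 ≤ 2 * a * (1 + Real.cos (γ * Real.log n)) ^ 2 := by positivity
  linarith

/-- The width of the Vinogradov-Korobov zero-free region at height `exp L`. -/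
noncomputable def vkWidth (L : ℝ) : ℝ := L ^ (-(2 / 3) : ℝ) * Real.log L ^ (-(1 / 3) : ℝ)

lemma one_le_log {L : ℝ} (hL : Real.exp 1 ≤ L) : 1 ≤ Real.log L := by
  rwa [Real.le_log_iff_exp_le ((Real.exp_pos 1).trans_le hL)]

lemma two_le_of_exp_one_le {L : ℝ} (hL : Real.exp 1 ≤ L) : 2 ≤ L := by
  linarith [Real.exp_one_gt_d9]

lemma vkWidth_pos {L : ℝ} (hL : Real.exp 1 ≤ L) : 0 < vkWidth L := by
  have h1 := one_le_log hL
  have h2 := two_le_of_exp_one_le hL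
  rw [vkWidth]
  positivity

lemma log_div_rpow_eq {L : ℝ} (hL : Real.exp 1 ≤ L) :
    (Real.log L / L) ^ (2 / 3 : ℝ) = vkWidth L * Real.log L := by
  have h1 := one_le_log hL
  have h2 := two_le_of_exp_one_le hL
  rw [vkWidth, mul_assoc, ← Real.rpow_add_one (by linarith), Real.div_rpow (by linarith)
    (by linarith), Real.rpow_neg (by linarith)]
  norm_num
  rw [div_eq_inv_mul]

lemma vkWidth_mul_log_le_one {L : ℝ} (hL : Real.exp 1 ≤ L) : vkWidth L * Real.log L ≤ 1 := by
  have h1 := one_le_log hL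
  have h2 := two_le_of_exp_one_le hL
  rw [← log_div_rpow_eq hL]
  refine Real.rpow_le_one (by positivity) ?_ (by norm_num)
  rw [div_le_one (by linarith)]
  exact Real.log_le_self (by linarith)

lemma vkWidth_le_one {L : ℝ} (hL : Real.exp 1 ≤ L) : vkWidth L ≤ 1 := by
  nlinarith [vkWidth_mul_log_le_one hL, one_le_log hL, vkWidth_pos hL]

lemma neg_log_vkWidth_le {L : ℝ} (hL : Real.exp 1 ≤ L) : -Real.log (vkWidth L) ≤ Real.log L := by
  have h1 := one_le_log hL
  have h2 := two_le_of_exp_one_le hL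
  rw [vkWidth, Real.log_mul (by positivity) (by positivity), Real.log_rpow (by linarith),
    Real.log_rpow (by linarith)]
  have := Real.log_le_sub_one_of_pos (show 0 < Real.log L by linarith)
  linarith

lemma exists_norm_riemannZeta_le_exp : ∃ K : ℝ, 0 < K ∧ ∀ L : ℝ, Real.exp 1 ≤ L → ∀ s : ℂ,
    16 ≤ |s.im| → Real.log |s.im| ≤ 2 * L → 1 - vkWidth L * Real.log L / 2 ≤ s.re → s.re ≤ 2 →
    ‖riemannZeta s‖ ≤ Real.exp (K * Real.log L) := by
  obtain ⟨K, hK, hz⟩ := exists_norm_riemannZeta_le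
  refine ⟨3 * K, by positivity, fun L hL s hs hsL hre hre2 => ?_⟩
  have h1 := one_le_log hL
  have h2 := two_le_of_exp_one_le hL
  set v := Real.log |s.im| with hv
  have hv1 : Real.exp 1 ≤ v := by
    have h3 : Real.log 16 ≤ v := Real.log_le_log (by norm_num) hs
    have h4 : Real.log 16 = 4 * Real.log 2 := by
      rw [show (16 : ℝ) = 2 ^ 4 by norm_num, Real.log_pow]; norm_num
    have := Real.log_two_gt_d9
    have := Real.exp_one_lt_d9
    linarith
  have hw := vkWidth_mul_log_le_one hL
  have hcmp : vkWidth L * Real.log L / 2 ≤ (Real.log v / v) ^ (2 / 3 : ℝ) := by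
    have h3 : Real.log (2 * L) / (2 * L) ≤ Real.log v / v :=
      Real.log_div_self_antitoneOn (Set.mem_Ici.mpr hv1) (Set.mem_Ici.mpr (hv1.trans hsL)) hsL
    have h4 : Real.log L / L / 2 ≤ Real.log v / v := by
      refine le_trans ?_ h3
      rw [div_div, mul_comm L 2]
      gcongr
      linarith
    rw [← log_div_rpow_eq hL]
    calc (Real.log L / L) ^ (2 / 3 : ℝ) / 2 ≤ (Real.log L / L) ^ (2 / 3 : ℝ) / 2 ^ (2 / 3 : ℝ) := by
          gcongr
          calc (2 : ℝ) ^ (2 / 3 : ℝ) ≤ 2 ^ (1 : ℝ) :=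
                Real.rpow_le_rpow_of_exponent_le (by norm_num) (by norm_num)
            _ = 2 := Real.rpow_one 2
      _ = (Real.log L / L / 2) ^ (2 / 3 : ℝ) := by
          exact (Real.div_rpow (by positivity) (by norm_num) _).symm
      _ ≤ _ := by gcongr
  by_cases hhalf : 1 / 2 < s.re
  · refine (hz s (by linarith) hhalf hre2 (by linarith)).trans ?_
    have hv0 : 0 < v := (Real.exp_pos 1).trans_le hv1
    calc K * v ^ K ≤ Real.exp K * (2 * L) ^ K := by
          gcongr
          linarith [Real.add_one_le_exp K]
      _ = Real.exp (K + Real.log (2 * L) * K) := by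
          rw [Real.exp_add, Real.rpow_def_of_pos (by linarith)]
      _ ≤ _ := by
          rw [Real.exp_le_exp, Real.log_mul (by norm_num) (by linarith)]
          have := Real.log_two_lt_d9
          nlinarith
  · exfalso
    have hlt : vkWidth L * Real.log L < 1 := by
      rw [← log_div_rpow_eq hL]
      refine Real.rpow_lt_one (by positivity) ?_ (by norm_num)
      rw [div_lt_one (by linarith)]
      linarith [Real.log_le_sub_one_of_pos (show 0 < L by linarith)]
    linarith

/-- Bounds for `ζ'/ζ` to the right of the line `re s = 1`. -/
lemma exists_neg_re_logDeriv_riemannZeta_le : ∃ A : ℝ, 1 ≤ A ∧ ∀ L : ℝ, Real.exp 1 ≤ L →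
    ∀ Q : ℝ, Real.exp (-Q) ≤ 1 / 8 → ∀ y : ℝ, 17 ≤ |y| → |y| + 1 ≤ Real.exp (2 * L) →
    -(logDeriv riemannZeta ((1 + Real.exp (-Q) * vkWidth L : ℝ) + y * Complex.I)).re ≤
      16 * (A + Q) / vkWidth L ∧
    ∀ β : ℝ, riemannZeta (β + y * Complex.I) = 0 →
      1 + Real.exp (-Q) * vkWidth L - β < vkWidth L * Real.log L / 4 →
      -(logDeriv riemannZeta ((1 + Real.exp (-Q) * vkWidth L : ℝ) + y * Complex.I)).re ≤
      20 * (A + Q) / vkWidth L - 1 / (1 + Real.exp (-Q) * vkWidth L - β) := by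
  obtain ⟨K, hK, hz⟩ := exists_norm_riemannZeta_le_exp
  obtain ⟨C, hC, hC1⟩ := exists_riemannZeta_near_one
  refine ⟨K + C + 1, by linarith, fun L hL Q hQ y hy hyL => ?_⟩
  have h1 := one_le_log hL
  have h2 := two_le_of_exp_one_le hL
  set w := vkWidth L with hw
  set l := Real.log L with hl
  have hw0 : 0 < w := vkWidth_pos hL
  have hwl : w * l ≤ 1 := vkWidth_mul_log_le_one hL
  have hw1 : w ≤ 1 := vkWidth_le_one hL
  set q := Real.exp (-Q) with hq
  have hq0 : 0 < q := Real.exp_pos _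
  have hQ0 : 0 < Q := by
    by_contra h
    have : 1 ≤ q := Real.one_le_exp (by linarith)
    linarith
  set δ := q * w with hδ
  have hδ0 : 0 < δ := by positivity
  set R := w * l / 4 with hR
  have hR0 : 0 < R := by positivity
  have hδR : δ ≤ R / 2 := by rw [hδ, hR]; nlinarith
  have hR4 : R ≤ 1 / 4 := by rw [hR]; linarith
  set s₀ : ℂ := (1 + δ : ℝ) + y * Complex.I with hs₀
  have hs₀re : s₀.re = 1 + δ := by simp [hs₀]
  have hs₀im : s₀.im = y := by simp [hs₀]
  set M := (K + C + 1 + Q) * l with hM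
  have hM0 : 0 < M := by positivity
  have hregion : ∀ z ∈ Metric.closedBall (0 : ℂ) R, 16 ≤ |(s₀ + z).im| ∧
      |(s₀ + z).im| ≤ |y| + 1 ∧ 1 - w * l / 2 ≤ (s₀ + z).re ∧ (s₀ + z).re ≤ 2 := by
    intro z hz
    rw [mem_closedBall_zero_iff] at hz
    have h3 := (Complex.abs_im_le_norm z).trans hz
    have h4 := abs_le.mp ((Complex.abs_re_le_norm z).trans hz)
    rw [Complex.add_im, Complex.add_re, hs₀re, hs₀im]
    have h5 := abs_sub_abs_le_abs_sub y (-z.im)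
    have h6 := abs_add_le y z.im
    rw [abs_neg, sub_neg_eq_add] at h5
    refine ⟨by linarith, by linarith, by linarith, by linarith⟩
  have hne1 : ∀ z ∈ Metric.closedBall (0 : ℂ) R, s₀ + z ≠ 1 := by
    intro z hz h
    have := (hregion z hz).1
    rw [h] at this
    norm_num at this
  set f : ℂ → ℂ := fun z => riemannZeta (s₀ + z) with hf
  have hfan : AnalyticOnNhd ℂ f (Metric.closedBall 0 R) := by
    have hopen : IsOpen {z : ℂ | s₀ + z ≠ 1} := isOpen_ne_fun (by fun_prop) (by fun_prop)
    have hd : DifferentiableOn ℂ f {z : ℂ | s₀ + z ≠ 1} := fun z hz =>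
      ((differentiableAt_riemannZeta hz).comp z (by fun_prop)).differentiableWithinAt
    exact (hd.analyticOnNhd hopen).mono fun z hz => hne1 z hz
  have hs1 : 1 < s₀.re := by rw [hs₀re]; linarith
  have hfzero : f 0 = riemannZeta s₀ := by simp [hf]
  have hf0 : f 0 ≠ 0 := by
    rw [hfzero]
    exact riemannZeta_ne_zero_of_one_le_re hs1.le
  have hlow : 1 ≤ C / δ * ‖f 0‖ := by
    have h3 := norm_inv_riemannZeta_le hs1
    rw [hs₀re, ← hfzero, norm_inv] at h3
    have h4 := h3.trans (hC1 δ hδ0 (by linarith)).1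
    rwa [inv_le_iff_one_le_mul₀ (norm_pos_iff.mpr hf0)] at h4
  have hfM : ∀ z ∈ Metric.closedBall (0 : ℂ) R, ‖f z‖ ≤ Real.exp M * ‖f 0‖ := by
    intro z hzR
    obtain ⟨r1, r2, r3, r4⟩ := hregion z hzR
    have h3 := hz L hL (s₀ + z) r1 ((Real.log_le_iff_le_exp (by linarith)).mpr (r2.trans hyL)) r3 r4
    have h4 : C / δ ≤ Real.exp ((C + 1 + Q) * l) := by
      rw [← Real.log_le_iff_le_exp (by positivity), Real.log_div (by positivity) hδ0.ne', hδ,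
        Real.log_mul hq0.ne' hw0.ne', hq, Real.log_exp]
      have := neg_log_vkWidth_le hL
      have := Real.log_le_sub_one_of_pos (show 0 < C by linarith)
      nlinarith
    calc ‖f z‖ ≤ Real.exp (K * l) * 1 := by rw [mul_one]; exact h3
      _ ≤ Real.exp (K * l) * (C / δ * ‖f 0‖) := by gcongr
      _ ≤ Real.exp (K * l) * (Real.exp ((C + 1 + Q) * l) * ‖f 0‖) := by gcongr
      _ = _ := by rw [← mul_assoc, ← Real.exp_add, hM]; ring_nf
  have hre : ∀ z ∈ Metric.ball (0 : ℂ) R, f z = 0 → z.re ≤ 0 := by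
    intro z hz hfz
    by_contra h
    refine riemannZeta_ne_zero_of_one_le_re (s := s₀ + z) ?_ hfz
    rw [Complex.add_re, hs₀re]
    linarith
  have hlog : logDeriv f 0 = logDeriv riemannZeta s₀ := by
    have h3 : HasDerivAt f (deriv riemannZeta s₀) 0 := by
      have h4 : HasDerivAt riemannZeta (deriv riemannZeta s₀) (s₀ + 0) := by
        rw [add_zero]
        refine (differentiableAt_riemannZeta ?_).hasDerivAt
        simpa using hne1 0 (Metric.mem_closedBall_self hR0.le)
      exact h4.comp_const_add s₀ 0
    rw [logDeriv_apply, logDeriv_apply, h3.deriv, hfzero]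
  obtain ⟨hA, hB⟩ := neg_re_logDeriv_le hR0 hM0 hfan hf0 hfM hre
  rw [hlog] at hA hB
  have hMR : 4 * M / R = 16 * (K + C + 1 + Q) / w := by
    rw [hM, hR]; field_simp; norm_num
  rw [hMR] at hA hB
  refine ⟨hA, fun β hβ hβR => ?_⟩
  set d := 1 + δ - β with hd
  have hβ1 : β < 1 := by
    by_contra h
    exact riemannZeta_ne_zero_of_one_le_re (by simpa using h) hβ
  have hd0 : 0 < d := by linarith
  have hρ : s₀ + (-d : ℝ) = β + y * Complex.I := by
    rw [hs₀, hd]; push_cast; ring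
  have hnorm : ‖((-d : ℝ) : ℂ)‖ = d := by
    rw [Complex.norm_real, norm_neg, Real.norm_of_nonneg hd0.le]
  have h3 := hB (-d : ℝ) (by rw [mem_ball_zero_iff, hnorm]; exact hβR)
    (by simp only [hf]; rw [hρ]; exact hβ)
  rw [hnorm, Complex.ofReal_re] at h3
  refine h3.trans ?_
  have e1 : -d * (1 / d ^ 2 - 1 / R ^ 2) = d / R ^ 2 - 1 / d := by
    field_simp
    ring
  have e2 : d / R ^ 2 ≤ 4 * (K + C + 1 + Q) / w := by
    calc d / R ^ 2 ≤ R / R ^ 2 := by gcongr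
      _ = 4 / (w * l) := by rw [hR]; field_simp
      _ ≤ 4 / w := by gcongr; nlinarith
      _ ≤ _ := by gcongr; linarith
  have e3 : 20 * (K + C + 1 + Q) / w =
      16 * (K + C + 1 + Q) / w + 4 * (K + C + 1 + Q) / w := by ring
  rw [e1, e3]
  linarith

/-- The **Vinogradov-Korobov zero-free region**. -/
theorem exists_riemannZeta_zero_free : ∃ c : ℝ, 0 < c ∧ c ≤ 1 / 8 ∧ ∀ L : ℝ, Real.exp 1 ≤ L →
    ∀ ρ : ℂ, 17 ≤ |ρ.im| → |ρ.im| ≤ Real.exp L + 1 → 1 - c * vkWidth L ≤ ρ.re →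
    riemannZeta ρ ≠ 0 := by
  obtain ⟨A, hA, hz⟩ := exists_neg_re_logDeriv_riemannZeta_le
  obtain ⟨C, hC, hC1⟩ := exists_riemannZeta_near_one
  set B := A + C with hB
  set Q := 400 * B with hQ
  have hB1 : 2 ≤ B := by linarith
  have hexp : 198 * (B + Q) ≤ Real.exp Q := by
    have := Real.quadratic_le_exp_of_nonneg (show 0 ≤ Q by linarith)
    nlinarith
  set q := Real.exp (-Q) with hq
  have hq0 : 0 < q := Real.exp_pos _
  have hqB : q * (198 * (B + Q)) ≤ 1 := by
    calc q * (198 * (B + Q)) ≤ q * Real.exp Q := by gcongr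
      _ = 1 := by rw [hq, ← Real.exp_add, neg_add_cancel, Real.exp_zero]
  have hq8 : q ≤ 1 / 8 := by nlinarith
  refine ⟨q / 8, by positivity, by linarith, fun L hL ρ hρ hρL hre hzero => ?_⟩
  have h1 := one_le_log hL
  have h2 := two_le_of_exp_one_le hL
  set w := vkWidth L with hw
  have hw0 : 0 < w := vkWidth_pos hL
  have hw1 : w ≤ 1 := vkWidth_le_one hL
  set β := ρ.re with hβ
  set γ := ρ.im with hγ
  have hρeq : (β : ℂ) + γ * Complex.I = ρ := Complex.re_add_im ρ
  have hβ1 : β < 1 := by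
    by_contra h
    exact riemannZeta_ne_zero_of_one_le_re (not_lt.mp h) hzero
  have hEL : 2 * Real.exp L + 4 ≤ Real.exp (2 * L) := by
    have h3 : 5 ≤ Real.exp L := by
      have := Real.quadratic_le_exp_of_nonneg (show 0 ≤ L by linarith)
      nlinarith
    rw [two_mul L, Real.exp_add]
    nlinarith
  set δ := q * w with hδ
  have hδ0 : 0 < δ := by positivity
  set d := 1 + δ - β with hd
  have hd0 : 0 < d := by linarith
  have hdle : d ≤ 9 / 8 * (q * w) := by rw [hd, hδ]; linarith
  have hγ2 : |2 * γ| = 2 * |γ| := by rw [abs_mul, abs_of_pos (by norm_num : (0 : ℝ) < 2)]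
  have e1 := (hz L hL Q hq8 (2 * γ) (by rw [hγ2]; linarith) (by rw [hγ2]; linarith)).1
  have e2 := (hz L hL Q hq8 γ hρ (by linarith [Real.exp_pos L])).2 β (by rw [hρeq]; exact hzero)
    (by
      change d < w * Real.log L / 4
      have : q * w ≤ 1 / 8 * w := by gcongr
      nlinarith)
  have e3 := (hC1 δ hδ0 (by nlinarith)).2
  have e4 := three_four_one δ γ hδ0
  have e5 : 1 / δ = 1 / q / w := by rw [hδ, div_div]
  have e6 : 8 / 9 * (1 / q / w) ≤ 1 / d := by
    calc 8 / 9 * (1 / q / w) = 1 / (9 / 8 * (q * w)) := by field_simp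
      _ ≤ 1 / d := by gcongr
  have e7 : C ≤ C / w := by rw [le_div_iff₀ hw0]; nlinarith
  have e8 : 99 * (B + Q) / w ≤ 1 / 2 * (1 / q / w) := by
    have h3 : 99 * (B + Q) ≤ 1 / 2 * (1 / q) := by
      rw [mul_one_div, le_div_iff₀ hq0]
      linarith
    calc 99 * (B + Q) / w ≤ 1 / 2 * (1 / q) / w := by gcongr
      _ = _ := by ring
  have e9 : 16 * (A + Q) / w + 4 * (20 * (A + Q) / w) + 3 * (C / w) ≤ 99 * (B + Q) / w := by
    have : 16 * (A + Q) / w + 4 * (20 * (A + Q) / w) + 3 * (C / w) =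
      (96 * (A + Q) + 3 * C) / w := by ring
    rw [this]
    gcongr
    rw [hB]
    linarith
  have e10 : 0 < 1 / q / w := by positivity
  change _ ≤ 20 * (A + Q) / w - 1 / d at e2
  rw [← hδ] at e1 e2
  linarith

/-- The reciprocal `1 / ζ`, with the value `0` at the pole of `ζ`. -/
noncomputable def zetaRecip (s : ℂ) : ℂ := (s - 1) / riemannZeta₁ s

lemma zetaRecip_eq {s : ℂ} (hs : s ≠ 1) : zetaRecip s = (riemannZeta s)⁻¹ := by
  rw [zetaRecip, riemannZeta_eq_inv_sub_mul hs, mul_inv, inv_inv, div_eq_mul_inv]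

lemma exists_zetaRecip_bound_of_abs_im_le : ∃ c B : ℝ, 0 < c ∧ 1 ≤ B ∧ ∀ s : ℂ, |s.im| ≤ 20 →
    1 - c ≤ s.re → s.re ≤ 2 → riemannZeta₁ s ≠ 0 ∧ ‖zetaRecip s‖ ≤ B := by
  have hK : IsCompact (Set.Icc (1 : ℝ) 2 ×ℂ Set.Icc (-20 : ℝ) 20) :=
    isCompact_Icc.reProdIm isCompact_Icc
  have hU : IsOpen {s : ℂ | riemannZeta₁ s ≠ 0} :=
    isOpen_ne_fun differentiable_riemannZeta₁.continuous continuous_const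
  obtain ⟨c, hc, hsub⟩ := hK.exists_cthickening_subset_open hU
    fun s hs => riemannZeta₁_ne_zero hs.1.1
  have hcont : ContinuousOn zetaRecip (Metric.cthickening c
      (Set.Icc (1 : ℝ) 2 ×ℂ Set.Icc (-20 : ℝ) 20)) :=
    ContinuousOn.div (by fun_prop) differentiable_riemannZeta₁.continuous.continuousOn
      fun s hs => hsub hs
  obtain ⟨B, hB⟩ := (hK.cthickening (r := c)).exists_bound_of_continuousOn hcont
  refine ⟨c, max B 1, hc, le_max_right _ _, fun s him hre1 hre2 => ?_⟩
  have hmem : s ∈ Metric.cthickening c (Set.Icc (1 : ℝ) 2 ×ℂ Set.Icc (-20 : ℝ) 20) := by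
    refine Metric.mem_cthickening_of_dist_le s (max s.re 1 + s.im * Complex.I) c _ ?_ ?_
    · simp only [Complex.mem_reProdIm, Set.mem_Icc]
      simpa using ⟨hre2, abs_le.mp him⟩
    · rw [dist_eq_norm]
      have : s - (((max s.re 1 : ℝ) : ℂ) + s.im * Complex.I) = ((s.re - max s.re 1 : ℝ) : ℂ) := by
        apply Complex.ext <;> simp
      rw [this, Complex.norm_real, Real.norm_eq_abs, abs_le]
      rcases max_cases s.re 1 with h | h <;> constructor <;> linarith
  exact ⟨hsub hmem, (hB s hmem).trans (le_max_left _ _)⟩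

set_option maxHeartbeats 800000 in
/-- A lower bound for `ζ` in the Vinogradov-Korobov region. -/
theorem exists_zetaRecip_bound : ∃ c A : ℝ, 0 < c ∧ c ≤ 1 / 8 ∧ 1 ≤ A ∧ ∀ L : ℝ,
    Real.exp 1 ≤ L → ∀ s : ℂ, |s.im| ≤ Real.exp L → 1 - c * vkWidth L ≤ s.re → s.re ≤ 2 →
    riemannZeta₁ s ≠ 0 ∧ ‖zetaRecip s‖ ≤ Real.exp (A * Real.log L) := by
  obtain ⟨c₁, B, hc₁, hB, hlow⟩ := exists_zetaRecip_bound_of_abs_im_le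
  obtain ⟨c, hc, hc8, hzf⟩ := exists_riemannZeta_zero_free
  obtain ⟨K, hK, hz⟩ := exists_norm_riemannZeta_le_exp
  obtain ⟨C, hC, hC1⟩ := exists_riemannZeta_near_one
  have hlogB : 0 ≤ Real.log B := Real.log_nonneg hB
  have hlogC : 0 ≤ Real.log (4 * C / c) := by
    apply Real.log_nonneg
    rw [le_div_iff₀ hc]
    linarith
  refine ⟨min c₁ (c / 4), Real.log B + 3 * (K + 1 + Real.log (4 * C / c)) + 1,
    by positivity, (min_le_right _ _).trans (by linarith), by linarith,
    fun L hL s him hre1 hre2 => ?_⟩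
  have h1 := one_le_log hL
  have h2 := two_le_of_exp_one_le hL
  set w := vkWidth L with hw
  set l := Real.log L with hl
  have hw0 : 0 < w := vkWidth_pos hL
  have hwl : w * l ≤ 1 := vkWidth_mul_log_le_one hL
  have hw1 : w ≤ 1 := vkWidth_le_one hL
  have hre4 : 1 - c / 4 * w ≤ s.re := by
    have : min c₁ (c / 4) * w ≤ c / 4 * w := by gcongr; exact min_le_right _ _
    linarith
  set M := (K + 1 + Real.log (4 * C / c)) * l with hM
  have hCw : 4 * C / (c * w) ≤ Real.exp ((1 + Real.log (4 * C / c)) * l) := by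
    have : 4 * C / (c * w) = Real.exp (Real.log (4 * C / c) - Real.log w) := by
      rw [Real.exp_sub, Real.exp_log (by positivity), Real.exp_log hw0, div_div]
    rw [this, Real.exp_le_exp]
    have := neg_log_vkWidth_le hL
    nlinarith
  by_cases him20 : |s.im| ≤ 20
  · obtain ⟨h3, h4⟩ := hlow s him20 (by
      have : min c₁ (c / 4) * w ≤ c₁ * 1 := by gcongr; exact min_le_left _ _
      linarith) hre2
    refine ⟨h3, h4.trans ?_⟩
    rw [← Real.log_le_iff_le_exp (by linarith)]
    nlinarith
  push Not at him20
  have hs1 : s ≠ 1 := by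
    rintro rfl
    norm_num at him20
  rw [zetaRecip_eq hs1]
  by_cases hright : 1 + c / 4 * w ≤ s.re
  · have hre : 1 < s.re := by nlinarith
    refine ⟨riemannZeta₁_ne_zero hre.le, (norm_inv_riemannZeta_le hre).trans ?_⟩
    have h3 := (hC1 (s.re - 1) (by linarith) (by linarith)).1
    rw [add_sub_cancel] at h3
    refine h3.trans ?_
    calc C / (s.re - 1) ≤ C / (c / 4 * w) := by
          gcongr
          linarith
      _ = 4 * C / (c * w) := by field_simp
      _ ≤ _ := hCw.trans (Real.exp_le_exp.mpr (by nlinarith))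
  push Not at hright
  set s₁ : ℂ := (1 + c / 4 * w : ℝ) + s.im * Complex.I with hs₁
  have hs₁re : s₁.re = 1 + c / 4 * w := by simp [hs₁]
  have hs₁im : s₁.im = s.im := by simp [hs₁]
  set R := 5 / 4 * c * w with hR
  have hR0 : 0 < R := by positivity
  have hR1 : R ≤ 1 / 4 := by rw [hR]; nlinarith
  have hball : ∀ z ∈ Metric.ball (0 : ℂ) R, 19 ≤ |(s₁ + z).im| ∧ |(s₁ + z).im| ≤ Real.exp L + 1 ∧
      1 - c * w ≤ (s₁ + z).re ∧ (s₁ + z).re ≤ 2 := by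
    intro z hz
    rw [mem_ball_zero_iff] at hz
    have h3 := abs_le.mp (Complex.abs_re_le_norm z)
    have h4 := Complex.abs_im_le_norm z
    rw [Complex.add_im, Complex.add_re, hs₁re, hs₁im]
    have h5 := abs_add_le s.im z.im
    have h6 := abs_sub_abs_le_abs_sub s.im (-z.im)
    rw [abs_neg, sub_neg_eq_add] at h6
    have h7 : c * w ≤ 1 / 8 := by nlinarith
    refine ⟨by linarith, by linarith, by linarith, by linarith⟩
  have hEL : Real.exp L + 1 ≤ Real.exp (2 * L) := by
    have h3 : 2 ≤ Real.exp L := by linarith [Real.add_one_le_exp L]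
    rw [two_mul L, Real.exp_add]
    nlinarith
  have hne1 : ∀ z ∈ Metric.ball (0 : ℂ) R, s₁ + z ≠ 1 := by
    intro z hz h
    have := (hball z hz).1
    rw [h] at this
    norm_num at this
  have hnz : ∀ z ∈ Metric.ball (0 : ℂ) R, riemannZeta (s₁ + z) ≠ 0 := by
    intro z hz
    obtain ⟨h3, h4, h5, -⟩ := hball z hz
    exact hzf L hL _ (by linarith) h4 h5
  have hlow1 : (4 * C / (c * w))⁻¹ ≤ ‖riemannZeta s₁‖ := by
    have hre : 1 < s₁.re := by rw [hs₁re]; linarith [show 0 < c / 4 * w by positivity]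
    have h3 := norm_inv_riemannZeta_le hre
    rw [hs₁re] at h3
    have h4 := h3.trans (hC1 (c / 4 * w) (by positivity) (by nlinarith)).1
    rw [norm_inv] at h4
    rw [inv_le_comm₀ (by positivity) (norm_pos_iff.mpr (riemannZeta_ne_zero_of_one_le_re hre.le))]
    refine h4.trans (le_of_eq ?_)
    field_simp
  have hlow2 : Real.exp (-((1 + Real.log (4 * C / c)) * l)) ≤ ‖riemannZeta s₁‖ := by
    refine le_trans ?_ hlow1
    rw [Real.exp_neg]
    gcongr
  have hM0 : 0 < M := by positivity
  obtain ⟨h, -, -, hh2, hh3⟩ := exists_eq_mul_exp_le (g := fun z => riemannZeta (s₁ + z)) (M := M)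
    hR0 hM0 (fun z hz => by
      have := (differentiableAt_riemannZeta (hne1 z hz))
      exact (this.comp z
        (by fun_prop : DifferentiableAt ℂ (fun z => s₁ + z) z)).differentiableWithinAt)
    hnz (fun z hz' => by
      obtain ⟨h3, h4, h5, h6⟩ := hball z hz'
      have h7 := hz L hL (s₁ + z) (by linarith) (by
        rw [Real.log_le_iff_le_exp (by linarith)]
        linarith) (by nlinarith) h6
      refine h7.trans ?_
      simp only [add_zero]
      calc Real.exp (K * l) = Real.exp M * Real.exp (-((1 + Real.log (4 * C / c)) * l)) := by
            rw [← Real.exp_add]; congr 1; rw [hM]; ring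
        _ ≤ _ := by gcongr)
  have hzs : s₁ + (s - s₁) = s := by ring
  have hnorm : ‖s - s₁‖ ≤ R / 2 := by
    have : s - s₁ = ((s.re - (1 + c / 4 * w) : ℝ) : ℂ) := by
      apply Complex.ext <;> simp [hs₁]
    rw [this, Complex.norm_real, Real.norm_eq_abs, abs_le, hR]
    constructor <;> nlinarith
  have hmem : s - s₁ ∈ Metric.ball (0 : ℂ) R := by
    rw [mem_ball_zero_iff]
    linarith
  have hsne := hnz _ hmem
  rw [hzs] at hsne
  refine ⟨fun h0 => hsne (by rw [riemannZeta_eq_inv_sub_mul hs1, h0, mul_zero]), ?_⟩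
  have h3 := hh2 _ hmem
  have h4 : ‖h (s - s₁)‖ ≤ 2 * M := by
    refine (hh3 _ hmem).trans ?_
    rw [div_le_iff₀ (by linarith)]
    nlinarith
  simp only [hzs, add_zero] at h3
  rw [h3, norm_inv, norm_mul, Complex.norm_exp]
  have h5 : Real.exp (-(2 * M)) ≤ Real.exp (h (s - s₁)).re := by
    rw [Real.exp_le_exp]
    linarith [(abs_le.mp (Complex.abs_re_le_norm (h (s - s₁)))).1]
  have h6 : Real.exp (-((1 + Real.log (4 * C / c)) * l)) * Real.exp (-(2 * M)) ≤
      ‖riemannZeta s₁‖ * Real.exp (h (s - s₁)).re := by gcongr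
  rw [← Real.exp_add] at h6
  calc _ ≤ (Real.exp (-((1 + Real.log (4 * C / c)) * l) + -(2 * M)))⁻¹ := by gcongr
    _ ≤ _ := by
      rw [← Real.exp_neg, Real.exp_le_exp, hM]
      nlinarith [mul_nonneg hlogB (by linarith : 0 ≤ l), mul_nonneg hK.le (by linarith : 0 ≤ l)]

end VinogradovKorobov

namespace VinogradovKorobov

open Finset MeasureTheory

/-- The Mellin transform of `u ↦ max 0 (1 - u)`. -/
noncomputable def rieszKernel (s : ℂ) : ℂ := 1 / s - 1 / (s + 1)

lemma norm_rieszKernel_le {s : ℂ} (hs : 1 / 2 ≤ s.re) :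
    ‖rieszKernel s‖ ≤ 2 * (1 + s.im ^ 2)⁻¹ := by
  have h0 : s ≠ 0 := by rintro rfl; norm_num at hs
  have h1 : s + 1 ≠ 0 := by
    intro h
    have := congrArg Complex.re h
    simp at this
    linarith
  have h2 : rieszKernel s = 1 / (s * (s + 1)) := by rw [rieszKernel]; field_simp; ring
  have h3 : (1 + s.im ^ 2) / 2 ≤ ‖s‖ * ‖s + 1‖ := by
    have e1 : ((1 + s.im ^ 2) / 2) ^ 2 ≤ (‖s‖ * ‖s + 1‖) ^ 2 := by
      rw [mul_pow, ← Complex.normSq_eq_norm_sq, ← Complex.normSq_eq_norm_sq, Complex.normSq_apply,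
        Complex.normSq_apply]
      simp only [Complex.add_re, Complex.one_re, Complex.add_im, Complex.one_im, add_zero]
      have a1 : (1 + s.im ^ 2) / 4 ≤ s.re * s.re + s.im * s.im := by nlinarith
      have a2 : 1 + s.im ^ 2 ≤ (s.re + 1) * (s.re + 1) + s.im * s.im := by nlinarith
      calc ((1 + s.im ^ 2) / 2) ^ 2 = (1 + s.im ^ 2) / 4 * (1 + s.im ^ 2) := by ring
        _ ≤ _ := by gcongr; nlinarith
    exact le_of_sq_le_sq e1 (by positivity)
  rw [h2, norm_div, norm_mul, norm_one, ← div_eq_mul_inv]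
  rw [div_le_div_iff₀ (by positivity) (by positivity)]
  linarith

lemma differentiableAt_rieszKernel {s : ℂ} (hs : 0 < s.re) : DifferentiableAt ℂ rieszKernel s := by
  have h0 : s ≠ 0 := by rintro rfl; norm_num at hs
  have h1 : s + 1 ≠ 0 := by
    intro h
    have := congrArg Complex.re h
    simp at this
    linarith
  unfold rieszKernel
  fun_prop (disch := assumption)

lemma continuous_rieszKernel_vertical {σ : ℝ} (hσ : 0 < σ) :
    Continuous fun y : ℝ => rieszKernel (σ + y * Complex.I) := by
  refine continuous_iff_continuousAt.mpr fun y => ?_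
  refine ContinuousAt.comp (g := rieszKernel) (f := fun y : ℝ => (σ + y * Complex.I : ℂ)) ?_
    (by fun_prop)
  exact (differentiableAt_rieszKernel (by simpa using hσ)).continuousAt

lemma integrable_rieszKernel {σ : ℝ} (hσ : 1 / 2 ≤ σ) :
    Integrable fun y : ℝ => rieszKernel (σ + y * Complex.I) := by
  refine (integrable_inv_one_add_sq.const_mul 2).mono'
    (continuous_rieszKernel_vertical (by linarith)).aestronglyMeasurable
    (Filter.Eventually.of_forall fun y => ?_)
  simpa using norm_rieszKernel_le (s := σ + y * Complex.I) (by simpa using hσ)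

lemma riesz_inversion {σ u : ℝ} (hσ : 1 / 2 ≤ σ) (hu : 0 < u) :
    (1 / (2 * Real.pi) : ℝ) • ∫ y : ℝ, (u : ℂ) ^ (-(σ + y * Complex.I)) *
      rieszKernel (σ + y * Complex.I) = ((max 0 (1 - u) : ℝ) : ℂ) := by
  set f : ℝ → ℂ := fun t => Set.indicator (Set.Ioc 0 1) (fun _ => 1 : ℝ → ℂ) t -
    Set.indicator (Set.Ioc 0 1) (fun t => (t : ℂ) ^ (1 : ℂ) : ℝ → ℂ) t with hf
  have hm : ∀ s : ℂ, 0 < s.re → HasMellin f s (rieszKernel s) := by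
    intro s hs
    have h1 := hasMellin_one_Ioc hs
    have h2 := hasMellin_cpow_Ioc 1 (s := s) (by simp; linarith)
    have := hasMellin_sub h1.1 h2.1
    rwa [h1.2, h2.2] at this
  have hline : ∀ y : ℝ, 0 < (σ + y * Complex.I : ℂ).re := fun y => by simp; linarith
  have heq : ∀ t : ℝ, 0 < t → f t = ((max 0 (1 - t) : ℝ) : ℂ) := by
    intro t ht
    by_cases h1 : t ≤ 1
    · have hmem : t ∈ Set.Ioc (0 : ℝ) 1 := ⟨ht, h1⟩
      simp only [hf, Set.indicator_of_mem hmem, Complex.cpow_one]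
      rw [max_eq_right (by linarith)]
      push_cast
      ring
    · have hmem : t ∉ Set.Ioc (0 : ℝ) 1 := fun h => h1 h.2
      simp only [hf, Set.indicator_of_notMem hmem]
      rw [max_eq_left (by linarith)]
      simp
  have hvert : (fun y : ℝ => mellin f (σ + y * Complex.I)) =
      fun y : ℝ => rieszKernel (σ + y * Complex.I) := funext fun y => (hm _ (hline y)).2
  have h := mellinInv_mellin_eq σ f hu (hm σ (by simp; linarith)).1
    (by
      rw [Complex.VerticalIntegrable, hvert]
      exact integrable_rieszKernel hσ)
    (by
      have : ContinuousAt (fun t : ℝ => ((max 0 (1 - t) : ℝ) : ℂ)) u := by fun_prop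
      refine this.congr ?_
      filter_upwards [lt_mem_nhds hu] with t ht using (heq t ht).symm)
  rw [heq u hu] at h
  rw [← h, mellinInv]
  congr 1
  refine integral_congr_ae (Filter.Eventually.of_forall fun y => ?_)
  simp only [smul_eq_mul]
  rw [← (hm _ (hline y)).2]

/-- Perron's formula with the Riesz weight `1 - n / x`. -/
lemma riesz_perron {σ x : ℝ} (hσ : 1 < σ) (hx : 0 < x) :
    ((∑ n ∈ Icc 1 ⌊x⌋₊, (ArithmeticFunction.moebius n : ℝ) * (1 - n / x) : ℝ) : ℂ) =
    (1 / (2 * Real.pi) : ℝ) • ∫ y : ℝ, zetaRecip (σ + y * Complex.I) *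
      (x : ℂ) ^ (σ + y * Complex.I) * rieszKernel (σ + y * Complex.I) := by
  set F : ℕ → ℝ → ℂ := fun n y => LSeries.term (fun n => (ArithmeticFunction.moebius n : ℂ))
    (σ + y * Complex.I) n * ((x : ℂ) ^ (σ + y * Complex.I) * rieszKernel (σ + y * Complex.I))
    with hF
  have hx0 : (x : ℂ) ≠ 0 := by exact_mod_cast hx.ne'
  have hre : ∀ y : ℝ, (σ + y * Complex.I : ℂ).re = σ := fun y => by simp
  have hterm : ∀ n : ℕ, n ≠ 0 → ∀ y : ℝ, F n y = (ArithmeticFunction.moebius n : ℂ) *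
      (((n / x : ℝ) : ℂ) ^ (-(σ + y * Complex.I)) * rieszKernel (σ + y * Complex.I)) := by
    intro n hn y
    simp only [hF, LSeries.term_of_ne_zero hn]
    have : (((n / x : ℝ) : ℂ)) ^ (-(σ + y * Complex.I)) =
        (x : ℂ) ^ (σ + y * Complex.I) / (n : ℂ) ^ (σ + y * Complex.I) := by
      rw [Complex.cpow_neg, div_eq_mul_inv (n : ℝ), Complex.ofReal_mul,
        Complex.mul_cpow_ofReal_nonneg (by positivity) (by positivity), Complex.ofReal_inv,
        Complex.inv_cpow _ _ (by rw [Complex.arg_ofReal_of_nonneg hx.le]; exact Real.pi_pos.ne)]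
      push_cast
      rw [mul_inv, inv_inv, div_eq_mul_inv, mul_comm]
    rw [this]
    ring
  have hnorm : ∀ n : ℕ, ∀ y : ℝ, ‖F n y‖ ≤
      x ^ σ * ‖rieszKernel (σ + y * Complex.I)‖ * (1 / (n : ℝ) ^ σ) := by
    intro n y
    simp only [hF, norm_mul, Complex.norm_cpow_eq_rpow_re_of_pos hx, hre]
    rw [mul_comm]
    gcongr
    rw [LSeries.norm_term_eq, hre]
    split_ifs with h
    · positivity
    · gcongr
      rw [Complex.norm_intCast]
      exact_mod_cast ArithmeticFunction.abs_moebius_le_one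
  have hcont : ∀ n : ℕ, Continuous (F n) := by
    intro n
    rcases eq_or_ne n 0 with rfl | hn
    · simp only [hF, LSeries.term_zero, zero_mul]; exact continuous_const
    have : NeZero (x : ℂ) := ⟨hx0⟩
    have : NeZero (n : ℂ) := ⟨by exact_mod_cast hn⟩
    have h1 : Continuous fun y : ℝ => (x : ℂ) ^ (σ + y * Complex.I) :=
      (continuous_const_cpow (x : ℂ)).comp (by fun_prop)
    have h2 : Continuous fun y : ℝ => (n : ℂ) ^ (σ + y * Complex.I) :=
      (continuous_const_cpow (n : ℂ)).comp (by fun_prop)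
    simp only [hF, LSeries.term_of_ne_zero hn]
    refine Continuous.mul (continuous_const.div h2 fun y => ?_)
      (h1.mul (continuous_rieszKernel_vertical (by linarith)))
    exact Complex.cpow_ne_zero_iff_of_exponent_ne_zero (fun h => by
      have := congrArg Complex.re h
      rw [hre] at this
      simp at this
      linarith) |>.mpr (by exact_mod_cast hn)
  have hinteg : ∀ n : ℕ, Integrable (F n) := fun n =>
    (((integrable_rieszKernel (by linarith : 1 / 2 ≤ σ)).norm.const_mul (x ^ σ)).mul_const
      (1 / (n : ℝ) ^ σ)).mono' (hcont n).aestronglyMeasurable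
      (Filter.Eventually.of_forall (hnorm n))
  have hsum : Summable fun n : ℕ => ∫ y : ℝ, ‖F n y‖ := by
    refine Summable.of_nonneg_of_le (fun n => integral_nonneg fun y => norm_nonneg _)
      (fun n => integral_mono (hinteg n).norm
        (((integrable_rieszKernel (by linarith : 1 / 2 ≤ σ)).norm.const_mul (x ^ σ)).mul_const
          (1 / (n : ℝ) ^ σ)) (hnorm n)) ?_
    simp_rw [integral_mul_const]
    exact (Real.summable_one_div_nat_rpow.mpr hσ).mul_left _
  have key := hasSum_integral_of_summable_integral_norm hinteg hsum
  have hR : (fun y : ℝ => ∑' n, F n y) = fun y : ℝ => zetaRecip (σ + y * Complex.I) *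
      (x : ℂ) ^ (σ + y * Complex.I) * rieszKernel (σ + y * Complex.I) := by
    funext y
    have hs : 1 < (σ + y * Complex.I : ℂ).re := by rw [hre]; exact hσ
    simp only [hF]
    rw [tsum_mul_right, mul_assoc]
    congr 1
    rw [zetaRecip_eq (by rintro h; rw [h] at hs; simp at hs)]
    have h := ArithmeticFunction.LSeries_zeta_mul_Lseries_moebius hs
    rw [ArithmeticFunction.LSeries_zeta_eq_riemannZeta hs] at h
    rw [inv_eq_of_mul_eq_one_right h]
    rfl
  rw [hR] at key
  have key2 := key.const_smul (1 / (2 * Real.pi) : ℝ)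
  refine HasSum.unique ?_ key2
  have hval : ∀ n : ℕ, (1 / (2 * Real.pi) : ℝ) • ∫ y : ℝ, F n y =
      if n ∈ Icc 1 ⌊x⌋₊ then (((ArithmeticFunction.moebius n : ℝ) * (1 - n / x) : ℝ) : ℂ)
        else 0 := by
    intro n
    rcases eq_or_ne n 0 with rfl | hn
    · simp [hF]
    have hn0 : (0 : ℝ) < n := by positivity
    simp_rw [hterm n hn]
    rw [integral_const_mul, ← mul_smul_comm, riesz_inversion (by linarith) (by positivity)]
    by_cases hmem : n ≤ ⌊x⌋₊
    · rw [if_pos (mem_Icc.mpr ⟨Nat.one_le_iff_ne_zero.mpr hn, hmem⟩), max_eq_right]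
      · push_cast; ring
      · rw [sub_nonneg, div_le_one hx]
        exact (Nat.le_floor_iff hx.le).mp hmem
    · rw [if_neg (fun h => hmem (mem_Icc.mp h).2), max_eq_left, Complex.ofReal_zero, mul_zero]
      rw [sub_nonpos, one_le_div hx]
      exact ((Nat.floor_lt hx.le).mp (not_le.mp hmem)).le
  simp_rw [hval]
  rw [Complex.ofReal_sum]
  set f : ℕ → ℂ := fun n => if n ∈ Icc 1 ⌊x⌋₊ then
    (((ArithmeticFunction.moebius n : ℝ) * (1 - n / x) : ℝ) : ℂ) else 0
  have : HasSum f (∑ n ∈ Icc 1 ⌊x⌋₊, f n) :=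
    hasSum_sum_of_ne_finset_zero fun n hn => if_neg hn
  have hf : ∑ n ∈ Icc 1 ⌊x⌋₊, f n = ∑ n ∈ Icc 1 ⌊x⌋₊,
      (((ArithmeticFunction.moebius n : ℝ) * (1 - n / x) : ℝ) : ℂ) :=
    sum_congr rfl fun n hn => if_pos hn
  rwa [hf] at this

lemma pi_div_two_sub_arctan_le {T : ℝ} (hT : 0 < T) : Real.pi / 2 - Real.arctan T ≤ 1 / T := by
  rw [← Real.arctan_inv_of_pos hT, one_div]
  have h := Real.arctan_pos.mpr (inv_pos.mpr hT)
  have := Real.le_tan h.le (Real.arctan_lt_pi_div_two _)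
  rwa [Real.tan_arctan] at this

/-- Integrals dominated by `B / (1 + y ^ 2)`, truncated at height `T`. -/
lemma norm_integral_sub_intervalIntegral_le {f : ℝ → ℂ} {B T : ℝ} (hT : 0 < T) (hB : 0 ≤ B)
    (hf : Integrable f) (hfB : ∀ y, ‖f y‖ ≤ B * (1 + y ^ 2)⁻¹) :
    ‖(∫ y, f y) - ∫ y in (-T)..T, f y‖ ≤ 2 * B / T := by
  have h1 : (∫ y, f y) - ∫ y in (-T)..T, f y =
      (∫ y in Set.Iic (-T), f y) + ∫ y in Set.Ioi T, f y := by
    have e1 := intervalIntegral.integral_interval_add_Ioi (a := -T) (b := T)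
      hf.integrableOn hf.integrableOn
    have e2 := intervalIntegral.integral_Iic_add_Ioi (b := -T) hf.integrableOn hf.integrableOn
    rw [← e2, ← e1]
    ring
  have hi := integrable_inv_one_add_sq.const_mul B
  have h2 : ‖∫ y in Set.Iic (-T), f y‖ ≤ B * (1 / T) := by
    calc _ ≤ ∫ y in Set.Iic (-T), B * (1 + y ^ 2)⁻¹ :=
          norm_integral_le_of_norm_le hi.integrableOn (Filter.Eventually.of_forall hfB)
      _ = B * (Real.pi / 2 - Real.arctan T) := by
          rw [integral_const_mul, integral_Iic_inv_one_add_sq, Real.arctan_neg]; ring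
      _ ≤ _ := by gcongr; exact pi_div_two_sub_arctan_le hT
  have h3 : ‖∫ y in Set.Ioi T, f y‖ ≤ B * (1 / T) := by
    calc _ ≤ ∫ y in Set.Ioi T, B * (1 + y ^ 2)⁻¹ :=
          norm_integral_le_of_norm_le hi.integrableOn (Filter.Eventually.of_forall hfB)
      _ = B * (Real.pi / 2 - Real.arctan T) := by
          rw [integral_const_mul, integral_Ioi_inv_one_add_sq]
      _ ≤ _ := by gcongr; exact pi_div_two_sub_arctan_le hT
  rw [h1]
  refine (norm_add_le _ _).trans ((add_le_add h2 h3).trans (le_of_eq (by ring)))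

lemma norm_intervalIntegral_le_pi_mul {f : ℝ → ℂ} {B T : ℝ} (hT : 0 < T) (hB : 0 ≤ B)
    (hfB : ∀ y ∈ Set.Icc (-T) T, ‖f y‖ ≤ B * (1 + y ^ 2)⁻¹) :
    ‖∫ y in (-T)..T, f y‖ ≤ Real.pi * B := by
  calc _ ≤ ∫ y in (-T)..T, B * (1 + y ^ 2)⁻¹ :=
        intervalIntegral.norm_integral_le_of_norm_le (by linarith)
          (Filter.Eventually.of_forall fun y hy => hfB y ⟨hy.1.le, hy.2⟩)
          (integrable_inv_one_add_sq.const_mul B).intervalIntegrable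
    _ = B * (Real.arctan T - Real.arctan (-T)) := by
        rw [intervalIntegral.integral_const_mul, integral_inv_one_add_sq]
    _ ≤ B * Real.pi := by
        gcongr
        linarith [Real.arctan_lt_pi_div_two T, Real.neg_pi_div_two_lt_arctan (-T)]
    _ = _ := mul_comm _ _

/-- The Riesz mean of the Möbius function, estimated by shifting the contour. -/
theorem exists_riesz_moebius_le : ∃ c A C : ℝ, 0 < c ∧ c ≤ 1 / 8 ∧ 1 ≤ A ∧ 0 < C ∧ ∀ L x : ℝ,
    Real.exp 1 ≤ L → 1 ≤ Real.log x → 0 < x →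
    |∑ n ∈ Icc 1 ⌊x⌋₊, (ArithmeticFunction.moebius n : ℝ) * (1 - n / x)| ≤
      C * x * Real.exp (A * Real.log L) * (Real.log x * Real.exp (-L) +
        Real.exp (-(c * vkWidth L * Real.log x))) := by
  obtain ⟨c, A, hc, hc8, hA, hz⟩ := exists_zetaRecip_bound
  obtain ⟨C, hC, hC1⟩ := exists_riemannZeta_near_one
  refine ⟨c, A, 50 * C, hc, hc8, hA, by positivity, fun L x hL hu hx => ?_⟩
  have h1 := one_le_log hL
  have h2 := two_le_of_exp_one_le hL
  set u := Real.log x with hu'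
  have hxu : Real.exp u = x := Real.exp_log hx
  set w := vkWidth L with hw
  have hw0 : 0 < w := vkWidth_pos hL
  have hw1 : w ≤ 1 := vkWidth_le_one hL
  set T := Real.exp L with hT'
  have hT : 0 < T := Real.exp_pos L
  have hT1 : 1 ≤ T := Real.one_le_exp (by linarith)
  set E := Real.exp (A * Real.log L) with hE
  have hE1 : 1 ≤ E := Real.one_le_exp (by positivity)
  set σ := 1 + 1 / u with hσ'
  have hu1 : 0 < 1 / u := by positivity
  have hu2 : 1 / u ≤ 1 := by rw [div_le_one (by linarith)]; exact hu
  have hσ : 1 < σ := by linarith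
  set α := 1 - c * w with hα
  have hα1 : 7 / 8 ≤ α := by rw [hα]; nlinarith
  have hα2 : α ≤ 1 := by rw [hα]; nlinarith
  have hxσ : x ^ σ = Real.exp 1 * x := by
    rw [Real.rpow_def_of_pos hx, ← hu']
    conv_rhs => rw [← hxu, ← Real.exp_add]
    congr 1
    rw [hσ']
    field_simp
    ring
  have hxα : x ^ α = x * Real.exp (-(c * w * u)) := by
    rw [Real.rpow_def_of_pos hx, ← hu']
    conv_rhs => rw [← hxu, ← Real.exp_add]
    congr 1
    rw [hα]
    ring
  have he := Real.exp_one_lt_d9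
  have he0 := Real.exp_pos 1
  set F : ℂ → ℂ := fun s => zetaRecip s * (x : ℂ) ^ s * rieszKernel s with hF
  have hFnorm : ∀ s : ℂ, 1 / 2 ≤ s.re →
      ‖F s‖ ≤ ‖zetaRecip s‖ * x ^ s.re * (2 * (1 + s.im ^ 2)⁻¹) := by
    intro s hs
    rw [hF, norm_mul, norm_mul, Complex.norm_cpow_eq_rpow_re_of_pos hx]
    gcongr
    exact norm_rieszKernel_le hs
  have hFdiff : ∀ s : ℂ, 0 < s.re → riemannZeta₁ s ≠ 0 → DifferentiableAt ℂ F s := by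
    intro s hs h0
    refine DifferentiableAt.mul (DifferentiableAt.mul ?_ ?_) (differentiableAt_rieszKernel hs)
    · exact DifferentiableAt.div (by fun_prop) (differentiable_riemannZeta₁ s) h0
    · exact (differentiableAt_id).const_cpow (Or.inl (by exact_mod_cast hx.ne'))
  have hre : ∀ a y : ℝ, (a + y * Complex.I : ℂ).re = a := fun a y => by simp
  have him : ∀ a y : ℝ, (a + y * Complex.I : ℂ).im = y := fun a y => by simp
  -- The line `re s = σ`.
  have hright : ∀ y : ℝ, ‖F (σ + y * Complex.I)‖ ≤ 2 * C * u * x ^ σ * (1 + y ^ 2)⁻¹ := by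
    intro y
    have h3 := hFnorm (σ + y * Complex.I) (by rw [hre]; linarith)
    have h4 : ‖zetaRecip (σ + y * Complex.I)‖ ≤ C * u := by
      have hs : 1 < (σ + y * Complex.I : ℂ).re := by rw [hre]; exact hσ
      rw [zetaRecip_eq (by rintro h; rw [h] at hs; simp at hs)]
      refine (norm_inv_riemannZeta_le hs).trans ?_
      rw [hre]
      refine (hC1 (1 / u) hu1 hu2).1.trans (le_of_eq ?_)
      rw [div_div_eq_mul_div, div_one]
    rw [hre, him] at h3
    refine h3.trans ?_
    calc _ ≤ C * u * x ^ σ * (2 * (1 + y ^ 2)⁻¹) := by gcongr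
      _ = _ := by ring
  have hinteg : Integrable fun y : ℝ => F (σ + y * Complex.I) := by
    refine (integrable_inv_one_add_sq.const_mul (2 * C * u * x ^ σ)).mono' ?_
      (Filter.Eventually.of_forall hright)
    refine Continuous.aestronglyMeasurable (continuous_iff_continuousAt.mpr fun y => ?_)
    refine ContinuousAt.comp (g := F) (f := fun y : ℝ => (σ + y * Complex.I : ℂ)) ?_ (by fun_prop)
    exact (hFdiff _ (by rw [hre]; linarith)
      (riemannZeta₁_ne_zero (by rw [hre]; linarith))).continuousAt
  have htail := norm_integral_sub_intervalIntegral_le hT (by positivity) hinteg hright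
  -- The line `re s = α`.
  have hleft : ‖∫ y in (-T)..T, F (α + y * Complex.I)‖ ≤ Real.pi * (2 * E * x ^ α) := by
    refine norm_intervalIntegral_le_pi_mul hT (by positivity) fun y hy => ?_
    have h3 := hFnorm (α + y * Complex.I) (by rw [hre]; linarith)
    have h4 := (hz L hL (α + y * Complex.I) (by rw [him]; exact abs_le.mpr hy)
      (by rw [hre]) (by rw [hre]; linarith)).2
    rw [hre, him] at h3
    refine h3.trans ?_
    calc _ ≤ E * x ^ α * (2 * (1 + y ^ 2)⁻¹) := by gcongr
      _ = _ := by ring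
  -- The horizontal segments.
  have hx1 : 1 ≤ x := by rw [← hxu]; exact Real.one_le_exp (by linarith)
  have hhor : ∀ y : ℝ, |y| = T → ‖∫ t in α..σ, F (t + y * Complex.I)‖ ≤
      4 * E * x ^ σ * T⁻¹ := by
    intro y hy
    have h3 : ∀ t ∈ Set.uIoc α σ, ‖F (t + y * Complex.I)‖ ≤ 2 * E * x ^ σ * T⁻¹ := by
      intro t ht
      rw [Set.uIoc_of_le (by linarith)] at ht
      have h3 := hFnorm (t + y * Complex.I) (by rw [hre]; linarith [ht.1])
      have h4 := (hz L hL (t + y * Complex.I) (by rw [him]; exact hy.le)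
        (by rw [hre]; exact ht.1.le) (by rw [hre]; linarith [ht.2])).2
      rw [hre, him, ← sq_abs, hy] at h3
      refine h3.trans ?_
      calc _ ≤ E * x ^ σ * (2 * T⁻¹) := by
            gcongr
            · exact ht.2
            · nlinarith
        _ = _ := by ring
    refine (intervalIntegral.norm_integral_le_of_norm_le_const h3).trans ?_
    have h5 : |σ - α| ≤ 2 := by
      rw [abs_of_nonneg (by linarith)]
      linarith
    calc _ ≤ 2 * E * x ^ σ * T⁻¹ * 2 := by gcongr
      _ = _ := by ring
  have hrect := Complex.integral_boundary_rect_eq_zero_of_differentiableOn F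
    (α + (-T : ℝ) * Complex.I) (σ + T * Complex.I) (by
      intro s hs
      rw [hre, hre, him, him, Set.uIcc_of_le (by linarith), Set.uIcc_of_le (by linarith),
        Complex.mem_reProdIm] at hs
      exact (hFdiff s (by linarith [hs.1.1]) (hz L hL s (abs_le.mpr hs.2) hs.1.1
        (by linarith [hs.1.2])).1).differentiableWithinAt)
  simp only [hre, him] at hrect
  have hmid : ‖∫ y in (-T)..T, F (σ + y * Complex.I)‖ ≤
      Real.pi * (2 * E * x ^ α) + 8 * E * x ^ σ * T⁻¹ := by
    have h3 : Complex.I * ∫ y in (-T)..T, F (σ + y * Complex.I) =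
        Complex.I * (∫ y in (-T)..T, F (α + y * Complex.I)) +
          ((∫ t in α..σ, F (t + T * Complex.I)) -
            ∫ t in α..σ, F (t + (-T : ℝ) * Complex.I)) := by
      rw [smul_eq_mul, smul_eq_mul] at hrect
      linear_combination hrect
    have h4 := congrArg norm h3
    rw [norm_mul, Complex.norm_I, one_mul] at h4
    rw [h4]
    refine (norm_add_le _ _).trans ?_
    rw [norm_mul, Complex.norm_I, one_mul]
    have h5 := hhor T (abs_of_pos hT)
    have h6 := hhor (-T) (by rw [abs_neg, abs_of_pos hT])
    have h7 := norm_sub_le (∫ t in α..σ, F (t + T * Complex.I))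
      (∫ t in α..σ, F (t + (-T : ℝ) * Complex.I))
    linarith
  have hperron := riesz_perron hσ hx
  have hpi := Real.pi_gt_three
  have hpi4 := Real.pi_lt_four
  rw [← Real.norm_eq_abs, ← Complex.norm_real, hperron, norm_smul, Real.norm_eq_abs,
    abs_of_pos (by positivity)]
  have hpi6 : 1 / (2 * Real.pi) ≤ 1 / 6 := by gcongr; linarith
  have htot : ‖∫ y : ℝ, F (σ + y * Complex.I)‖ ≤
      2 * (2 * C * u * x ^ σ) / T + (Real.pi * (2 * E * x ^ α) + 8 * E * x ^ σ * T⁻¹) := by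
    have := norm_sub_norm_le (∫ y : ℝ, F (σ + y * Complex.I))
      (∫ y in (-T)..T, F (σ + y * Complex.I))
    linarith
  have hTL : Real.exp (-L) = T⁻¹ := Real.exp_neg L
  rw [hTL]
  calc _ ≤ 1 / 6 * (2 * (2 * C * u * x ^ σ) / T +
        (Real.pi * (2 * E * x ^ α) + 8 * E * x ^ σ * T⁻¹)) := by gcongr
    _ ≤ 1 / 6 * (2 * (2 * C * u * (3 * x)) * T⁻¹ * E +
        (4 * (2 * E * x ^ α) * C + 8 * E * (3 * x) * T⁻¹ * (C * u))) := by
        rw [div_eq_mul_inv (2 * (2 * C * u * x ^ σ)) T, hxσ]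
        have hCu : 1 ≤ C * u := by nlinarith
        have he3 : Real.exp 1 ≤ 3 := by linarith
        gcongr ?_ * (?_ + (?_ + ?_))
        · rw [← mul_one (2 * (2 * C * u * (Real.exp 1 * x)) * T⁻¹)]
          gcongr
        · rw [← mul_one (Real.pi * (2 * E * x ^ α))]
          gcongr
        · rw [← mul_one (8 * E * (Real.exp 1 * x) * T⁻¹)]
          gcongr
    _ = C * x * E * (6 * (u * T⁻¹) + 4 / 3 * Real.exp (-(c * w * u))) := by rw [hxα]; ring
    _ ≤ C * x * E * (50 * (u * T⁻¹) + 50 * Real.exp (-(c * w * u))) := by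
        gcongr <;> norm_num
    _ = _ := by ring

end VinogradovKorobov

namespace VinogradovKorobov

open Finset

/-- The saving exponent `(w ^ 3 / log (w + 3)) ^ (1 / 5)`, for `1 ≤ w`. -/
noncomputable def vkSaving (w : ℝ) : ℝ := (w ^ 3 / Real.log (w + 3)) ^ (1 / 5 : ℝ)

/-- The saving in the Vinogradov-Korobov prime number theorem at `exp u`. -/
noncomputable def vkPhi (u : ℝ) : ℝ := vkSaving (max u 0 + 1)

lemma one_le_log_add_three {w : ℝ} (hw : 1 ≤ w) : 1 ≤ Real.log (w + 3) := by
  rw [Real.le_log_iff_exp_le (by linarith)]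
  linarith [Real.exp_one_lt_d9]

lemma vkSaving_pos {w : ℝ} (hw : 1 ≤ w) : 0 < vkSaving w := by
  have := one_le_log_add_three hw
  rw [vkSaving]
  positivity

lemma vkSaving_pow_mul_log {w : ℝ} (hw : 1 ≤ w) : vkSaving w ^ 5 * Real.log (w + 3) = w ^ 3 := by
  have := one_le_log_add_three hw
  rw [vkSaving, ← Real.rpow_natCast, ← Real.rpow_mul (by positivity)]
  norm_num
  field_simp

lemma vkSaving_mono {w v : ℝ} (hw : 1 ≤ w) (hwv : w ≤ v) : vkSaving w ≤ vkSaving v := by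
  have h1 := one_le_log_add_three hw
  have h2 := one_le_log_add_three (hw.trans hwv)
  rw [vkSaving, vkSaving]
  refine Real.rpow_le_rpow (by positivity) ?_ (by norm_num)
  rw [div_le_div_iff₀ (by positivity) (by positivity)]
  have he := Real.exp_one_lt_d9
  have h3 : Real.log (v + 3) / (v + 3) ≤ Real.log (w + 3) / (w + 3) :=
    Real.log_div_self_antitoneOn (Set.mem_Ici.mpr (by linarith)) (Set.mem_Ici.mpr (by linarith))
      (by linarith)
  rw [div_le_div_iff₀ (by linarith) (by linarith)] at h3
  have h4 : w * Real.log (v + 3) ≤ v * Real.log (w + 3) := by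
    have h5 : w * (v + 3) ≤ v * (w + 3) := by linarith
    have h6 : w * Real.log (v + 3) * (w + 3) ≤ v * Real.log (w + 3) * (w + 3) := by
      calc w * Real.log (v + 3) * (w + 3) = w * (Real.log (v + 3) * (w + 3)) := by ring
        _ ≤ w * (Real.log (w + 3) * (v + 3)) := by gcongr
        _ = Real.log (w + 3) * (w * (v + 3)) := by ring
        _ ≤ Real.log (w + 3) * (v * (w + 3)) := by gcongr
        _ = _ := by ring
    exact le_of_mul_le_mul_right h6 (by linarith)
  calc w ^ 3 * Real.log (v + 3) = w ^ 2 * (w * Real.log (v + 3)) := by ring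
    _ ≤ v ^ 2 * (v * Real.log (w + 3)) := by gcongr
    _ = _ := by ring

lemma mul_vkSaving_le {w v : ℝ} (hw : 1 ≤ w) (hwv : w ≤ v) : w * vkSaving v ≤ v * vkSaving w := by
  have h1 := one_le_log_add_three hw
  have h2 := one_le_log_add_three (hw.trans hwv)
  have h3 := vkSaving_pow_mul_log hw
  have h4 := vkSaving_pow_mul_log (hw.trans hwv)
  have h5 := vkSaving_pos hw
  have h6 := vkSaving_pos (hw.trans hwv)
  have hw0 : 0 < w := by linarith
  have hv0 : 0 < v := by linarith
  refine le_of_pow_le_pow_left₀ (n := 5) (by norm_num) (by positivity) ?_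
  have hlog : Real.log (w + 3) ≤ Real.log (v + 3) := Real.log_le_log (by linarith) (by linarith)
  refine le_of_mul_le_mul_right ?_ (show 0 < Real.log (v + 3) by linarith)
  calc (w * vkSaving v) ^ 5 * Real.log (v + 3) = w ^ 5 * (vkSaving v ^ 5 * Real.log (v + 3)) := by
        ring
    _ = w ^ 3 * (w ^ 2 * v ^ 3) := by rw [h4]; ring
    _ ≤ w ^ 3 * (v ^ 2 * v ^ 3) := by gcongr
    _ = v ^ 5 * vkSaving w ^ 5 * Real.log (w + 3) := by rw [← h3]; ring
    _ ≤ v ^ 5 * vkSaving w ^ 5 * Real.log (v + 3) := by gcongr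
    _ = _ := by ring

lemma vkSaving_le_self {w : ℝ} (hw : 1 ≤ w) : vkSaving w ≤ w := by
  have h1 := one_le_log_add_three hw
  have h3 := vkSaving_pow_mul_log hw
  have h5 := vkSaving_pos hw
  refine le_of_pow_le_pow_left₀ (n := 5) (by norm_num) (by positivity) ?_
  calc vkSaving w ^ 5 ≤ vkSaving w ^ 5 * Real.log (w + 3) :=
        le_mul_of_one_le_right (by positivity) h1
    _ = w ^ 3 := h3
    _ ≤ w ^ 5 := pow_le_pow_right₀ hw (by norm_num)

lemma vkSaving_le_add {w v : ℝ} (hw : 1 ≤ w) (hwv : w ≤ v) :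
    vkSaving v ≤ vkSaving w + (v - w) := by
  have h1 := mul_vkSaving_le hw hwv
  have h2 := vkSaving_le_self hw
  have h3 := vkSaving_pos hw
  have h4 : w * vkSaving v ≤ w * (vkSaving w + (v - w)) := by nlinarith
  exact le_of_mul_le_mul_left h4 (by linarith)

lemma sq_le_vkSaving_pow {w : ℝ} (hw : 1 ≤ w) : w ^ 2 ≤ 3 * vkSaving w ^ 5 := by
  have h1 := one_le_log_add_three hw
  have h3 := vkSaving_pow_mul_log hw
  have h5 := vkSaving_pos hw
  have h6 : Real.log (w + 3) ≤ 3 * w := by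
    linarith [Real.log_le_sub_one_of_pos (show 0 < w + 3 by linarith)]
  refine le_of_mul_le_mul_right ?_ (show 0 < w by linarith)
  calc w ^ 2 * w = vkSaving w ^ 5 * Real.log (w + 3) := by rw [h3]; ring
    _ ≤ vkSaving w ^ 5 * (3 * w) := by gcongr
    _ = _ := by ring

lemma le_vkWidth_mul {w : ℝ} (hw : 1 ≤ w) (he : Real.exp 1 ≤ vkSaving w) :
    vkSaving w ≤ vkWidth (vkSaving w) * w := by
  have h1 := one_le_log_add_three hw
  have h3 := vkSaving_pow_mul_log hw
  have h4 := vkSaving_le_self hw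
  set L := vkSaving w
  have hl := one_le_log he
  have h2 := two_le_of_exp_one_le he
  have hw3 : w = L ^ (5 / 3 : ℝ) * Real.log (w + 3) ^ (1 / 3 : ℝ) := by
    have : (w ^ 3) ^ (1 / 3 : ℝ) = w := by
      rw [← Real.rpow_natCast, ← Real.rpow_mul (by linarith)]
      norm_num
    conv_lhs => rw [← this, ← h3]
    rw [Real.mul_rpow (by positivity) (by positivity), ← Real.rpow_natCast,
      ← Real.rpow_mul (by linarith)]
    norm_num
  have hlog : Real.log L ≤ Real.log (w + 3) := Real.log_le_log (by linarith) (by linarith)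
  calc L = L ^ (-(2 / 3) + 5 / 3 : ℝ) * Real.log L ^ (-(1 / 3) + 1 / 3 : ℝ) := by norm_num
    _ = vkWidth L * (L ^ (5 / 3 : ℝ) * Real.log L ^ (1 / 3 : ℝ)) := by
        rw [Real.rpow_add (by linarith), Real.rpow_add (by linarith), vkWidth]; ring
    _ ≤ vkWidth L * (L ^ (5 / 3 : ℝ) * Real.log (w + 3) ^ (1 / 3 : ℝ)) := by
        have := vkWidth_pos he
        gcongr
    _ = _ := by rw [← hw3]

lemma one_le_max_add_one (u : ℝ) : 1 ≤ max u 0 + 1 := by linarith [le_max_right u 0]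

lemma vkPhi_pos (u : ℝ) : 0 < vkPhi u := vkSaving_pos (one_le_max_add_one u)

lemma vkPhi_mono {u v : ℝ} (h : u ≤ v) : vkPhi u ≤ vkPhi v :=
  vkSaving_mono (one_le_max_add_one u) (by linarith [max_le_max_right 0 h])

lemma vkPhi_le_add {u v : ℝ} (h : u ≤ v) : vkPhi v ≤ vkPhi u + (v - u) := by
  have h1 := vkSaving_le_add (one_le_max_add_one u)
    (show max u 0 + 1 ≤ max v 0 + 1 by linarith [max_le_max_right 0 h])
  have h2 : max v 0 - max u 0 ≤ v - u := by
    rcases max_cases u 0 with h3 | h3 <;> rcases max_cases v 0 with h4 | h4 <;> linarith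
  rw [vkPhi, vkPhi]
  linarith

lemma vkPhi_le {u : ℝ} (hu : 0 ≤ u) : vkPhi u ≤ u + 1 := by
  rw [vkPhi, max_eq_left hu]
  exact vkSaving_le_self (by linarith)

lemma vkPhi_le_mul {u t : ℝ} (hu : 0 ≤ u) (ht : 1 ≤ t) : vkPhi u ≤ t * vkPhi (u / t) := by
  have ht0 : 0 < t := by linarith
  have h1 : u / t ≤ u := div_le_self hu ht
  rw [vkPhi, vkPhi, max_eq_left hu, max_eq_left (by positivity)]
  have h2 := mul_vkSaving_le (w := u / t + 1) (v := u + 1) (by linarith [div_nonneg hu ht0.le])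
    (by linarith)
  have h3 := vkSaving_pos (w := u / t + 1) (by linarith [div_nonneg hu ht0.le])
  have h4 : 0 ≤ u / t := div_nonneg hu ht0.le
  have h5 : u + 1 ≤ t * (u / t + 1) := by
    rw [mul_add, mul_div_cancel₀ u ht0.ne']
    linarith
  refine le_of_mul_le_mul_left ?_ (show 0 < u / t + 1 by linarith)
  calc _ ≤ (u + 1) * vkSaving (u / t + 1) := h2
    _ ≤ t * (u / t + 1) * vkSaving (u / t + 1) := by gcongr
    _ = _ := by ring

/-- Logarithms are dominated by any linear function. -/
lemma mul_log_le_add {A ε L : ℝ} (hA : 0 < A) (hε : 0 < ε) (hL : 0 < L) :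
    A * Real.log L ≤ ε * L + A * Real.log (A / ε) := by
  have h1 := Real.log_le_sub_one_of_pos (show 0 < ε * L / A by positivity)
  rw [Real.log_div (by positivity) (by positivity), Real.log_mul hε.ne' hL.ne'] at h1
  rw [Real.log_div hA.ne' hε.ne']
  have h2 := mul_le_mul_of_nonneg_left h1 hA.le
  have h3 : A * (ε * L / A - 1) = ε * L - A := by field_simp
  rw [h3] at h2
  linarith

lemma abs_moebius_le_one' (n : ℕ) : |(ArithmeticFunction.moebius n : ℝ)| ≤ 1 := by
  exact_mod_cast ArithmeticFunction.abs_moebius_le_one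

theorem exists_riesz_moebius_le_exp : ∃ c C : ℝ, 0 < c ∧ c ≤ 1 / 8 ∧ 0 < C ∧ ∀ x : ℝ, 0 < x →
    |∑ n ∈ Icc 1 ⌊x⌋₊, (ArithmeticFunction.moebius n : ℝ) * (1 - n / x)| ≤
      C * x * Real.exp (-(c * vkPhi (Real.log x))) := by
  obtain ⟨c, A, C, hc, hc8, hA, hC, hz⟩ := exists_riesz_moebius_le
  set K := (A + 3) * Real.log ((A + 3) / (c / 4)) with hK
  refine ⟨c / 4, max (Real.exp 1) (4 * C * Real.exp K), by positivity, by linarith, by positivity,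
    fun x hx => ?_⟩
  set u := Real.log x with hu
  set L := vkPhi u with hL
  have hL0 : 0 < L := vkPhi_pos u
  rcases lt_or_ge L (Real.exp 1) with hlt | hge
  · have h1 : |∑ n ∈ Icc 1 ⌊x⌋₊, (ArithmeticFunction.moebius n : ℝ) * (1 - n / x)| ≤ x := by
      refine (abs_sum_le_sum_abs _ _).trans ?_
      calc _ ≤ ∑ n ∈ Icc 1 ⌊x⌋₊, (1 : ℝ) := by
            refine sum_le_sum fun n hn => ?_
            have hnx : (n : ℝ) / x ≤ 1 := by
              rw [div_le_one hx]
              exact (Nat.le_floor_iff hx.le).mp (mem_Icc.mp hn).2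
            have hn0 : 0 ≤ (n : ℝ) / x := by positivity
            rw [abs_mul]
            refine mul_le_one₀ (abs_moebius_le_one' n) (abs_nonneg _) ?_
            rw [abs_le]
            constructor <;> linarith
        _ = ⌊x⌋₊ := by simp
        _ ≤ x := Nat.floor_le hx.le
    refine h1.trans ?_
    have h2 : 1 ≤ Real.exp 1 * Real.exp (-(c / 4 * L)) := by
      rw [← Real.exp_add]
      apply Real.one_le_exp
      have := Real.exp_one_lt_d9
      nlinarith
    calc x ≤ x * (Real.exp 1 * Real.exp (-(c / 4 * L))) := le_mul_of_one_le_right hx.le h2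
      _ = Real.exp 1 * x * Real.exp (-(c / 4 * L)) := by ring
      _ ≤ _ := by gcongr; exact le_max_left _ _
  · have h2 := two_le_of_exp_one_le hge
    have hl := one_le_log hge
    have hw1 := one_le_max_add_one u
    have hLw : L ≤ max u 0 + 1 := vkSaving_le_self hw1
    have hu1 : 1 ≤ u := by
      rcases max_cases u 0 with h | h <;> linarith
    have hmax : max u 0 = u := max_eq_left (by linarith)
    have h3 := hz L x hge hu1 hx
    refine h3.trans ?_
    have hLeq : vkSaving (u + 1) = L := by rw [hL, vkPhi, hmax]
    have h4 : L / 2 ≤ vkWidth L * u := by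
      have := le_vkWidth_mul (w := u + 1) (by linarith) (by rw [hLeq]; exact hge)
      rw [hLeq] at this
      have hw := vkWidth_pos hge
      nlinarith
    have h5 : u ≤ 3 * Real.exp (3 * Real.log L) := by
      have := sq_le_vkSaving_pow (w := u + 1) (by linarith)
      rw [hLeq] at this
      have h6 : Real.exp (3 * Real.log L) = L ^ 3 := by
        rw [show 3 * Real.log L = ((3 : ℕ) : ℝ) * Real.log L by norm_num, Real.exp_nat_mul,
          Real.exp_log hL0]
      rw [h6]
      have h7 : u ^ 2 ≤ (3 * L ^ 3) ^ 2 := by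
        calc u ^ 2 ≤ (u + 1) ^ 2 := by nlinarith
          _ ≤ 3 * L ^ 5 := this
          _ ≤ 9 * L ^ 5 * L := by nlinarith [pow_pos hL0 5]
          _ = _ := by ring
      exact le_of_sq_le_sq h7 (by positivity)
    have h8 : u * Real.exp (-L) + Real.exp (-(c * vkWidth L * u)) ≤
        4 * (Real.exp (3 * Real.log L) * Real.exp (-(c / 2 * L))) := by
      have e1 : 1 ≤ Real.exp (3 * Real.log L) := Real.one_le_exp (by positivity)
      have e2 : Real.exp (-L) ≤ Real.exp (-(c / 2 * L)) := Real.exp_le_exp.mpr (by nlinarith)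
      have e3 : Real.exp (-(c * vkWidth L * u)) ≤ Real.exp (-(c / 2 * L)) :=
        Real.exp_le_exp.mpr (by nlinarith)
      have e4 := Real.exp_pos (-(c / 2 * L))
      calc _ ≤ 3 * Real.exp (3 * Real.log L) * Real.exp (-(c / 2 * L)) +
            Real.exp (3 * Real.log L) * Real.exp (-(c / 2 * L)) := by
              gcongr
              refine e3.trans ?_
              nlinarith
        _ = _ := by ring
    have h9 := mul_log_le_add (A := A + 3) (ε := c / 4) (by linarith) (by positivity) hL0
    calc C * x * Real.exp (A * Real.log L) *
        (u * Real.exp (-L) + Real.exp (-(c * vkWidth L * u))) ≤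
        C * x * Real.exp (A * Real.log L) *
          (4 * (Real.exp (3 * Real.log L) * Real.exp (-(c / 2 * L)))) := by gcongr
      _ = 4 * C * x * Real.exp ((A + 3) * Real.log L + -(c / 2 * L)) := by
          rw [add_mul, Real.exp_add, Real.exp_add]; ring
      _ ≤ 4 * C * x * Real.exp (K + -(c / 4 * L)) := by
          gcongr 4 * C * x * Real.exp ?_
          linarith
      _ = 4 * C * Real.exp K * x * Real.exp (-(c / 4 * L)) := by rw [Real.exp_add]; ring
      _ ≤ _ := by gcongr; exact le_max_right _ _

/-- The **Vinogradov-Korobov bound** for the Mertens function. -/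
theorem exists_mertens_le : ∃ c C : ℝ, 0 < c ∧ c ≤ 1 / 16 ∧ 0 < C ∧ ∀ x : ℝ, 0 < x →
    |∑ n ∈ Icc 1 ⌊x⌋₊, (ArithmeticFunction.moebius n : ℝ)| ≤
      C * x * Real.exp (-(c * vkPhi (Real.log x))) := by
  obtain ⟨c, C, hc, hc8, hC, hz⟩ := exists_riesz_moebius_le_exp
  refine ⟨c / 2, 5 * C + 4, by positivity, by linarith, by positivity, fun x hx => ?_⟩
  rcases lt_or_ge x 1 with hx1 | hx1
  · rw [Nat.floor_eq_zero.mpr hx1]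
    simp only [zero_lt_one, Icc_eq_empty_of_lt, sum_empty, abs_zero]
    positivity
  set ε := Real.exp (-(c / 2 * vkPhi (Real.log x))) with hε
  have hε0 : 0 < ε := Real.exp_pos _
  have hΦ := vkPhi_pos (Real.log x)
  have hε1 : ε ≤ 1 := Real.exp_le_one_iff.mpr (by nlinarith)
  have hε2 : Real.exp (-(c * vkPhi (Real.log x))) = ε ^ 2 := by
    rw [hε, ← Real.exp_nat_mul]
    congr 1
    push_cast
    ring
  have hlogx : 0 ≤ Real.log x := Real.log_nonneg hx1
  have hxε : 1 ≤ 3 * (x * ε) := by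
    have h1 := vkPhi_le hlogx
    have h2 : Real.exp (-1) ≤ x * ε := by
      conv_rhs => rw [← Real.exp_log hx, hε, ← Real.exp_add]
      rw [Real.exp_le_exp]
      nlinarith
    have h3 : 1 / 3 ≤ Real.exp (-1) := by
      rw [Real.exp_neg, ← one_div]
      gcongr
      linarith [Real.exp_one_lt_d9]
    linarith
  set h := x * ε with hh
  have hh0 : 0 < h := by positivity
  have hhx : h ≤ x := mul_le_of_le_one_right hx.le hε1
  have hI : ∀ y : ℝ, 0 < y →
      y * ∑ n ∈ Icc 1 ⌊y⌋₊, (ArithmeticFunction.moebius n : ℝ) * (1 - n / y) =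
      ∑ n ∈ Icc 1 ⌊y⌋₊, (ArithmeticFunction.moebius n : ℝ) * (y - n) := by
    intro y hy
    rw [mul_sum]
    refine sum_congr rfl fun n _ => ?_
    field_simp
  have hIx : |∑ n ∈ Icc 1 ⌊x⌋₊, (ArithmeticFunction.moebius n : ℝ) * (x - n)| ≤
      C * x ^ 2 * ε ^ 2 := by
    rw [← hI x hx, abs_mul, abs_of_pos hx]
    have := hz x hx
    rw [hε2] at this
    calc _ ≤ x * (C * x * ε ^ 2) := by gcongr
      _ = _ := by ring
  have hIxh : |∑ n ∈ Icc 1 ⌊x + h⌋₊, (ArithmeticFunction.moebius n : ℝ) * (x + h - n)| ≤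
      4 * C * x ^ 2 * ε ^ 2 := by
    rw [← hI (x + h) (by positivity), abs_mul, abs_of_pos (by positivity)]
    have := hz (x + h) (by positivity)
    have hmono : vkPhi (Real.log x) ≤ vkPhi (Real.log (x + h)) :=
      vkPhi_mono (Real.log_le_log hx (by linarith))
    calc _ ≤ (x + h) * (C * (x + h) * Real.exp (-(c * vkPhi (Real.log (x + h))))) := by gcongr
      _ ≤ (2 * x) * (C * (2 * x) * Real.exp (-(c * vkPhi (Real.log x)))) := by
          gcongr <;> linarith
      _ = _ := by rw [hε2]; ring
  have hfl : ⌊x⌋₊ ≤ ⌊x + h⌋₊ := Nat.floor_le_floor (by linarith)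
  have hsplit : ∑ n ∈ Icc 1 ⌊x + h⌋₊, (ArithmeticFunction.moebius n : ℝ) * (x + h - n) =
      ∑ n ∈ Icc 1 ⌊x⌋₊, (ArithmeticFunction.moebius n : ℝ) * (x - n) +
        h * ∑ n ∈ Icc 1 ⌊x⌋₊, (ArithmeticFunction.moebius n : ℝ) +
        ∑ n ∈ Ioc ⌊x⌋₊ ⌊x + h⌋₊, (ArithmeticFunction.moebius n : ℝ) * (x + h - n) := by
    rw [mul_sum, ← sum_add_distrib]
    have : ∀ k : ℕ, Icc 1 k = Ioc 0 k := fun k => rfl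
    rw [this, this, ← sum_Ioc_consecutive _ (Nat.zero_le _) hfl]
    congr 1
    refine sum_congr rfl fun n _ => ?_
    ring
  have hshort : |∑ n ∈ Ioc ⌊x⌋₊ ⌊x + h⌋₊, (ArithmeticFunction.moebius n : ℝ) * (x + h - n)| ≤
      (h + 1) * h := by
    refine (abs_sum_le_sum_abs _ _).trans ?_
    calc _ ≤ ∑ n ∈ Ioc ⌊x⌋₊ ⌊x + h⌋₊, h := by
          refine sum_le_sum fun n hn => ?_
          rw [mem_Ioc] at hn
          have h1 : x < n := (Nat.floor_lt hx.le).mp hn.1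
          have h2 : (n : ℝ) ≤ x + h := (Nat.le_floor_iff (by positivity)).mp hn.2
          rw [abs_mul, abs_of_nonneg (show 0 ≤ x + h - n by linarith)]
          calc _ ≤ 1 * (x + h - n) := by gcongr; exact abs_moebius_le_one' n
            _ ≤ h := by linarith
      _ = ((⌊x + h⌋₊ : ℝ) - ⌊x⌋₊) * h := by
          rw [sum_const, Nat.card_Ioc, nsmul_eq_mul, Nat.cast_sub hfl]
      _ ≤ _ := by
          gcongr
          linarith [Nat.floor_le (show 0 ≤ x + h by positivity), Nat.lt_floor_add_one x]
  have hfin : |h * ∑ n ∈ Icc 1 ⌊x⌋₊, (ArithmeticFunction.moebius n : ℝ)| ≤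
      h * ((5 * C + 4) * x * ε) := by
    have e1 : 5 * C * x ^ 2 * ε ^ 2 + (h + 1) * h ≤ h * ((5 * C + 4) * x * ε) := by
      have e2 : h * ((5 * C + 4) * x * ε) = 5 * C * x ^ 2 * ε ^ 2 + h * (4 * (x * ε)) := by
        rw [hh]; ring
      rw [e2, ← hh]
      nlinarith
    have e3 := abs_le.mp hIx
    have e4 := abs_le.mp hIxh
    have e5 := abs_le.mp hshort
    rw [abs_le]
    constructor <;> linarith
  rw [abs_mul, abs_of_pos hh0] at hfin
  exact le_of_mul_le_mul_left hfin hh0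

/-- The sum of `f n` over the natural numbers `n` exceeding `z`. -/
noncomputable def tail (f : ℕ → ℝ) (z : ℝ) : ℝ := ∑' n : ℕ, if z < n then f n else 0

lemma Summable.ite_real {f : ℕ → ℝ} (hf : Summable f) (P : ℕ → Prop) [DecidablePred P] :
    Summable fun n => if P n then f n else 0 := by
  refine (hf.indicator {n | P n}).congr fun n => ?_
  simp [Set.indicator_apply]

lemma sum_range_tail (f : ℕ → ℝ) {z : ℝ} (hz : 0 ≤ z) (N : ℕ) :
    ∑ n ∈ range (N + 1), (if z < n then f n else 0) = ∑ n ∈ Ioc ⌊z⌋₊ N, f n := by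
  rw [← sum_filter]
  refine sum_congr ?_ fun _ _ => rfl
  ext n
  rw [mem_filter, mem_range, mem_Ioc, Nat.floor_lt hz]
  constructor <;> rintro ⟨h1, h2⟩
  · exact ⟨h2, by omega⟩
  · exact ⟨by omega, h1⟩

lemma tendsto_sum_Ioc_tail {f : ℕ → ℝ} (hf : Summable f) {z : ℝ} (hz : 0 ≤ z) :
    Filter.Tendsto (fun N => ∑ n ∈ Ioc ⌊z⌋₊ N, f n) Filter.atTop (nhds (tail f z)) := by
  have h := (Summable.ite_real hf (fun n : ℕ => z < n)).hasSum.tendsto_sum_nat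
  have h2 := h.comp (Filter.tendsto_add_atTop_nat 1)
  refine h2.congr fun N => ?_
  exact sum_range_tail f hz N

lemma tail_le {f : ℕ → ℝ} (hf : Summable f) {z B : ℝ} (hz : 0 ≤ z)
    (h : ∀ N, ⌊z⌋₊ ≤ N → ∑ n ∈ Ioc ⌊z⌋₊ N, f n ≤ B) : tail f z ≤ B :=
  le_of_tendsto (tendsto_sum_Ioc_tail hf hz) (Filter.eventually_atTop.mpr ⟨_, h⟩)

lemma abs_tail_le {f : ℕ → ℝ} (hf : Summable f) {z B : ℝ} (hz : 0 ≤ z)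
    (h : ∀ N, ⌊z⌋₊ ≤ N → |∑ n ∈ Ioc ⌊z⌋₊ N, f n| ≤ B) : |tail f z| ≤ B :=
  le_of_tendsto (tendsto_sum_Ioc_tail hf hz).abs (Filter.eventually_atTop.mpr ⟨_, h⟩)

lemma abs_sum_mul_le_of_partial_sums {a f : ℕ → ℝ} {B z : ℝ} {m N : ℕ} (hmN : m ≤ N)
    (hB : 0 ≤ B) (hmz : m ≤ z) (hf : ∀ k, m < k → f (k + 1) ≤ f k) (hf0 : ∀ k, 0 ≤ f k)
    (hm : |∑ n ∈ Icc 1 m, a n| ≤ B * z) (hM : ∀ k, m < k → |∑ n ∈ Icc 1 k, a n| ≤ B * k) :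
    |∑ n ∈ Ioc m N, a n * f n| ≤ B * (2 * z * f (m + 1) + ∑ n ∈ Ioc m N, f n) := by
  have hz : 0 ≤ z := (Nat.cast_nonneg m).trans hmz
  set M : ℕ → ℝ := fun k => ∑ n ∈ Icc 1 k, a n with hMdef
  have hMs : ∀ k, M (k + 1) = M k + a (k + 1) := fun k => sum_Icc_succ_top (by omega) _
  have h1 : ∀ N, m ≤ N → ∑ n ∈ Ioc m N, a n * f n =
      M N * f (N + 1) - M m * f (m + 1) + ∑ n ∈ Ioc m N, M n * (f n - f (n + 1)) := by
    intro N hN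
    induction N, hN using Nat.le_induction with
    | base => simp
    | succ k hk ih =>
      rw [sum_Ioc_succ_top (by omega), sum_Ioc_succ_top (by omega), ih, hMs k]
      ring
  have h2 : ∀ N, m ≤ N → ∑ n ∈ Ioc m N, (n : ℝ) * (f n - f (n + 1)) =
      m * f (m + 1) - N * f (N + 1) + ∑ n ∈ Ioc m N, f n := by
    intro N hN
    induction N, hN using Nat.le_induction with
    | base => simp
    | succ k hk ih =>
      rw [sum_Ioc_succ_top (by omega), sum_Ioc_succ_top (by omega), ih]
      push_cast
      ring
  rcases hmN.eq_or_lt with rfl | hlt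
  · simp only [Ioc_self, sum_empty, abs_zero, add_zero]
    have := hf0 (m + 1)
    positivity
  have h3 : |∑ n ∈ Ioc m N, M n * (f n - f (n + 1))| ≤
      B * ∑ n ∈ Ioc m N, (n : ℝ) * (f n - f (n + 1)) := by
    refine (abs_sum_le_sum_abs _ _).trans ?_
    rw [mul_sum]
    refine sum_le_sum fun n hn => ?_
    have hn' := (mem_Ioc.mp hn).1
    rw [abs_mul, abs_of_nonneg (sub_nonneg.mpr (hf n hn')), ← mul_assoc]
    exact mul_le_mul_of_nonneg_right (hM n hn') (sub_nonneg.mpr (hf n hn'))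
  have h4 : |M N * f (N + 1)| ≤ B * N * f (N + 1) := by
    rw [abs_mul, abs_of_nonneg (hf0 _)]
    exact mul_le_mul_of_nonneg_right (hM N hlt) (hf0 _)
  have h5 : |M m * f (m + 1)| ≤ B * z * f (m + 1) := by
    rw [abs_mul, abs_of_nonneg (hf0 _)]
    exact mul_le_mul_of_nonneg_right hm (hf0 _)
  have h6 : B * (m * f (m + 1)) ≤ B * (z * f (m + 1)) := by
    have := hf0 (m + 1)
    gcongr
  rw [h2 N hmN] at h3
  rw [h1 N hmN]
  have e3 := abs_le.mp h3
  have e4 := abs_le.mp h4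
  have e5 := abs_le.mp h5
  rw [abs_le]
  constructor <;> linarith

lemma sum_Ioc_inv_sq_le_two_div {z : ℝ} (hz : 0 < z) {N : ℕ} (hN : ⌊z⌋₊ ≤ N) :
    ∑ n ∈ Ioc ⌊z⌋₊ N, 1 / (n : ℝ) ^ 2 ≤ 2 / z := by
  have hlt := Nat.lt_floor_add_one z
  rcases Nat.eq_zero_or_pos ⌊z⌋₊ with h0 | h0
  · rw [h0] at hlt ⊢
    have hz1 : z < 1 := by simpa using hlt
    have h2 : 2 ≤ 2 / z := by
      rw [le_div_iff₀ hz]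
      linarith
    refine le_trans ?_ h2
    rcases Nat.eq_zero_or_pos N with hN0 | hN0
    · simp [hN0]
    · rw [← sum_Ioc_consecutive _ (Nat.zero_le 1) hN0]
      have := sum_Ioc_inv_sq_le_sub (α := ℝ) (k := 1) (n := N) one_ne_zero hN0
      simp only [one_div]
      have h3 : (0 : ℝ) ≤ (N : ℝ)⁻¹ := by positivity
      have h4 : ∑ i ∈ Ioc (0 : ℕ) 1, ((i : ℝ) ^ 2)⁻¹ = 1 := by simp
      rw [h4]
      push_cast at this
      linarith
  · have := sum_Ioc_inv_sq_le_sub (α := ℝ) (k := ⌊z⌋₊) (n := N) h0.ne' hN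
    simp only [one_div]
    refine this.trans ?_
    have h3 : (0 : ℝ) ≤ (N : ℝ)⁻¹ := by positivity
    have h4 : (1 : ℝ) ≤ ⌊z⌋₊ := by exact_mod_cast h0
    have h5 : ((⌊z⌋₊ : ℝ))⁻¹ ≤ 2 / z := by
      rw [inv_eq_one_div, div_le_div_iff₀ (by linarith) hz]
      linarith
    linarith

lemma sum_Ioc_inv_pow_le {z : ℝ} (hz : 0 < z) (j : ℕ) {N : ℕ} (hN : ⌊z⌋₊ ≤ N) :
    ∑ n ∈ Ioc ⌊z⌋₊ N, 1 / (n : ℝ) ^ (j + 2) ≤ 2 / z ^ (j + 1) := by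
  calc _ ≤ ∑ n ∈ Ioc ⌊z⌋₊ N, 1 / z ^ j * (1 / (n : ℝ) ^ 2) := by
        refine sum_le_sum fun n hn => ?_
        have h1 : z < n := (Nat.floor_lt hz.le).mp (mem_Ioc.mp hn).1
        have hn0 : (0 : ℝ) < n := hz.trans h1
        rw [pow_add, ← one_div_mul_one_div]
        gcongr
    _ ≤ 1 / z ^ j * (2 / z) := by
        rw [← mul_sum]
        have := sum_Ioc_inv_sq_le_two_div hz hN
        gcongr
    _ = _ := by
        rw [pow_succ]
        field_simp

lemma summable_inv_pow (j : ℕ) : Summable fun n : ℕ => 1 / (n : ℝ) ^ (j + 2) :=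
  Real.summable_one_div_nat_pow.mpr (by omega)

lemma tail_inv_pow_le {z : ℝ} (hz : 0 < z) (j : ℕ) :
    tail (fun n => 1 / (n : ℝ) ^ (j + 2)) z ≤ 2 / z ^ (j + 1) :=
  tail_le (summable_inv_pow j) hz.le fun _ hN => sum_Ioc_inv_pow_le hz j hN

lemma abs_tail_inv_sq_sub_le {z : ℝ} (hz : 0 < z) :
    |tail (fun n => 1 / (n : ℝ) ^ 2) z - 1 / z| ≤ 2 / z ^ 2 := by
  have hlt := Nat.lt_floor_add_one z
  have hle := Nat.floor_le hz.le
  set m := ⌊z⌋₊ with hm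
  have hlow : 1 / ((m : ℝ) + 1) ≤ tail (fun n => 1 / (n : ℝ) ^ 2) z := by
    have h1 : ∀ N, m ≤ N → 1 / ((m : ℝ) + 1) - 1 / ((N : ℝ) + 1) ≤
        ∑ n ∈ Ioc m N, 1 / (n : ℝ) ^ 2 := by
      intro N hN
      induction N, hN using Nat.le_induction with
      | base => simp
      | succ k hk ih =>
        rw [sum_Ioc_succ_top (by omega)]
        have : 1 / ((k : ℝ) + 1) - 1 / (((k + 1 : ℕ) : ℝ) + 1) ≤ 1 / ((k + 1 : ℕ) : ℝ) ^ 2 := by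
          push_cast
          rw [div_sub_div _ _ (by positivity) (by positivity),
            div_le_div_iff₀ (by positivity) (by positivity)]
          nlinarith
        linarith
    have h2 : Filter.Tendsto (fun N : ℕ => 1 / ((m : ℝ) + 1) - 1 / ((N : ℝ) + 1)) Filter.atTop
        (nhds (1 / ((m : ℝ) + 1) - 0)) :=
      tendsto_one_div_add_atTop_nhds_zero_nat.const_sub _
    rw [sub_zero] at h2
    exact le_of_tendsto_of_tendsto h2 (tendsto_sum_Ioc_tail (summable_inv_pow 0) hz.le)
      (Filter.eventually_atTop.mpr ⟨m, h1⟩)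
  have hup : tail (fun n => 1 / (n : ℝ) ^ 2) z ≤ 1 / z + 2 / z ^ 2 := by
    rcases Nat.eq_zero_or_pos m with h0 | h0
    · have hz1 : z < 1 := by
        rw [h0] at hlt
        simpa using hlt
      have h1 := tail_inv_pow_le hz 0
      have h2 : 2 / z ^ (0 + 1) ≤ 2 / z ^ 2 := by
        exact div_le_div_of_nonneg_left (by norm_num) (by positivity)
          (pow_le_pow_of_le_one hz.le hz1.le (by norm_num))
      have h3 : 0 ≤ 1 / z := by positivity
      exact h1.trans (by linarith)
    · have h4 : (1 : ℝ) ≤ m := by exact_mod_cast h0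
      refine tail_le (summable_inv_pow 0) hz.le fun N hN => ?_
      have := sum_Ioc_inv_sq_le_sub (α := ℝ) (k := m) (n := N) h0.ne' hN
      simp only [zero_add, one_div] at this ⊢
      refine this.trans ?_
      have h3 : (0 : ℝ) ≤ (N : ℝ)⁻¹ := by positivity
      have h5 : ((m : ℝ))⁻¹ ≤ z⁻¹ + 2 / z ^ 2 := by
        have h6 : z⁻¹ + 2 / z ^ 2 = (z + 2) / z ^ 2 := by field_simp
        rw [h6, inv_eq_one_div, div_le_div_iff₀ (by linarith) (by positivity)]
        nlinarith
      linarith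
  have h7 : 1 / z - 1 / ((m : ℝ) + 1) ≤ 2 / z ^ 2 := by
    have hm0 : (0 : ℝ) < (m : ℝ) + 1 := by positivity
    rw [div_sub_div _ _ hz.ne' hm0.ne', div_le_div_iff₀ (by positivity) (by positivity)]
    nlinarith [mul_pos hz hz, mul_pos hz hm0]
  rw [abs_le]
  constructor <;> linarith

lemma abs_moebius_div_le (n k : ℕ) :
    |(ArithmeticFunction.moebius n : ℝ) / (n : ℝ) ^ k| ≤ 1 / (n : ℝ) ^ k := by
  rw [abs_div, abs_of_nonneg (show (0 : ℝ) ≤ (n : ℝ) ^ k by positivity)]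
  gcongr
  exact abs_moebius_le_one' n

lemma summable_moebius_div (j : ℕ) :
    Summable fun n : ℕ => (ArithmeticFunction.moebius n : ℝ) / (n : ℝ) ^ (j + 2) :=
  Summable.of_norm_bounded (summable_inv_pow j) fun n => abs_moebius_div_le n _

theorem exists_tail_moebius_le : ∃ c C : ℝ, 0 < c ∧ c ≤ 1 / 16 ∧ 0 < C ∧ ∀ (j : ℕ) (z : ℝ), 0 < z →
    |tail (fun n => (ArithmeticFunction.moebius n : ℝ) / (n : ℝ) ^ (j + 2)) z| ≤
      C / z ^ (j + 1) * Real.exp (-(c * vkPhi (Real.log z))) := by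
  obtain ⟨c, C, hc, hc16, hC, hM⟩ := exists_mertens_le
  refine ⟨c, 4 * C, hc, hc16, by positivity, fun j z hz => ?_⟩
  refine abs_tail_le (summable_moebius_div j) hz.le fun N hN => ?_
  set B := C * Real.exp (-(c * vkPhi (Real.log z))) with hB
  have hB0 : 0 < B := by positivity
  have h1 := abs_sum_mul_le_of_partial_sums (a := fun n => (ArithmeticFunction.moebius n : ℝ))
    (f := fun n => 1 / (n : ℝ) ^ (j + 2)) (B := B) (z := z) hN hB0.le (Nat.floor_le hz.le)
    (fun k hk => by
      have hk0 : 0 < k := by omega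
      have : (0 : ℝ) < k := by exact_mod_cast hk0
      push_cast
      gcongr
      linarith) (fun k => by positivity)
    (by
      refine (hM z hz).trans (le_of_eq ?_)
      rw [hB]; ring)
    (fun k hk => by
      have hzk : z < k := (Nat.floor_lt hz.le).mp hk
      have hk0 : (0 : ℝ) < k := hz.trans hzk
      have := hM k hk0
      rw [Nat.floor_natCast] at this
      have hmono : vkPhi (Real.log z) ≤ vkPhi (Real.log k) := vkPhi_mono (Real.log_le_log hz hzk.le)
      calc _ ≤ C * k * Real.exp (-(c * vkPhi (Real.log k))) := this
        _ ≤ C * k * Real.exp (-(c * vkPhi (Real.log z))) := by gcongr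
        _ = _ := by rw [hB]; ring)
  simp only [mul_one_div] at h1
  refine h1.trans ?_
  have h2 := sum_Ioc_inv_pow_le hz j hN
  have h3 : z / (((⌊z⌋₊ + 1 : ℕ) : ℝ) ^ (j + 2)) ≤ 1 / z ^ (j + 1) := by
    have hlt : z ≤ ((⌊z⌋₊ + 1 : ℕ) : ℝ) := by
      push_cast
      exact (Nat.lt_floor_add_one z).le
    calc _ ≤ z / z ^ (j + 2) := by gcongr
      _ = _ := by rw [pow_succ z (j + 1)]; field_simp
  calc _ ≤ B * (2 * (1 / z ^ (j + 1)) + 2 / z ^ (j + 1)) := by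
        gcongr B * (?_ + ?_)
        calc _ = 2 * (z / (((⌊z⌋₊ + 1 : ℕ) : ℝ) ^ (j + 2))) := by ring
          _ ≤ _ := by gcongr
    _ = _ := by rw [hB]; ring

lemma tail_eq_sub {f : ℕ → ℝ} (hf : Summable f) (h0 : f 0 = 0) {z : ℝ} (hz : 0 ≤ z) :
    tail f z = ∑' n, f n - ∑ n ∈ Icc 1 ⌊z⌋₊, f n := by
  have h1 := tendsto_sum_Ioc_tail hf hz
  have h2 := (hf.hasSum.tendsto_sum_nat.comp (Filter.tendsto_add_atTop_nat 1)).sub_const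
    (∑ n ∈ Icc 1 ⌊z⌋₊, f n)
  refine tendsto_nhds_unique h1 (h2.congr' ?_)
  filter_upwards [Filter.eventually_ge_atTop ⌊z⌋₊] with N hN
  simp only [Function.comp_apply]
  rw [sum_range_succ', h0, add_zero, range_eq_Ico, sum_Ico_add' f 0 N 1]
  have e1 : Ico (0 + 1) (N + 1) = Ioc 0 N := by ext; simp only [mem_Ico, mem_Ioc]; omega
  have e2 : Icc 1 ⌊z⌋₊ = Ioc 0 ⌊z⌋₊ := rfl
  rw [e1, e2, ← sum_Ioc_consecutive f (Nat.zero_le _) hN]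
  ring

lemma tail_nonneg {f : ℕ → ℝ} (hf : ∀ n, 0 ≤ f n) (z : ℝ) : 0 ≤ tail f z :=
  tsum_nonneg fun n => by split_ifs <;> simp [hf n]

lemma tail_le_tsum {f : ℕ → ℝ} (hs : Summable f) (hf : ∀ n, 0 ≤ f n) (z : ℝ) :
    tail f z ≤ ∑' n, f n :=
  Summable.tsum_le_tsum (fun n => by split_ifs <;> simp [hf n])
    (Summable.ite_real hs _) hs

lemma tsum_inv_sq : ∑' n : ℕ, 1 / (n : ℝ) ^ 2 = Real.pi ^ 2 / 6 := hasSum_zeta_two.tsum_eq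

lemma tsum_inv_sq_le : ∑' n : ℕ, 1 / (n : ℝ) ^ 2 ≤ 2 := by
  rw [tsum_inv_sq]
  nlinarith [Real.pi_lt_d2, Real.pi_pos]

lemma tsum_moebius_div_sq :
    ∑' n : ℕ, (ArithmeticFunction.moebius n : ℝ) / (n : ℝ) ^ 2 = 6 / Real.pi ^ 2 := by
  have h1 := LSeries_one_mul_Lseries_moebius (s := 2) (by norm_num)
  rw [LSeries_one_eq_riemannZeta (by norm_num), riemannZeta_two] at h1
  have h2 : LSeries (fun n => (ArithmeticFunction.moebius n : ℂ)) 2 =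
      ((∑' n : ℕ, (ArithmeticFunction.moebius n : ℝ) / (n : ℝ) ^ 2 : ℝ) : ℂ) := by
    rw [LSeries, Complex.ofReal_tsum]
    refine tsum_congr fun n => ?_
    rcases eq_or_ne n 0 with rfl | hn
    · simp
    · rw [LSeries.term_of_ne_zero hn]
      push_cast
      congr 1
      exact_mod_cast Complex.cpow_natCast (n : ℂ) 2
  have h2' := h2
  rw [h2'] at h1
  have h3 : Real.pi ^ 2 / 6 * ∑' n : ℕ, (ArithmeticFunction.moebius n : ℝ) / (n : ℝ) ^ 2 = 1 := by
    exact_mod_cast h1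
  have hpi := Real.pi_pos
  rw [eq_div_iff (by positivity)]
  linarith

lemma sum_divisors_moebius (b : ℕ) :
    ∑ d ∈ b.divisors, (ArithmeticFunction.moebius d : ℝ) = if b = 1 then 1 else 0 := by
  have h : ∑ d ∈ b.divisors, ArithmeticFunction.moebius d = if b = 1 then 1 else 0 := by
    rw [← ArithmeticFunction.coe_mul_zeta_apply, ArithmeticFunction.moebius_mul_coe_zeta,
      ArithmeticFunction.one_apply]
  exact_mod_cast h

lemma tsum_moebius_sq_dvd {n : ℕ} (hn : n ≠ 0) :
    ∑' d : ℕ, (if d ^ 2 ∣ n then (ArithmeticFunction.moebius d : ℝ) else 0) =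
      (ArithmeticFunction.moebius n : ℝ) ^ 2 := by
  obtain ⟨a, b, hab, ha⟩ := Nat.sq_mul_squarefree n
  have hb0 : b ≠ 0 := by
    rintro rfl
    simp at hab
    exact hn hab.symm
  have hdvd : ∀ d : ℕ, d ^ 2 ∣ n ↔ d ∣ b := by
    intro d
    refine ⟨fun h => ?_, fun h => hab ▸ (pow_dvd_pow_of_dvd h 2).mul_right a⟩
    obtain ⟨d', b', hcop, hd, hb⟩ := Nat.exists_coprime d b
    have hg : 0 < Nat.gcd d b := Nat.gcd_pos_of_pos_right _ (Nat.pos_of_ne_zero hb0)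
    have h1 : d' ^ 2 ∣ a := by
      have h2 : d' ^ 2 * Nat.gcd d b ^ 2 ∣ b' ^ 2 * a * Nat.gcd d b ^ 2 := by
        calc d' ^ 2 * Nat.gcd d b ^ 2 = d ^ 2 := by rw [← mul_pow, ← hd]
          _ ∣ n := h
          _ = (b' * Nat.gcd d b) ^ 2 * a := by rw [← hb, hab]
          _ = _ := by ring
      have h3 := Nat.dvd_of_mul_dvd_mul_right (by positivity) h2
      exact (Nat.Coprime.pow 2 2 hcop).dvd_of_dvd_mul_left h3
    have h4 : d' = 1 := by
      have := ha d' (by rwa [← sq])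
      exact Nat.isUnit_iff.mp this
    rw [hd, h4, one_mul]
    exact Nat.gcd_dvd_right d b
  rw [tsum_eq_sum (s := b.divisors)]
  · have h5 : ∑ d ∈ b.divisors, (if d ^ 2 ∣ n then (ArithmeticFunction.moebius d : ℝ) else 0) =
        ∑ d ∈ b.divisors, (ArithmeticFunction.moebius d : ℝ) :=
      sum_congr rfl fun d hd => if_pos ((hdvd d).mpr (Nat.dvd_of_mem_divisors hd))
    rw [h5, sum_divisors_moebius]
    split_ifs with hb
    · have hsq : Squarefree n := by
        rw [← hab, hb]
        simpa using ha
      exact_mod_cast (ArithmeticFunction.moebius_sq_eq_one_of_squarefree hsq).symm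
    · have hsq : ¬ Squarefree n := fun h => hb (by
        have := h b (by rw [← sq]; exact (hdvd b).mpr dvd_rfl)
        exact Nat.isUnit_iff.mp this)
      rw [ArithmeticFunction.moebius_eq_zero_of_not_squarefree hsq]
      simp
  · intro d hd
    refine if_neg fun h => hd ?_
    exact Nat.mem_divisors.mpr ⟨(hdvd d).mp h, hb0⟩

lemma tsum_ite_dvd {k : ℕ} (hk : 0 < k) (f : ℕ → ℝ) :
    ∑' n : ℕ, (if k ∣ n then f n else 0) = ∑' m : ℕ, f (k * m) := by
  have hinj : Function.Injective fun m : ℕ => k * m := mul_right_injective₀ hk.ne'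
  rw [← hinj.tsum_eq]
  · exact tsum_congr fun m => if_pos (dvd_mul_right k m)
  · intro n hn
    have : k ∣ n := by
      by_contra h
      exact hn (if_neg h)
    obtain ⟨m, rfl⟩ := this
    exact ⟨m, rfl⟩

lemma tail_inv_sq_scale {k : ℕ} (hk : 0 < k) (y : ℝ) :
    ∑' m : ℕ, (if y < ((k * m : ℕ) : ℝ) then 1 / ((k * m : ℕ) : ℝ) ^ 2 else 0) =
      1 / (k : ℝ) ^ 2 * tail (fun n => 1 / (n : ℝ) ^ 2) (y / k) := by
  rw [tail, ← tsum_mul_left]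
  refine tsum_congr fun m => ?_
  have hk0 : (0 : ℝ) < k := by exact_mod_cast hk
  have : y < ((k * m : ℕ) : ℝ) ↔ y / k < m := by
    push_cast
    rw [div_lt_iff₀ hk0, mul_comm]
  simp only [this]
  split_ifs
  · push_cast
    rw [mul_pow, one_div_mul_one_div]
  · simp

lemma summable_moebius_mul_tail (y : ℝ) : Summable fun d : ℕ =>
    (ArithmeticFunction.moebius d : ℝ) / (d : ℝ) ^ 4 *
      tail (fun n => 1 / (n : ℝ) ^ 2) (y / (d : ℝ) ^ 2) := by
  refine Summable.of_norm_bounded ((summable_inv_pow 2).mul_right 2) fun d => ?_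
  rw [Real.norm_eq_abs, abs_mul, abs_of_nonneg (tail_nonneg (fun n => by positivity) _)]
  gcongr
  · exact tail_nonneg (fun n => by positivity) _
  · exact abs_moebius_div_le d _
  · exact (tail_le_tsum (summable_inv_pow 0) (fun n => by positivity) _).trans tsum_inv_sq_le

lemma summable_ite_sq_dvd {a h : ℕ → ℝ} {K : ℝ} (hs : Summable h) (h0 : ∀ n, 0 ≤ h n)
    (ha : ∀ d, |a d| ≤ 1) (ha0 : a 0 = 0)
    (hrow : ∀ d : ℕ, 0 < d → ∑' n, (if d ^ 2 ∣ n then h n else 0) ≤ K * (1 / (d : ℝ) ^ 4)) :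
    Summable fun p : ℕ × ℕ => if p.1 ^ 2 ∣ p.2 then a p.1 * h p.2 else 0 := by
  have hnn : ∀ d n : ℕ, 0 ≤ if d ^ 2 ∣ n then |a d| * h n else 0 := fun d n => by
    have := h0 n
    split_ifs <;> positivity
  have hs2 : Summable fun p : ℕ × ℕ => if p.1 ^ 2 ∣ p.2 then |a p.1| * h p.2 else 0 := by
    refine (summable_prod_of_nonneg fun p => hnn p.1 p.2).mpr
      ⟨fun d => Summable.ite_real (hs.mul_left |a d|) (fun n => d ^ 2 ∣ n), ?_⟩
    refine Summable.of_nonneg_of_le (fun d => tsum_nonneg fun n => hnn d n) (fun d => ?_)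
      ((summable_inv_pow 2).mul_left |K|)
    have e1 : ∀ n : ℕ, (if d ^ 2 ∣ n then |a d| * h n else 0) =
        |a d| * (if d ^ 2 ∣ n then h n else 0) := by
      intro n
      split_ifs <;> simp
    simp only [e1]
    rw [tsum_mul_left]
    rcases Nat.eq_zero_or_pos d with rfl | hd
    · simp [ha0]
    · have h1 : 0 ≤ ∑' n, (if d ^ 2 ∣ n then h n else 0) := tsum_nonneg fun n => by
        have := h0 n
        split_ifs <;> positivity
      calc _ ≤ 1 * (K * (1 / (d : ℝ) ^ 4)) := mul_le_mul (ha d) (hrow d hd) h1 zero_le_one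
        _ ≤ _ := by
          rw [one_mul]
          gcongr
          exact le_abs_self K
  refine Summable.of_norm_bounded hs2 fun p => ?_
  split_ifs
  · rw [Real.norm_eq_abs, abs_mul, abs_of_nonneg (h0 _)]
  · simp

lemma tail_moebius_sq_eq (y : ℝ) :
    tail (fun n => (ArithmeticFunction.moebius n : ℝ) ^ 2 / (n : ℝ) ^ 2) y =
      ∑' d : ℕ, (ArithmeticFunction.moebius d : ℝ) / (d : ℝ) ^ 4 *
        tail (fun n => 1 / (n : ℝ) ^ 2) (y / (d : ℝ) ^ 2) := by
  set h : ℕ → ℝ := fun n => if y < n then 1 / (n : ℝ) ^ 2 else 0 with hh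
  have hh0 : ∀ n, 0 ≤ h n := fun n => by
    simp only [hh]
    split_ifs <;> positivity
  have hhs : Summable h := Summable.ite_real (summable_inv_pow 0) _
  have hz : h 0 = 0 := by simp [hh]
  have hrow : ∀ (α : ℝ) (d : ℕ), 0 < d → ∑' n, (if d ^ 2 ∣ n then α * h n else 0) =
      α / (d : ℝ) ^ 4 * tail (fun n => 1 / (n : ℝ) ^ 2) (y / (d : ℝ) ^ 2) := by
    intro α d hd
    rw [tsum_ite_dvd (by positivity), tsum_mul_left, hh]
    simp only
    rw [tail_inv_sq_scale (by positivity)]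
    push_cast
    ring
  have hsum : Summable fun p : ℕ × ℕ =>
      if p.1 ^ 2 ∣ p.2 then (ArithmeticFunction.moebius p.1 : ℝ) * h p.2 else 0 := by
    refine summable_ite_sq_dvd (a := fun d => (ArithmeticFunction.moebius d : ℝ)) (h := h) (K := 2)
      hhs hh0 abs_moebius_le_one' (by simp) fun d hd => ?_
    have h1 := hrow 1 d hd
    simp only [one_mul] at h1
    have h2 : tail (fun n => 1 / (n : ℝ) ^ 2) (y / (d : ℝ) ^ 2) ≤ 2 :=
      (tail_le_tsum (summable_inv_pow 0) (fun n => by positivity) _).trans tsum_inv_sq_le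
    rw [h1, mul_comm]
    gcongr
  have hcomm := Summable.tsum_comm (f := fun d n : ℕ =>
    if d ^ 2 ∣ n then (ArithmeticFunction.moebius d : ℝ) * h n else 0) hsum
  have hL : tail (fun n => (ArithmeticFunction.moebius n : ℝ) ^ 2 / (n : ℝ) ^ 2) y =
      ∑' n : ℕ, ∑' d : ℕ, if d ^ 2 ∣ n then (ArithmeticFunction.moebius d : ℝ) * h n else 0 := by
    refine tsum_congr fun n => ?_
    have e1 : ∀ d : ℕ, (if d ^ 2 ∣ n then (ArithmeticFunction.moebius d : ℝ) * h n else 0) =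
        (if d ^ 2 ∣ n then (ArithmeticFunction.moebius d : ℝ) else 0) * h n := by
      intro d
      split_ifs <;> simp
    simp only [e1]
    rw [tsum_mul_right]
    rcases eq_or_ne n 0 with rfl | hn
    · simp [hz]
    · rw [tsum_moebius_sq_dvd hn]
      simp only [hh]
      split_ifs
      · ring
      · simp
  rw [hL, hcomm]
  refine tsum_congr fun d => ?_
  rcases Nat.eq_zero_or_pos d with rfl | hd
  · simp
  · exact hrow _ d hd

lemma tail_moebius_mul_tail_eq (y : ℝ) {D : ℝ} (hD : 0 < D) :
    tail (fun d => (ArithmeticFunction.moebius d : ℝ) / (d : ℝ) ^ 4 *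
        tail (fun n => 1 / (n : ℝ) ^ 2) (y / (d : ℝ) ^ 2)) D =
      ∑' m : ℕ, 1 / (m : ℝ) ^ 2 *
        tail (fun d => (ArithmeticFunction.moebius d : ℝ) / (d : ℝ) ^ 4) (max D (√(y / m))) := by
  have hprod : Summable fun p : ℕ × ℕ => 1 / (p.1 : ℝ) ^ 4 * (1 / (p.2 : ℝ) ^ 2) :=
    (summable_inv_pow 2).mul_of_nonneg (summable_inv_pow 0) (fun n => by positivity)
      (fun n => by positivity)
  have hsum : Summable fun p : ℕ × ℕ =>
      if D < p.1 ∧ y / (p.1 : ℝ) ^ 2 < p.2 then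
        (ArithmeticFunction.moebius p.1 : ℝ) / (p.1 : ℝ) ^ 4 * (1 / (p.2 : ℝ) ^ 2) else 0 := by
    refine Summable.of_norm_bounded hprod fun p => ?_
    split_ifs
    · rw [Real.norm_eq_abs, abs_mul,
        abs_of_nonneg (show 0 ≤ 1 / (p.2 : ℝ) ^ 2 by positivity)]
      gcongr
      exact abs_moebius_div_le _ _
    · rw [norm_zero]
      positivity
  have hcomm := Summable.tsum_comm (f := fun d m : ℕ =>
    if D < d ∧ y / (d : ℝ) ^ 2 < m then
        (ArithmeticFunction.moebius d : ℝ) / (d : ℝ) ^ 4 * (1 / (m : ℝ) ^ 2) else 0) hsum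
  refine Eq.trans ?_ (hcomm.symm.trans ?_)
  · refine tsum_congr fun d => ?_
    by_cases h : D < d
    · rw [if_pos h]
      unfold tail
      beta_reduce
      rw [← tsum_mul_left]
      refine tsum_congr fun m => ?_
      simp only [h, true_and]
      split_ifs <;> simp
    · simp [h]
  · refine tsum_congr fun m => ?_
    rcases Nat.eq_zero_or_pos m with rfl | hm
    · simp
    · rw [tail, ← tsum_mul_left]
      refine tsum_congr fun d => ?_
      have hm0 : (0 : ℝ) < m := by exact_mod_cast hm
      have hiff : D < d ∧ y / (d : ℝ) ^ 2 < m ↔ max D (√(y / m)) < d := by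
        rw [max_lt_iff]
        refine and_congr_right fun h => ?_
        have hd : (0 : ℝ) < d := hD.trans h
        rw [Real.sqrt_lt' hd, div_lt_iff₀ (by positivity), div_lt_iff₀ hm0, mul_comm]
      simp only [hiff]
      split_ifs <;> ring

theorem exists_squarefree_tail_le : ∃ c C : ℝ, 0 < c ∧ c ≤ 1 / 256 ∧ 0 < C ∧ ∀ y : ℝ, 0 < y →
    |tail (fun n => (ArithmeticFunction.moebius n : ℝ) ^ 2 / (n : ℝ) ^ 2) y -
      6 / Real.pi ^ 2 / y| ≤ C * (Real.exp (-(c * vkPhi (Real.log y))) / (y * √y)) := by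
  obtain ⟨c₀, C, hc₀, hc16, hC, hS⟩ := exists_tail_moebius_le
  have hpi : 6 / Real.pi ^ 2 ≤ 1 := by
    rw [div_le_one (by positivity)]
    nlinarith [Real.pi_gt_three]
  have hpi0 : 0 < 6 / Real.pi ^ 2 := by have := Real.pi_pos; positivity
  refine ⟨c₀ / 16, 3 * C * Real.exp 1 + 9, by positivity, by linarith, by positivity,
    fun y hy => ?_⟩
  set Φ := vkPhi (Real.log y) with hΦ
  set ε := Real.exp (-(c₀ / 16 * Φ)) with hε
  have hε0 : 0 < ε := Real.exp_pos _
  have hΦ0 : 0 < Φ := vkPhi_pos _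
  have hsy : 0 < √y := Real.sqrt_pos.mpr hy
  have hsy2 : √y * √y = y := Real.mul_self_sqrt hy.le
  rcases lt_or_ge y 1 with hy1 | hy1
  · have h1 : tail (fun n => (ArithmeticFunction.moebius n : ℝ) ^ 2 / (n : ℝ) ^ 2) y ≤ 2 := by
      have hle : ∀ n : ℕ, (ArithmeticFunction.moebius n : ℝ) ^ 2 / (n : ℝ) ^ 2 ≤
          1 / (n : ℝ) ^ 2 := fun n => by
        gcongr
        exact (sq_le_one_iff_abs_le_one _).mpr (abs_moebius_le_one' n)
      have hs : Summable fun n : ℕ => (ArithmeticFunction.moebius n : ℝ) ^ 2 / (n : ℝ) ^ 2 :=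
        Summable.of_nonneg_of_le (fun n => by positivity) hle (summable_inv_pow 0)
      exact (tail_le_tsum hs (fun n => by positivity) y).trans
        ((Summable.tsum_le_tsum hle hs (summable_inv_pow 0)).trans tsum_inv_sq_le)
    have h2 : 0 ≤ tail (fun n => (ArithmeticFunction.moebius n : ℝ) ^ 2 / (n : ℝ) ^ 2) y :=
      tail_nonneg (fun n => by positivity) y
    have hΦ1 : Φ ≤ 1 := by
      have e1 := vkPhi_mono (Real.log_nonpos hy.le hy1.le)
      have e2 := vkPhi_le le_rfl
      linarith
    have hε3 : 1 / 3 ≤ ε := by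
      have : Real.exp (-1) ≤ ε := Real.exp_le_exp.mpr (by nlinarith)
      refine le_trans ?_ this
      rw [Real.exp_neg, ← one_div]
      gcongr
      linarith [Real.exp_one_lt_d9]
    have hs1 : √y ≤ 1 := Real.sqrt_le_one.mpr hy1.le
    have h3 : 1 / y ≤ 1 / (y * √y) :=
      one_div_le_one_div_of_le (by positivity) (mul_le_of_le_one_right hy.le hs1)
    have h4 : 1 ≤ 1 / y := by
      rw [le_div_iff₀ hy]
      linarith
    have h5 : 6 / Real.pi ^ 2 / y ≤ 1 / y := by gcongr
    have h6 : 0 ≤ 6 / Real.pi ^ 2 / y := by positivity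
    calc _ ≤ 2 + 1 / y := by
          rw [abs_le]
          constructor <;> linarith
      _ ≤ 3 * (1 / (y * √y)) := by linarith
      _ ≤ 9 * (ε / (y * √y)) := by
          rw [mul_one_div, ← mul_div_assoc]
          gcongr
          linarith
      _ ≤ _ := by
          gcongr
          linarith [show 0 ≤ 3 * C * Real.exp 1 by positivity]
  have hL0 : 0 ≤ Real.log y := Real.log_nonneg hy1
  set D := √y * ε with hD
  have hD0 : 0 < D := by positivity
  have hlogD : Real.log D = Real.log y / 2 - c₀ / 16 * Φ := by
    rw [hD, Real.log_mul hsy.ne' hε0.ne', Real.log_sqrt hy.le, hε, Real.log_exp]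
    ring
  set G := Real.exp (-(c₀ * vkPhi (Real.log D))) with hG
  have hG0 : 0 < G := Real.exp_pos _
  have hGle : G ≤ Real.exp 1 * ε ^ 4 := by
    have h1 : vkPhi (Real.log y / 4) - 1 ≤ vkPhi (Real.log D) := by
      rcases le_total (Real.log y / 4) (Real.log D) with h | h
      · linarith [vkPhi_mono h]
      · have h2 := vkPhi_le_add h
        have h3 : Φ ≤ Real.log y + 1 := vkPhi_le hL0
        have h4 : Real.log y / 4 - Real.log D ≤ 1 := by
          rw [hlogD]
          nlinarith
        linarith
    have h2 : Φ ≤ 4 * vkPhi (Real.log y / 4) := vkPhi_le_mul hL0 (by norm_num)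
    rw [hG, hε, ← Real.exp_nat_mul, ← Real.exp_add]
    apply Real.exp_le_exp.mpr
    push_cast
    nlinarith
  have hs4 := hS 2
  have hs2 := hS 0 D hD0
  rw [← hG] at hs2
  simp only [zero_add, pow_one] at hs2
  rw [tail_moebius_sq_eq y]
  have hsum := summable_moebius_mul_tail y
  have hsplit := tail_eq_sub hsum (by simp) hD0.le
  have hsplit2 := tail_eq_sub (summable_moebius_div 0) (by simp) hD0.le
  simp only [zero_add] at hsplit2
  rw [tsum_moebius_div_sq] at hsplit2
  have htail : |tail (fun d => (ArithmeticFunction.moebius d : ℝ) / (d : ℝ) ^ 4 *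
      tail (fun n => 1 / (n : ℝ) ^ 2) (y / (d : ℝ) ^ 2)) D| ≤ 2 * (C / D ^ 3 * G) := by
    rw [tail_moebius_mul_tail_eq y hD0]
    have hb : ∀ m : ℕ, ‖1 / (m : ℝ) ^ 2 *
        tail (fun d => (ArithmeticFunction.moebius d : ℝ) / (d : ℝ) ^ 4) (max D (√(y / m)))‖ ≤
        1 / (m : ℝ) ^ 2 * (C / D ^ 3 * G) := by
      intro m
      have hz : D ≤ max D (√(y / m)) := le_max_left _ _
      rw [Real.norm_eq_abs, abs_mul, abs_of_nonneg (show 0 ≤ 1 / (m : ℝ) ^ 2 by positivity)]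
      refine mul_le_mul_of_nonneg_left ((hs4 _ (hD0.trans_le hz)).trans ?_) (by positivity)
      have hmono := vkPhi_mono (Real.log_le_log hD0 hz)
      simp only [Nat.reduceAdd]
      rw [hG]
      gcongr
    have h1 := tsum_of_norm_bounded ((summable_inv_pow 0).mul_right (C / D ^ 3 * G)).hasSum hb
    rw [Real.norm_eq_abs] at h1
    refine h1.trans ?_
    rw [tsum_mul_right]
    gcongr
    exact tsum_inv_sq_le
  have hhead : |∑ d ∈ Icc 1 ⌊D⌋₊, (ArithmeticFunction.moebius d : ℝ) / (d : ℝ) ^ 4 *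
      (tail (fun n => 1 / (n : ℝ) ^ 2) (y / (d : ℝ) ^ 2) - 1 / (y / (d : ℝ) ^ 2))| ≤
      2 * D / y ^ 2 := by
    refine (abs_sum_le_sum_abs _ _).trans ?_
    calc _ ≤ ∑ d ∈ Icc 1 ⌊D⌋₊, 2 / y ^ 2 := by
          refine sum_le_sum fun d hd => ?_
          have hd0 : (0 : ℝ) < d := by exact_mod_cast (mem_Icc.mp hd).1
          rw [abs_mul]
          calc _ ≤ 1 / (d : ℝ) ^ 4 * (2 / (y / (d : ℝ) ^ 2) ^ 2) := by
                gcongr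
                · exact abs_moebius_div_le d 4
                · exact abs_tail_inv_sq_sub_le (by positivity)
            _ = _ := by field_simp
      _ = ⌊D⌋₊ * (2 / y ^ 2) := by simp
      _ ≤ D * (2 / y ^ 2) := by
          gcongr
          exact Nat.floor_le hD0.le
      _ = _ := by ring
  have hmain : ∑ d ∈ Icc 1 ⌊D⌋₊, (ArithmeticFunction.moebius d : ℝ) / (d : ℝ) ^ 4 *
      (1 / (y / (d : ℝ) ^ 2)) =
      (1 / y) * ∑ d ∈ Icc 1 ⌊D⌋₊, (ArithmeticFunction.moebius d : ℝ) / (d : ℝ) ^ 2 := by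
    rw [mul_sum]
    refine sum_congr rfl fun d hd => ?_
    have hd0 : (0 : ℝ) < d := by exact_mod_cast (mem_Icc.mp hd).1
    field_simp
  simp only [mul_sub, sum_sub_distrib] at hhead
  rw [hmain] at hhead
  have hs2' : |1 / y * tail (fun n => (ArithmeticFunction.moebius n : ℝ) / (n : ℝ) ^ 2) D| ≤
      1 / y * (C / D * G) := by
    rw [abs_mul, abs_of_pos (show 0 < 1 / y by positivity)]
    gcongr
  have htotal : |∑' d : ℕ, (ArithmeticFunction.moebius d : ℝ) / (d : ℝ) ^ 4 *
        tail (fun n => 1 / (n : ℝ) ^ 2) (y / (d : ℝ) ^ 2) - 6 / Real.pi ^ 2 / y| ≤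
      2 * (C / D ^ 3 * G) + 2 * D / y ^ 2 + 1 / y * (C / D * G) := by
    have e1 : ∑ d ∈ Icc 1 ⌊D⌋₊, (ArithmeticFunction.moebius d : ℝ) / (d : ℝ) ^ 2 =
      6 / Real.pi ^ 2 - tail (fun n => (ArithmeticFunction.moebius n : ℝ) / (n : ℝ) ^ 2) D := by
      linarith
    rw [e1, mul_sub, show 1 / y * (6 / Real.pi ^ 2) = 6 / Real.pi ^ 2 / y by ring] at hhead
    have e2 := abs_le.mp hhead
    have e3 := abs_le.mp hs2'
    have e4 := abs_le.mp htail
    rw [abs_le]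
    constructor <;> linarith
  refine htotal.trans ?_
  have hε1 : ε ≤ 1 := Real.exp_le_one_iff.mpr (by nlinarith)
  calc _ ≤ 2 * (C / D ^ 3 * (Real.exp 1 * ε ^ 4)) + 2 * D / y ^ 2 +
        1 / y * (C / D * (Real.exp 1 * ε ^ 4)) := by gcongr
    _ = (2 * C * Real.exp 1 * ε + 2 * ε + C * Real.exp 1 * ε ^ 3) / (y * √y) := by
        have hy2 : y = √y ^ 2 := by rw [sq, hsy2]
        have hD3 : D ^ 3 = √y ^ 3 * ε ^ 3 := by rw [hD]; ring
        rw [hD3, hD]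
        generalize √y = s at *
        subst hy2
        field_simp
    _ ≤ ((3 * C * Real.exp 1 + 9) * ε) / (y * √y) := by
        gcongr ?_ / _
        have h3 : ε ^ 3 ≤ ε := pow_le_of_le_one hε0.le hε1 (by norm_num)
        have h4 : C * Real.exp 1 * ε ^ 3 ≤ C * Real.exp 1 * ε := by gcongr
        linarith
    _ = _ := by ring

/-- The indicator of the squarefree numbers having no prime factor in `S`, divided by `n ^ 2`. -/
noncomputable def coprimeTerm (S : Finset ℕ) (n : ℕ) : ℝ :=
  if ∀ p ∈ S, ¬ p ∣ n then (ArithmeticFunction.moebius n : ℝ) ^ 2 / (n : ℝ) ^ 2 else 0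

lemma coprimeTerm_nonneg (S : Finset ℕ) (n : ℕ) : 0 ≤ coprimeTerm S n := by
  rw [coprimeTerm]
  split_ifs <;> positivity

lemma coprimeTerm_le (S : Finset ℕ) (n : ℕ) : coprimeTerm S n ≤ 1 / (n : ℝ) ^ 2 := by
  rw [coprimeTerm]
  split_ifs
  · gcongr
    exact (sq_le_one_iff_abs_le_one _).mpr (abs_moebius_le_one' n)
  · positivity

lemma summable_coprimeTerm (S : Finset ℕ) : Summable (coprimeTerm S) :=
  Summable.of_nonneg_of_le (coprimeTerm_nonneg S) (coprimeTerm_le S) (summable_inv_pow 0)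

lemma coprimeTerm_mul {S : Finset ℕ} (hS : ∀ q ∈ S, q.Prime) {p : ℕ} (hp : p.Prime) (hpS : p ∉ S)
    (m : ℕ) : coprimeTerm S (p * m) = 1 / (p : ℝ) ^ 2 * coprimeTerm (insert p S) m := by
  by_cases hpm : p ∣ m
  · have h1 : ¬ Squarefree (p * m) := fun h =>
      hp.not_isUnit (h p (mul_dvd_mul_left p hpm))
    have h2 : ¬ ∀ q ∈ insert p S, ¬ q ∣ m := fun h => h p (mem_insert_self p S) hpm
    rw [coprimeTerm, coprimeTerm, if_neg h2,
      ArithmeticFunction.moebius_eq_zero_of_not_squarefree h1]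
    simp
  · have hcop : p.Coprime m := (Nat.Prime.coprime_iff_not_dvd hp).mpr hpm
    have hiff : (∀ q ∈ S, ¬ q ∣ p * m) ↔ ∀ q ∈ insert p S, ¬ q ∣ m := by
      rw [forall_mem_insert]
      simp only [hpm, not_false_eq_true, true_and]
      refine forall₂_congr fun q hq => not_congr ?_
      rw [(hS q hq).dvd_mul, Nat.prime_dvd_prime_iff_eq (hS q hq) hp]
      have : q ≠ p := fun h => hpS (h ▸ hq)
      simp [this]
    rw [coprimeTerm, coprimeTerm]
    simp only [hiff]
    split_ifs
    · rw [ArithmeticFunction.isMultiplicative_moebius.map_mul_of_coprime hcop,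
        ArithmeticFunction.moebius_apply_prime hp]
      push_cast
      ring
    · simp

lemma tail_coprimeTerm_insert {S : Finset ℕ} (hS : ∀ q ∈ S, q.Prime) {p : ℕ} (hp : p.Prime)
    (hpS : p ∉ S) (x : ℝ) : tail (coprimeTerm (insert p S)) x =
      tail (coprimeTerm S) x - 1 / (p : ℝ) ^ 2 * tail (coprimeTerm (insert p S)) (x / p) := by
  have hp0 : (0 : ℝ) < p := by exact_mod_cast hp.pos
  have h1 : ∑' n : ℕ, (if p ∣ n then (if x < n then coprimeTerm S n else 0) else 0) =
      1 / (p : ℝ) ^ 2 * tail (coprimeTerm (insert p S)) (x / p) := by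
    rw [tsum_ite_dvd hp.pos, tail, ← tsum_mul_left]
    refine tsum_congr fun m => ?_
    have : x < ((p * m : ℕ) : ℝ) ↔ x / p < m := by
      push_cast
      rw [div_lt_iff₀ hp0, mul_comm]
    simp only [this]
    split_ifs
    · exact coprimeTerm_mul hS hp hpS m
    · simp
  rw [← h1, eq_sub_iff_add_eq, tail, ← Summable.tsum_add
    (Summable.ite_real (summable_coprimeTerm _) _)
    (Summable.ite_real (Summable.ite_real (summable_coprimeTerm _) _) _)]
  refine tsum_congr fun n => ?_
  have hiff : (∀ q ∈ insert p S, ¬ q ∣ n) ↔ ¬ p ∣ n ∧ ∀ q ∈ S, ¬ q ∣ n := forall_mem_insert ..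
  by_cases hx : x < n
  · simp only [if_pos hx, coprimeTerm, hiff]
    by_cases hpn : p ∣ n <;> simp [hpn]
  · simp [hx]

lemma abs_le_of_abs_le_recurrence {E E' h : ℝ → ℝ} {p r N : ℝ} (hp : 1 < p) (hr : r < 1)
    (hN : 0 ≤ N)
    (hrec : ∀ x, 0 < x → |E' x| ≤ |E x| + 1 / p ^ 2 * |E' (x / p)|)
    (htriv : ∀ x, 0 < x → |E' x| ≤ 2 + 1 / x)
    (hE : ∀ x, 0 < x → |E x| ≤ N * h x) (hh0 : ∀ x, 0 < x → 0 ≤ h x)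
    (hh : ∀ x, 0 < x → 1 / p ^ 2 * h (x / p) ≤ r * h x) {x : ℝ} (hx : 0 < x) :
    |E' x| ≤ N * (1 - r)⁻¹ * h x := by
  have hp0 : 0 < p := by linarith
  have hr' : 0 < 1 - r := by linarith
  have key : ∀ (K : ℕ) (x : ℝ), 0 < x →
      |E' x| ≤ N * (1 - r)⁻¹ * h x + (1 / p ^ 2) ^ K * (2 + p ^ K / x) := by
    intro K
    induction K with
    | zero =>
      intro x hx
      have h1 := hh0 x hx
      have h2 : 0 ≤ N * (1 - r)⁻¹ * h x := by positivity
      have := htriv x hx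
      simp only [pow_zero, one_mul]
      linarith
    | succ K ih =>
      intro x hx
      calc |E' x| ≤ |E x| + 1 / p ^ 2 * |E' (x / p)| := hrec x hx
        _ ≤ N * h x + 1 / p ^ 2 * (N * (1 - r)⁻¹ * h (x / p) +
            (1 / p ^ 2) ^ K * (2 + p ^ K / (x / p))) := by
            gcongr
            · exact hE x hx
            · exact ih _ (by positivity)
        _ = N * h x + N * (1 - r)⁻¹ * (1 / p ^ 2 * h (x / p)) +
            (1 / p ^ 2) ^ (K + 1) * (2 + p ^ (K + 1) / x) := by
            rw [show p ^ K / (x / p) = p ^ (K + 1) / x by rw [pow_succ]; field_simp]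
            ring
        _ ≤ N * h x + N * (1 - r)⁻¹ * (r * h x) +
            (1 / p ^ 2) ^ (K + 1) * (2 + p ^ (K + 1) / x) := by
            have := mul_le_mul_of_nonneg_left (hh x hx) (show 0 ≤ N * (1 - r)⁻¹ by positivity)
            linarith
        _ = _ := by
            have : N * h x + N * (1 - r)⁻¹ * (r * h x) = N * (1 - r)⁻¹ * h x := by
              field_simp
              ring
            rw [this]
  have hlim : Filter.Tendsto (fun K : ℕ => N * (1 - r)⁻¹ * h x +
      (2 * (1 / p ^ 2) ^ K + (1 / p) ^ K * (1 / x))) Filter.atTop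
      (nhds (N * (1 - r)⁻¹ * h x + (2 * 0 + 0 * (1 / x)))) := by
    have h1 : Filter.Tendsto (fun K : ℕ => (1 / p) ^ K) Filter.atTop (nhds 0) :=
      tendsto_pow_atTop_nhds_zero_of_lt_one (by positivity) ((div_lt_one hp0).mpr hp)
    have h2 : Filter.Tendsto (fun K : ℕ => (1 / p ^ 2) ^ K) Filter.atTop (nhds 0) :=
      tendsto_pow_atTop_nhds_zero_of_lt_one (by positivity)
        ((div_lt_one (by positivity)).mpr (one_lt_pow₀ hp (by norm_num)))
    exact ((h2.const_mul 2).add (h1.mul_const _)).const_add _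
  rw [mul_zero, zero_mul, add_zero, add_zero] at hlim
  refine ge_of_tendsto' hlim fun K => (key K x hx).trans (le_of_eq ?_)
  have hpK : (1 / p ^ 2) ^ K * p ^ K = (1 / p) ^ K := by
    rw [← mul_pow]
    congr 1
    field_simp
  rw [← hpK]
  ring

/-- The density of the squarefree numbers having no prime factor in `S`. -/
noncomputable def coprimeDensity (S : Finset ℕ) : ℝ :=
  6 / Real.pi ^ 2 * ∏ p ∈ S, (1 + 1 / (p : ℝ))⁻¹

lemma coprimeDensity_nonneg (S : Finset ℕ) : 0 ≤ coprimeDensity S := by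
  have := Real.pi_pos
  have h : 0 ≤ ∏ p ∈ S, (1 + 1 / (p : ℝ))⁻¹ := prod_nonneg fun p _ => by positivity
  rw [coprimeDensity]
  positivity

lemma coprimeDensity_le_one (S : Finset ℕ) : coprimeDensity S ≤ 1 := by
  have h1 : ∏ p ∈ S, (1 + 1 / (p : ℝ))⁻¹ ≤ 1 := prod_le_one (fun p _ => by positivity)
    fun p _ => inv_le_one_of_one_le₀ (by linarith [show 0 ≤ 1 / (p : ℝ) by positivity])
  have h2 : 0 ≤ ∏ p ∈ S, (1 + 1 / (p : ℝ))⁻¹ := prod_nonneg fun p _ => by positivity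
  have hpi : 6 / Real.pi ^ 2 ≤ 1 := by
    have := Real.pi_pos
    rw [div_le_one (by positivity)]
    nlinarith [Real.pi_gt_three]
  exact mul_le_one₀ hpi h2 h1

lemma exp_vkPhi_div_scale {c x p : ℝ} (hc0 : 0 < c) (hc : c ≤ 1 / 20) (hx : 0 < x) (hp : 1 ≤ p) :
    1 / p ^ 2 * (Real.exp (-(c * vkPhi (Real.log (x / p)))) / (x / p * √(x / p))) ≤
      p ^ (-(9 / 20) : ℝ) * (Real.exp (-(c * vkPhi (Real.log x))) / (x * √x)) := by
  have hp0 : 0 < p := by linarith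
  have hsp := Real.sqrt_pos.mpr hp0
  have hsx := Real.sqrt_pos.mpr hx
  have hlog : Real.log (x / p) = Real.log x - Real.log p := Real.log_div hx.ne' hp0.ne'
  have hlp : 0 ≤ Real.log p := Real.log_nonneg hp
  have h1 := vkPhi_le_add (show Real.log (x / p) ≤ Real.log x by linarith)
  have h2 : Real.exp (-(c * vkPhi (Real.log (x / p)))) ≤
      p ^ (1 / 20 : ℝ) * Real.exp (-(c * vkPhi (Real.log x))) := by
    rw [Real.rpow_def_of_pos hp0, ← Real.exp_add]
    apply Real.exp_le_exp.mpr
    nlinarith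
  have h3 : √p = p ^ (1 / 2 : ℝ) := Real.sqrt_eq_rpow p
  have h4 : p ^ (-(9 / 20) : ℝ) * √p = p ^ (1 / 20 : ℝ) := by
    rw [h3, ← Real.rpow_add hp0]
    norm_num
  have h5 : √p * √p = p := Real.mul_self_sqrt hp0.le
  rw [Real.sqrt_div hx.le]
  calc _ ≤ 1 / p ^ 2 * ((p ^ (1 / 20 : ℝ) * Real.exp (-(c * vkPhi (Real.log x)))) /
        (x / p * (√x / √p))) := by gcongr
    _ = _ := by
      rw [← h4]
      field_simp
      rw [sq, h5]

theorem exists_coprime_tail_le : ∃ c C : ℝ, 0 < c ∧ 0 < C ∧ ∀ S : Finset ℕ, (∀ p ∈ S, p.Prime) →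
    ∀ x : ℝ, 0 < x → |tail (coprimeTerm S) x - coprimeDensity S / x| ≤
      C * (∏ p ∈ S, (1 - (p : ℝ) ^ (-(9 / 20) : ℝ))⁻¹) *
        (Real.exp (-(c * vkPhi (Real.log x))) / (x * √x)) := by
  obtain ⟨c, C, hc, hc256, hC, hT⟩ := exists_squarefree_tail_le
  refine ⟨c, C, hc, hC, fun S => ?_⟩
  induction S using Finset.induction_on with
  | empty =>
    intro _ x hx
    have h : coprimeTerm ∅ =
        fun n => (ArithmeticFunction.moebius n : ℝ) ^ 2 / (n : ℝ) ^ 2 := by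
      funext n
      simp [coprimeTerm]
    rw [h, coprimeDensity]
    simpa using hT x hx
  | insert p S hpS ih =>
    intro hS x hx
    have hp := hS p (mem_insert_self p S)
    have hS' : ∀ q ∈ S, q.Prime := fun q hq => hS q (mem_insert_of_mem hq)
    have hp1 : (1 : ℝ) < p := by exact_mod_cast hp.one_lt
    have hp0 : (0 : ℝ) < p := by linarith
    have hr : (p : ℝ) ^ (-(9 / 20) : ℝ) < 1 := Real.rpow_lt_one_of_one_lt_of_neg hp1 (by norm_num)
    have hN : 0 ≤ C * ∏ q ∈ S, (1 - (q : ℝ) ^ (-(9 / 20) : ℝ))⁻¹ := by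
      refine mul_nonneg hC.le (prod_nonneg fun q hq => ?_)
      have hq1 : (1 : ℝ) < q := by exact_mod_cast (hS' q hq).one_lt
      have : (q : ℝ) ^ (-(9 / 20) : ℝ) < 1 := Real.rpow_lt_one_of_one_lt_of_neg hq1 (by norm_num)
      exact inv_nonneg.mpr (by linarith)
    have hA : coprimeDensity S = coprimeDensity (insert p S) * (1 + 1 / (p : ℝ)) := by
      rw [coprimeDensity, coprimeDensity, prod_insert hpS]
      field_simp
    have hmain := abs_le_of_abs_le_recurrence
      (E := fun x => tail (coprimeTerm S) x - coprimeDensity S / x)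
      (E' := fun x => tail (coprimeTerm (insert p S)) x - coprimeDensity (insert p S) / x)
      (h := fun x => Real.exp (-(c * vkPhi (Real.log x))) / (x * √x))
      hp1 hr hN
      (fun x hx => by
        have e : tail (coprimeTerm (insert p S)) x - coprimeDensity (insert p S) / x =
            (tail (coprimeTerm S) x - coprimeDensity S / x) - 1 / (p : ℝ) ^ 2 *
              (tail (coprimeTerm (insert p S)) (x / p) -
                coprimeDensity (insert p S) / (x / p)) := by
          rw [tail_coprimeTerm_insert hS' hp hpS x, hA]
          field_simp
          ring
        rw [e]
        refine (abs_sub _ _).trans (le_of_eq ?_)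
        rw [abs_mul, abs_of_pos (show 0 < 1 / (p : ℝ) ^ 2 by positivity)])
      (fun x hx => by
        have e1 := tail_nonneg (coprimeTerm_nonneg (insert p S)) x
        have e2 := (tail_le_tsum (summable_coprimeTerm (insert p S))
          (coprimeTerm_nonneg (insert p S)) x).trans ((Summable.tsum_le_tsum
            (coprimeTerm_le (insert p S)) (summable_coprimeTerm _) (summable_inv_pow 0)).trans
            tsum_inv_sq_le)
        have e3 := coprimeDensity_nonneg (insert p S)
        have e4 : coprimeDensity (insert p S) / x ≤ 1 / x := by
          gcongr
          exact coprimeDensity_le_one _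
        have e5 : 0 ≤ coprimeDensity (insert p S) / x := by positivity
        rw [abs_le]
        constructor <;> linarith)
      (fun x hx => ih hS' x hx) (fun x hx => by positivity)
      (fun x hx => exp_vkPhi_div_scale hc (by linarith) hx hp1.le) hx
    refine hmain.trans (le_of_eq ?_)
    rw [prod_insert hpS]
    ring

lemma sum_Icc_rpow_le (k : ℕ) :
    ∑ n ∈ Icc 1 k, (n : ℝ) ^ (-(9 / 20) : ℝ) ≤ 2 * (k : ℝ) ^ (11 / 20 : ℝ) := by
  induction k with
  | zero => simp
  | succ k ih =>
    rw [sum_Icc_succ_top (by omega)]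
    refine (add_le_add_left ih _).trans ?_
    have hs : (0 : ℝ) < ((k + 1 : ℕ) : ℝ) := by positivity
    set s : ℝ := ((k + 1 : ℕ) : ℝ) with hsdef
    have hk : (k : ℝ) = s * (1 + -(1 / s)) := by
      rw [hsdef]
      push_cast
      field_simp
      ring
    have hs1 : 1 ≤ s := by
      rw [hsdef]
      push_cast
      linarith [show (0 : ℝ) ≤ k by positivity]
    have h1s : 1 / s ≤ 1 := (div_le_one hs).mpr hs1
    have h1 := rpow_one_add_le_one_add_mul_self (s := -(1 / s)) (p := 11 / 20) (by linarith)
      (by norm_num) (by norm_num)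
    have h2 : s ^ (-(9 / 20) : ℝ) = s ^ (11 / 20 : ℝ) * (1 / s) := by
      rw [one_div, ← Real.rpow_neg_one, ← Real.rpow_add hs]
      norm_num
    rw [hk, Real.mul_rpow hs.le (by linarith), h2]
    have h3 : 0 < s ^ (11 / 20 : ℝ) := by positivity
    have h4 : 0 < 1 / s := by positivity
    have h5 := mul_le_mul_of_nonneg_left h1 h3.le
    nlinarith [mul_pos h3 h4]

lemma sum_rpow_le_card {S : Finset ℕ} (hS : ∀ p ∈ S, 1 ≤ p) :
    ∑ p ∈ S, (p : ℝ) ^ (-(9 / 20) : ℝ) ≤ 3 * (#S : ℝ) ^ (11 / 20 : ℝ) := by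
  rcases Nat.eq_zero_or_pos #S with h0 | h0
  · rw [card_eq_zero.mp h0]
    simp
  have hk : (0 : ℝ) < #S := by exact_mod_cast h0
  rw [← sum_filter_add_sum_filter_not S (fun p => p ≤ #S)]
  have h1 : ∑ p ∈ S with p ≤ #S, (p : ℝ) ^ (-(9 / 20) : ℝ) ≤ 2 * (#S : ℝ) ^ (11 / 20 : ℝ) := by
    refine le_trans (sum_le_sum_of_subset_of_nonneg (t := Icc 1 #S) (fun p hp => ?_)
      fun p _ _ => by positivity) (sum_Icc_rpow_le _)
    rw [mem_filter] at hp
    exact mem_Icc.mpr ⟨hS p hp.1, hp.2⟩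
  have h2 : ∑ p ∈ S with ¬ p ≤ #S, (p : ℝ) ^ (-(9 / 20) : ℝ) ≤ (#S : ℝ) ^ (11 / 20 : ℝ) := by
    calc _ ≤ ∑ p ∈ S with ¬ p ≤ #S, (#S : ℝ) ^ (-(9 / 20) : ℝ) := by
          refine sum_le_sum fun p hp => ?_
          rw [mem_filter, not_le] at hp
          exact Real.rpow_le_rpow_of_nonpos hk (by exact_mod_cast hp.2.le) (by norm_num)
      _ ≤ #S * (#S : ℝ) ^ (-(9 / 20) : ℝ) := by
          rw [sum_const, nsmul_eq_mul]
          gcongr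
          exact filter_subset _ _
      _ = _ := by
          conv_lhs => rw [← Real.rpow_one (#S : ℝ), Real.rpow_one (#S : ℝ)]
          nth_rewrite 1 [← Real.rpow_one (#S : ℝ)]
          rw [← Real.rpow_add hk]
          norm_num
  linarith

lemma prod_primes_le_exp {S : Finset ℕ} (hS : ∀ p ∈ S, p.Prime) :
    ∏ p ∈ S, (1 - (p : ℝ) ^ (-(9 / 20) : ℝ))⁻¹ ≤ Real.exp (12 * (#S : ℝ) ^ (11 / 20 : ℝ)) := by
  have h2 : (2 : ℝ) ^ (-(9 / 20) : ℝ) ≤ 3 / 4 := by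
    refine le_of_pow_le_pow_left₀ (n := 20) (by norm_num) (by norm_num) ?_
    rw [← Real.rpow_natCast, ← Real.rpow_mul (by norm_num)]
    norm_num
  have hr : ∀ p ∈ S, (p : ℝ) ^ (-(9 / 20) : ℝ) ≤ 3 / 4 := fun p hp =>
    (Real.rpow_le_rpow_of_nonpos (by norm_num) (by exact_mod_cast (hS p hp).two_le)
      (by norm_num)).trans h2
  calc _ ≤ ∏ p ∈ S, Real.exp (4 * (p : ℝ) ^ (-(9 / 20) : ℝ)) := by
        refine prod_le_prod (fun p hp => inv_nonneg.mpr (by linarith [hr p hp])) fun p hp => ?_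
        have h3 := hr p hp
        have h4 : 0 ≤ (p : ℝ) ^ (-(9 / 20) : ℝ) := by positivity
        refine le_trans ?_ (Real.add_one_le_exp _)
        rw [inv_le_iff_one_le_mul₀ (by linarith)]
        nlinarith
    _ = Real.exp (4 * ∑ p ∈ S, (p : ℝ) ^ (-(9 / 20) : ℝ)) := by rw [← Real.exp_sum, mul_sum]
    _ ≤ _ := by
        apply Real.exp_le_exp.mpr
        linarith [sum_rpow_le_card fun p hp => (hS p hp).one_le]

lemma card_primeFactors_le {l : ℕ} (hl : 1 ≤ l) {u : ℝ} (hu : Real.log l ≤ 10 * u) :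
    (#l.primeFactors : ℝ) ≤ 15 * u := by
  have h1 : 2 ^ #l.primeFactors ≤ l := by
    calc 2 ^ #l.primeFactors ≤ ∏ p ∈ l.primeFactors, p :=
          pow_card_le_prod _ _ _ fun p hp => (Nat.prime_of_mem_primeFactors hp).two_le
      _ ≤ l := Nat.le_of_dvd hl (Nat.prod_primeFactors_dvd l)
  have h2 : (#l.primeFactors : ℝ) * Real.log 2 ≤ Real.log l := by
    rw [← Real.log_pow]
    exact Real.log_le_log (by positivity) (by exact_mod_cast h1)
  have h3 := Real.log_two_gt_d9
  have h4 : (0 : ℝ) ≤ #l.primeFactors := by positivity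
  nlinarith

lemma rpow_le_vkSaving {w : ℝ} (hw : 1 ≤ w) : w ^ (23 / 40 : ℝ) ≤ 2 * vkSaving w := by
  have hw0 : 0 < w := by linarith
  have h1 := vkSaving_pow_mul_log hw
  have h2 := vkSaving_pos hw
  have h3 : Real.log (w + 3) ≤ 16 * w ^ (1 / 8 : ℝ) := by
    have e1 := Real.log_le_rpow_div (x := w + 3) (by linarith) (show (0 : ℝ) < 1 / 8 by norm_num)
    have e2 : (w + 3) ^ (1 / 8 : ℝ) ≤ (2 ^ (8 : ℕ) * w) ^ (1 / 8 : ℝ) :=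
      Real.rpow_le_rpow (by linarith) (by linarith) (by norm_num)
    have e3 : ((2 : ℝ) ^ (8 : ℕ)) ^ (1 / 8 : ℝ) = 2 := by
      rw [← Real.rpow_natCast, ← Real.rpow_mul (by norm_num)]
      norm_num
    rw [Real.mul_rpow (by norm_num) hw0.le, e3] at e2
    linarith
  refine le_of_pow_le_pow_left₀ (n := 5) (by norm_num) (by positivity) ?_
  have h4 : (w ^ (23 / 40 : ℝ)) ^ 5 * w ^ (1 / 8 : ℝ) = w ^ 3 := by
    rw [← Real.rpow_natCast, ← Real.rpow_mul hw0.le, ← Real.rpow_add hw0, ← Real.rpow_natCast]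
    norm_num
  refine le_of_mul_le_mul_right ?_ (show 0 < w ^ (1 / 8 : ℝ) by positivity)
  rw [h4, ← h1]
  calc _ ≤ vkSaving w ^ 5 * (16 * w ^ (1 / 8 : ℝ)) := by gcongr
    _ ≤ _ := by
      have : 0 ≤ vkSaving w ^ 5 * w ^ (1 / 8 : ℝ) := by positivity
      nlinarith

lemma mul_rpow_le_vkPhi_add {A η : ℝ} (hA : 0 < A) (hη : 0 < η) {u : ℝ} (hu : 0 ≤ u) :
    A * u ^ (11 / 20 : ℝ) ≤ η * vkPhi u + A * (2 * A / η) ^ 22 := by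
  have h1 := rpow_le_vkSaving (w := u + 1) (by linarith)
  rw [vkPhi, max_eq_left hu]
  have hw : 0 < u + 1 := by linarith
  have h2 : A * u ^ (11 / 20 : ℝ) ≤ A * (u + 1) ^ (11 / 20 : ℝ) := by
    gcongr
    linarith
  refine h2.trans ?_
  set t := (u + 1) ^ (1 / 40 : ℝ) with ht
  have ht0 : 0 < t := by positivity
  have e1 : (u + 1) ^ (11 / 20 : ℝ) = t ^ 22 := by
    rw [ht, ← Real.rpow_natCast, ← Real.rpow_mul hw.le]
    norm_num
  have e2 : (u + 1) ^ (23 / 40 : ℝ) = t ^ 23 := by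
    rw [ht, ← Real.rpow_natCast, ← Real.rpow_mul hw.le]
    norm_num
  rw [e2] at h1
  rw [e1]
  rcases le_total t (2 * A / η) with h | h
  · have h3 : A * t ^ 22 ≤ A * (2 * A / η) ^ 22 := by gcongr
    have h4 : 0 < η * vkSaving (u + 1) := mul_pos hη (vkSaving_pos (by linarith))
    linarith
  · rw [div_le_iff₀ hη] at h
    have h3 : A * t ^ 22 ≤ η * vkSaving (u + 1) := by
      calc A * t ^ 22 = 2 * A * t ^ 22 / 2 := by ring
        _ ≤ t * η * t ^ 22 / 2 := by gcongr
        _ = η * t ^ 23 / 2 := by ring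
        _ ≤ η * (2 * vkSaving (u + 1)) / 2 := by gcongr
        _ = _ := by ring
    have h4 : 0 < A * (2 * A / η) ^ 22 := by positivity
    linarith

theorem exists_coprime_tail_le_exp : ∃ c C : ℝ, 0 < c ∧ 0 < C ∧ ∀ (x : ℝ) (l : ℕ), 1 ≤ x → 1 ≤ l →
    Real.log l ≤ 10 * Real.log x → ∀ t : ℝ, x ≤ t →
    |tail (coprimeTerm l.primeFactors) t - coprimeDensity l.primeFactors / t| ≤
      C * Real.exp (-(c * vkPhi (Real.log x))) * (1 / (t * √t)) := by
  obtain ⟨c, C, hc, hC, hT⟩ := exists_coprime_tail_le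
  set A : ℝ := 12 * 15 ^ (11 / 20 : ℝ) with hA
  have hA0 : 0 < A := by positivity
  set K := A * (2 * A / (c / 2)) ^ 22 with hK
  refine ⟨c / 2, C * Real.exp K, by positivity, by positivity, fun x l hx hl hlx t hxt => ?_⟩
  have hx0 : 0 < x := by linarith
  have ht0 : 0 < t := by linarith
  have hu : 0 ≤ Real.log x := Real.log_nonneg hx
  have hst := Real.sqrt_pos.mpr ht0
  have hprime : ∀ p ∈ l.primeFactors, p.Prime := fun p hp => Nat.prime_of_mem_primeFactors hp
  refine (hT _ hprime t ht0).trans ?_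
  have h1 : ∏ p ∈ l.primeFactors, (1 - (p : ℝ) ^ (-(9 / 20) : ℝ))⁻¹ ≤
      Real.exp (c / 2 * vkPhi (Real.log x) + K) := by
    refine (prod_primes_le_exp hprime).trans (Real.exp_le_exp.mpr ?_)
    refine le_trans ?_ (mul_rpow_le_vkPhi_add hA0 (half_pos hc) hu)
    rw [hA, mul_assoc, ← Real.mul_rpow (by norm_num) hu]
    have := card_primeFactors_le hl hlx
    gcongr
  have h2 : vkPhi (Real.log x) ≤ vkPhi (Real.log t) := vkPhi_mono (Real.log_le_log hx0 hxt)
  calc _ ≤ C * Real.exp (c / 2 * vkPhi (Real.log x) + K) *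
        (Real.exp (-(c * vkPhi (Real.log x))) / (t * √t)) := by gcongr
    _ = C * (Real.exp (c / 2 * vkPhi (Real.log x) + K) * Real.exp (-(c * vkPhi (Real.log x)))) *
        (1 / (t * √t)) := by ring
    _ = C * (Real.exp K * Real.exp (-(c / 2 * vkPhi (Real.log x)))) * (1 / (t * √t)) := by
        rw [← Real.exp_add, ← Real.exp_add]
        ring_nf
    _ = _ := by ring

end VinogradovKorobov

namespace VinogradovKorobov

open Finset MeasureTheory

lemma integral_Ioi_ite_div {x b : ℝ} (hx : 0 < x) (n : ℕ) :
    IntegrableOn (fun t : ℝ => if t < n then b / t else 0) (Set.Ioi x) ∧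
      ∫ t in Set.Ioi x, (if t < (n : ℝ) then b / t else 0) =
        if x < n then b * (Real.log n - Real.log x) else 0 := by
  have hfun : (fun t : ℝ => if t < n then b / t else 0) =
      (Set.Iio (n : ℝ)).indicator fun t => b / t := by
    funext t
    simp [Set.indicator_apply]
  have hset : Set.Ioi x ∩ Set.Iio (n : ℝ) = Set.Ioo x n := rfl
  rw [hfun]
  have hinteg : IntegrableOn (fun t => b / t) (Set.Ioo x n) := by
    refine IntegrableOn.mono_set (ContinuousOn.integrableOn_Icc ?_) Set.Ioo_subset_Icc_self
    exact continuousOn_const.div continuousOn_id fun t ht => (hx.trans_le ht.1).ne'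
  constructor
  · rw [IntegrableOn, integrable_indicator_iff measurableSet_Iio, IntegrableOn,
      Measure.restrict_restrict measurableSet_Iio, Set.inter_comm, hset]
    exact hinteg
  · rw [setIntegral_indicator measurableSet_Iio, hset]
    split_ifs with h
    · rw [← integral_Ioc_eq_integral_Ioo, ← intervalIntegral.integral_of_le h.le]
      simp only [div_eq_mul_inv]
      rw [intervalIntegral.integral_const_mul, integral_inv_of_pos hx (hx.trans h),
        Real.log_div (hx.trans h).ne' hx.ne']
    · rw [Set.Ioo_eq_empty h]
      simp

lemma summable_mul_log {b : ℕ → ℝ} (hb0 : ∀ n, 0 ≤ b n) (hb : ∀ n, b n ≤ 1 / (n : ℝ) ^ 2) :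
    Summable fun n => b n * Real.log n := by
  have hs : Summable fun n : ℕ => 2 * (1 / (n : ℝ) ^ (3 / 2 : ℝ)) :=
    (Real.summable_one_div_nat_rpow.mpr (by norm_num)).mul_left 2
  refine Summable.of_nonneg_of_le (fun n => mul_nonneg (hb0 n) (Real.log_natCast_nonneg n))
    (fun n => ?_) hs
  rcases Nat.eq_zero_or_pos n with rfl | hn
  · simp
  have hn0 : (0 : ℝ) < n := by exact_mod_cast hn
  have h1 := Real.log_le_rpow_div hn0.le (show (0 : ℝ) < 1 / 2 by norm_num)
  have h2 : 1 / (n : ℝ) ^ 2 * (n : ℝ) ^ (1 / 2 : ℝ) = 1 / (n : ℝ) ^ (3 / 2 : ℝ) := by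
    have h3 : (n : ℝ) ^ (3 / 2 : ℝ) * (n : ℝ) ^ (1 / 2 : ℝ) = (n : ℝ) ^ 2 := by
      rw [← Real.rpow_add hn0, ← Real.rpow_natCast]
      norm_num
    rw [← h3]
    field_simp
  calc b n * Real.log n ≤ 1 / (n : ℝ) ^ 2 * ((n : ℝ) ^ (1 / 2 : ℝ) / (1 / 2)) := by
        have := Real.log_natCast_nonneg n
        gcongr
        exact hb n
    _ = _ := by rw [← h2]; ring

/-- Partial summation for `log`, in the form of an integral of tails. -/
lemma tail_mul_log {b : ℕ → ℝ} (hb0 : ∀ n, 0 ≤ b n) (hb : ∀ n, b n ≤ 1 / (n : ℝ) ^ 2) {x : ℝ}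
    (hx : 0 < x) : tail (fun n => b n * Real.log n) x =
      Real.log x * tail b x + ∫ t in Set.Ioi x, tail b t / t := by
  have hbs : Summable b := Summable.of_nonneg_of_le hb0 hb (summable_inv_pow 0)
  have hls := summable_mul_log hb0 hb
  have hterm : ∀ n : ℕ, (if x < n then b n * (Real.log n - Real.log x) else 0) =
      (if x < n then b n * Real.log n else 0) - Real.log x * (if x < n then b n else 0) := by
    intro n
    split_ifs <;> ring
  have hs1 := Summable.ite_real hls (fun n : ℕ => x < n)
  have hs2 := (Summable.ite_real hbs (fun n : ℕ => x < n)).mul_left (Real.log x)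
  have hnorm : ∀ n : ℕ, ∫ t in Set.Ioi x, ‖(if t < n then b n / t else 0 : ℝ)‖ =
      ∫ t in Set.Ioi x, (if t < n then b n / t else 0) := by
    intro n
    refine setIntegral_congr_fun measurableSet_Ioi fun t ht => ?_
    have ht0 : 0 < t := hx.trans ht
    have := hb0 n
    rw [Real.norm_eq_abs, abs_of_nonneg]
    split_ifs <;> positivity
  have hmain := hasSum_integral_of_summable_integral_norm
    (μ := volume.restrict (Set.Ioi x)) (F := fun (n : ℕ) (t : ℝ) => if t < n then b n / t else 0)
    (fun n => (integral_Ioi_ite_div hx n).1)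
    (by
      simp only [hnorm, (integral_Ioi_ite_div hx _).2, hterm]
      exact hs1.sub hs2)
  have heq := hmain.tsum_eq
  simp only [(integral_Ioi_ite_div hx _).2, hterm] at heq
  rw [hs1.tsum_sub hs2, tsum_mul_left] at heq
  have hinteg : ∫ t in Set.Ioi x, (∑' n : ℕ, if t < n then b n / t else 0) =
      ∫ t in Set.Ioi x, tail b t / t := by
    refine setIntegral_congr_fun measurableSet_Ioi fun t _ => ?_
    rw [tail, ← tsum_div_const]
    refine tsum_congr fun n => ?_
    split_ifs <;> simp
  rw [hinteg] at heq
  rw [← heq, tail, tail]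
  ring

lemma integrableOn_tail_div {b : ℕ → ℝ} (hb0 : ∀ n, 0 ≤ b n) (hb : ∀ n, b n ≤ 1 / (n : ℝ) ^ 2)
    {x : ℝ} (hx : 0 < x) : IntegrableOn (fun t => tail b t / t) (Set.Ioi x) := by
  have hbs : Summable b := Summable.of_nonneg_of_le hb0 hb (summable_inv_pow 0)
  have hanti : Antitone (tail b) := by
    intro s t hst
    refine Summable.tsum_le_tsum (fun n => ?_) (Summable.ite_real hbs _) (Summable.ite_real hbs _)
    split_ifs with h1 h2 h2
    · exact le_rfl
    · exact absurd (hst.trans_lt h1) h2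
    · exact hb0 n
    · exact le_rfl
  have hle : ∀ t, 0 < t → tail b t ≤ 2 / t := fun t ht => by
    have h1 := tail_inv_pow_le ht 0
    simp only [zero_add, pow_one] at h1
    refine le_trans (Summable.tsum_le_tsum (fun n => ?_) (Summable.ite_real hbs _)
      (Summable.ite_real (summable_inv_pow 0) _)) h1
    split_ifs
    · exact hb n
    · exact le_rfl
  have hdom : IntegrableOn (fun t : ℝ => 2 * t ^ (-2 : ℝ)) (Set.Ioi x) :=
    (integrableOn_Ioi_rpow_of_lt (by norm_num) hx).const_mul 2
  refine Integrable.mono' hdom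
    (hanti.measurable.div measurable_id).aestronglyMeasurable ?_
  filter_upwards [ae_restrict_mem measurableSet_Ioi] with t ht
  have ht0 : 0 < t := hx.trans ht
  have h0 := tail_nonneg hb0 t
  rw [Real.norm_eq_abs, abs_of_nonneg (by positivity), Real.rpow_neg ht0.le]
  calc tail b t / t ≤ 2 / t / t := by
        gcongr
        exact hle t ht0
    _ = _ := by
        rw [show (2 : ℝ) = ((2 : ℕ) : ℝ) by norm_num, Real.rpow_natCast]
        field_simp

lemma abs_tail_mul_log_sub_le {b : ℕ → ℝ} (hb0 : ∀ n, 0 ≤ b n)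
    (hb : ∀ n, b n ≤ 1 / (n : ℝ) ^ 2) {x A B : ℝ} (hx : 1 ≤ x)
    (h : ∀ t, x ≤ t → |tail b t - A / t| ≤ B * (1 / (t * √t))) :
    |tail (fun n => b n * Real.log n) x - (Real.log x + 1) * A / x| ≤
      (Real.log x + 1) * (B * (1 / (x * √x))) := by
  have hx0 : 0 < x := by linarith
  have hlog : 0 ≤ Real.log x := Real.log_nonneg hx
  have hB : 0 ≤ B * (1 / (x * √x)) := (abs_nonneg _).trans (h x le_rfl)
  have hA1 : IntegrableOn (fun t : ℝ => A * t ^ (-2 : ℝ)) (Set.Ioi x) :=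
    (integrableOn_Ioi_rpow_of_lt (by norm_num) hx0).const_mul A
  have hA2 : ∫ t in Set.Ioi x, A * t ^ (-2 : ℝ) = A / x := by
    rw [integral_const_mul, integral_Ioi_rpow_of_lt (by norm_num) hx0]
    norm_num
    rw [Real.rpow_neg_one]
    ring
  have hB1 : IntegrableOn (fun t : ℝ => B * t ^ (-(5 / 2) : ℝ)) (Set.Ioi x) :=
    (integrableOn_Ioi_rpow_of_lt (by norm_num) hx0).const_mul B
  have hxs : x ^ (-(3 / 2) : ℝ) = 1 / (x * √x) := by
    rw [Real.rpow_neg hx0.le, one_div, show (3 / 2 : ℝ) = 1 + 1 / 2 by norm_num,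
      Real.rpow_add hx0, Real.rpow_one, ← Real.sqrt_eq_rpow]
  have hB2 : ∫ t in Set.Ioi x, B * t ^ (-(5 / 2) : ℝ) = 2 / 3 * (B * (1 / (x * √x))) := by
    rw [integral_const_mul, integral_Ioi_rpow_of_lt (by norm_num) hx0,
      show (-(5 / 2) + 1 : ℝ) = -(3 / 2) by norm_num, hxs]
    ring
  have hT := integrableOn_tail_div hb0 hb hx0
  have hE : |∫ t in Set.Ioi x, (tail b t / t - A * t ^ (-2 : ℝ))| ≤
      2 / 3 * (B * (1 / (x * √x))) := by
    rw [← hB2, ← Real.norm_eq_abs]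
    refine norm_integral_le_of_norm_le hB1 ?_
    filter_upwards [ae_restrict_mem measurableSet_Ioi] with t ht
    have hxt : x < t := ht
    have ht0 : 0 < t := hx0.trans hxt
    have hst := Real.sqrt_pos.mpr ht0
    have e1 : tail b t / t - A * t ^ (-2 : ℝ) = (tail b t - A / t) / t := by
      rw [Real.rpow_neg ht0.le, show (2 : ℝ) = ((2 : ℕ) : ℝ) by norm_num, Real.rpow_natCast]
      field_simp
    have e2 : t ^ (-(5 / 2) : ℝ) = 1 / (t * √t) / t := by
      rw [Real.rpow_neg ht0.le, show (5 / 2 : ℝ) = 1 + 1 / 2 + 1 by norm_num,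
        Real.rpow_add ht0, Real.rpow_add ht0, Real.rpow_one, ← Real.sqrt_eq_rpow]
      field_simp
    rw [e1, e2, Real.norm_eq_abs, abs_div, abs_of_pos ht0, mul_div_assoc']
    gcongr
    exact h t hxt.le
  rw [integral_sub hT hA1, hA2] at hE
  rw [tail_mul_log hb0 hb hx0]
  have e3 : Real.log x * tail b x + ∫ t in Set.Ioi x, tail b t / t =
      Real.log x * (tail b x - A / x) + ((∫ t in Set.Ioi x, tail b t / t) - A / x) +
        (Real.log x + 1) * A / x := by ring
  rw [e3, add_sub_cancel_right]
  refine (abs_add_le _ _).trans ?_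
  rw [abs_mul, abs_of_nonneg hlog]
  have h1 := mul_le_mul_of_nonneg_left (h x le_rfl) hlog
  linarith

lemma exists_rpow_le_vkPhi : ∃ κ : ℝ, 0 < κ ∧ ∀ x : ℝ, 3 ≤ x →
    κ * (Real.log x ^ (3 / 5 : ℝ) * Real.log (Real.log x) ^ (-1 / 5 : ℝ)) ≤
      vkPhi (Real.log x) := by
  set u₀ := Real.log 3 with hu₀
  have h1 : 1 < u₀ := by
    rw [hu₀, Real.lt_log_iff_exp_lt (by norm_num)]
    linarith [Real.exp_one_lt_d9]
  set K := 1 + Real.log 5 / Real.log u₀ with hK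
  have hl0 : 0 < Real.log u₀ := Real.log_pos h1
  have hK0 : 0 < K := by
    have : 0 < Real.log 5 := Real.log_pos (by norm_num)
    positivity
  refine ⟨K ^ (-(1 / 5) : ℝ), by positivity, fun x hx => ?_⟩
  set u := Real.log x with hu
  have hu3 : u₀ ≤ u := Real.log_le_log (by norm_num) hx
  have hu1 : 1 < u := h1.trans_le hu3
  have hlu : Real.log u₀ ≤ Real.log u := Real.log_le_log (by linarith) hu3
  have hlu0 : 0 < Real.log u := hl0.trans_le hlu
  have hlog : Real.log (u + 1 + 3) ≤ K * Real.log u := by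
    have e1 : Real.log (u + 1 + 3) ≤ Real.log (5 * u) := Real.log_le_log (by linarith) (by linarith)
    rw [Real.log_mul (by norm_num) (by linarith)] at e1
    have e2 : Real.log 5 ≤ Real.log 5 / Real.log u₀ * Real.log u := by
      have : 0 < Real.log 5 := Real.log_pos (by norm_num)
      rw [div_mul_eq_mul_div, le_div_iff₀ hl0]
      gcongr
    rw [hK]
    linarith
  have hlog0 : 0 < Real.log (u + 1 + 3) := Real.log_pos (by linarith)
  rw [vkPhi, max_eq_left (by linarith), vkSaving]
  calc _ = (u ^ 3 / (K * Real.log u)) ^ (1 / 5 : ℝ) := by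
        rw [Real.div_rpow (by positivity) (by positivity), Real.mul_rpow hK0.le hlu0.le,
          ← Real.rpow_natCast, ← Real.rpow_mul (by linarith), Real.rpow_neg hK0.le,
          show (-1 / 5 : ℝ) = -(1 / 5) by norm_num, Real.rpow_neg hlu0.le]
        norm_num
        ring
    _ ≤ _ := by
        gcongr
        linarith

lemma log_add_one_mul_exp_le {c u : ℝ} (hc : 0 < c) (hu : 0 ≤ u) :
    (u + 1) * Real.exp (-(c * vkPhi u)) ≤ 32 / c ^ 2 * Real.exp (-(c / 2 * vkPhi u)) := by
  have hw : 1 ≤ u + 1 := by linarith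
  have h1 := rpow_le_vkSaving hw
  have hΦ : vkPhi u = vkSaving (u + 1) := by rw [vkPhi, max_eq_left hu]
  rw [← hΦ] at h1
  have hΦ0 := vkPhi_pos u
  set Φ := vkPhi u
  have h2 : u + 1 ≤ (2 * Φ) ^ 2 := by
    calc u + 1 = (u + 1) ^ (1 : ℝ) := (Real.rpow_one _).symm
      _ ≤ (u + 1) ^ (23 / 20 : ℝ) := Real.rpow_le_rpow_of_exponent_le hw (by norm_num)
      _ = ((u + 1) ^ (23 / 40 : ℝ)) ^ 2 := by
          rw [← Real.rpow_natCast, ← Real.rpow_mul (by linarith)]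
          norm_num
      _ ≤ _ := by gcongr
  have h3 := Real.quadratic_le_exp_of_nonneg (show 0 ≤ c / 2 * Φ by positivity)
  have h4 : (2 * Φ) ^ 2 ≤ 32 / c ^ 2 * Real.exp (c / 2 * Φ) := by
    have e1 : (c / 2 * Φ) ^ 2 / 2 ≤ Real.exp (c / 2 * Φ) := by
      have : 0 ≤ c / 2 * Φ := by positivity
      linarith
    calc (2 * Φ) ^ 2 = 32 / c ^ 2 * ((c / 2 * Φ) ^ 2 / 2) := by field_simp; norm_num
      _ ≤ _ := by gcongr
  calc _ ≤ 32 / c ^ 2 * Real.exp (c / 2 * Φ) * Real.exp (-(c * Φ)) := by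
        gcongr
        exact h2.trans h4
    _ = 32 / c ^ 2 * (Real.exp (c / 2 * Φ) * Real.exp (-(c * Φ))) := by ring
    _ = _ := by rw [← Real.exp_add]; ring_nf

lemma tsum_subtype_coprime {f : ℕ → ℝ} (g : ℕ → ℝ) (x : ℝ) {l : ℕ} (hl : 1 ≤ l)
    (hfg : ∀ n, (∀ p ∈ l.primeFactors, ¬ p ∣ n) → f n = g n)
    (hg : ∀ n, ¬ (∀ p ∈ l.primeFactors, ¬ p ∣ n) → g n = 0) :
    ∑' n : {n : ℕ // x < (n : ℝ) ∧ Nat.Coprime n l}, f n = tail g x := by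
  have h := tsum_subtype (s := {n : ℕ | x < (n : ℝ) ∧ Nat.Coprime n l}) f
  refine h.trans (tsum_congr fun n => ?_)
  have hiff : Nat.Coprime n l ↔ ∀ p ∈ l.primeFactors, ¬ p ∣ n := by
    constructor
    · intro hc p hp hpn
      rw [Nat.mem_primeFactors] at hp
      exact Nat.not_coprime_of_dvd_of_dvd hp.1.one_lt hpn hp.2.1 hc
    · intro hp
      exact Nat.coprime_of_dvd fun p hpp hpn hpl =>
        hp p (Nat.mem_primeFactors.mpr ⟨hpp, hpl, by lia⟩) hpn
  by_cases hx : x < (n : ℝ)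
  · by_cases hn : ∀ p ∈ l.primeFactors, ¬ p ∣ n
    · rw [Set.indicator_of_mem (Set.mem_ofPred_eq.mpr ⟨hx, hiff.mpr hn⟩), if_pos hx, hfg n hn]
    · rw [Set.indicator_of_notMem fun hmem => hn (hiff.mp hmem.2), if_pos hx, hg n hn]
  · rw [Set.indicator_of_notMem fun hmem => hx hmem.1, if_neg hx]

end VinogradovKorobov

open Finset Real

/-- tails of squarefree sums restricted to integers coprime to `ℓ`. -/
theorem squarefree_tail_sums :
    ∃ c C : ℝ, 0 < c ∧ 0 < C ∧ ∀ x : ℝ, 3 ≤ x → ∀ l : ℕ, 1 ≤ l → (l : ℝ) ≤ x ^ (10 : ℝ) →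
      (|(∑' n : {n : ℕ // x < (n : ℝ) ∧ Nat.Coprime n l},
            (ArithmeticFunction.moebius (n : ℕ) : ℝ) ^ 2 / ((n : ℕ) : ℝ) ^ 2)
          - (1 / (Real.pi ^ 2 / 6 * x)) * ∏ p ∈ l.primeFactors, (1 + 1 / (p : ℝ))⁻¹|
        ≤ C / (x ^ ((3 : ℝ) / 2) *
            Real.exp (c * Real.log x ^ ((3 : ℝ) / 5) *
              Real.log (Real.log x) ^ (-(1 : ℝ) / 5))))
      ∧
      (|(∑' n : {n : ℕ // x < (n : ℝ) ∧ Nat.Coprime n l},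
            (ArithmeticFunction.moebius (n : ℕ) : ℝ) ^ 2 * Real.log ((n : ℕ) : ℝ)
              / ((n : ℕ) : ℝ) ^ 2)
          - ((Real.log x + 1) / (Real.pi ^ 2 / 6 * x)) *
              ∏ p ∈ l.primeFactors, (1 + 1 / (p : ℝ))⁻¹|
        ≤ C / (x ^ ((3 : ℝ) / 2) *
            Real.exp (c * Real.log x ^ ((3 : ℝ) / 5) *
              Real.log (Real.log x) ^ (-(1 : ℝ) / 5)))) := by
  obtain ⟨c, C, hc, hC, hmain⟩ := VinogradovKorobov.exists_coprime_tail_le_exp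
  obtain ⟨κ, hκ, hphi⟩ := VinogradovKorobov.exists_rpow_le_vkPhi
  refine ⟨c / 2 * κ, C * (1 + 32 / c ^ 2), by positivity, by positivity, fun x hx l hl hlx => ?_⟩
  have hx0 : 0 < x := by linarith
  have hu : 0 ≤ Real.log x := Real.log_nonneg (by linarith)
  have hlog : Real.log l ≤ 10 * Real.log x := by
    rw [← Real.log_rpow hx0]
    exact Real.log_le_log (by exact_mod_cast hl) hlx
  have htail := hmain x l (by linarith) hl hlog
  have hsqrt : x * √x = x ^ ((3 : ℝ) / 2) := by
    rw [Real.sqrt_eq_rpow, show ((3 : ℝ) / 2) = 1 + 1 / 2 by norm_num, Real.rpow_add hx0,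
      Real.rpow_one]
  have hΦ := VinogradovKorobov.vkPhi_pos (Real.log x)
  set w := Real.log x ^ ((3 : ℝ) / 5) * Real.log (Real.log x) ^ (-(1 : ℝ) / 5) with hw
  have hexp : Real.exp (-(c / 2 * VinogradovKorobov.vkPhi (Real.log x))) ≤
      Real.exp (-(c / 2 * κ * w)) := by
    rw [mul_assoc (c / 2)]
    gcongr
    exact hphi x hx
  have hrhs : C * (1 + 32 / c ^ 2) / (x ^ ((3 : ℝ) / 2) *
      Real.exp (c / 2 * κ * Real.log x ^ ((3 : ℝ) / 5) *
        Real.log (Real.log x) ^ (-(1 : ℝ) / 5))) =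
      C * ((1 + 32 / c ^ 2) * Real.exp (-(c / 2 * κ * w))) * (1 / (x * √x)) := by
    rw [hsqrt, mul_assoc (c / 2 * κ), ← hw, Real.exp_neg]
    field_simp
  have hmono : Real.exp (-(c * VinogradovKorobov.vkPhi (Real.log x))) ≤
      Real.exp (-(c / 2 * VinogradovKorobov.vkPhi (Real.log x))) :=
    Real.exp_le_exp.mpr (by nlinarith [mul_pos hc hΦ])
  have h32 : 0 < 32 / c ^ 2 := by positivity
  have hπ := Real.pi_pos
  rw [hrhs]
  constructor
  · rw [VinogradovKorobov.tsum_subtype_coprime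
      (f := fun n => (ArithmeticFunction.moebius n : ℝ) ^ 2 / (n : ℝ) ^ 2)
      (VinogradovKorobov.coprimeTerm l.primeFactors) x hl
      (fun n hn => (if_pos hn).symm) fun n hn => if_neg hn]
    have hden : (1 / (Real.pi ^ 2 / 6 * x)) * ∏ p ∈ l.primeFactors, (1 + 1 / (p : ℝ))⁻¹ =
        VinogradovKorobov.coprimeDensity l.primeFactors / x := by
      rw [VinogradovKorobov.coprimeDensity]
      field_simp
    rw [hden]
    refine (htail x le_rfl).trans ?_
    gcongr
    refine (hmono.trans hexp).trans (le_mul_of_one_le_left (Real.exp_pos _).le (by linarith))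
  · rw [VinogradovKorobov.tsum_subtype_coprime
      (f := fun n => (ArithmeticFunction.moebius n : ℝ) ^ 2 * Real.log n / (n : ℝ) ^ 2)
      (fun n => VinogradovKorobov.coprimeTerm l.primeFactors n * Real.log n) x hl
      (fun n hn => by rw [VinogradovKorobov.coprimeTerm, if_pos hn, mul_div_right_comm])
      fun n hn => by rw [VinogradovKorobov.coprimeTerm, if_neg hn, zero_mul]]
    have hden : ((Real.log x + 1) / (Real.pi ^ 2 / 6 * x)) *
        ∏ p ∈ l.primeFactors, (1 + 1 / (p : ℝ))⁻¹ =
        (Real.log x + 1) * VinogradovKorobov.coprimeDensity l.primeFactors / x := by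
      rw [VinogradovKorobov.coprimeDensity]
      field_simp
    rw [hden]
    refine (VinogradovKorobov.abs_tail_mul_log_sub_le (VinogradovKorobov.coprimeTerm_nonneg _)
      (VinogradovKorobov.coprimeTerm_le _) (by linarith) htail).trans ?_
    rw [← mul_assoc, mul_left_comm]
    have hlast : (Real.log x + 1) * Real.exp (-(c * VinogradovKorobov.vkPhi (Real.log x))) ≤
        (1 + 32 / c ^ 2) * Real.exp (-(c / 2 * κ * w)) := by
      refine (VinogradovKorobov.log_add_one_mul_exp_le hc hu).trans ?_
      gcongr
      linarith
    exact mul_le_mul_of_nonneg_right (mul_le_mul_of_nonneg_left hlast hC.le) (by positivity)
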